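/- Let n ≥ 5 and let φ be an endomorphism of A[B_n]. Then there exists x ∈ A[B_n] such that ψ = conj_x ∘ φ is given on the standard generators r_1, …, r_n by one of the following: (I) there exist commuting g, h ∈ A[B_n] with ψ(r_i) = g for all 1 ≤ i ≤ n−1 and ψ(r_n) = h; (IIa) there exist ε ∈ {1,−1} and p, q ∈ ℤ with ψ(r_i) = r_i^ε Δ_B^p for all 1 ≤ i ≤ n−1 and ψ(r_n) = r_n^ε Δ_B^q; (IIb) there exist ε ∈ {1,−1} and p, q ∈ ℤ with ψ(r_i) = r_i^ε Δ_B^p for all 1 ≤ i ≤ n−1 and ψ(r_n) = δ^{−ε} r_n^{−ε} Δ_B^q; (IIIa) there exist ε ∈ {1,−1} and p, q, r, s ∈ ℤ with ψ(r_i) = r_i^ε Δ_Y^{2p} Δ_B^q for all 1 ≤ i ≤ n−1 and ψ(r_n) = Δ_Y^{2r} Δ_B^s; (IIIb) there exist ε ∈ {1,−1} and p, q, r, s ∈ ℤ with ψ(r_i) = r_i^ε Δ_Y^{2p} Δ_B^q for all 1 ≤ i ≤ n−1 and ψ(r_n) = δ^{−ε} Δ_Y^{2r} Δ_B^s. -/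

import Mathlib

/-- The defining relators of the Artin group of type `Bₙ`, as elements of the free
group on `n` generators (0-indexed: generator `i` corresponds to `r_{i+1}`). -/
def BnRels (n : ℕ) : Set (FreeGroup (Fin n)) :=
  {w | (∃ i j : Fin n, (i : ℕ) + 1 = (j : ℕ) ∧ (j : ℕ) + 1 < n ∧
          w = FreeGroup.of i * FreeGroup.of j * FreeGroup.of i *
              (FreeGroup.of j * FreeGroup.of i * FreeGroup.of j)⁻¹) ∨
       (∃ i j : Fin n, (i : ℕ) + 2 = n ∧ (j : ℕ) + 1 = n ∧
          w = FreeGroup.of i * FreeGroup.of j * FreeGroup.of i * FreeGroup.of j *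
              (FreeGroup.of j * FreeGroup.of i * FreeGroup.of j * FreeGroup.of i)⁻¹) ∨
       (∃ i j : Fin n, (i : ℕ) + 2 ≤ (j : ℕ) ∧
          w = FreeGroup.of i * FreeGroup.of j * (FreeGroup.of j * FreeGroup.of i)⁻¹)}

/-- The Artin group `A[Bₙ]` of type `Bₙ`. -/
abbrev ArtinB (n : ℕ) := PresentedGroup (BnRels n)

/-- The standard generator `r_i` (1-indexed, `1 ≤ i ≤ n`). -/
def rB (n i : ℕ) : ArtinB n :=
  if h : i - 1 < n then PresentedGroup.of ⟨i - 1, h⟩ else 1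

/-- `ρ_B = r_1 r_2 ⋯ r_n`. -/
def ρB (n : ℕ) : ArtinB n := ((List.range n).map fun i => rB n (i + 1)).prod

/-- `Δ_B = ρ_B ^ n`, the generator of the center. -/
def ΔB (n : ℕ) : ArtinB n := ρB n ^ n

/-- `t_i` for `i` read modulo `n`: `t_i = r_i` for `1 ≤ i ≤ n-1`,
and `t_0 = ρ_B r_{n-1} ρ_B⁻¹`. -/
def tB (n i : ℕ) : ArtinB n :=
  if i % n = 0 then ρB n * rB n (n - 1) * (ρB n)⁻¹ else rB n (i % n)

/-- `Δ_Y = (t_1⋯t_{n-1})(t_1⋯t_{n-2})⋯(t_1t_2)t_1`, the Garside element of the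
parabolic subgroup of type `A_{n-1}`. -/
def ΔY (n : ℕ) : ArtinB n :=
  ((List.range (n - 1)).map fun k =>
    ((List.range (n - 1 - k)).map fun i => rB n (i + 1)).prod).prod

/-- `ρ_0 = t_1 t_2 ⋯ t_{n-1}`. -/
def ρ₀B (n : ℕ) : ArtinB n := ((List.range (n - 1)).map fun i => rB n (i + 1)).prod

/-- `ρ_1 = t_1⁻¹ t_2⁻¹ ⋯ t_{n-1}⁻¹`. -/
def ρ₁B (n : ℕ) : ArtinB n := ((List.range (n - 1)).map fun i => (rB n (i + 1))⁻¹).prod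

/-- `ρ_k` for `k ∈ {0,1}`. -/
def ρkB (n k : ℕ) : ArtinB n := if k = 0 then ρ₀B n else ρ₁B n

/-- `v_k = ρ_k t_{n-1} ρ_k⁻¹` for `k ∈ {0,1}`. -/
def vB (n k : ℕ) : ArtinB n := ρkB n k * rB n (n - 1) * (ρkB n k)⁻¹

/-- `δ = r_{n-1} r_{n-2} ⋯ r_2 r_1² r_2 ⋯ r_{n-2} r_{n-1}`. -/
def δB (n : ℕ) : ArtinB n :=
  ((List.range (n - 2)).map fun i => rB n (n - 1 - i)).prod * rB n 1 ^ 2 *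
  ((List.range (n - 2)).map fun i => rB n (i + 2)).prod

/-- The quotient `Ā = A[Bₙ]/Z(A[Bₙ])`. -/
abbrev AbarB (n : ℕ) := ArtinB n ⧸ Subgroup.center (ArtinB n)

/-- The canonical projection `π : A[Bₙ] → Ā`. -/
def πB (n : ℕ) : ArtinB n →* AbarB n := QuotientGroup.mk' (Subgroup.center (ArtinB n))

/-- `t̄_i = π(t_i)`. -/
def tbar (n i : ℕ) : AbarB n := πB n (tB n i)

/-- `ρ̄_B = π(ρ_B)`. -/
def ρbar (n : ℕ) : AbarB n := πB n (ρB n)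

/-- The composition `conj_x ∘ φ` of an endomorphism with an inner automorphism. -/
def conjComp {G : Type*} [Group G] (x : G) (φ : G →* G) : G →* G :=
  (MulAut.conj x).toMonoidHom.comp φ

/-- Type (1): there are commuting `g, h` with `φ(t_i) = g` for all `0 ≤ i ≤ n-1`
and `φ(ρ_B) = h`. -/
def IsType1 (n : ℕ) (φ : ArtinB n →* ArtinB n) : Prop :=
  ∃ g h : ArtinB n, g * h = h * g ∧ (∀ i < n, φ (tB n i) = g) ∧ φ (ρB n) = h

/-- Type (2a) with parameters `ε ∈ {1,-1}`, `p q : ℤ`. -/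
def IsType2a (n : ℕ) (ε p q : ℤ) (φ : ArtinB n →* ArtinB n) : Prop :=
  (ε = 1 ∨ ε = -1) ∧ (∀ i < n, φ (tB n i) = tB n i ^ ε * ΔB n ^ p) ∧
    φ (ρB n) = ρB n * ΔB n ^ q

/-- Type (2b) with parameters `ε ∈ {1,-1}`, `p q : ℤ`. -/
def IsType2b (n : ℕ) (ε p q : ℤ) (φ : ArtinB n →* ArtinB n) : Prop :=
  (ε = 1 ∨ ε = -1) ∧ (∀ i < n, φ (tB n i) = tB n (n - i) ^ ε * ΔB n ^ p) ∧
    φ (ρB n) = (ρB n)⁻¹ * ΔB n ^ q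

/-- Type (3) with parameters `ε ∈ {1,-1}`, `k ∈ {0,1}`, `p q r s : ℤ`. -/
def IsType3 (n : ℕ) (ε : ℤ) (k : ℕ) (p q r s : ℤ) (φ : ArtinB n →* ArtinB n) : Prop :=
  (ε = 1 ∨ ε = -1) ∧ (k = 0 ∨ k = 1) ∧
    (∀ i, 1 ≤ i → i ≤ n - 1 → φ (tB n i) = tB n i ^ ε * ΔY n ^ (2 * p) * ΔB n ^ q) ∧
    φ (tB n 0) = vB n k ^ ε * ΔY n ^ (2 * p) * ΔB n ^ q ∧
    φ (ρB n) = ρkB n k * ΔY n ^ (2 * r) * ΔB n ^ s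


namespace BraidB

/-- The Artin braid relations on `s 0, …, s (n-2)`. -/
structure BraidRel {G : Type*} [Group G] (n : ℕ) (s : ℕ → G) : Prop where
  comm : ∀ i j, i + 2 ≤ j → j + 1 < n → s i * s j = s j * s i
  braid : ∀ i, i + 2 < n → s i * s (i + 1) * s i = s (i + 1) * s i * s (i + 1)

/-- Relators of the braid group on `n` strands, with generators indexed by `ℕ`
(those of index at least `n - 1` being trivial). -/
def brRels (n : ℕ) : Set (FreeGroup ℕ) :=
  {w | (∃ i j, i + 2 ≤ j ∧ j + 1 < n ∧
          w = FreeGroup.of i * FreeGroup.of j * (FreeGroup.of j * FreeGroup.of i)⁻¹) ∨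
       (∃ i, i + 2 < n ∧ w = FreeGroup.of i * FreeGroup.of (i + 1) * FreeGroup.of i *
          (FreeGroup.of (i + 1) * FreeGroup.of i * FreeGroup.of (i + 1))⁻¹) ∨
       (∃ i, n ≤ i + 1 ∧ w = FreeGroup.of i)}

/-- The braid group on `n` strands. -/
def Br (n : ℕ) : Type := PresentedGroup (brRels n)

instance (n : ℕ) : Group (Br n) := inferInstanceAs (Group (PresentedGroup (brRels n)))

/-- The standard generators of the braid group. -/
def sg (n i : ℕ) : Br n := PresentedGroup.of (rels := brRels n) i

lemma sg_eq_one {n i : ℕ} (h : n ≤ i + 1) : sg n i = 1 :=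
  PresentedGroup.one_of_mem (rels := brRels n) (Or.inr (Or.inr ⟨i, h, rfl⟩))

lemma braidRel_sg (n : ℕ) : BraidRel n (sg n) where
  comm i j h1 h2 := by
    have := PresentedGroup.one_of_mem (rels := brRels n)
      (Or.inl ⟨i, j, h1, h2, rfl⟩)
    simp only [map_mul, map_inv] at this
    exact mul_inv_eq_one.mp this
  braid i h := by
    have := PresentedGroup.one_of_mem (rels := brRels n)
      (Or.inr (Or.inl ⟨i, h, rfl⟩))
    simp only [map_mul, map_inv] at this
    exact mul_inv_eq_one.mp this

section
variable {G : Type*} [Group G] {n : ℕ}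

lemma BraidRel.map {H : Type*} [Group H] {s : ℕ → G} (hs : BraidRel n s) (f : G →* H) :
    BraidRel n (fun i => f (s i)) where
  comm i j h1 h2 := by simp only [← map_mul, hs.comm i j h1 h2]
  braid i h := by simp only [← map_mul, hs.braid i h]

lemma BraidRel.mono {s : ℕ → G} (hs : BraidRel n s) {m : ℕ} (h : m ≤ n) : BraidRel m s where
  comm i j h1 h2 := hs.comm i j h1 (by omega)
  braid i h := hs.braid i (by omega)

lemma BraidRel.shift {s : ℕ → G} (hs : BraidRel n s) (k : ℕ) :
    BraidRel (n - k) (fun i => s (i + k)) where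
  comm i j h1 h2 := hs.comm _ _ (by omega) (by omega)
  braid i h := by
    have := hs.braid (i + k) (by omega)
    rwa [show i + k + 1 = i + 1 + k by omega] at this

/-- Homomorphisms out of the braid group. -/
def Br.lift (s : ℕ → G) (hs : BraidRel n s) : Br n →* G :=
  PresentedGroup.toGroup (rels := brRels n) (f := fun i => if i + 1 < n then s i else 1) (by
    rintro w (⟨i, j, h1, h2, rfl⟩ | ⟨i, h, rfl⟩ | ⟨i, h, rfl⟩)
    · have h3 : i + 1 < n := by omega
      simp [h2, h3, hs.comm i j h1 h2]
    · have h3 : i + 1 < n := by omega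
      have h4 : i + 1 + 1 < n := by omega
      have := hs.braid i h
      simp only [map_mul, map_inv, FreeGroup.lift_apply_of, h3, h4, if_true]
      rw [this]; simp
    · simp [h])

@[simp] lemma Br.lift_sg (s : ℕ → G) (hs : BraidRel n s) {i : ℕ} (h : i + 1 < n) :
    Br.lift s hs (sg n i) = s i := by
  have : Br.lift s hs (sg n i) = if i + 1 < n then s i else 1 :=
    PresentedGroup.toGroup.of (rels := brRels n) _
  rw [this, if_pos h]

lemma Br.hom_ext {f g : Br n →* G} (h : ∀ i, i + 1 < n → f (sg n i) = g (sg n i)) : f = g := by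
  refine PresentedGroup.ext (rels := brRels n) fun i => ?_
  by_cases hi : i + 1 < n
  · exact h i hi
  · have : (PresentedGroup.of (rels := brRels n) i) = (1 : Br n) := sg_eq_one (by omega)
    rw [this]; exact (map_one f).trans (map_one g).symm

lemma Br.closure_sg (n : ℕ) : Subgroup.closure {g | ∃ i, i + 1 < n ∧ g = sg n i} = ⊤ := by
  rw [eq_top_iff]
  have : Subgroup.closure (Set.range (PresentedGroup.of (rels := brRels n))) = ⊤ :=
    PresentedGroup.closure_range_of _
  refine (this.symm.le).trans ?_
  refine (Subgroup.closure_le _).2 ?_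
  rintro _ ⟨i, rfl⟩
  by_cases hi : i + 1 < n
  · exact Subgroup.subset_closure ⟨i, hi, rfl⟩
  · have : (PresentedGroup.of (rels := brRels n) i) = (1 : Br n) := sg_eq_one (by omega)
    rw [this]; exact Subgroup.one_mem _

lemma Br.induction {p : Br n → Prop} (g : Br n) (h1 : p 1)
    (hs : ∀ i, i + 1 < n → p (sg n i)) (hm : ∀ a b, p a → p b → p (a * b))
    (hi : ∀ a, p a → p a⁻¹) : p g := by
  have hg : g ∈ Subgroup.closure {g | ∃ i, i + 1 < n ∧ g = sg n i} := by
    rw [Br.closure_sg]; trivial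
  induction hg using Subgroup.closure_induction with
  | mem x hx => obtain ⟨i, hi, rfl⟩ := hx; exact hs i hi
  | one => exact h1
  | mul a b _ _ ha hb => exact hm a b ha hb
  | inv a _ ha => exact hi a ha

end

/-- The free group of rank `n`. -/
abbrev Fr (n : ℕ) := FreeGroup (Fin n)

/-- The basis `c_1, …, c_n` of the free group; `c_j = 1` for other `j`. -/
def cc (n : ℕ) (j : ℕ) : Fr n := if h : 0 < j ∧ j ≤ n then FreeGroup.of ⟨j - 1, by omega⟩ else 1

@[simp] lemma cc_zero (n : ℕ) : cc n 0 = 1 := by simp [cc]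

lemma cc_of_lt {n j : ℕ} (h : n < j) : cc n j = 1 := by
  simp only [cc]; rw [dif_neg]; omega

lemma cc_succ {n j : ℕ} (h : j < n) : cc n (j + 1) = FreeGroup.of ⟨j, h⟩ := by
  simp only [cc]; rw [dif_pos]; · rfl
  omega

section
variable {G : Type*} [Group G] {n : ℕ}

/-- Homomorphism from the free group determined by the images of `c_j`, `1 ≤ j ≤ n`. -/
def liftF (n : ℕ) (f : ℕ → G) : Fr n →* G := FreeGroup.lift fun i => f (i + 1)

lemma liftF_cc (f : ℕ → G) {j : ℕ} (h0 : 0 < j) (h : j ≤ n) : liftF n f (cc n j) = f j := by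
  obtain ⟨k, rfl⟩ : ∃ k, j = k + 1 := ⟨j - 1, by omega⟩
  rw [cc_succ (by omega)]; simp [liftF]

lemma Fr.hom_ext {f g : Fr n →* G} (h : ∀ j, 0 < j → j ≤ n → f (cc n j) = g (cc n j)) :
    f = g := by
  refine FreeGroup.ext_hom _ _ fun i => ?_
  have := h (i + 1) (by omega) (by omega)
  rwa [cc_succ i.2] at this

end

/-- Image of `c_j` under the `i`th braid generator. -/
def sfun (n i j : ℕ) : Fr n := if j = i + 1 then cc n i * (cc n (i + 1))⁻¹ * cc n (i + 2) else cc n j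
/-- Image of `c_j` under the inverse of the `i`th braid generator. -/
def sfun' (n i j : ℕ) : Fr n :=
  if j = i + 1 then cc n (i + 2) * (cc n (i + 1))⁻¹ * cc n i else cc n j

lemma liftF_sfun {n i : ℕ} (h : i + 1 < n) (j : ℕ) :
    liftF n (sfun n i) (cc n j) = sfun n i j := by
  rcases Nat.eq_zero_or_pos j with rfl | h0
  · simp [sfun]
  · by_cases hj : j ≤ n
    · exact liftF_cc _ h0 hj
    · rw [sfun, if_neg (by omega), cc_of_lt (by omega), map_one]

lemma liftF_sfun' {n i : ℕ} (h : i + 1 < n) (j : ℕ) :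
    liftF n (sfun' n i) (cc n j) = sfun' n i j := by
  rcases Nat.eq_zero_or_pos j with rfl | h0
  · simp [sfun']
  · by_cases hj : j ≤ n
    · exact liftF_cc _ h0 hj
    · rw [sfun', if_neg (by omega), cc_of_lt (by omega), map_one]

/-- The `i`th braid generator as an automorphism of the free group. -/
def sAut (n i : ℕ) : MulAut (Fr n) :=
  if h : i + 1 < n then
    MonoidHom.toMulEquiv (liftF n (sfun n i)) (liftF n (sfun' n i))
      (by
        refine Fr.hom_ext fun j _ _ => ?_
        simp only [MonoidHom.comp_apply, liftF_sfun h, MonoidHom.id_apply]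
        by_cases hj : j = i + 1
        · subst hj
          simp [sfun, liftF_sfun' h, sfun', mul_assoc]
        · simp [sfun, hj, liftF_sfun' h, sfun'])
      (by
        refine Fr.hom_ext fun j _ _ => ?_
        simp only [MonoidHom.comp_apply, liftF_sfun' h, MonoidHom.id_apply]
        by_cases hj : j = i + 1
        · subst hj
          simp [sfun', liftF_sfun h, sfun, mul_assoc]
        · simp [sfun', hj, liftF_sfun h, sfun])
  else 1

lemma sAut_cc {n i : ℕ} (h : i + 1 < n) (j : ℕ) :
    sAut n i (cc n j) =
      if j = i + 1 then cc n i * (cc n (i + 1))⁻¹ * cc n (i + 2) else cc n j := by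
  rw [sAut, dif_pos h]; exact liftF_sfun h j

lemma mulAut_ext_cc {n : ℕ} {f g : MulAut (Fr n)}
    (h : ∀ j, 0 < j → j ≤ n → f (cc n j) = g (cc n j)) : f = g := by
  have : (f : Fr n →* Fr n) = g := Fr.hom_ext h
  ext x
  exact DFunLike.congr_fun this x

lemma braidRel_sAut (n : ℕ) : BraidRel n (sAut n) where
  comm i j h1 h2 := by
    refine mulAut_ext_cc fun k _ _ => ?_
    have h3 : i + 1 < n := by omega
    simp only [MulAut.mul_apply, sAut_cc h2, sAut_cc h3]
    by_cases hk : k = i + 1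
    · subst hk
      rw [if_neg (by omega)]
      simp [sAut_cc h2, sAut_cc h3, show ¬ i = j + 1 by omega, show ¬ i = j by omega,
        show ¬ i + 2 = j + 1 by omega]
    · by_cases hk' : k = j + 1
      · subst hk'
        simp [sAut_cc h2, sAut_cc h3, show ¬ j = i + 1 by omega, show ¬ j = i by omega,
          show ¬ j + 2 = i + 1 by omega]
      · simp [hk, hk', sAut_cc h2, sAut_cc h3]
  braid i h := by
    refine mulAut_ext_cc fun k _ _ => ?_
    have h3 : i + 1 < n := by omega
    have h4 : i + 1 + 1 < n := by omega
    simp only [MulAut.mul_apply, sAut_cc h4, sAut_cc h3]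
    by_cases hk : k = i + 1
    · subst hk
      simp [sAut_cc h4, sAut_cc h3, mul_assoc, show i ≠ i + 1 + 1 by omega]
    · by_cases hk' : k = i + 1 + 1
      · subst hk'
        simp [sAut_cc h4, sAut_cc h3, mul_assoc, show i ≠ i + 1 + 1 by omega]
      · simp [hk, hk', sAut_cc h4, sAut_cc h3]

/-- The Artin action of the braid group on the free group. -/
def act (n : ℕ) : Br n →* MulAut (Fr n) := Br.lift (sAut n) (braidRel_sAut n)

lemma act_sg {n i : ℕ} (h : i + 1 < n) (j : ℕ) :
    act n (sg n i) (cc n j) =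
      if j = i + 1 then cc n i * (cc n (i + 1))⁻¹ * cc n (i + 2) else cc n j := by
  rw [act, Br.lift_sg _ _ h, sAut_cc h]

lemma act_sg_of_ne {n i : ℕ} (h : i + 1 < n) {j : ℕ} (hj : j ≠ i + 1) :
    act n (sg n i) (cc n j) = cc n j := by rw [act_sg h, if_neg hj]

lemma act_cc_top {n : ℕ} (g : Br n) : act n g (cc n n) = cc n n := by
  induction g using Br.induction with
  | h1 => simp
  | hs i hi => rw [act_sg_of_ne hi (by omega)]
  | hm a b ha hb => rw [map_mul, MulAut.mul_apply, hb, ha]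
  | hi a ha => rw [map_inv, MulAut.inv_apply, MulEquiv.symm_apply_eq, ha]

/-- The alternative basis `x_0, …, x_{n-1}` of the free group. -/
def xx (n j : ℕ) : Fr n := cc n (j + 1) * (cc n j)⁻¹

lemma act_xx_succ {n i : ℕ} (h : i + 1 < n) : act n (sg n i) (xx n (i + 1)) = xx n i := by
  simp [xx, act_sg h, mul_assoc]

lemma act_xx_self {n i : ℕ} (h : i + 1 < n) :
    act n (sg n i) (xx n i) = (xx n i)⁻¹ * xx n (i + 1) * xx n i := by
  simp [xx, act_sg h, mul_assoc]

lemma act_xx_of_ne {n i j : ℕ} (h : i + 1 < n) (h1 : j ≠ i) (h2 : j ≠ i + 1) :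
    act n (sg n i) (xx n j) = xx n j := by
  simp [xx, act_sg h, h1, h2]

lemma cc_succ_eq (n j : ℕ) : cc n (j + 1) = xx n j * cc n j := by simp [xx]

/-- The semidirect product model of the Artin group of type `B_n`. -/
abbrev D (n : ℕ) := Fr n ⋊[act n] Br n

/-- Inclusion of the braid group in `D n`. -/
abbrev dr {n : ℕ} : Br n →* D n := SemidirectProduct.inr
/-- Inclusion of the free group in `D n`. -/
abbrev dl {n : ℕ} : Fr n →* D n := SemidirectProduct.inl
/-- Projection of `D n` to the braid group. -/
abbrev pr {n : ℕ} : D n →* Br n := SemidirectProduct.rightHom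

lemma dr_dl {n : ℕ} (g : Br n) (f : Fr n) : dr g * dl f = dl (act n g f) * dr g := by
  rw [SemidirectProduct.inl_aut]; simp

lemma D.hom_ext {n : ℕ} {G : Type*} [Group G] {f g : D n →* G}
    (h1 : ∀ i, i + 1 < n → f (dr (sg n i)) = g (dr (sg n i)))
    (h2 : f (dl (xx n (n - 1))) = g (dl (xx n (n - 1)))) : f = g := by
  have key : f.comp dr = g.comp dr := Br.hom_ext h1
  have hk : ∀ b, f (dr b) = g (dr b) := fun b => DFunLike.congr_fun key b
  have hx : ∀ k, k < n → f (dl (xx n (n - 1 - k))) = g (dl (xx n (n - 1 - k))) := by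
    intro k
    induction k with
    | zero => intro _; exact h2
    | succ k ih =>
      intro hk'
      have e : n - 1 - k = n - 1 - (k + 1) + 1 := by omega
      have hx := ih (by omega)
      rw [e] at hx
      rw [← act_xx_succ (by omega), SemidirectProduct.inl_aut]
      simp only [map_mul, hk, hx]
  have hc : ∀ j, j ≤ n → f (dl (cc n j)) = g (dl (cc n j)) := by
    intro j
    induction j with
    | zero => simp
    | succ j ih =>
      intro hj
      have := hx (n - 1 - j) (by omega)
      rw [show n - 1 - (n - 1 - j) = j by omega] at this
      rw [cc_succ_eq, map_mul, map_mul, map_mul, this, ih (by omega)]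
  exact SemidirectProduct.hom_ext (Fr.hom_ext fun j _ hj => hc j hj) key

end BraidB

namespace BraidB

lemma braid_conj {G : Type*} [Group G] {a b : G} (h : a * b * a = b * a * b) :
    b⁻¹ * a * b = a * b * a⁻¹ := by
  rw [eq_mul_inv_iff_mul_eq, mul_assoc, mul_assoc, inv_mul_eq_iff_eq_mul, ← mul_assoc, h,
    mul_assoc]

/-- The four-term braid relation. -/
def Four {G : Type*} [Group G] (a b : G) : Prop := a * b * a * b = b * a * b * a

lemma Four.map {G H : Type*} [Group G] [Group H] {a b : G} (h : Four a b) (f : G →* H) :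
    Four (f a) (f b) := by
  unfold Four at *; simp only [← map_mul, h]

lemma Four.conj {G : Type*} [Group G] {a b : G} (h : Four a b) (c : G) :
    Four (c * a * c⁻¹) (c * b * c⁻¹) := by
  simpa using h.map (MulAut.conj c).toMonoidHom

section DLift
variable {G : Type*} [Group G] {n : ℕ}

/-- The relations of the Artin group of type `B_n`: `s 0, …, s (n-2)` satisfy the braid
relations, and `g` plays the role of the last generator. -/
structure DRel (n : ℕ) (s : ℕ → G) (g : G) : Prop where
  br : BraidRel n s
  comm : ∀ i, i + 3 ≤ n → s i * g = g * s i
  four : 2 ≤ n → Four (s (n - 2)) g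

lemma DRel.map {H : Type*} [Group H] {s : ℕ → G} {g : G} (h : DRel n s g) (f : G →* H) :
    DRel n (fun i => f (s i)) (f g) where
  br := h.br.map f
  comm i hi := by simp only [← map_mul, h.comm i hi]
  four hn := (h.four hn).map f

lemma dRel_D (n : ℕ) : DRel n (fun i => (dr (sg n i) : D n)) (dl (xx n (n - 1))) where
  br := (braidRel_sg n).map dr
  comm i hi := by
    rw [dr_dl, act_xx_of_ne (by omega) (by omega) (by omega)]
  four hn := by
    obtain ⟨m, rfl⟩ : ∃ m, n = m + 2 := ⟨n - 2, by omega⟩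
    simp only [show m + 2 - 2 = m by omega, show m + 2 - 1 = m + 1 by omega, Four]
    rw [dr_dl, act_xx_succ (by omega)]
    have e1 : (dr (sg (m+2) m) * dl (xx (m+2) (m+1)) : D (m+2)) =
        dl (xx (m+2) m) * dr (sg (m+2) m) := by rw [dr_dl, act_xx_succ (by omega)]
    have e2 : (dr (sg (m+2) m) * dl (xx (m+2) m) : D (m+2)) =
        dl ((xx (m+2) m)⁻¹ * xx (m+2) (m+1) * xx (m+2) m) * dr (sg (m+2) m) := by
      rw [dr_dl, act_xx_self (by omega)]
    calc _ = dl (xx (m+2) m) * dr (sg (m+2) m) * (dr (sg (m+2) m) * dl (xx (m+2) (m+1))) := by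
          simp only [mul_assoc]
      _ = dl (xx (m+2) m) * (dr (sg (m+2) m) * dl (xx (m+2) m)) * dr (sg (m+2) m) := by
          rw [e1]; simp only [mul_assoc]
      _ = dl (xx (m+2) (m+1)) * dl (xx (m+2) m) * dr (sg (m+2) m) * dr (sg (m+2) m) := by
          rw [e2]; simp only [map_mul, map_inv, mul_assoc, mul_inv_cancel_left]
      _ = _ := by rw [mul_assoc (dl (xx (m+2) (m+1))) (dr _) (dl _), e1]; simp only [mul_assoc]

/-- Auxiliary descending family. -/
def Yf (n : ℕ) (s : ℕ → G) (g : G) : ℕ → G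
  | 0 => g
  | k + 1 => s (n - 2 - k) * Yf n s g k * (s (n - 2 - k))⁻¹

/-- Images of the elements `xx n j`. -/
def Xf (n : ℕ) (s : ℕ → G) (g : G) (j : ℕ) : G := Yf n s g (n - 1 - j)

/-- Images of the elements `cc n j`. -/
def Cf (n : ℕ) (s : ℕ → G) (g : G) : ℕ → G
  | 0 => 1
  | k + 1 => Xf n s g k * Cf n s g k

lemma Xf_last (n : ℕ) (s : ℕ → G) (g : G) : Xf n s g (n - 1) = g := by simp [Xf, Yf]

lemma Xf_rec (s : ℕ → G) (g : G) {j : ℕ} (h : j + 1 < n) :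
    Xf n s g j = s j * Xf n s g (j + 1) * (s j)⁻¹ := by
  have e : n - 1 - j = (n - 1 - (j + 1)) + 1 := by omega
  rw [Xf, e, Yf, show n - 2 - (n - 1 - (j + 1)) = j by omega, Xf]

/-- Downward induction principle. -/
lemma down_induction {p : ℕ → Prop} (m : ℕ) (hm : p m) (h : ∀ j, j < m → p (j + 1) → p j) :
    ∀ j, j ≤ m → p j := by
  intro j hj
  obtain ⟨k, rfl⟩ : ∃ k, m = j + k := ⟨m - j, by omega⟩
  clear hj
  induction k generalizing j with
  | zero => exact hm
  | succ k ih =>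
    exact h j (by omega) (ih (j + 1) (by rwa [show j + 1 + k = j + (k + 1) by omega])
      (fun i hi => h i (by omega)))

variable {s : ℕ → G} {g : G}

lemma Xf_comm_hi (h : DRel n s g) {i : ℕ} (hi : i + 3 ≤ n) :
    ∀ j, j ≤ n - 1 → i + 2 ≤ j → Commute (s i) (Xf n s g j) := by
  refine down_induction _ ?_ ?_
  · intro _; rw [Xf_last]; exact h.comm i hi
  · intro j hj ih hij
    have c : Commute (s i) (s j) := h.br.comm i j hij (by omega)
    rw [Xf_rec s g (by omega)]
    exact (c.mul_right (ih (by omega))).mul_right c.inv_right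

lemma Xf_four (h : DRel n s g) (hn : 2 ≤ n) : ∀ i, i ≤ n - 2 →
    Four (s i) (Xf n s g (i + 1)) := by
  refine down_induction _ ?_ ?_
  · rw [show n - 2 + 1 = n - 1 by omega, Xf_last]; exact h.four hn
  · intro i hi ih
    have hc : Commute (s i) (Xf n s g (i + 2)) := Xf_comm_hi h (by omega) _ (by omega) le_rfl
    have hb := braid_conj (h.br.braid i (by omega))
    have h1 := (ih.conj (s i)).conj (s (i + 1))
    rw [← hb] at h1
    rw [show i + 1 + 1 = i + 2 by rfl, hc.eq, mul_inv_cancel_right,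
      ← Xf_rec s g (show i + 1 + 1 < n by omega)] at h1
    convert h1 using 1
    group

lemma Xf_self (h : DRel n s g) {i : ℕ} (hi : i + 1 < n) :
    s i * Xf n s g i * (s i)⁻¹ = (Xf n s g i)⁻¹ * Xf n s g (i + 1) * Xf n s g i := by
  have h1 := Xf_four h (by omega) i (by omega)
  rw [Xf_rec s g hi]
  generalize Xf n s g (i + 1) = y at *
  generalize s i = a at *
  unfold Four at h1
  rw [mul_assoc (_)⁻¹ y, eq_inv_mul_iff_mul_eq]
  calc _ = (a * y * a * y) * (a⁻¹ * a⁻¹) := by group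
    _ = (y * a * y * a) * (a⁻¹ * a⁻¹) := by rw [h1]
    _ = _ := by group

lemma Xf_comm_lo (h : DRel n s g) {i : ℕ} (hi : i + 1 < n) {j : ℕ} (hj : j < i) :
    Commute (s i) (Xf n s g j) := by
  suffices H : ∀ j, j ≤ i - 1 → Commute (s i) (Xf n s g j) from H j (by omega)
  refine down_induction _ ?_ ?_
  · obtain ⟨k, rfl⟩ : ∃ k, i = k + 1 := ⟨i - 1, by omega⟩
    have hc : Commute (s k) (Xf n s g (k + 2)) := Xf_comm_hi h (by omega) _ (by omega) le_rfl
    have hb := h.br.braid k (by omega)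
    rw [show k + 1 - 1 = k by omega, Xf_rec s g (by omega), Xf_rec s g hi]
    have h2 : s (k + 1) * (s k * s (k + 1)) = (s k * s (k + 1)) * s k := by
      rw [hb, mul_assoc]
    have h3 := (SemiconjBy.conj_mk (s k) (s k * s (k + 1))⁻¹)
    have : s k * (s (k + 1) * Xf n s g (k + 1 + 1) * (s (k + 1))⁻¹) * (s k)⁻¹ =
        (s k * s (k + 1)) * Xf n s g (k + 1 + 1) * (s k * s (k + 1))⁻¹ := by group
    rw [this]
    have h4 : s (k + 1) = (s k * s (k + 1)) * s k * (s k * s (k + 1))⁻¹ := by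
      rw [← h2]; group
    have := hc.map (MulAut.conj (s k * s (k + 1))).toMonoidHom
    simp only [MulEquiv.coe_toMonoidHom, MulAut.conj_apply] at this
    rwa [← h4] at this
  · intro j hj ih
    have c : Commute (s i) (s j) := (h.br.comm j i (by omega) hi).symm
    rw [Xf_rec s g (by omega)]
    exact (c.mul_right ih).mul_right c.inv_right

lemma Cf_succ (n : ℕ) (s : ℕ → G) (g : G) (k : ℕ) :
    Cf n s g (k + 1) = Xf n s g k * Cf n s g k := rfl

lemma Cf_two (n : ℕ) (s : ℕ → G) (g : G) (k : ℕ) :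
    Cf n s g (k + 2) = Xf n s g (k + 1) * (Xf n s g k * Cf n s g k) := rfl

lemma Cf_conj (h : DRel n s g) {i : ℕ} (hi : i + 1 < n) (j : ℕ) (hj : j ≤ n) :
    s i * Cf n s g j * (s i)⁻¹ = if j = i + 1 then
      Cf n s g i * (Cf n s g (i + 1))⁻¹ * Cf n s g (i + 2) else Cf n s g j := by
  have lo : ∀ j, j ≤ i → Commute (s i) (Cf n s g j) := by
    intro j
    induction j with
    | zero => intro _; exact Commute.one_right _
    | succ j ih => intro hj; exact (Xf_comm_lo h hi (by omega)).mul_right (ih (by omega))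
  have e1 : s i * Cf n s g (i + 1) * (s i)⁻¹ =
      Cf n s g i * (Cf n s g (i + 1))⁻¹ * Cf n s g (i + 2) := by
    have e : s i * Cf n s g (i + 1) * (s i)⁻¹ =
        (s i * Xf n s g i * (s i)⁻¹) * (s i * Cf n s g i * (s i)⁻¹) := by rw [Cf_succ]; group
    rw [e, Xf_self h hi, (lo i le_rfl).eq, Cf_two, Cf_succ]; group
  have e2 : s i * Cf n s g (i + 2) * (s i)⁻¹ = Cf n s g (i + 2) := by
    have e : s i * Cf n s g (i + 2) * (s i)⁻¹ =
        (s i * Xf n s g (i + 1) * (s i)⁻¹) * (s i * Xf n s g i * (s i)⁻¹) *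
          (s i * Cf n s g i * (s i)⁻¹) := by rw [Cf_two]; group
    rw [e, Xf_self h hi, (lo i le_rfl).eq, ← Xf_rec s g hi, Cf_two]; group
  have hiC : ∀ k, i + 2 + k ≤ n → Commute (s i) (Cf n s g (i + 2 + k)) := by
    intro k
    induction k with
    | zero => intro _; exact (eq_mul_inv_iff_mul_eq.1 e2.symm).symm
    | succ k ih =>
      intro hk
      have : Cf n s g (i + 2 + (k + 1)) = Xf n s g (i + 2 + k) * Cf n s g (i + 2 + k) := rfl
      rw [this]
      exact (Xf_comm_hi h (by omega) _ (by omega) (by omega)).mul_right (ih (by omega))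
  split_ifs with hji
  · subst hji; exact e1
  · rw [mul_inv_eq_iff_eq_mul]
    rcases Nat.lt_or_ge i j with h1 | h1
    · obtain ⟨k, rfl⟩ : ∃ k, j = i + 2 + k := ⟨j - (i + 2), by omega⟩
      exact (hiC k hj)
    · exact (lo j h1)

/-- Homomorphisms out of `D n`. -/
def D.lift (s : ℕ → G) (g : G) (h : DRel n s g) : D n →* G :=
  SemidirectProduct.lift (liftF n (Cf n s g)) (Br.lift s h.br) (by
    intro b
    induction b using Br.induction with
    | h1 => ext; simp
    | hs i hi =>
      have H : ∀ j, j ≤ n → liftF n (Cf n s g) (cc n j) = Cf n s g j := by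
        intro j hj
        rcases Nat.eq_zero_or_pos j with rfl | h0
        · simp [Cf]
        · exact liftF_cc _ h0 hj
      refine Fr.hom_ext fun j h0 hj => ?_
      simp only [MonoidHom.comp_apply, MulEquiv.coe_toMonoidHom, act_sg hi, MulAut.conj_apply,
        Br.lift_sg _ _ hi]
      rw [H j hj, Cf_conj h hi j hj]
      split_ifs
      · simp [H i (by omega), H (i + 1) (by omega), H (i + 2) (by omega)]
      · exact H j hj
    | hm a b ha hb =>
      ext1 x
      have h1 := DFunLike.congr_fun ha (act n b (FreeGroup.of x))
      have h2 := DFunLike.congr_fun hb (FreeGroup.of x)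
      simp only [MonoidHom.comp_apply, MulEquiv.coe_toMonoidHom, map_mul, MulAut.mul_apply] at *
      rw [h1, h2]
    | hi a ha =>
      ext1 x
      have h1 := DFunLike.congr_fun ha ((act n a)⁻¹ (FreeGroup.of x))
      simp only [MonoidHom.comp_apply, MulEquiv.coe_toMonoidHom, map_inv,
        MulAut.apply_inv_self] at *
      rw [h1]; simp [mul_assoc])

lemma D.lift_dr (h : DRel n s g) (b : Br n) : D.lift s g h (dr b) = Br.lift s h.br b := by
  simp [D.lift]

lemma D.lift_sg (h : DRel n s g) {i : ℕ} (hi : i + 1 < n) : D.lift s g h (dr (sg n i)) = s i := by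
  rw [D.lift_dr, Br.lift_sg _ _ hi]

lemma D.lift_cc (h : DRel n s g) {j : ℕ} (hj : j ≤ n) :
    D.lift s g h (dl (cc n j)) = Cf n s g j := by
  rw [D.lift, SemidirectProduct.lift_inl]
  rcases Nat.eq_zero_or_pos j with rfl | h0
  · simp [Cf]
  · exact liftF_cc _ h0 hj

lemma D.lift_xx (h : DRel n s g) {j : ℕ} (hj : j < n) :
    D.lift s g h (dl (xx n j)) = Xf n s g j := by
  rw [xx, map_mul, map_mul, map_inv, map_inv, D.lift_cc h hj, D.lift_cc h (by omega), Cf,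
    mul_inv_cancel_right]

lemma D.lift_x (h : DRel n s g) (hn : 0 < n) : D.lift s g h (dl (xx n (n - 1))) = g := by
  rw [D.lift_xx h (by omega), Xf_last]

end DLift
end BraidB

namespace BraidB

section Twist
variable {G : Type*} [Group G] {n : ℕ} {s : ℕ → G}

/-- The product `s 0 * ⋯ * s (k-1)`. -/
def ew (s : ℕ → G) : ℕ → G
  | 0 => 1
  | k + 1 => ew s k * s k

@[simp] lemma ew_zero (s : ℕ → G) : ew s 0 = 1 := rfl
lemma ew_succ (s : ℕ → G) (k : ℕ) : ew s (k + 1) = ew s k * s k := rfl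

lemma ew_map {H : Type*} [Group H] (f : G →* H) (s : ℕ → G) (k : ℕ) :
    f (ew s k) = ew (fun i => f (s i)) k := by
  induction k with
  | zero => simp
  | succ k ih => simp [ew_succ, ih]

lemma ew_congr {s t : ℕ → G} {k : ℕ} (h : ∀ i, i < k → s i = t i) : ew s k = ew t k := by
  induction k with
  | zero => rfl
  | succ k ih => rw [ew_succ, ew_succ, ih fun i hi => h i (by omega), h k (by omega)]

lemma ew_comm (hs : BraidRel n s) {k i : ℕ} (h1 : k + 1 ≤ i) (h2 : i + 1 < n) :
    Commute (ew s k) (s i) := by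
  induction k with
  | zero => exact Commute.one_left _
  | succ k ih =>
    exact (ih (by omega)).mul_left (hs.comm k i (by omega) h2)

lemma ew_shift (hs : BraidRel n s) {k i : ℕ} (h1 : i + 1 < k) (h2 : k < n) :
    ew s k * s i = s (i + 1) * ew s k := by
  induction k with
  | zero => omega
  | succ k ih =>
    rcases Nat.lt_or_ge (i + 1) k with h | h
    · have c := hs.comm i k (by omega) (by omega)
      rw [ew_succ, mul_assoc, ← c, ← mul_assoc, ih h (by omega), mul_assoc]
    · obtain rfl : k = i + 1 := by omega
      have b := hs.braid i (by omega)
      have c := ew_comm hs (k := i) (i := i + 1) le_rfl (by omega)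
      calc ew s (i + 1 + 1) * s i = ew s i * (s i * s (i + 1) * s i) := by
            simp only [ew_succ, mul_assoc]
        _ = (ew s i * s (i + 1)) * s i * s (i + 1) := by rw [b]; simp only [mul_assoc]
        _ = _ := by rw [c.eq]; simp only [ew_succ, mul_assoc]

lemma ew_shift_pow (hs : BraidRel n s) {k i j : ℕ} (h1 : i + j < k) (h2 : k < n) :
    ew s k ^ j * s i = s (i + j) * ew s k ^ j := by
  induction j with
  | zero => simp
  | succ j ih =>
    rw [pow_succ', mul_assoc, ih (by omega), ← mul_assoc, ew_shift hs (by omega) h2, mul_assoc]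
    rfl

lemma ew_mul_ew (hs : BraidRel n s) {k : ℕ} (h2 : k + 1 < n) :
    s 0 * ew s (k + 1) * ew s k = ew s (k + 1) * ew s (k + 1) := by
  have : ∀ j, j ≤ k → s 0 * ew s (k + 1) * ew s j = ew s (j + 1) * ew s (k + 1) := by
    intro j
    induction j with
    | zero => intro _; simp [ew_succ s 0]
    | succ j ih =>
      intro hj
      rw [ew_succ s j, ← mul_assoc, ih (by omega), mul_assoc, ew_shift hs (by omega) h2,
        ew_succ s (j + 1), mul_assoc]
  exact this k le_rfl

lemma ew_wrap (hs : BraidRel n s) {k : ℕ} (h2 : k + 1 < n) :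
    ew s (k + 1) ^ 2 * s k = s 0 * ew s (k + 1) ^ 2 := by
  have := ew_mul_ew hs h2
  calc _ = ew s (k + 1) * ew s (k + 1) * s k := by rw [pow_two]
    _ = s 0 * ew s (k + 1) * (ew s k * s k) := by rw [← this]; simp only [mul_assoc]
    _ = _ := by rw [← ew_succ, pow_two, mul_assoc]

/-- The full twist on the first `m` strands. -/
def tw (s : ℕ → G) (m : ℕ) : G := ew s (m - 1) ^ m

lemma tw_map {H : Type*} [Group H] (f : G →* H) (s : ℕ → G) (k : ℕ) :
    f (tw s k) = tw (fun i => f (s i)) k := by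
  rw [tw, map_pow, ew_map, tw]

@[simp] lemma tw_zero (s : ℕ → G) : tw s 0 = 1 := by simp [tw]
@[simp] lemma tw_one (s : ℕ → G) : tw s 1 = 1 := by simp [tw]

lemma tw_congr {s t : ℕ → G} {k : ℕ} (h : ∀ i, i + 1 < k → s i = t i) : tw s k = tw t k := by
  rw [tw, tw, ew_congr fun i hi => h i (by omega)]

lemma tw_comm (hs : BraidRel n s) {m i : ℕ} (hm : m ≤ n) (hi : i + 1 < m) :
    Commute (tw s m) (s i) := by
  obtain ⟨k, rfl⟩ : ∃ k, m = k + 2 := ⟨m - 2, by omega⟩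
  have h1 := ew_shift_pow hs (k := k + 1) (i := i) (j := k - i) (by omega) (by omega)
  have h2 := ew_wrap hs (k := k) (by omega)
  have h3 := ew_shift_pow hs (k := k + 1) (i := 0) (j := i) (by omega) (by omega)
  rw [show i + (k - i) = k by omega] at h1
  rw [zero_add] at h3
  rw [tw, show k + 2 - 1 = k + 1 by omega]
  generalize ew s (k + 1) = e at *
  have : e ^ (k + 2) = e ^ i * e ^ 2 * e ^ (k - i) := by
    rw [← pow_add, ← pow_add]; congr 1; omega
  rw [this]
  calc _ = e ^ i * e ^ 2 * (e ^ (k - i) * s i) := by simp only [mul_assoc]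
    _ = e ^ i * (e ^ 2 * s k) * e ^ (k - i) := by rw [h1]; simp only [mul_assoc]
    _ = (e ^ i * s 0) * e ^ 2 * e ^ (k - i) := by rw [h2]; simp only [mul_assoc]
    _ = _ := by rw [h3]; simp only [mul_assoc]

lemma tw_comm_hi (hs : BraidRel n s) {m i : ℕ} (hm : m ≤ i) (hi : i + 1 < n) :
    Commute (tw s m) (s i) := by
  rcases Nat.eq_zero_or_pos m with rfl | h
  · simp
  · exact (ew_comm hs (by omega) hi).pow_left _

lemma tw_comm_ew (hs : BraidRel n s) {m k : ℕ} (hm : m ≤ n) (hi : k < m) :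
    Commute (tw s m) (ew s k) := by
  induction k with
  | zero => exact Commute.one_right _
  | succ k ih => exact (ih (by omega)).mul_right (tw_comm hs hm (by omega))

lemma tw_comm_tw (hs : BraidRel n s) {m k : ℕ} (hm : m ≤ n) (hi : k ≤ m) :
    Commute (tw s m) (tw s k) := by
  rcases Nat.eq_zero_or_pos k with rfl | h
  · simp
  · exact (tw_comm_ew hs hm (by omega)).pow_right _

end Twist

section
variable {n : ℕ}

/-- The `m`-strand full twist in the braid group. -/
abbrev twB (n m : ℕ) : Br n := tw (sg n) m

lemma twB_central (g : Br n) : Commute (twB n n) g := by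
  induction g using Br.induction with
  | h1 => exact Commute.one_right _
  | hs i hi => exact tw_comm (braidRel_sg n) le_rfl hi
  | hm a b ha hb => exact ha.mul_right hb
  | hi a ha => exact ha.inv_right

lemma act_ew_lo {k j : ℕ} (hk : k < n) (hj : j ≤ k) :
    act n (ew (sg n) k) (cc n j) = (cc n 1)⁻¹ * cc n (j + 1) := by
  have hi : ∀ k, k < n → ∀ j, k < j → act n (ew (sg n) k) (cc n j) = cc n j := by
    intro k
    induction k with
    | zero => simp
    | succ k ih =>
      intro hk j hj
      rw [ew_succ, map_mul, MulAut.mul_apply, act_sg_of_ne hk (by omega), ih (by omega) j (by omega)]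
  induction k generalizing j with
  | zero => obtain rfl : j = 0 := by omega
            simp
  | succ k ih =>
    rw [ew_succ, map_mul, MulAut.mul_apply, act_sg hk]
    split_ifs with h
    · subst h
      rw [map_mul, map_mul, map_inv, ih (by omega) le_rfl, hi k (by omega) _ (by omega),
        hi k (by omega) _ (by omega)]
      simp
    · exact ih (by omega) (by omega)

lemma act_ew_hi {k j : ℕ} (hk : k < n) (hj : k < j) :
    act n (ew (sg n) k) (cc n j) = cc n j := by
  induction k generalizing j with
  | zero => simp
  | succ k ih =>
    rw [ew_succ, map_mul, MulAut.mul_apply, act_sg_of_ne hk (by omega), ih (by omega) (by omega)]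

lemma act_ew_pow {k i j : ℕ} (hk : k < n) (hj : i + j ≤ k + 1) :
    act n (ew (sg n) k ^ i) (cc n j) = (cc n i)⁻¹ * cc n (j + i) := by
  induction i with
  | zero => simp
  | succ i ih =>
    rw [pow_succ', map_mul, MulAut.mul_apply, ih (by omega), map_mul, map_inv,
      act_ew_lo hk (by omega), act_ew_lo hk (by omega), mul_inv_rev, inv_inv, mul_assoc,
      mul_inv_cancel_left]
    rfl

lemma act_tw_lo {m j : ℕ} (hm : m ≤ n) (hj : j ≤ m) :
    act n (twB n m) (cc n j) = (cc n m)⁻¹ * cc n j * cc n m := by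
  rcases Nat.eq_zero_or_pos m with rfl | h0
  · obtain rfl : j = 0 := by omega
    simp
  have hk : m - 1 < n := by omega
  have h1 := act_ew_pow (n := n) (k := m - 1) (i := m - j) (j := j) hk (by omega)
  have h2 := act_ew_pow (n := n) (k := m - 1) (i := j) (j := m - j) hk (by omega)
  have h3 : act n (ew (sg n) (m - 1) ^ j) (cc n m) = cc n m := by
    clear h1 h2
    induction j with
    | zero => simp
    | succ j ih => rw [pow_succ', map_mul, MulAut.mul_apply, ih (by omega),
        act_ew_hi hk (by omega)]
  have : twB n m = ew (sg n) (m - 1) ^ j * ew (sg n) (m - 1) ^ (m - j) := by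
    rw [← pow_add, twB, tw]; congr 1; omega
  rw [this, map_mul, MulAut.mul_apply, h1, map_mul, map_inv, h2]
  rw [show j + (m - j) = m by omega, h3, show m - j + j = m by omega]
  simp

lemma act_tw_hi {m j : ℕ} (hm : m ≤ n) (hj : m < j) : act n (twB n m) (cc n j) = cc n j := by
  rcases Nat.eq_zero_or_pos m with rfl | h0
  · simp
  rw [twB, tw]
  have : ∀ i, act n (ew (sg n) (m - 1) ^ i) (cc n j) = cc n j := by
    intro i
    induction i with
    | zero => simp
    | succ i ih => rw [pow_succ', map_mul, MulAut.mul_apply, ih, act_ew_hi (by omega) (by omega)]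
  exact this _

lemma act_tw_full (f : Fr n) : act n (twB n n) f = (cc n n)⁻¹ * f * cc n n := by
  have : (act n (twB n n) : Fr n →* Fr n) = (MulAut.conj (cc n n)⁻¹ : Fr n →* Fr n) := by
    refine Fr.hom_ext fun j _ hj => ?_
    have := act_tw_lo le_rfl hj
    simpa using this
  have := DFunLike.congr_fun this f
  simpa using this

/-- The central element of `D n`. -/
def zD (n : ℕ) : D n := dl (cc n n) * dr (twB n n)

lemma dr_dl_comm_cc_top (b : Br n) : Commute (dr b : D n) (dl (cc n n)) := by
  rw [Commute, SemiconjBy, dr_dl, act_cc_top]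

lemma zD_central (g : D n) : Commute (zD n) g := by
  have hr : ∀ b : Br n, Commute (zD n) (dr b) := fun b =>
    (dr_dl_comm_cc_top b).symm.mul_left ((twB_central b).map dr)
  have hl : ∀ f : Fr n, Commute (zD n) (dl f) := by
    intro f
    rw [Commute, SemiconjBy, zD, mul_assoc, dr_dl, act_tw_full]
    simp only [map_mul, map_inv, mul_assoc, mul_inv_cancel_left]
  rw [← SemidirectProduct.inl_left_mul_inr_right g]
  exact (hl _).mul_right (hr _)

lemma zD_eq_pow (hn : 0 < n) :
    zD n = (ew (fun i => dr (sg n i)) (n - 1) * dl (xx n (n - 1))) ^ n := by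
  rw [← ew_map]
  set e := ew (sg n) (n - 1) with he
  have h1 : (dr e * dl (xx n (n - 1)) : D n) = dl (cc n 1) * dr e := by
    rw [dr_dl, xx, map_mul, map_inv, he, act_ew_lo (by omega) le_rfl,
      show n - 1 + 1 = n by omega, act_ew_hi (by omega) (by omega)]
    simp
  have h2 : ∀ k, k ≤ n → (dl (cc n 1) * dr e : D n) ^ k = dl (cc n k) * dr (e ^ k) := by
    intro k
    induction k with
    | zero => intro _; simp
    | succ k ih =>
      intro hk
      have := act_ew_pow (n := n) (k := n - 1) (i := k) (j := 1) (by omega) (by omega)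
      rw [pow_succ, ih (by omega), mul_assoc, ← mul_assoc (dr _), dr_dl, he, this, ← he,
        pow_succ, add_comm 1 k]
      simp [mul_assoc]
  rw [h1, h2 n le_rfl, zD, twB, tw]

end

end BraidB

namespace BraidB

section
variable {n : ℕ}

lemma iotaRel (n : ℕ) : DRel n (sg (n + 1)) (sg (n + 1) (n - 1) ^ 2) where
  br := (braidRel_sg (n + 1)).mono (by omega)
  comm i hi := by
    have c : Commute (sg (n + 1) i) (sg (n + 1) (n - 1)) :=
      (braidRel_sg (n + 1)).comm i (n - 1) (by omega) (by omega)
    exact c.pow_right 2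
  four hn := by
    have h := (braidRel_sg (n + 1)).braid (n - 2) (by omega)
    rw [show n - 2 + 1 = n - 1 by omega] at h
    unfold Four
    generalize sg (n + 1) (n - 1) = b at *
    generalize sg (n + 1) (n - 2) = a at *
    calc a * b ^ 2 * a * b ^ 2 = a * b * (b * a * b) * b := by simp only [pow_two, mul_assoc]
      _ = a * (b * (a * (b * (a * b)))) := by rw [← h]; simp only [mul_assoc]
      _ = (a * b * a) * (b * a * b) := by simp only [mul_assoc]
      _ = (b * a * b) * (a * b * a) := by rw [h]
      _ = b * (a * (b * (a * (b * a)))) := by simp only [mul_assoc]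
      _ = b * (b * a * b) * b * a := by rw [← h]; simp only [mul_assoc]
      _ = _ := by simp only [pow_two, mul_assoc]

/-- The embedding of `D n` in the braid group on `n + 1` strands. -/
def iota (n : ℕ) : D n →* Br (n + 1) := D.lift _ _ (iotaRel n)

lemma iota_sg {i : ℕ} (hi : i + 1 < n) : iota n (dr (sg n i)) = sg (n + 1) i := D.lift_sg _ hi

lemma iota_x (hn : 0 < n) : iota n (dl (xx n (n - 1))) = sg (n + 1) (n - 1) ^ 2 := D.lift_x _ hn

/-- Auxiliary descending product. -/
def hq (n : ℕ) : ℕ → Br (n + 1)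
  | 0 => 1
  | k + 1 => hq n k * (sg (n + 1) (n - 1 - k))⁻¹

/-- Coset representatives for the stabilizer of the last strand. -/
def hh (n j : ℕ) : Br (n + 1) := hq n (n - j)

@[simp] lemma hh_self (n : ℕ) : hh n n = 1 := by simp [hh, hq]

lemma hh_rec {j : ℕ} (h : j < n) : hh n j = hh n (j + 1) * (sg (n + 1) j)⁻¹ := by
  rw [hh, show n - j = (n - (j + 1)) + 1 by omega, hq, hh,
    show n - 1 - (n - (j + 1)) = j by omega]

lemma hh_comm {i : ℕ} : ∀ j, j ≤ n → i + 1 < j → Commute (hh n j) (sg (n + 1) i) := by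
  refine down_induction n ?_ ?_
  · intro _; simp
  · intro j hj ih hij
    have c : Commute (sg (n + 1) i) (sg (n + 1) j) :=
      (braidRel_sg (n + 1)).comm i j (by omega) (by omega)
    rw [hh_rec hj]
    exact (ih (by omega)).mul_left c.symm.inv_left

lemma hh_shift {i : ℕ} (hi : i < n) : ∀ j, j < i →
    hh n j * sg (n + 1) i = sg (n + 1) (i - 1) * hh n j := by
  suffices H : ∀ j, j ≤ i - 1 → j < i →
    hh n j * sg (n + 1) i = sg (n + 1) (i - 1) * hh n j from fun j hj => H j (by omega) hj
  refine down_induction _ ?_ ?_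
  · intro hi'
    obtain ⟨k, rfl⟩ : ∃ k, i = k + 1 := ⟨i - 1, by omega⟩
    have hb := (braidRel_sg (n + 1)).braid k (by omega)
    have hc := hh_comm (n := n) (i := k) (k + 1 + 1) (by omega) (by omega)
    rw [show k + 1 - 1 = k by omega, hh_rec (by omega), hh_rec (by omega)]
    have h2 := braid_conj hb.symm
    rw [← eq_mul_inv_iff_mul_eq] at h2
    generalize sg (n + 1) (k + 1) = b at *
    generalize sg (n + 1) k = a at *
    generalize hh n (k + 1 + 1) = h at *
    calc h * b⁻¹ * a⁻¹ * b = h * b⁻¹ * (a⁻¹ * b) := by group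
      _ = h * a * b⁻¹ * a⁻¹ := by rw [h2]; group
      _ = _ := by rw [hc.eq]; group
  · intro j hj ih hji
    have c : Commute (sg (n + 1) j) (sg (n + 1) i) :=
      (braidRel_sg (n + 1)).comm j i (by omega) (by omega)
    rw [hh_rec (by omega), mul_assoc, c.inv_left.eq, ← mul_assoc, ih (by omega), mul_assoc]

lemma iota_xx {j : ℕ} (hj : j < n) :
    iota n (dl (xx n j)) = hh n (j + 1) * sg (n + 1) j ^ 2 * (hh n (j + 1))⁻¹ := by
  rw [iota, D.lift_xx _ hj]
  suffices H : ∀ j, j ≤ n - 1 → Xf n (sg (n + 1)) (sg (n + 1) (n - 1) ^ 2) j =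
    hh n (j + 1) * sg (n + 1) j ^ 2 * (hh n (j + 1))⁻¹ from H j (by omega)
  refine down_induction _ ?_ ?_
  · rw [Xf_last, show n - 1 + 1 = n by omega]; simp
  · intro j hj ih
    rw [Xf_rec _ _ (by omega), ih]
    have hb := (braidRel_sg (n + 1)).braid j (by omega)
    have hc := hh_comm (n := n) (i := j) (j + 1 + 1) (by omega) (by omega)
    rw [hh_rec (j := j + 1) (by omega)]
    have h2 := braid_conj hb
    generalize sg (n + 1) (j + 1) = b at *
    generalize sg (n + 1) j = a at *
    generalize hh n (j + 1 + 1) = h at *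
    have e1 : a * (h * b ^ 2 * h⁻¹) * a⁻¹ = (a * h) * b ^ 2 * (a * h)⁻¹ := by group
    have e2 : h * b⁻¹ * a ^ 2 * (h * b⁻¹)⁻¹ = h * (b⁻¹ * a * b) ^ 2 * h⁻¹ := by simp only [pow_two]; group
    rw [e1, e2, h2, ← hc.eq]; simp only [pow_two]; group

/-- Wreath product with the permutations of `ℕ`. -/
abbrev Wr (A : Type*) [Group A] := (ℕ → A) ⋊[mulAutArrow] Equiv.Perm ℕ

/-- The components of the cocycle on generators. -/
def kgen (n i j : ℕ) : D n :=
  if n < j then 1 else if i + 1 < j then dr (sg n i) else if j = i + 1 then dl (xx n i)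
    else if j = i then 1 else dr (sg n (i - 1))

/-- The wreath product elements associated with generators. -/
def kw (n i : ℕ) : Wr (D n) := ⟨kgen n i, Equiv.swap i (i + 1)⟩

lemma wr_mul_left {A : Type*} [Group A] (a b : Wr A) (k : ℕ) :
    (a * b).left k = a.left k * b.left (a.right⁻¹ k) := rfl

lemma kgen_big {i j : ℕ} (h : n < j) : kgen n i j = 1 := by simp [kgen, h]
lemma kgen_hi {i j : ℕ} (h : j ≤ n) (h1 : i + 1 < j) : kgen n i j = dr (sg n i) := by
  simp [kgen, h1, not_lt.2 h]
lemma kgen_succ {i : ℕ} (h : i < n) : kgen n i (i + 1) = dl (xx n i) := by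
  simp [kgen, show ¬ n < i + 1 by omega]
lemma kgen_self {i : ℕ} : kgen n i i = 1 := by simp [kgen]
lemma kgen_lo {i j : ℕ} (h : i < n) (h1 : j < i) : kgen n i j = dr (sg n (i - 1)) := by
  simp [kgen, show ¬ n < j by omega, show ¬ i + 1 < j by omega, show j ≠ i + 1 by omega, h1.ne]

lemma swap_succ_of_ne {i j : ℕ} (h1 : j ≠ i) (h2 : j ≠ i + 1) : Equiv.swap i (i + 1) j = j :=
  Equiv.swap_apply_of_ne_of_ne h1 h2

lemma braidRel_swap (n : ℕ) : BraidRel n (fun i => (Equiv.swap i (i + 1) : Equiv.Perm ℕ)) where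
  comm i j h1 _ := by
    refine (Equiv.Perm.Disjoint.commute ?_).eq
    intro k
    by_cases h : k = i ∨ k = i + 1
    · right; exact swap_succ_of_ne (by omega) (by omega)
    · left; exact swap_succ_of_ne (by omega) (by omega)
  braid i _ := by
    ext k
    simp only [Equiv.Perm.mul_apply, Equiv.swap_apply_def]
    split_ifs <;> omega

lemma braidRel_kw (n : ℕ) : BraidRel (n + 1) (kw n) where
  comm i j h1 h2 := by
    refine SemidirectProduct.ext (funext fun k => ?_) ((braidRel_swap (n + 1)).comm i j h1 h2)
    rw [wr_mul_left, wr_mul_left]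
    simp only [kw, Equiv.swap_inv]
    have hi : i < n := by omega
    have hj : j < n := by omega
    rcases lt_or_ge n k with hk | hk
    · rw [swap_succ_of_ne (by omega) (by omega), swap_succ_of_ne (by omega) (by omega)]
      simp [kgen_big hk]
    rcases lt_or_ge (j + 1) k with hk1 | hk1
    · rw [swap_succ_of_ne (by omega) (by omega), swap_succ_of_ne (by omega) (by omega),
        kgen_hi hk hk1, kgen_hi hk (by omega), ← map_mul, ← map_mul,
        (braidRel_sg n).comm i j h1 (by omega)]
    by_cases hk2 : k = j + 1
    · subst hk2
      rw [swap_succ_of_ne (by omega) (by omega), Equiv.swap_apply_right, kgen_hi (by omega) (by omega),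
        kgen_succ hj, kgen_hi (by omega) (by omega), dr_dl, act_xx_of_ne (by omega) (by omega)
        (by omega)]
    by_cases hk3 : k = j
    · subst hk3
      rw [swap_succ_of_ne (by omega) (by omega), Equiv.swap_apply_left, kgen_hi (by omega) (by omega),
        kgen_self, kgen_hi (by omega) (by omega), mul_one, one_mul]
    rcases lt_or_ge (i + 1) k with hk4 | hk4
    · rw [swap_succ_of_ne (by omega) (by omega), swap_succ_of_ne (by omega) (by omega),
        kgen_hi hk hk4, kgen_lo hj (by omega), ← map_mul, ← map_mul,
        (braidRel_sg n).comm i (j - 1) (by omega) (by omega)]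
    by_cases hk5 : k = i + 1
    · subst hk5
      rw [Equiv.swap_apply_right, swap_succ_of_ne (by omega) (by omega), kgen_lo hj (by omega),
        kgen_succ hi, kgen_lo hj (by omega), dr_dl, act_xx_of_ne (by omega) (by omega)
        (by omega)]
    by_cases hk6 : k = i
    · subst hk6
      rw [Equiv.swap_apply_left, swap_succ_of_ne (by omega) (by omega), kgen_lo hj (by omega),
        kgen_self, kgen_lo hj (by omega), mul_one, one_mul]
    · rw [swap_succ_of_ne (by omega) (by omega), swap_succ_of_ne (by omega) (by omega),
        kgen_lo hj (by omega), kgen_lo hi (by omega), ← map_mul, ← map_mul,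
        (braidRel_sg n).comm (i - 1) (j - 1) (by omega) (by omega)]
  braid i h := by
    refine SemidirectProduct.ext (funext fun k => ?_) ((braidRel_swap (n + 1)).braid i h)
    have e1 : ∀ a b c : Wr (D n), (a * b * c).left k =
        a.left k * b.left (a.right⁻¹ k) * c.left (b.right⁻¹ (a.right⁻¹ k)) := fun _ _ _ => rfl
    rw [e1, e1]
    simp only [kw, Equiv.swap_inv]
    have hi : i < n := by omega
    have hi' : i + 1 < n := by omega
    rcases lt_or_ge n k with hk | hk
    · simp only [swap_succ_of_ne (show k ≠ i by omega) (show k ≠ i + 1 by omega),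
        swap_succ_of_ne (show k ≠ i + 1 by omega) (show k ≠ i + 1 + 1 by omega), kgen_big hk]
    rcases lt_or_ge (i + 2) k with hk1 | hk1
    · simp only [swap_succ_of_ne (show k ≠ i by omega) (show k ≠ i + 1 by omega),
        swap_succ_of_ne (show k ≠ i + 1 by omega) (show k ≠ i + 1 + 1 by omega)]
      rw [kgen_hi hk (by omega), kgen_hi hk (by omega)]
      simp only [← map_mul]
      rw [(braidRel_sg n).braid i (by omega)]
    by_cases hk2 : k = i + 1 + 1
    · subst hk2
      rw [swap_succ_of_ne (by omega) (by omega), Equiv.swap_apply_right, Equiv.swap_apply_right,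
        kgen_hi (by omega) (by omega), kgen_succ hi', kgen_succ hi, kgen_hi hk (by omega) |>.symm,
        kgen_lo hi' (by omega), kgen_hi hk (by omega), mul_assoc, ← map_mul, dr_dl, map_mul,
        act_xx_succ hi', act_xx_self hi']
      simp [mul_assoc]
    by_cases hk3 : k = i + 1
    · subst hk3
      rw [Equiv.swap_apply_right, swap_succ_of_ne (by omega) (by omega), Equiv.swap_apply_left,
        kgen_succ hi, kgen_lo hi' (by omega), kgen_self, kgen_self,
        kgen_hi (by omega) (by omega), swap_succ_of_ne (by omega) (by omega), kgen_succ hi',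
        show i + 1 - 1 = i by omega, mul_one, one_mul, dr_dl, act_xx_succ hi']
    by_cases hk4 : k = i
    · subst hk4
      rw [Equiv.swap_apply_left, Equiv.swap_apply_left, swap_succ_of_ne (by omega) (by omega),
        kgen_self, kgen_self, kgen_lo hi' (by omega), Equiv.swap_apply_left,
        kgen_self, kgen_hi (by omega) (by omega)]
      simp
    · have hlt : k < i := by omega
      have e2 := (braidRel_sg n).braid (i - 1) (by omega)
      rw [show i - 1 + 1 = i by omega] at e2
      simp only [swap_succ_of_ne (show k ≠ i by omega) (show k ≠ i + 1 by omega),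
        swap_succ_of_ne (show k ≠ i + 1 by omega) (show k ≠ i + 1 + 1 by omega)]
      rw [kgen_lo hi hlt, kgen_lo hi' (by omega), show i + 1 - 1 = i by omega]
      simp only [← map_mul]
      rw [e2]

/-- The permutation of `ℕ` underlying a braid. -/
def prm (n : ℕ) : Br n →* Equiv.Perm ℕ := Br.lift _ (braidRel_swap n)

lemma prm_sg {i : ℕ} (hi : i + 1 < n) : prm n (sg n i) = Equiv.swap i (i + 1) :=
  Br.lift_sg _ _ hi

lemma prm_of_le (g : Br n) {j : ℕ} (hj : n ≤ j) : prm n g j = j := by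
  induction g using Br.induction with
  | h1 => simp
  | hs i hi => rw [prm_sg hi, swap_succ_of_ne (by omega) (by omega)]
  | hm a b ha hb => rw [map_mul, Equiv.Perm.mul_apply, hb, ha]
  | hi a ha => rw [map_inv, Equiv.Perm.inv_eq_iff_eq, ha]

lemma prm_lt_iff (g : Br n) {j : ℕ} : prm n g j < n ↔ j < n := by
  constructor
  · intro h
    by_contra hj
    rw [prm_of_le g (by omega)] at h
    exact hj h
  · intro h
    by_contra hj
    have := prm_of_le g (not_lt.1 hj)
    have := (prm n g).injective this
    omega

/-- The wreath recursion on braid groups. -/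
def kapW (n : ℕ) : Br (n + 1) →* Wr (D n) := Br.lift _ (braidRel_kw n)

lemma kapW_right (g : Br (n + 1)) : (kapW n g).right = prm (n + 1) g := by
  have : (SemidirectProduct.rightHom).comp (kapW n) = prm (n + 1) := by
    refine Br.hom_ext fun i hi => ?_
    rw [MonoidHom.comp_apply, kapW, Br.lift_sg _ _ hi, prm_sg hi]; rfl
  exact DFunLike.congr_fun this g

/-- The components of the wreath recursion. -/
def kap (n j : ℕ) (g : Br (n + 1)) : D n := (kapW n g).left j

lemma kap_sg {i j : ℕ} (hi : i < n) : kap n j (sg (n + 1) i) = kgen n i j := by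
  rw [kap, kapW, Br.lift_sg _ _ (by omega)]; rfl

@[simp] lemma kap_one {j : ℕ} : kap n j 1 = 1 := by simp [kap]

lemma kap_mul {j : ℕ} (g h : Br (n + 1)) :
    kap n j (g * h) = kap n j g * kap n ((prm (n + 1) g)⁻¹ j) h := by
  rw [kap, map_mul, wr_mul_left, kapW_right]; rfl

lemma kap_inv {j : ℕ} (g : Br (n + 1)) :
    kap n j g⁻¹ = (kap n (prm (n + 1) g j) g)⁻¹ := by
  have := kap_mul (j := j) g⁻¹ g
  rw [inv_mul_cancel, kap_one, map_inv, inv_inv] at this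
  exact eq_inv_of_mul_eq_one_left this.symm

lemma hh_mul (g : Br (n + 1)) : ∀ j, j ≤ n →
    hh n j * g = iota n (kap n j g) * hh n ((prm (n + 1) g)⁻¹ j) := by
  induction g using Br.induction with
  | h1 => simp
  | hs i hi =>
    intro j hj
    have hi' : i < n := by omega
    rw [kap_sg hi', prm_sg hi, Equiv.swap_inv]
    rcases lt_or_ge (i + 1) j with h | h
    · rw [kgen_hi hj h, swap_succ_of_ne (by omega) (by omega), iota_sg (by omega)]
      exact hh_comm _ hj h
    by_cases h1 : j = i + 1
    · subst h1
      rw [kgen_succ hi', Equiv.swap_apply_right, iota_xx hi', hh_rec hi']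
      group
    by_cases h2 : j = i
    · subst h2
      rw [kgen_self, Equiv.swap_apply_left, hh_rec hi']; simp
    · rw [kgen_lo hi' (by omega), swap_succ_of_ne h2 h1, iota_sg (by omega)]
      exact hh_shift hi' _ (by omega)
  | hm a b ha hb =>
    intro j hj
    have : (prm (n + 1) a)⁻¹ j ≤ n := by
      have := (prm_lt_iff a⁻¹ (j := j)).2 (by omega)
      rw [map_inv] at this; omega
    rw [← mul_assoc, ha j hj, mul_assoc, hb _ this, kap_mul, map_mul, map_mul, mul_inv_rev,
      Equiv.Perm.mul_apply, mul_assoc]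
  | hi a ha =>
    intro j hj
    have h1 : prm (n + 1) a j ≤ n := by
      have := (prm_lt_iff a (j := j)).2 (by omega)
      omega
    have := ha _ h1
    rw [show (prm (n + 1) a)⁻¹ (prm (n + 1) a j) = j by simp] at this
    rw [mul_inv_eq_iff_eq_mul, kap_inv, map_inv, map_inv, inv_inv, mul_assoc, this]
    simp

end
end BraidB

namespace BraidB

section
variable {n : ℕ}

lemma prm_iota (d : D n) : prm (n + 1) (iota n d) = prm n (pr d) := by
  rcases Nat.eq_zero_or_pos n with rfl | hn
  · have : d = 1 := by
      refine SemidirectProduct.ext (Subsingleton.elim _ _) ?_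
      have : (MonoidHom.id (Br 0)) = 1 := Br.hom_ext fun i hi => absurd hi (by omega)
      exact DFunLike.congr_fun this d.right
    subst this; simp
  have : (prm (n + 1)).comp (iota n) = (prm n).comp pr := by
    refine D.hom_ext (fun i hi => ?_) ?_
    · simp only [MonoidHom.comp_apply, iota_sg hi, SemidirectProduct.rightHom_inr]
      rw [prm_sg hi, prm_sg (by omega)]
    · simp only [MonoidHom.comp_apply, iota_x hn, SemidirectProduct.rightHom_inl, map_one]
      rw [map_pow, prm_sg (by omega), pow_two, Equiv.swap_mul_self]
  exact DFunLike.congr_fun this d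

lemma prm_iota_top (d : D n) : prm (n + 1) (iota n d) n = n := by
  rw [prm_iota, prm_of_le _ le_rfl]

lemma kap_mul_top {g : Br (n + 1)} (hg : prm (n + 1) g n = n) (h : Br (n + 1)) :
    kap n n (g * h) = kap n n g * kap n n h := by
  rw [kap_mul, Equiv.Perm.inv_eq_iff_eq.2 hg.symm]

lemma kap_iota (d : D n) : kap n n (iota n d) = d := by
  rcases Nat.eq_zero_or_pos n with rfl | hn
  · have : d = 1 := by
      refine SemidirectProduct.ext (Subsingleton.elim _ _) ?_
      have : (MonoidHom.id (Br 0)) = 1 := Br.hom_ext fun i hi => absurd hi (by omega)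
      exact DFunLike.congr_fun this d.right
    subst this; simp
  let f : D n →* D n := MonoidHom.mk' (fun d => kap n n (iota n d)) (fun a b => by
    rw [map_mul, kap_mul_top (prm_iota_top a)])
  have : f = MonoidHom.id _ := by
    refine D.hom_ext (fun i hi => ?_) ?_
    · change kap n n (iota n _) = dr (sg n i)
      rw [iota_sg hi, kap_sg (by omega), kgen_hi le_rfl hi]
    · change kap n n (iota n _) = dl (xx n (n - 1))
      rw [iota_x hn, pow_two, kap_mul, kap_sg (by omega), prm_sg (by omega), Equiv.swap_inv]
      obtain ⟨m, rfl⟩ : ∃ m, n = m + 1 := ⟨n - 1, by omega⟩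
      rw [show m + 1 - 1 = m by omega, Equiv.swap_apply_right, kap_sg (by omega),
        kgen_succ (by omega), kgen_self, mul_one]
  exact DFunLike.congr_fun this d

lemma iota_injective : Function.Injective (iota n) :=
  Function.LeftInverse.injective kap_iota

lemma iota_kap {g : Br (n + 1)} (hg : prm (n + 1) g n = n) : iota n (kap n n g) = g := by
  have := hh_mul g n le_rfl
  rw [Equiv.Perm.inv_eq_iff_eq.2 hg.symm, hh_self, one_mul, mul_one] at this
  exact this.symm

lemma prm_pr_kap {g : Br (n + 1)} (hg : prm (n + 1) g n = n) :
    prm n (pr (kap n n g)) = prm (n + 1) g := by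
  rw [← prm_iota, iota_kap hg]

/-- The degree homomorphism of the braid group. -/
def degB (n : ℕ) : Br n →* Multiplicative ℤ :=
  Br.lift (fun _ => Multiplicative.ofAdd 1) ⟨fun _ _ _ _ => rfl, fun _ _ => rfl⟩

/-- The integer valued degree of a braid. -/
def dgB {n : ℕ} (g : Br n) : ℤ := Multiplicative.toAdd (degB n g)

lemma dgB_sg {i : ℕ} (hi : i + 1 < n) : dgB (sg n i) = 1 := by
  rw [dgB, degB, Br.lift_sg _ _ hi]; rfl
@[simp] lemma dgB_one : dgB (1 : Br n) = 0 := by simp [dgB]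
@[simp] lemma dgB_mul (a b : Br n) : dgB (a * b) = dgB a + dgB b := by simp [dgB]
@[simp] lemma dgB_inv (a : Br n) : dgB a⁻¹ = - dgB a := by simp [dgB]
@[simp] lemma dgB_zpow (a : Br n) (k : ℤ) : dgB (a ^ k) = k * dgB a := by simp [dgB]
@[simp] lemma dgB_pow (a : Br n) (k : ℕ) : dgB (a ^ k) = k * dgB a := by simp [dgB]

lemma dgB_ew {k : ℕ} (h : k < n) : dgB (ew (sg n) k) = k := by
  induction k with
  | zero => simp
  | succ k ih => rw [ew_succ, dgB_mul, ih (by omega), dgB_sg (by omega)]; push_cast; ring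

lemma dgB_tw {m : ℕ} (h : m ≤ n) : dgB (twB n m) = m * (m - 1) := by
  rcases Nat.eq_zero_or_pos m with rfl | h0
  · simp
  · rw [twB, tw, dgB_pow, dgB_ew (by omega)]; push_cast [h0]; ring

/-- The degree homomorphism of the free group, with `c_j` of degree `j`. -/
def degF (n : ℕ) : Fr n →* Multiplicative ℤ := liftF n fun j => Multiplicative.ofAdd (j : ℤ)

/-- The integer valued degree. -/
def dgF {n : ℕ} (g : Fr n) : ℤ := Multiplicative.toAdd (degF n g)

lemma dgF_cc {j : ℕ} (hj : j ≤ n) : dgF (cc n j) = j := by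
  rcases Nat.eq_zero_or_pos j with rfl | h
  · simp [dgF]
  · rw [dgF, degF, liftF_cc _ h hj]; rfl
@[simp] lemma dgF_one : dgF (1 : Fr n) = 0 := by simp [dgF]
@[simp] lemma dgF_mul (a b : Fr n) : dgF (a * b) = dgF a + dgF b := by simp [dgF]
@[simp] lemma dgF_inv (a : Fr n) : dgF a⁻¹ = - dgF a := by simp [dgF]
@[simp] lemma dgF_zpow (a : Fr n) (k : ℤ) : dgF (a ^ k) = k * dgF a := by simp [dgF]

lemma dgF_act (b : Br n) (f : Fr n) : dgF (act n b f) = dgF f := by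
  suffices h : ∀ f, degF n (act n b f) = degF n f by rw [dgF, h, dgF]
  induction b using Br.induction with
  | h1 => simp
  | hs i hi =>
    intro f
    have : (degF n).comp (act n (sg n i) : Fr n →* Fr n) = degF n := by
      refine Fr.hom_ext fun j _ hj => ?_
      apply Multiplicative.toAdd.injective
      change dgF (act n (sg n i) (cc n j)) = dgF (cc n j)
      rw [act_sg hi]
      split_ifs with h
      · subst h
        rw [dgF_mul, dgF_mul, dgF_inv, dgF_cc (by omega), dgF_cc hj, dgF_cc (by omega)]
        push_cast; ring
      · rfl
    exact DFunLike.congr_fun this f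
  | hm a b ha hb => intro f; rw [map_mul, MulAut.mul_apply, ha, hb]
  | hi a ha => intro f; rw [← ha, map_inv, MulAut.apply_inv_self]

end
end BraidB

namespace BraidB

section FS
variable {α β : Type*}

/-- The subgroup of a free group generated by a set of letters. -/
def FS (S : Set α) : Subgroup (FreeGroup α) := Subgroup.closure (FreeGroup.of '' S)

lemma of_mem_FS {S : Set α} {a : α} (h : a ∈ S) : FreeGroup.of a ∈ FS S :=
  Subgroup.subset_closure ⟨a, h, rfl⟩

lemma FS_mono {S T : Set α} (h : S ⊆ T) : FS S ≤ FS T :=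
  Subgroup.closure_mono (Set.image_mono h)

lemma FS_le_comap {G : Type*} [Group G] {S : Set α} {H : Subgroup G} {f : FreeGroup α →* G}
    (h : ∀ a ∈ S, f (FreeGroup.of a) ∈ H) {g : FreeGroup α} (hg : g ∈ FS S) : f g ∈ H := by
  have : FS S ≤ H.comap f := by
    refine (Subgroup.closure_le _).2 ?_
    rintro _ ⟨a, ha, rfl⟩
    exact h a ha
  exact this hg

lemma FS_eqOn {G : Type*} [Group G] {S : Set α} {f f' : FreeGroup α →* G}
    (h : ∀ a ∈ S, f (FreeGroup.of a) = f' (FreeGroup.of a)) {g : FreeGroup α} (hg : g ∈ FS S) :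
    f g = f' g := by
  have : FS S ≤ f.eqLocus f' := by
    refine (Subgroup.closure_le _).2 ?_
    rintro _ ⟨a, ha, rfl⟩
    exact h a ha
  exact this hg

lemma mem_FS_univ (g : FreeGroup α) : g ∈ FS (Set.univ : Set α) := by
  rw [FS, Set.image_univ, FreeGroup.closure_range_of]; trivial

lemma FS_empty {g : FreeGroup α} (h : g ∈ FS (∅ : Set α)) : g = 1 := by
  simpa [FS] using h

lemma FS_singleton {a : α} {g : FreeGroup α} (h : g ∈ FS {a}) :
    ∃ k : ℤ, g = FreeGroup.of a ^ k := by
  rw [FS, Set.image_singleton, ← Subgroup.zpowers_eq_closure, Subgroup.mem_zpowers_iff] at h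
  obtain ⟨k, hk⟩ := h
  exact ⟨k, hk.symm⟩

open Classical in
/-- Retraction onto the subgroup generated by a set of letters. -/
noncomputable def ret (S : Set α) : FreeGroup α →* FreeGroup α :=
  FreeGroup.lift fun a => if a ∈ S then FreeGroup.of a else 1

lemma ret_of_mem {S : Set α} {a : α} (h : a ∈ S) : ret S (FreeGroup.of a) = FreeGroup.of a := by
  simp [ret, h]

lemma ret_of_notMem {S : Set α} {a : α} (h : a ∉ S) : ret S (FreeGroup.of a) = 1 := by
  simp [ret, h]

lemma ret_mem {S T : Set α} {g : FreeGroup α} (hg : g ∈ FS T) : ret S g ∈ FS (S ∩ T) := by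
  refine FS_le_comap (fun a ha => ?_) hg
  by_cases h : a ∈ S
  · rw [ret_of_mem h]; exact of_mem_FS ⟨h, ha⟩
  · rw [ret_of_notMem h]; exact Subgroup.one_mem _

lemma ret_eq_self {S : Set α} {g : FreeGroup α} (hg : g ∈ FS S) : ret S g = g :=
  FS_eqOn (f' := MonoidHom.id _) (fun _ ha => ret_of_mem ha) hg

lemma FS_inter {S T : Set α} {g : FreeGroup α} (h1 : g ∈ FS S) (h2 : g ∈ FS T) :
    g ∈ FS (S ∩ T) := by
  rw [← ret_eq_self h1]; exact ret_mem h2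

lemma FS_inter_conj {S T : Set α} {u v : FreeGroup α} (hu : u ∈ FS S) (hv : v ∈ FS T)
    (h : IsConj u v) : ∃ w ∈ FS (S ∩ T), IsConj u w := by
  refine ⟨ret S v, ret_mem hv, ?_⟩
  have := MonoidHom.map_isConj (ret S) h
  rwa [ret_eq_self hu] at this

lemma exists_finite_FS (g : FreeGroup α) : ∃ S : Set α, S.Finite ∧ g ∈ FS S := by
  induction g using FreeGroup.induction_on with
  | C1 => exact ⟨∅, Set.finite_empty, Subgroup.one_mem _⟩
  | of a => exact ⟨{a}, Set.finite_singleton a, of_mem_FS rfl⟩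
  | inv_of a _ => exact ⟨{a}, Set.finite_singleton a, Subgroup.inv_mem _ (of_mem_FS rfl)⟩
  | mul x y hx hy =>
    obtain ⟨S, hS, hxS⟩ := hx
    obtain ⟨T, hT, hyT⟩ := hy
    exact ⟨S ∪ T, hS.union hT, Subgroup.mul_mem _ (FS_mono Set.subset_union_left hxS)
      (FS_mono Set.subset_union_right hyT)⟩

lemma map_mem_FS {S : Set α} {T : Set β} {f : α → β} (h : ∀ a ∈ S, f a ∈ T) {g : FreeGroup α}
    (hg : g ∈ FS S) : FreeGroup.map f g ∈ FS T :=
  FS_le_comap (fun a ha => by rw [FreeGroup.map.of]; exact of_mem_FS (h a ha)) hg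

/-- Levels of an element of `FreeGroup (α × ℤ)` are bounded. -/
lemma exists_bound_FS (g : FreeGroup (α × ℤ)) :
    ∃ B : ℤ, 0 < B ∧ g ∈ FS {p : α × ℤ | |p.2| < B} := by
  obtain ⟨S, hS, hg⟩ := exists_finite_FS g
  obtain ⟨B, hB⟩ := (hS.image fun p => |p.2|).bddAbove
  refine ⟨|B| + 1, by positivity, FS_mono (fun p hp => ?_) hg⟩
  have := hB ⟨p, hp, rfl⟩
  have h2 := le_abs_self B
  simp only [Set.mem_ofPred_eq]
  exact Int.lt_add_one_of_le (this.trans h2)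

end FS

section Shift
variable {α : Type*}

/-- Shift of the level. -/
def shf (r : ℤ) : FreeGroup (α × ℤ) →* FreeGroup (α × ℤ) :=
  FreeGroup.map fun p => (p.1, p.2 + r)

lemma shf_of (r : ℤ) (p : α × ℤ) : shf r (FreeGroup.of p) = FreeGroup.of (p.1, p.2 + r) :=
  FreeGroup.map.of

lemma shf_shf (r r' : ℤ) (g : FreeGroup (α × ℤ)) : shf r (shf r' g) = shf (r + r') g := by
  have : (shf r).comp (shf r') = shf (α := α) (r + r') := by
    ext p; simp [shf_of]; ring_nf
  exact DFunLike.congr_fun this g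

@[simp] lemma shf_zero (g : FreeGroup (α × ℤ)) : shf 0 g = g := by
  have : shf 0 = MonoidHom.id (FreeGroup (α × ℤ)) := by ext p; simp [shf_of]
  exact DFunLike.congr_fun this g

/-- Shift action of the integers on the free group on `α × ℤ`. -/
def shA (α : Type*) : Multiplicative ℤ →* MulAut (FreeGroup (α × ℤ)) where
  toFun r := MonoidHom.toMulEquiv (shf r.toAdd) (shf (-r.toAdd))
    (by ext p; simp [shf_of]) (by ext p; simp [shf_of])
  map_one' := by ext g; exact shf_zero g
  map_mul' a b := by ext g; exact (shf_shf a.toAdd b.toAdd g).symm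

lemma shA_apply (r : Multiplicative ℤ) (g : FreeGroup (α × ℤ)) : shA α r g = shf r.toAdd g := rfl

/-- Semidirect product containing the free group on `α`. -/
abbrev KK (α : Type*) := FreeGroup (α × ℤ) ⋊[shA α] Multiplicative ℤ

open Classical in
/-- Embedding of a free group in a semidirect product, the letter `b` being sent to the shift. -/
noncomputable def emb (b : α) : FreeGroup α →* KK α :=
  FreeGroup.lift fun a => if a = b then SemidirectProduct.inr (Multiplicative.ofAdd 1)
    else SemidirectProduct.inl (FreeGroup.of (a, 0))

lemma emb_self (b : α) : emb b (FreeGroup.of b) = SemidirectProduct.inr (Multiplicative.ofAdd 1) := by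
  simp [emb]

lemma emb_of_ne {a b : α} (h : a ≠ b) :
    emb b (FreeGroup.of a) = SemidirectProduct.inl (FreeGroup.of (a, 0)) := by
  simp [emb, h]

lemma emb_self_zpow (b : α) (k : ℤ) :
    emb b (FreeGroup.of b ^ k) = SemidirectProduct.inr (Multiplicative.ofAdd k) := by
  rw [map_zpow, emb_self, ← map_zpow, ← ofAdd_zsmul]; simp

/-- Left inverse of `emb`. -/
def bak (b : α) : KK α →* FreeGroup α :=
  SemidirectProduct.lift
    (FreeGroup.lift fun p => FreeGroup.of b ^ p.2 * FreeGroup.of p.1 * (FreeGroup.of b ^ p.2)⁻¹)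
    (zpowersHom _ (FreeGroup.of b)) (by
      intro r
      ext p
      simp only [MonoidHom.comp_apply, MulEquiv.coe_toMonoidHom, shA_apply, shf_of,
        FreeGroup.lift_apply_of, zpowersHom_apply, MulAut.conj_apply]
      rw [add_comm, zpow_add]; group)

lemma bak_inl_of (b : α) (p : α × ℤ) : bak b (SemidirectProduct.inl (FreeGroup.of p)) =
    FreeGroup.of b ^ p.2 * FreeGroup.of p.1 * (FreeGroup.of b ^ p.2)⁻¹ := by
  simp [bak]

lemma bak_inr (b : α) (r : Multiplicative ℤ) : bak b (SemidirectProduct.inr r) =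
    FreeGroup.of b ^ r.toAdd := by
  simp [bak]

lemma bak_emb (b : α) (g : FreeGroup α) : bak b (emb b g) = g := by
  have : (bak b).comp (emb b) = MonoidHom.id _ := by
    ext a
    by_cases h : a = b
    · subst h; simp [emb_self, bak_inr]
    · simp [emb_of_ne h, bak_inl_of]
  exact DFunLike.congr_fun this g

lemma bak_mem {b : α} {M : Set α} (hb : b ∈ M) {u : FreeGroup (α × ℤ)}
    (hu : u ∈ FS {p : α × ℤ | p.1 ∈ M}) : bak b (SemidirectProduct.inl u) ∈ FS M := by
  refine FS_le_comap (f := (bak b).comp SemidirectProduct.inl) (fun p hp => ?_) hu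
  rw [MonoidHom.comp_apply, bak_inl_of]
  have h1 := Subgroup.zpow_mem _ (of_mem_FS hb) p.2
  exact Subgroup.mul_mem _ (Subgroup.mul_mem _ h1 (of_mem_FS hp)) (Subgroup.inv_mem _ h1)

/-- The exponent sum of a letter. -/
noncomputable def expo (b : α) (g : FreeGroup α) : ℤ := (emb b g).right.toAdd

lemma emb_eq (b : α) (g : FreeGroup α) : emb b g =
    SemidirectProduct.inl (emb b g).left * SemidirectProduct.inr (emb b g).right :=
  (SemidirectProduct.inl_left_mul_inr_right _).symm

lemma eq_bak_mul (b : α) (g : FreeGroup α) :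
    g = bak b (SemidirectProduct.inl (emb b g).left) * FreeGroup.of b ^ expo b g := by
  conv_lhs => rw [← bak_emb b g, emb_eq b g, map_mul, bak_inr]
  rfl

lemma shf_fixed {u : FreeGroup (α × ℤ)} {k : ℤ} (hk : k ≠ 0) (h : shf k u = u) : u = 1 := by
  have hj : ∀ j : ℕ, shf (k * j) u = u := by
    intro j
    induction j with
    | zero => simp
    | succ j ih =>
      have := shf_shf k (k * j) u
      rw [ih, h] at this
      rw [show k * ((j + 1 : ℕ) : ℤ) = k + k * j by push_cast; ring]
      exact this.symm
  obtain ⟨B, hB, hu⟩ := exists_bound_FS u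
  have h2 : u ∈ FS {p : α × ℤ | B ≤ |p.2|} := by
    rw [← hj (2 * B).toNat]
    refine map_mem_FS (fun p hp => ?_) hu
    simp only [Set.mem_ofPred_eq] at *
    rw [Int.toNat_of_nonneg (by omega)]
    have h3 : |k * (2 * B)| ≥ 2 * B := by
      rw [abs_mul, abs_of_pos (show 0 < 2 * B by omega)]
      have := Int.one_le_abs hk
      nlinarith
    have h4 := abs_sub_abs_le_abs_sub (k * (2 * B)) (-p.2)
    rw [abs_neg, sub_neg_eq_add, add_comm (k * _)] at h4
    omega
  refine FS_empty (FS_mono ?_ (FS_inter hu h2))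
  rintro p ⟨h1, h2⟩
  simp only [Set.mem_ofPred_eq] at *
  omega

lemma centralizer_of_zpow {b : α} {k : ℤ} (hk : k ≠ 0) {g : FreeGroup α}
    (h : Commute (FreeGroup.of b ^ k) g) : ∃ r : ℤ, g = FreeGroup.of b ^ r := by
  have h1 := h.map (emb b)
  rw [emb_self_zpow, emb_eq] at h1
  have h2 := congrArg SemidirectProduct.left h1.eq
  simp [shA_apply] at h2
  have h3 := shf_fixed hk h2
  refine ⟨expo b g, ?_⟩
  conv_lhs => rw [eq_bak_mul b g, h3]
  simp

open Classical in
/-- The twist: letters of `M` are conjugated by a power of `b`. -/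
noncomputable def twi (b : α) (M : Set α) (N : ℤ) : FreeGroup α →* FreeGroup α :=
  FreeGroup.lift fun a => if a ∈ M then
    (FreeGroup.of b ^ N)⁻¹ * FreeGroup.of a * FreeGroup.of b ^ N else FreeGroup.of a

open Classical in
/-- The twist on levels. -/
noncomputable def tsh (M : Set α) (N : ℤ) : FreeGroup (α × ℤ) →* FreeGroup (α × ℤ) :=
  FreeGroup.map fun p => if p.1 ∈ M then (p.1, p.2 - N) else p

lemma twi_of_mem {b a : α} {M : Set α} (N : ℤ) (h : a ∈ M) : twi b M N (FreeGroup.of a) =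
    (FreeGroup.of b ^ N)⁻¹ * FreeGroup.of a * FreeGroup.of b ^ N := by simp [twi, h]

lemma twi_of_notMem {b a : α} {M : Set α} (N : ℤ) (h : a ∉ M) : twi b M N (FreeGroup.of a) =
    FreeGroup.of a := by simp [twi, h]

lemma twi_twi {b : α} {M : Set α} (hb : b ∉ M) (N N' : ℤ) (g : FreeGroup α) :
    twi b M N (twi b M N' g) = twi b M (N + N') g := by
  have : (twi b M N).comp (twi b M N') = twi b M (N + N') := by
    ext a
    rw [MonoidHom.comp_apply]
    by_cases h : a ∈ M
    · rw [twi_of_mem _ h, twi_of_mem _ h, map_mul, map_mul, map_inv, map_zpow,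
        twi_of_notMem _ hb, twi_of_mem _ h, zpow_add]
      group
    · simp only [twi_of_notMem _ h]
  exact DFunLike.congr_fun this g

lemma emb_twi {b : α} {M : Set α} (hb : b ∉ M) (N : ℤ) (g : FreeGroup α) :
    emb b (twi b M N g) = ⟨tsh M N (emb b g).left, (emb b g).right⟩ := by
  have hcomm : ∀ r : Multiplicative ℤ, ((tsh M N).comp (shA α r).toMonoidHom) =
      (shA α r).toMonoidHom.comp (tsh M N) := by
    intro r
    ext p
    simp only [MonoidHom.comp_apply, MulEquiv.coe_toMonoidHom, shA_apply, shf_of, tsh,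
      FreeGroup.map.of]
    split_ifs with h
    · simp; ring_nf
    · rfl
  have : (emb b).comp (twi b M N) =
      (SemidirectProduct.map (tsh M N) (MonoidHom.id _) hcomm).comp (emb b) := by
    ext1 a
    rw [MonoidHom.comp_apply, MonoidHom.comp_apply]
    by_cases hab : a = b
    · subst hab
      rw [twi_of_notMem _ hb, emb_self]; simp
    · by_cases h : a ∈ M
      · rw [twi_of_mem _ h, map_mul, map_mul, map_inv, emb_self_zpow, emb_of_ne hab,
          SemidirectProduct.map_inl]
        simp only [tsh, FreeGroup.map.of, h, if_true]
        rw [← map_inv, ← ofAdd_neg]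
        refine SemidirectProduct.ext ?_ ?_
        · simp only [SemidirectProduct.mul_left, SemidirectProduct.mul_right,
            SemidirectProduct.left_inr, SemidirectProduct.right_inr, SemidirectProduct.left_inl,
            SemidirectProduct.right_inl, one_mul, mul_one, shA_apply, shf_of, map_one, toAdd_ofAdd]
          simp [sub_eq_add_neg]
        · simp
      · rw [twi_of_notMem _ h, emb_of_ne hab, SemidirectProduct.map_inl]
        simp [tsh, h]
  exact DFunLike.congr_fun this g

lemma tsh_mem {M : Set α} {N : ℤ} {S T : Set (α × ℤ)} {u : FreeGroup (α × ℤ)}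
    (h1 : ∀ p ∈ S, p.1 ∈ M → (p.1, p.2 - N) ∈ T) (h2 : ∀ p ∈ S, p.1 ∉ M → p ∈ T)
    (hu : u ∈ FS S) : tsh M N u ∈ FS T := by
  refine map_mem_FS (fun p hp => ?_) hu
  split_ifs with h
  · exact h1 p hp h
  · exact h2 p hp h

lemma twi_fixed {b : α} {M : Set α} (hb : b ∉ M) {w : FreeGroup α} (h : twi b M 1 w = w) :
    w ∈ FS Mᶜ := by
  have hN : ∀ N : ℕ, twi b M N w = w := by
    intro N
    induction N with
    | zero =>
      have := twi_twi hb 0 1 w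
      rw [zero_add, h] at this
      simpa using this
    | succ N ih =>
      rw [Nat.cast_succ, ← twi_twi hb, h, ih]
  obtain ⟨B, hB, hu⟩ := exists_bound_FS (emb b w).left
  have h1 : tsh M (2 * B) (emb b w).left = (emb b w).left := by
    have := hN (2 * B).toNat
    rw [Int.toNat_of_nonneg (by omega)] at this
    have h2 := emb_twi hb (2 * B) w
    rw [this] at h2
    exact (congrArg SemidirectProduct.left h2).symm
  have h2 : (emb b w).left ∈ FS {p : α × ℤ | p.1 ∈ M → B ≤ |p.2|} := by
    rw [← h1]
    refine tsh_mem ?_ ?_ hu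
    · intro p hp _ _
      simp only [Set.mem_ofPred_eq] at hp ⊢
      have := abs_lt.1 hp
      rw [le_abs]; omega
    · intro p _ hp h; exact absurd h hp
  have h3 : (emb b w).left ∈ FS {p : α × ℤ | p.1 ∈ Mᶜ} := by
    refine FS_mono ?_ (FS_inter hu h2)
    rintro p ⟨h4, h5⟩ h6
    have := h5 h6
    simp only [Set.mem_ofPred_eq] at h4
    omega
  rw [eq_bak_mul b w]
  exact Subgroup.mul_mem _ (bak_mem hb h3) (Subgroup.zpow_mem _ (of_mem_FS hb) _)

lemma twi_isConj {b : α} {M : Set α} (hb : b ∉ M) {w : FreeGroup α} (h0 : expo b w = 0)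
    (h : ∀ N : ℕ, IsConj (twi b M N w) w) :
    (∃ v ∈ FS Mᶜ, IsConj w v) ∨ (∃ v ∈ FS (insert b M), IsConj w v) := by
  obtain ⟨B, hB, hu⟩ := exists_bound_FS (emb b w).left
  have hr : (emb b w).right = 1 := h0
  have hw : w = bak b (SemidirectProduct.inl (emb b w).left) := by
    conv_lhs => rw [eq_bak_mul b w, h0]
    simp
  have hN := h (4 * B).toNat
  rw [Int.toNat_of_nonneg (by omega)] at hN
  obtain ⟨c, hc⟩ := isConj_iff.1 (MonoidHom.map_isConj (emb b) hN)
  have h1 := congrArg SemidirectProduct.left (mul_inv_eq_iff_eq_mul.1 hc)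
  rw [emb_twi hb, hr] at h1
  simp only [SemidirectProduct.mul_left, shA_apply, hr, map_one, MulAut.one_apply] at h1
  have h2 : IsConj (emb b w).left (shf c.right.toAdd (tsh M (4 * B) (emb b w).left)) :=
    (isConj_iff.2 ⟨c.left, by rw [h1]; group⟩ : IsConj _ _).symm
  have key : ∀ T : Set α, b ∈ T → ∀ S : Set (α × ℤ),
      shf c.right.toAdd (tsh M (4 * B) (emb b w).left) ∈ FS S →
      (∀ p ∈ S, |p.2| < B → p.1 ∈ T) → ∃ v ∈ FS T, IsConj w v := by
    intro T hbT S hS hST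
    obtain ⟨v, hv, hcv⟩ := FS_inter_conj hu hS h2
    refine ⟨bak b (SemidirectProduct.inl v), bak_mem hbT (FS_mono ?_ hv), ?_⟩
    · rintro p ⟨h3, h4⟩; exact hST p h4 h3
    · have := MonoidHom.map_isConj ((bak b).comp SemidirectProduct.inl) hcv
      rw [MonoidHom.comp_apply, MonoidHom.comp_apply, ← hw] at this
      exact this
  by_cases hrB : 2 * B ≤ |c.right.toAdd|
  · right
    refine key _ (Set.mem_insert _ _) {p | p.1 ∉ M → B ≤ |p.2|} ?_ ?_
    · refine map_mem_FS (S := {p | p.1 ∉ M → |p.2| < B}) (fun p hp hpM => ?_)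
        (tsh_mem (S := {p | |p.2| < B}) ?_ ?_ hu)
      have := abs_lt.1 (hp hpM)
      rw [le_abs] at hrB ⊢
      simp only
      omega
      · intro p _ h h'; exact absurd h h'
      · intro p hp _ _; exact hp
    · intro p hp hpB
      by_contra hpM
      have := hp fun h => hpM (Or.inr h)
      omega
  · left
    refine key _ hb {p | p.1 ∈ M → B ≤ |p.2|} ?_ ?_
    · refine map_mem_FS (S := {p | p.1 ∈ M → |p.2 + 4 * B| < B}) (fun p hp hpM => ?_)
        (tsh_mem (S := {p | |p.2| < B}) ?_ ?_ hu)
      have := abs_lt.1 (hp hpM)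
      rw [not_le] at hrB
      have := abs_lt.1 hrB
      rw [le_abs]
      simp only
      omega
      · intro p hp _ _; simpa using hp
      · intro p _ h h'; exact absurd h' h
    · intro p hp hpB hpM
      have := hp hpM
      omega

end Shift
end BraidB

namespace BraidB

section Expo
variable {α : Type*}

/-- The exponent sum of a letter, as a homomorphism. -/
noncomputable def exH (b : α) : FreeGroup α →* Multiplicative ℤ :=
  SemidirectProduct.rightHom.comp (emb b)

@[simp] lemma expo_one (b : α) : expo b 1 = 0 := congrArg Multiplicative.toAdd (map_one (exH b))
@[simp] lemma expo_mul (b : α) (g h : FreeGroup α) : expo b (g * h) = expo b g + expo b h :=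
  congrArg Multiplicative.toAdd (map_mul (exH b) g h)
@[simp] lemma expo_inv (b : α) (g : FreeGroup α) : expo b g⁻¹ = - expo b g :=
  congrArg Multiplicative.toAdd (map_inv (exH b) g)
@[simp] lemma expo_self (b : α) : expo b (FreeGroup.of b) = 1 := by simp [expo, emb_self]
lemma expo_of_ne {a b : α} (h : a ≠ b) : expo b (FreeGroup.of a) = 0 := by
  simp [expo, emb_of_ne h]
@[simp] lemma expo_zpow (b : α) (g : FreeGroup α) (k : ℤ) : expo b (g ^ k) = k * expo b g :=
  (congrArg Multiplicative.toAdd (map_zpow (exH b) g k)).trans (by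
    simp [toAdd_zpow]; exact Or.inl rfl)

lemma expo_conj {b : α} {g h : FreeGroup α} (hc : IsConj g h) : expo b g = expo b h := by
  obtain ⟨c, rfl⟩ := isConj_iff.1 hc
  simp

lemma expo_of_FS {b : α} {S : Set α} (hb : b ∉ S) {g : FreeGroup α} (hg : g ∈ FS S) :
    expo b g = 0 := by
  have := FS_eqOn (f := exH b) (f' := 1) (fun a ha => by
    apply Multiplicative.toAdd.injective
    exact expo_of_ne fun h => hb (h ▸ ha)) hg
  exact congrArg Multiplicative.toAdd this

/-- An additive identity between homomorphisms on letters. -/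
lemma expo_comp {β : Type*} {f : FreeGroup α →* FreeGroup β} {b : β} {a a' : α} {k k' : ℤ}
    (h : ∀ i, expo b (f (FreeGroup.of i)) =
      k * expo a (FreeGroup.of i) + k' * expo a' (FreeGroup.of i))
    (g : FreeGroup α) : expo b (f g) = k * expo a g + k' * expo a' g := by
  have : (exH b).comp f = (exH a) ^ k * (exH a') ^ k' := by
    ext i
    exact (h i).trans (by simp [toAdd_zpow]; rfl)
  exact (congrArg Multiplicative.toAdd (DFunLike.congr_fun this g)).trans
    (by simp [toAdd_zpow]; rfl)

end Expo

section
variable {m : ℕ}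

lemma expo_act {n i : ℕ} (h : i + 1 < n) (u : Fr n) :
    expo ⟨i + 1, h⟩ (act n (sg n i) u) =
      1 * expo ⟨i + 1, h⟩ u + 1 * expo (⟨i, by omega⟩ : Fin n) u := by
  refine expo_comp (f := (act n (sg n i) : Fr n →* Fr n)) (fun j => ?_) u
  obtain ⟨j, hj⟩ := j
  change expo _ (act n (sg n i) _) = _
  rw [← cc_succ hj, act_sg h]
  split_ifs with h1
  · obtain rfl : j = i := by omega
    rw [cc_succ h, cc_succ hj, expo_mul, expo_mul, expo_self, expo_inv]
    rcases Nat.eq_zero_or_pos j with rfl | h0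
    · simp [expo_of_ne]
    · obtain ⟨k, rfl⟩ : ∃ k, j = k + 1 := ⟨j - 1, by omega⟩
      rw [cc_succ (by omega), expo_of_ne, expo_of_ne] <;> simp
      omega
  · rw [cc_succ hj, expo_of_ne (a := (⟨j, hj⟩ : Fin n)) (b := ⟨i, _⟩) (by simp; omega)]; ring

lemma expo_of_invariant {n : ℕ} {u : Fr n} (h : ∀ β, IsConj (act n β u) u) {i : ℕ}
    (hi : i + 1 < n) : expo (⟨i, by omega⟩ : Fin n) u = 0 := by
  have := expo_act hi u
  rw [expo_conj (h _)] at this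
  omega

lemma dgF_eq_zero {n : ℕ} {u : Fr n} (h : ∀ i, expo i u = 0) : dgF u = 0 := by
  have : degF n = ∏ i : Fin n, (exH i) ^ (i + 1 : ℤ) := by
    ext j
    rw [MonoidHom.finsetProd_apply, toAdd_prod]
    rw [Finset.sum_eq_single j]
    · rw [← cc_succ j.2]
      have := dgF_cc (n := n) (j := j + 1) j.2
      refine Eq.trans this ?_
      rw [cc_succ j.2]
      simp [exH, emb_self]
    · intro b _ hb
      have : exH b (FreeGroup.of j) = 1 := expo_of_ne (Ne.symm hb)
      simp [this]
    · simp
  rw [dgF, this, MonoidHom.finsetProd_apply, toAdd_prod]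
  refine Finset.sum_eq_zero fun i _ => ?_
  have : exH i u = 1 := h i
  simp [this]

/-- The change of basis used for the square of the last braid generator. -/
def bch (m : ℕ) : Fr (m + 3) →* Fr (m + 3) := liftF (m + 3) fun j =>
  if j = m + 1 then cc (m + 3) (m + 3) * (cc (m + 3) (m + 1))⁻¹ else
    if j = m + 2 then cc (m + 3) (m + 2) * (cc (m + 3) (m + 1))⁻¹ else cc (m + 3) j

/-- The inverse of `bch`. -/
def bch' (m : ℕ) : Fr (m + 3) →* Fr (m + 3) := liftF (m + 3) fun j =>
  if j = m + 1 then (cc (m + 3) (m + 1))⁻¹ * cc (m + 3) (m + 3) else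
    if j = m + 2 then cc (m + 3) (m + 2) * (cc (m + 3) (m + 1))⁻¹ * cc (m + 3) (m + 3)
    else cc (m + 3) j

lemma bch_cc {j : ℕ} (h0 : 0 < j) (h : j ≤ m + 3) : bch m (cc (m + 3) j) =
  if j = m + 1 then cc (m + 3) (m + 3) * (cc (m + 3) (m + 1))⁻¹ else
    if j = m + 2 then cc (m + 3) (m + 2) * (cc (m + 3) (m + 1))⁻¹ else cc (m + 3) j :=
  liftF_cc _ h0 h

lemma bch'_cc {j : ℕ} (h0 : 0 < j) (h : j ≤ m + 3) : bch' m (cc (m + 3) j) =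
  if j = m + 1 then (cc (m + 3) (m + 1))⁻¹ * cc (m + 3) (m + 3) else
    if j = m + 2 then cc (m + 3) (m + 2) * (cc (m + 3) (m + 1))⁻¹ * cc (m + 3) (m + 3)
    else cc (m + 3) j :=
  liftF_cc _ h0 h

lemma bch_bch' (u : Fr (m + 3)) : bch m (bch' m u) = u := by
  have : (bch m).comp (bch' m) = MonoidHom.id _ := by
    refine Fr.hom_ext fun j h0 h => ?_
    rw [MonoidHom.comp_apply, bch'_cc h0 h]
    split_ifs with h1 h2
    · subst h1; simp [bch_cc]
    · subst h2; simp [bch_cc]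
    · simp [bch_cc h0 h, h1, h2]
  exact DFunLike.congr_fun this u

lemma bch'_bch (u : Fr (m + 3)) : bch' m (bch m u) = u := by
  have : (bch' m).comp (bch m) = MonoidHom.id _ := by
    refine Fr.hom_ext fun j h0 h => ?_
    rw [MonoidHom.comp_apply, bch_cc h0 h]
    split_ifs with h1 h2
    · subst h1; simp [bch'_cc]
    · subst h2; simp [bch'_cc]
    · simp [bch'_cc h0 h, h1, h2]
  exact DFunLike.congr_fun this u

/-- In the new basis the square of the last braid generator is a twist. -/
lemma bch_twi (N : ℕ) (u : Fr (m + 3)) :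
    bch m (twi ⟨m, by omega⟩ {⟨m + 1, by omega⟩} N u) =
      act (m + 3) ((sg (m + 3) (m + 1)) ^ (2 * N)) (bch m u) := by
  induction N generalizing u with
  | zero =>
    have : twi (⟨m, by omega⟩ : Fin (m + 3)) {⟨m + 1, by omega⟩} 0 = MonoidHom.id _ := by
      ext a; by_cases h : a ∈ ({⟨m + 1, by omega⟩} : Set (Fin (m + 3)))
      · rw [twi_of_mem _ h]; simp
      · rw [twi_of_notMem _ h]; simp
    simp [this]
  | succ N ih =>
    rw [Nat.cast_succ, ← twi_twi (by simp), ih, mul_add, pow_add, map_mul, MulAut.mul_apply]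
    congr 1
    have : (bch m).comp (twi ⟨m, by omega⟩ {⟨m + 1, by omega⟩} 1) =
        (act (m + 3) ((sg (m + 3) (m + 1)) ^ (2 * 1)) : Fr (m + 3) →* Fr (m + 3)).comp (bch m) := by
      have hm1 : (m + 3) ≠ (m + 2) := by omega
      refine Fr.hom_ext fun j h0 h => ?_
      rw [MonoidHom.comp_apply, MonoidHom.comp_apply, bch_cc h0 h]
      change _ = act _ _ _
      rw [mul_one, pow_two, map_mul, MulAut.mul_apply]
      obtain ⟨j, rfl⟩ : ∃ i, j = i + 1 := ⟨j - 1, by omega⟩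
      by_cases h2 : j = m + 1
      · subst h2
        rw [cc_succ (by omega), twi_of_mem _ (Set.mem_singleton _)]
        rw [← cc_succ (n := m + 3) (j := m) (by omega),
          ← cc_succ (n := m + 3) (j := m + 1) (by omega)]
        simp [bch_cc, act_sg, mul_assoc]
      · rw [cc_succ (by omega), twi_of_notMem _ (by simpa using h2),
          ← cc_succ (n := m + 3) (j := j) (by omega), bch_cc h0 h]
        have : j + 1 ≠ m + 2 := by omega
        split_ifs with h3
        · simp [act_sg]
        · rw [act_sg_of_ne (by omega) this, act_sg_of_ne (by omega) this]
    exact DFunLike.congr_fun this u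

lemma act_tw_twi (N : ℕ) (u : Fr (m + 3)) :
    twi (⟨m + 1, by omega⟩ : Fin (m + 3)) {j | (j : ℕ) < m + 1} N u = act (m + 3) ((twB (m + 3) (m + 2)) ^ N) u := by
  induction N generalizing u with
  | zero =>
    have : twi (⟨m + 1, by omega⟩ : Fin (m + 3)) {j | (j : ℕ) < m + 1} 0 = MonoidHom.id _ := by
      ext a; by_cases h : a ∈ ({j | (j : ℕ) < m + 1} : Set (Fin (m + 3)))
      · rw [twi_of_mem _ h]; simp
      · rw [twi_of_notMem _ h]; simp
    rw [Nat.cast_zero, this]; simp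
  | succ N ih =>
    rw [Nat.cast_succ, ← twi_twi (by simp), ih, pow_succ, map_mul, MulAut.mul_apply]
    congr 1
    have : twi (⟨m + 1, by omega⟩ : Fin (m + 3)) {j | (j : ℕ) < m + 1} 1 =
        (act (m + 3) (twB (m + 3) (m + 2)) : Fr (m + 3) →* Fr (m + 3)) := by
      ext1 j
      change _ = act _ _ _
      rw [← cc_succ j.2]
      by_cases h : (j : ℕ) < m + 2
      · rw [act_tw_lo (by omega) (by omega), cc_succ j.2]
        by_cases h' : (j : ℕ) < m + 1
        · rw [twi_of_mem (a := j) _ h', cc_succ (by omega)]; simp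
        · rw [twi_of_notMem (a := j) _ h']
          have : j = ⟨m + 1, by omega⟩ := Fin.ext (by change (j : ℕ) = m + 1; omega)
          rw [cc_succ (by omega), ← this]; simp
      · rw [act_tw_hi (by omega) (by omega), cc_succ j.2, twi_of_notMem]
        simp only [Set.mem_ofPred_eq]; omega
    exact DFunLike.congr_fun this u

lemma bch_mem {u : Fr (m + 3)} (hu : u ∈ FS {(⟨m + 1, by omega⟩ : Fin (m + 3))}ᶜ) :
    bch m u ∈ FS {(⟨m + 1, by omega⟩ : Fin (m + 3))}ᶜ := by
  refine FS_le_comap (fun a ha => ?_) hu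
  have h1 : (⟨m, by omega⟩ : Fin (m + 3)) ∈ ({⟨m + 1, by omega⟩}ᶜ : Set (Fin (m + 3))) := by simp
  have h2 : (⟨m + 2, by omega⟩ : Fin (m + 3)) ∈ ({⟨m + 1, by omega⟩}ᶜ : Set (Fin (m + 3))) := by
    simp
  obtain ⟨a, ha'⟩ := a
  have ha2 : a ≠ m + 1 := by simpa using ha
  rw [← cc_succ ha', bch_cc (by omega) (by omega), if_neg (show a + 1 ≠ m + 2 by omega)]
  split_ifs with h
  · rw [cc_succ (j := m + 2) (by omega), cc_succ (j := m) (by omega)]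
    exact Subgroup.mul_mem _ (of_mem_FS h2) (Subgroup.inv_mem _ (of_mem_FS h1))
  · rw [cc_succ ha']; exact of_mem_FS ha

/-- Elements of nonzero degree with braid invariant conjugacy class are conjugate to powers
of `c_n`. -/
lemma conj_cc_top_of_invariant {u : Fr (m + 3)} (h : ∀ β, IsConj (act (m + 3) β u) u)
    (hd : dgF u ≠ 0) : ∃ k : ℤ, IsConj u (cc (m + 3) (m + 3) ^ k) := by
  have h0 : ∀ i : Fin (m + 3), (i : ℕ) ≠ m + 2 → expo i u = 0 := by
    rintro ⟨i, hi⟩ h1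
    exact expo_of_invariant h (i := i) (by simp at h1; omega)
  have hC : expo (⟨m + 2, by omega⟩ : Fin (m + 3)) u ≠ 0 := by
    intro hC
    refine hd (dgF_eq_zero fun i => ?_)
    by_cases hi : (i : ℕ) = m + 2
    · rw [← hC]; congr 1; exact Fin.ext hi
    · exact h0 i hi
  have h1 : ∃ v ∈ FS {j : Fin (m + 3) | (j : ℕ) < m + 1}ᶜ, IsConj u v := by
    refine (twi_isConj (b := (⟨m + 1, by omega⟩ : Fin (m + 3))) (by simp) (h0 _ (by simp)) fun N => ?_).resolve_right
      ?_
    · rw [act_tw_twi]; exact h _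
    · rintro ⟨v, hv, huv⟩
      refine hC ((expo_conj huv).trans (expo_of_FS ?_ hv))
      simp
  have e1 : expo (⟨m, by omega⟩ : Fin (m + 3)) (bch' m u) =
      (-1) * expo ⟨m, by omega⟩ u + (-1) * expo (⟨m + 1, by omega⟩ : Fin (m + 3)) u := by
    refine expo_comp (fun j => ?_) u
    obtain ⟨j, hj⟩ := j
    rw [← cc_succ hj, bch'_cc (by omega) (by omega)]
    split_ifs with h1 h2
    · obtain rfl : j = m := by omega
      rw [cc_succ (by omega), cc_succ (by omega)]
      simp [expo_of_ne]
    · obtain rfl : j = m + 1 := by omega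
      rw [cc_succ (by omega), cc_succ (by omega), cc_succ (by omega)]
      simp [expo_of_ne]
    · rw [cc_succ (by omega), expo_of_ne, expo_of_ne] <;> simp <;> omega
  have e2 : ∀ v, expo (⟨m + 2, by omega⟩ : Fin (m + 3)) (bch m v) =
      1 * expo ⟨m + 2, by omega⟩ v + 1 * expo (⟨m, by omega⟩ : Fin (m + 3)) v := by
    refine expo_comp fun j => ?_
    obtain ⟨j, hj⟩ := j
    rw [← cc_succ hj, bch_cc (by omega) (by omega)]
    split_ifs with h1 h2
    · obtain rfl : j = m := by omega
      rw [cc_succ (by omega), cc_succ (by omega)]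
      simp [expo_of_ne]
    · obtain rfl : j = m + 1 := by omega
      rw [cc_succ (by omega), cc_succ (by omega)]
      simp [expo_of_ne]
    · rw [cc_succ (by omega), expo_of_ne (a := (⟨j, hj⟩ : Fin (m + 3))) (b := ⟨m, _⟩)]
      · ring
      · simp; omega
  rw [h0 _ (by simp), h0 _ (by simp)] at e1
  have h2 : ∃ v ∈ FS {(⟨m + 1, by omega⟩ : Fin (m + 3))}ᶜ, IsConj (bch' m u) v := by
    refine (twi_isConj (b := (⟨m, by omega⟩ : Fin (m + 3))) (by simp) (by simpa using e1)
      fun N => ?_).resolve_right ?_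
    · rw [← bch'_bch (twi _ _ _ _), bch_twi, bch_bch']
      exact MonoidHom.map_isConj (bch' m) (h _)
    · rintro ⟨v, hv, huv⟩
      have h3 := expo_conj (b := ⟨m + 2, by omega⟩) (MonoidHom.map_isConj (bch m) huv)
      rw [bch_bch', e2, ← expo_conj (b := ⟨m, _⟩) huv, e1,
        expo_of_FS (by simp) hv] at h3
      exact hC (by simpa using h3)
  obtain ⟨v, hv, huv⟩ := h1
  obtain ⟨w, hw, huw⟩ := h2
  have huw' := MonoidHom.map_isConj (bch m) huw
  rw [bch_bch'] at huw'
  obtain ⟨t, ht, hvt⟩ := FS_inter_conj hv (bch_mem hw) (huv.symm.trans huw')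
  have ht' : t ∈ FS {(⟨m + 2, by omega⟩ : Fin (m + 3))} := by
    refine FS_mono ?_ ht
    rintro ⟨j, hj⟩ ⟨h1, h2⟩
    simp at h1 h2 ⊢
    omega
  obtain ⟨k, rfl⟩ := FS_singleton ht'
  refine ⟨k, ?_⟩
  rw [cc_succ (by omega)]
  exact huv.trans hvt

end
end BraidB

namespace BraidB

section FunctionalEquation

lemma ret_mem_self {α : Type*} (S : Set α) (U : FreeGroup α) : ret S U ∈ FS S :=
  FS_mono (S := S ∩ Set.univ) (T := S) Set.inter_subset_left (ret_mem (mem_FS_univ U))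

/-- Words satisfying `w(XY) = w(X)w(Y)` letterwise are trivial or letters. -/
lemma eq_one_or_letter_of_mult {α : Type*} {U : FreeGroup α}
    (h : FreeGroup.map (fun a => (false, a)) U * FreeGroup.map (fun a => (true, a)) U =
      FreeGroup.lift (fun a => FreeGroup.of (false, a) * FreeGroup.of (true, a)) U) :
    U = 1 ∨ ∃ a, U = FreeGroup.of a := by
  classical
  have key : ∀ S : Set α, ret Sᶜ U * ret S U = U := by
    intro S
    let χ : FreeGroup (Bool × α) →* FreeGroup α := FreeGroup.lift fun p =>
      if p.1 = true ↔ p.2 ∈ S then FreeGroup.of p.2 else 1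
    have h1 := congrArg χ h
    have e1 : χ.comp (FreeGroup.map (fun a => (false, a))) = ret Sᶜ := by
      ext a; by_cases ha : a ∈ S <;> simp [χ, ret, ha]
    have e2 : χ.comp (FreeGroup.map (fun a => (true, a))) = ret S := by
      ext a; by_cases ha : a ∈ S <;> simp [χ, ret, ha]
    have e3 : χ.comp (FreeGroup.lift (fun a => FreeGroup.of (false, a) * FreeGroup.of (true, a))) =
        MonoidHom.id _ := by
      ext a; by_cases ha : a ∈ S <;> simp [χ, ha]
    rw [map_mul] at h1
    simpa [← MonoidHom.comp_apply, e1, e2, e3] using h1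
  have hJ : ∀ J, ret {J} U = 1 ∨ U = ret {J} U := by
    intro J
    have h1 := key {J}
    have h2 := key {J}ᶜ
    rw [compl_compl] at h2
    obtain ⟨k, hk⟩ := FS_singleton (ret_mem_self {J} U)
    by_cases hk0 : k = 0
    · left; rw [hk, hk0, zpow_zero]
    · right
      have hc : Commute (FreeGroup.of J ^ k) (ret {J}ᶜ U) := by
        rw [← hk]; exact h2.trans h1.symm
      obtain ⟨r, hr⟩ := centralizer_of_zpow hk0 hc
      have h3 : ret {J}ᶜ U = 1 := by
        apply FS_empty
        have m1 : ret {J}ᶜ U ∈ FS ({J} : Set α) := by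
          rw [hr]
          exact Subgroup.zpow_mem _ (of_mem_FS (S := {J}) (Set.mem_singleton J)) _
        have m2 : ret {J}ᶜ U ∈ FS ({J}ᶜ : Set α) := ret_mem_self {J}ᶜ U
        have h4 := FS_inter m1 m2
        rwa [Set.inter_compl_self] at h4
      rw [h3, one_mul] at h1
      exact h1.symm
  by_cases hall : ∀ J, ret {J} U = 1
  · left
    have hn : ∀ J, U ∈ FS {J}ᶜ := by
      intro J
      have h1 := key {J}
      rw [hall J, mul_one] at h1
      rw [← h1]
      exact ret_mem_self {J}ᶜ U
    obtain ⟨S, hS, hU⟩ := exists_finite_FS U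
    induction S, hS using Set.Finite.induction_on with
    | empty => exact FS_empty hU
    | @insert a S _ _ ih =>
      refine ih (FS_mono ?_ (FS_inter hU (hn a)))
      rintro b ⟨h1 | h1, h2⟩
      · exact absurd h1 h2
      · exact h1
  · push Not at hall
    obtain ⟨J, hJ1⟩ := hall
    have h1 := (hJ J).resolve_left hJ1
    obtain ⟨k, hk⟩ := FS_singleton (ret_mem_self {J} U)
    rw [hk] at h1
    subst h1
    let χ : FreeGroup (Bool × α) →* DihedralGroup 0 := FreeGroup.lift fun p =>
      if p.1 = true then DihedralGroup.sr 1 else DihedralGroup.sr 0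
    have h2 := congrArg χ h
    simp only [map_mul, map_zpow, FreeGroup.map.of, FreeGroup.lift_apply_of, χ, if_true,
      Bool.false_eq_true, if_false, DihedralGroup.sr_mul_sr] at h2
    have sq : ∀ i : ZMod 0, (DihedralGroup.sr i : DihedralGroup 0) ^ (2 : ℤ) = 1 := by
      intro i; rw [zpow_ofNat, pow_two, DihedralGroup.sr_mul_self]
    have hr : ∀ k : ℤ, (DihedralGroup.r (1 - 0) : DihedralGroup 0) ^ k = DihedralGroup.r k := by
      intro k
      rw [sub_zero]
      cases k with
      | ofNat k => simp; rfl
      | negSucc k => rw [zpow_negSucc, DihedralGroup.r_one_pow, DihedralGroup.inv_r]; rfl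
    rw [hr] at h2
    rcases Int.even_or_odd' k with ⟨l, rfl | rfl⟩
    · left
      rw [zpow_mul, zpow_mul, sq, sq, one_zpow, mul_one, DihedralGroup.one_def] at h2
      have : (0 : ℤ) = 2 * l := DihedralGroup.r.inj h2
      rw [← this, zpow_zero]
    · right
      rw [zpow_add, zpow_add, zpow_mul, zpow_mul, sq, sq, one_zpow, one_mul, one_mul, zpow_one,
        zpow_one, DihedralGroup.sr_mul_sr] at h2
      have : (1 : ℤ) - 0 = 2 * l + 1 := DihedralGroup.r.inj h2
      exact ⟨J, by rw [← this]; simp⟩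

/-- Substitution in a word on two letters. -/
def sub2 {G : Type*} [Group G] (x c : G) : FreeGroup Bool →* G :=
  FreeGroup.lift fun b => if b = true then c else x

lemma sub2_map {G H : Type*} [Group G] [Group H] (f : G →* H) (x c : G) (g : FreeGroup Bool) :
    f (sub2 x c g) = sub2 (f x) (f c) g := by
  have : f.comp (sub2 x c) = sub2 (f x) (f c) := by
    ext b; cases b <;> simp [sub2]
  exact DFunLike.congr_fun this g

@[simp] lemma sub2_false {G : Type*} [Group G] (x c : G) :
    sub2 x c (FreeGroup.of false) = x := by simp [sub2]
@[simp] lemma sub2_true {G : Type*} [Group G] (x c : G) :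
    sub2 x c (FreeGroup.of true) = c := by simp [sub2]

/-- Solutions of `g(x,c) g(y,c) = g(xy,c) g(1,c)`. -/
lemma sub2_equation {g : FreeGroup Bool}
    (h : ∀ (G : Type) [Group G] (x y c : G),
      sub2 x c g * sub2 y c g = sub2 (x * y) c g * sub2 1 c g) :
    (∃ a : ℤ, g = FreeGroup.of true ^ a) ∨
    ∃ j : ℤ, g = FreeGroup.of true ^ j * FreeGroup.of false * FreeGroup.of true ^ (-j) := by
  let E : FreeGroup Bool →* KK Unit := sub2 (SemidirectProduct.inl (FreeGroup.of ((), 0)))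
    (SemidirectProduct.inr (Multiplicative.ofAdd 1))
  let B : KK Unit →* FreeGroup Bool := SemidirectProduct.lift
    (FreeGroup.lift fun p => FreeGroup.of true ^ p.2 * FreeGroup.of false *
      (FreeGroup.of true ^ p.2)⁻¹)
    (zpowersHom _ (FreeGroup.of true)) (by
      intro r
      ext p
      simp only [MonoidHom.comp_apply, MulEquiv.coe_toMonoidHom, shA_apply, shf_of,
        FreeGroup.lift_apply_of, zpowersHom_apply, MulAut.conj_apply]
      rw [add_comm, zpow_add]; group)
  have hBE : ∀ g, B (E g) = g := by
    intro g
    have : B.comp E = MonoidHom.id _ := by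
      ext b; cases b <;> simp [B, E, sub2]
    exact DFunLike.congr_fun this g
  have map_of_comm : ∀ (f : FreeGroup (Unit × ℤ) →* FreeGroup (Bool × ℤ)),
      (∀ r p, f (shf r (FreeGroup.of p)) = shf r (f (FreeGroup.of p))) →
      sub2 (SemidirectProduct.inl (f (FreeGroup.of ((), 0))))
        (SemidirectProduct.inr (Multiplicative.ofAdd 1)) g =
      (⟨f (E g).left, (E g).right⟩ : KK Bool) := by
    intro f hf
    have hcomm : ∀ r : Multiplicative ℤ, f.comp (shA Unit r).toMonoidHom =
        (shA Bool r).toMonoidHom.comp f := by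
      intro r; ext p; exact hf _ p
    have e1 := sub2_map (SemidirectProduct.map f (MonoidHom.id _) hcomm)
      (SemidirectProduct.inl (FreeGroup.of ((), 0)))
      (SemidirectProduct.inr (Multiplicative.ofAdd 1)) g
    rw [SemidirectProduct.map_inl, SemidirectProduct.map_inr] at e1
    exact e1.symm
  let F : Bool → FreeGroup (Unit × ℤ) →* FreeGroup (Bool × ℤ) := fun b =>
    FreeGroup.map fun p => (b, p.2)
  let P : FreeGroup (Unit × ℤ) →* FreeGroup (Bool × ℤ) := FreeGroup.lift fun p =>
    FreeGroup.of (false, p.2) * FreeGroup.of (true, p.2)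
  have hF := fun b => map_of_comm (F b) (fun r p => by simp [F, shf_of])
  have hP := map_of_comm P (fun r p => by simp [P, shf_of])
  have h1 := map_of_comm 1 (fun r p => by simp)
  have H := h (KK Bool) (SemidirectProduct.inl (F false (FreeGroup.of ((), 0))))
    (SemidirectProduct.inl (F true (FreeGroup.of ((), 0))))
    (SemidirectProduct.inr (Multiplicative.ofAdd 1))
  have hPF : P (FreeGroup.of ((), 0)) = F false (FreeGroup.of ((), 0)) *
    F true (FreeGroup.of ((), 0)) := by simp [P, F]
  rw [MonoidHom.one_apply, map_one] at h1
  rw [← map_mul, ← hPF, hF, hF, hP, h1] at H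
  have H1 := congrArg SemidirectProduct.left H
  simp only [SemidirectProduct.mul_left, MonoidHom.one_apply, map_one, mul_one, shA_apply] at H1
  have hg : g = B (SemidirectProduct.inl (E g).left) * FreeGroup.of true ^ (E g).right.toAdd := by
    conv_lhs => rw [← hBE g, ← SemidirectProduct.inl_left_mul_inr_right (E g), map_mul]
    simp [B]
  by_cases ha : (E g).right.toAdd = 0
  · rw [ha, zpow_zero, mul_one] at hg
    rw [ha, shf_zero] at H1
    set U := (E g).left
    have h2 : U = 1 ∨ ∃ a, U = FreeGroup.of a := by
      apply eq_one_or_letter_of_mult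
      let χ : FreeGroup (Bool × ℤ) →* FreeGroup (Bool × Unit × ℤ) :=
        FreeGroup.map fun p => (p.1, ((), p.2))
      have H2 := congrArg χ H1
      rw [map_mul] at H2
      have e1 : ∀ b, χ.comp (F b) = FreeGroup.map (fun a => (b, a)) := by
        intro b; ext p; simp [χ, F]
      have e3 : χ.comp P = FreeGroup.lift
          (fun a => FreeGroup.of (false, a) * FreeGroup.of (true, a)) := by
        ext p; simp [χ, P]
      rw [← e1, ← e1, ← e3]
      exact H2
    rcases h2 with h2 | ⟨⟨_, j⟩, h2⟩
    · left; exact ⟨0, by rw [hg, h2]; simp⟩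
    · right; refine ⟨j, ?_⟩
      rw [hg, h2]; simp [B]
  · left
    refine ⟨(E g).right.toAdd, ?_⟩
    have h3 := congrArg (ret {p : Bool × ℤ | p.1 = true}) H1
    have e1 : (ret {p : Bool × ℤ | p.1 = true}).comp (F false) = 1 := by
      ext p; simp [F, ret]
    have e2 : (ret {p : Bool × ℤ | p.1 = true}).comp P = F true := by
      ext p; simp [F, P, ret]
    have e3 : ((ret {p : Bool × ℤ | p.1 = true}).comp (shf (E g).right.toAdd)).comp (F true) =
        (shf (E g).right.toAdd).comp (F true) := by
      ext p; simp [F, ret, shf_of]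
    rw [map_mul] at h3
    have h4 : shf (E g).right.toAdd (F true (E g).left) = F true (E g).left := by
      have a1 := DFunLike.congr_fun e1 (E g).left
      have a2 := DFunLike.congr_fun e2 (E g).left
      have a3 := DFunLike.congr_fun e3 (E g).left
      simp only [MonoidHom.comp_apply] at a1 a2 a3
      rw [a1, a2, a3, MonoidHom.one_apply, one_mul] at h3
      exact h3
    have h5 := shf_fixed ha h4
    have h6 : (E g).left = 1 := by
      have e4 : (FreeGroup.map fun p : Bool × ℤ => ((), p.2)).comp (F true) = MonoidHom.id _ := by
        ext p; simp [F]
      have := DFunLike.congr_fun e4 (E g).left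
      rw [MonoidHom.comp_apply, h5, map_one] at this
      exact this.symm
    conv_lhs => rw [hg, h6]
    simp

end FunctionalEquation
end BraidB

namespace BraidB

section FourSolutions
variable {m : ℕ}

lemma FS_le_sub2_range {α : Type*} {a b : α} {f : FreeGroup α} (hf : f ∈ FS ({a, b} : Set α)) :
    ∃ g, f = sub2 (FreeGroup.of b * (FreeGroup.of a)⁻¹) (FreeGroup.of b) g := by
  have : FS ({a, b} : Set α) ≤
      (sub2 (FreeGroup.of b * (FreeGroup.of a)⁻¹) (FreeGroup.of b)).range := by
    rw [FS, Subgroup.closure_le]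
    rintro _ ⟨c, rfl | rfl, rfl⟩
    · exact ⟨(FreeGroup.of false)⁻¹ * FreeGroup.of true, by simp⟩
    · exact ⟨FreeGroup.of true, by simp⟩
  obtain ⟨g, hg⟩ := this hf
  exact ⟨g, hg.symm⟩

/-- Solutions of the four term relation with the last generator in the free subgroup on the
last two letters. -/
lemma four_solutions {f : Fr (m + 3)}
    (hf : f ∈ FS ({⟨m + 1, by omega⟩, ⟨m + 2, by omega⟩} : Set (Fin (m + 3))))
    (h : Four (dr (sg (m + 3) (m + 1)) : D (m + 3)) (dl f)) :
    (∃ a : ℤ, f = cc (m + 3) (m + 3) ^ a) ∨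
    ∃ j : ℤ, f = cc (m + 3) (m + 3) ^ j * xx (m + 3) (m + 2) * cc (m + 3) (m + 3) ^ (-j) := by
  obtain ⟨g, hg⟩ := FS_le_sub2_range hf
  have eC : cc (m + 3) (m + 3) = FreeGroup.of ⟨m + 2, by omega⟩ := cc_succ (by omega)
  have eP : cc (m + 3) (m + 2) = FreeGroup.of ⟨m + 1, by omega⟩ := cc_succ (by omega)
  have eQ : cc (m + 3) (m + 1) = FreeGroup.of ⟨m, by omega⟩ := cc_succ (by omega)
  rw [← eC, ← eP] at hg
  set C := cc (m + 3) (m + 3) with hC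
  set P := cc (m + 3) (m + 2) with hP
  set Q := cc (m + 3) (m + 1) with hQ
  set σ := act (m + 3) (sg (m + 3) (m + 1)) with hσ
  have hx : xx (m + 3) (m + 2) = C * P⁻¹ := rfl
  have sC : σ C = C := act_cc_top _
  have sP : σ P = Q * P⁻¹ * C := by
    rw [hσ, hP, act_sg (by omega), if_pos rfl]
  have sf : σ f = sub2 (P * Q⁻¹) C g := by
    have := sub2_map (σ : Fr (m + 3) →* Fr (m + 3)) (C * P⁻¹) C g
    rw [← hg] at this
    refine Eq.trans this ?_
    change sub2 (σ (C * P⁻¹)) (σ C) g = _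
    rw [map_mul, map_inv, sC, sP]
    congr 2; group
  have hW : σ (f * σ f) = f * σ f := by
    have h1 := congrArg SemidirectProduct.left h
    simpa [hσ] using h1
  have hW2 : act (m + 3) (sg (m + 3) (m + 1) ^ (2 * 1)) (f * σ f) = f * σ f := by
    rw [mul_one, pow_two, MonoidHom.map_mul, MulAut.mul_apply]
    exact (congrArg σ hW).trans hW
  have h2 : twi (⟨m, by omega⟩ : Fin (m + 3)) {⟨m + 1, by omega⟩} (1 : ℕ) (bch' m (f * σ f)) =
      bch' m (f * σ f) := by
    have := bch_twi 1 (bch' m (f * σ f))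
    rw [bch_bch', hW2] at this
    rw [← bch'_bch (twi _ _ _ _), this]
  have h3 := ret_eq_self (twi_fixed (by simp) h2)
  have bC : bch' m C = C := by
    rw [hC, bch'_cc (by omega) le_rfl, if_neg (by omega), if_neg (by omega)]
  have bP : bch' m P = P * Q⁻¹ * C := by
    rw [hP, bch'_cc (by omega) (by omega), if_neg (by omega), if_pos rfl]
  have bQ : bch' m Q = Q⁻¹ * C := by
    rw [hQ, bch'_cc (by omega) (by omega), if_pos rfl]
  have h4 : bch' m (f * σ f) = sub2 (Q * P⁻¹) C g * sub2 P C g := by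
    rw [map_mul, sf, hg, sub2_map, sub2_map, map_mul, map_inv, map_mul, map_inv, bC, bP, bQ]
    congr 3 <;> group
  have h5 : sub2 (Q * P⁻¹) C g * sub2 P C g = sub2 Q C g * sub2 1 C g := by
    have rP : ret ({⟨m + 1, by omega⟩}ᶜ : Set (Fin (m + 3))) P = 1 := by
      rw [eP]; exact ret_of_notMem (by simp)
    have rQ : ret ({⟨m + 1, by omega⟩}ᶜ : Set (Fin (m + 3))) Q = Q := by
      rw [eQ]; exact ret_of_mem (by simp)
    have rC : ret ({⟨m + 1, by omega⟩}ᶜ : Set (Fin (m + 3))) C = C := by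
      rw [eC]; exact ret_of_mem (by simp)
    rw [← h4, ← h3, h4, map_mul, sub2_map, sub2_map, map_mul, map_inv, rP, rQ, rC, inv_one, mul_one]
  have h6 := sub2_equation (g := g) (by
    intro G _ x y c
    let χ : Fr (m + 3) →* G := FreeGroup.lift fun i =>
      if (i : ℕ) = m then x * y else if (i : ℕ) = m + 1 then y else c
    have := congrArg χ h5
    have cC : χ C = c := by simp [χ, eC]
    have cP : χ P = y := by simp [χ, eP]
    have cQ : χ Q = x * y := by simp [χ, eQ]
    simpa only [map_mul, map_inv, map_one, sub2_map, cC, cP, cQ, mul_inv_cancel_right] using this)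
  rcases h6 with ⟨a, h6⟩ | ⟨j, h6⟩
  · left; exact ⟨a, by rw [hg, h6]; simp⟩
  · right; exact ⟨j, by rw [hg, h6, hx]; simp⟩

lemma zpow_apply_of_conj {G : Type*} [Group G] {A : MulAut G} {p x : G} (hp : A p = p)
    (hx : A x = p⁻¹ * x * p) (i : ℤ) : (A ^ i) x = p ^ (-i) * x * p ^ i := by
  have h1 : Commute (MulAut.conj p) A := by
    ext y; simp [hp]
  have h2 : MulAut.conj p * A ∈ MulAction.stabilizer (MulAut G) x := by
    rw [MulAction.mem_stabilizer_iff, MulAut.smul_def, MulAut.mul_apply, hx]; simp [mul_assoc]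
  have h3 := Subgroup.zpow_mem _ h2 i
  rw [h1.mul_zpow, MulAction.mem_stabilizer_iff, MulAut.smul_def, MulAut.mul_apply, ← map_zpow,
    MulAut.conj_apply] at h3
  generalize (A ^ i) x = y at h3 ⊢
  rw [← h3]; group

/-- A power of the full twist on all but the last strand satisfying the four term relation. -/
lemma four_tw_zpow {i : ℤ} (h : Four (sg (m + 3) (m + 1)) (twB (m + 3) (m + 2) ^ i)) :
    i = 0 ∨ i = 1 := by
  by_contra hi
  push Not at hi
  have eP : cc (m + 3) (m + 2) = FreeGroup.of ⟨m + 1, by omega⟩ := cc_succ (by omega)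
  have eQ : cc (m + 3) (m + 1) = FreeGroup.of ⟨m, by omega⟩ := cc_succ (by omega)
  have eC : cc (m + 3) (m + 3) = FreeGroup.of ⟨m + 2, by omega⟩ := cc_succ (by omega)
  set T := act (m + 3) (twB (m + 3) (m + 2)) with hTdef
  have hT : ∀ j ≤ m + 2, (T ^ i) (cc (m + 3) j) =
      (cc (m + 3) (m + 2)) ^ (-i) * cc (m + 3) j * (cc (m + 3) (m + 2)) ^ i := by
    intro j hj
    refine zpow_apply_of_conj ?_ (act_tw_lo (by omega) hj) i
    rw [act_tw_lo (by omega) le_rfl]; group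
  have hTC : (T ^ i) (cc (m + 3) (m + 3)) = cc (m + 3) (m + 3) := by
    rw [hTdef, ← map_zpow]; exact act_cc_top _
  have sP : act (m + 3) (sg (m + 3) (m + 1)) (cc (m + 3) (m + 2)) =
      cc (m + 3) (m + 1) * (cc (m + 3) (m + 2))⁻¹ * cc (m + 3) (m + 3) := by
    rw [act_sg (by omega), if_pos rfl]
  have sQ : act (m + 3) (sg (m + 3) (m + 1)) (cc (m + 3) (m + 1)) = cc (m + 3) (m + 1) := by
    rw [act_sg (by omega), if_neg (by omega)]
  have sC : act (m + 3) (sg (m + 3) (m + 1)) (cc (m + 3) (m + 3)) = cc (m + 3) (m + 3) :=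
    act_cc_top _
  have h1 := congrArg (fun b => act (m + 3) b (cc (m + 3) (m + 2))) h
  simp only [map_mul, map_zpow, ← hTdef] at h1
  simp only [map_mul, MulAut.mul_apply, hT _ le_rfl, hT _ (show m + 1 ≤ m + 2 by omega), sP, sQ, sC,
    hTC, map_inv, map_zpow] at h1
  let χ : Fr (m + 3) →* FreeGroup Bool := FreeGroup.lift fun i =>
      if (i : ℕ) = m then FreeGroup.of true * FreeGroup.of false else
        if (i : ℕ) = m + 1 then FreeGroup.of false else 1
  have cC : χ (cc (m + 3) (m + 3)) = 1 := by simp [χ, eC]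
  have cP : χ (cc (m + 3) (m + 2)) = FreeGroup.of false := by simp [χ, eP]
  have cQ : χ (cc (m + 3) (m + 1)) = FreeGroup.of true * FreeGroup.of false := by simp [χ, eQ]
  have h2 := congrArg χ h1
  simp only [map_mul, map_inv, map_zpow, cC, cP, cQ] at h2
  set w : FreeGroup Bool := FreeGroup.of true
  set p : FreeGroup Bool := FreeGroup.of false with hp
  have a1 : w * p * p⁻¹ * 1 = w := by group
  have a2 : w ^ (-i) * (w * p) * w ^ i * (w ^ (-i) * w * w ^ i)⁻¹ * 1 =
      w ^ (1 - i) * p * w ^ (i - 1) := by group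
  have a3 : p ^ (-i) * (w * p) * p ^ i * (p ^ (-i) * p * p ^ i)⁻¹ * 1 = p ^ (-i) * w * p ^ i := by
    group
  have a4 : ∀ k : ℤ, (p ^ (-i) * w * p ^ i) ^ k = p ^ (-i) * w ^ k * p ^ i := by
    intro k
    have := conj_zpow (a := p ^ (-i)) (b := w) (i := k)
    rwa [zpow_neg, inv_inv, ← zpow_neg] at this
  simp only [a1, a2, a3, a4] at h2
  set q := w ^ (1 - i) * p * w ^ (i - 1) with hq
  have h3 : Commute (p ^ i) q := by
    have e1 : q ^ (-i) * q * q ^ i = q := by group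
    rw [e1] at h2
    have e2 : q = p ^ (-i) * q * p ^ i := h2.trans (by rw [hq]; group)
    have e3 : p ^ i * (p ^ (-i) * q * p ^ i) = q * p ^ i := by group
    exact (congrArg (p ^ i * ·) e2).trans e3
  obtain ⟨r, hr⟩ := centralizer_of_zpow hi.1 h3
  have h4 : r = 1 := by
    have := congrArg (expo false) hr
    simp only [hq, expo_mul, expo_zpow, hp, expo_self,
      expo_of_ne (show true ≠ false by decide), w] at this
    linarith
  rw [h4, zpow_one] at hr
  have h5 : Commute (p ^ (1 : ℤ)) (w ^ (1 - i)) := by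
    have e1 : q * w ^ (1 - i) = w ^ (1 - i) * p := by rw [hq]; group
    rw [hr] at e1
    rwa [zpow_one]
  obtain ⟨t, ht⟩ := centralizer_of_zpow one_ne_zero h5
  have := congrArg (expo true) ht
  simp only [expo_zpow, expo_self, expo_of_ne (show false ≠ true by decide), w] at this
  omega

end FourSolutions
end BraidB

namespace BraidB

section Twists
variable {G : Type*} [Group G] {n : ℕ} {s : ℕ → G}

/-- The braid in which the strand `j` runs around the preceding ones. -/
def dd (s : ℕ → G) : ℕ → G
  | 0 => 1
  | k + 1 => s k * dd s k * s k

@[simp] lemma dd_zero (s : ℕ → G) : dd s 0 = 1 := rfl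
lemma dd_succ (s : ℕ → G) (k : ℕ) : dd s (k + 1) = s k * dd s k * s k := rfl

lemma dd_map {H : Type*} [Group H] (f : G →* H) (s : ℕ → G) (k : ℕ) :
    f (dd s k) = dd (fun i => f (s i)) k := by
  induction k with
  | zero => simp
  | succ k ih => simp only [dd_succ, map_mul, ih]

lemma dd_congr {s t : ℕ → G} {k : ℕ} (h : ∀ i, i < k → s i = t i) : dd s k = dd t k := by
  induction k with
  | zero => rfl
  | succ k ih => rw [dd_succ, dd_succ, ih fun i hi => h i (by omega), h k (by omega)]

/-- The product of the last generators in increasing order. -/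
lemma ew_mul_last_pow (hs : BraidRel n s) {k : ℕ} (h : k + 1 < n) :
    (ew s (k + 1) * s k) ^ (k + 1) = ew s (k + 1) ^ (k + 2) := by
  have key : ∀ j, j ≤ k + 1 → (ew s (k + 1) * s k) ^ j =
      ew s (k + 1) ^ j * ew (fun i => s (k + 1 - j + i)) j := by
    intro j
    induction j with
    | zero => simp
    | succ j ih =>
      intro hj
      have h1 : ew (fun i => s (k + 1 - (j + 1) + i)) (j + 1) =
          s (k - j) * ew (fun i => s (k + 1 - j + i)) j := by
        have : ∀ (t : ℕ → G) (l : ℕ), ew t (l + 1) = t 0 * ew (fun i => t (i + 1)) l := by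
          intro t l
          induction l with
          | zero => simp [ew]
          | succ l ih => rw [ew_succ, ih, mul_assoc, ew_succ]
        rw [this, show k + 1 - (j + 1) + 0 = k - j by omega]
        congr 1
        refine ew_congr fun i _ => ?_
        rw [show k + 1 - (j + 1) + (i + 1) = k + 1 - j + i by omega]
      rw [pow_succ', ih (by omega), h1, pow_succ']
      have h2 := ew_shift_pow hs (k := k + 1) (i := k - j) (j := j) (by omega) (by omega)
      rw [show k - j + j = k by omega] at h2
      rw [mul_assoc (ew s (k + 1)) (s k), ← mul_assoc (s k), ← h2]
      simp only [mul_assoc]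
  rw [key _ le_rfl, pow_succ _ (k + 1)]
  congr 1
  refine ew_congr fun i _ => ?_
  rw [show k + 1 - (k + 1) + i = i by omega]

lemma iota_cc {j : ℕ} (hj : j ≤ n) :
    iota n (dl (cc n j)) = hh n j * dd (sg (n + 1)) j * (hh n j)⁻¹ := by
  induction j with
  | zero => simp [cc_zero]
  | succ j ih =>
    rw [cc_succ_eq, map_mul, map_mul, ih (by omega), iota_xx (by omega),
      hh_rec (show j < n by omega), dd_succ, pow_two]
    group

lemma iota_cc_top : iota n (dl (cc n n)) = dd (sg (n + 1)) n := by
  rw [iota_cc le_rfl, hh_self]; group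

lemma iota_tw {m : ℕ} (hm : m ≤ n) : iota n (dr (twB n m)) = twB (n + 1) m := by
  rw [twB, tw_map, tw_map]
  exact tw_congr fun i hi => iota_sg (by omega)

lemma iota_zD : iota n (zD n) = twB (n + 1) (n + 1) := by
  rcases Nat.eq_zero_or_pos n with rfl | hn
  · simp [zD, cc_zero]
  obtain ⟨k, rfl⟩ : ∃ k, n = k + 1 := ⟨n - 1, by omega⟩
  rw [zD_eq_pow hn, map_pow, map_mul, iota_x hn, ew_map, twB, tw]
  have : ew (fun i => iota (k + 1) (dr (sg (k + 1) i))) (k + 1 - 1) = ew (sg (k + 1 + 1)) k :=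
    ew_congr fun i hi => iota_sg (by omega)
  rw [this, show k + 1 - 1 = k by omega, show k + 1 + 1 - 1 = k + 1 by omega,
    ← ew_mul_last_pow (braidRel_sg (k + 1 + 1)) (by omega), ew_succ, pow_two, mul_assoc]

lemma twB_succ : twB (n + 1) (n + 1) = dd (sg (n + 1)) n * twB (n + 1) n := by
  rw [← iota_zD, zD, map_mul, iota_cc_top, iota_tw le_rfl]

lemma tw_succ (hs : BraidRel n s) {k : ℕ} (hk : k + 1 ≤ n) : tw s (k + 1) = dd s k * tw s k := by
  have h := congrArg (Br.lift s (hs.mono hk)) (twB_succ (n := k))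
  rw [map_mul, dd_map, twB, tw_map, twB, tw_map] at h
  rw [tw_congr (t := s) fun i hi => Br.lift_sg _ _ (by omega),
    tw_congr (t := s) (k := k) fun i hi => Br.lift_sg _ _ (by omega),
    dd_congr (t := s) (k := k) fun i hi => Br.lift_sg _ _ (by omega)] at h
  exact h

lemma dd_eq (hs : BraidRel n s) {k : ℕ} (hk : k + 1 ≤ n) :
    dd s k = tw s (k + 1) * (tw s k)⁻¹ := by
  rw [tw_succ hs hk, mul_inv_cancel_right]

/-- The full twist on all but the last strand and the last generator satisfy the four term
relation. -/
lemma four_tw (hs : BraidRel n s) {k : ℕ} (hk : k + 2 ≤ n) : Four (s k) (tw s (k + 1)) := by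
  have h1 := tw_succ hs (k := k) (by omega)
  have h2 := tw_succ hs (k := k + 1) (by omega)
  have c1 : Commute (tw s k) (s k) := tw_comm_hi hs le_rfl (by omega)
  have c2 : Commute (tw s (k + 2)) (tw s (k + 1)) := tw_comm_tw hs (by omega) (by omega)
  have c3 : Commute (tw s (k + 1)) (tw s k) := tw_comm_tw hs (by omega) (by omega)
  have c4 : Commute (dd s (k + 1)) (tw s (k + 1)) := by
    rw [dd_eq hs (by omega)]; exact c2.mul_left (Commute.refl _).inv_left
  have e : s k * tw s (k + 1) * s k = dd s (k + 1) * tw s k := by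
    rw [h1, dd_succ]; simp only [mul_assoc]; rw [c1.eq]
  unfold Four
  rw [e, mul_assoc, mul_assoc (tw s (k + 1)), mul_assoc (tw s (k + 1)), e,
    ← mul_assoc (tw s (k + 1)), ← c4.eq, mul_assoc, c3.eq]

/-- The Garside element. -/
def gars (s : ℕ → G) : ℕ → G
  | 0 => 1
  | k + 1 => ew s (k + 1) * gars s k

lemma gars_succ (s : ℕ → G) (k : ℕ) : gars s (k + 1) = ew s (k + 1) * gars s k := rfl

lemma gars_comm (hs : BraidRel n s) {k i : ℕ} (h1 : k + 1 ≤ i) (h2 : i + 1 < n) :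
    Commute (gars s k) (s i) := by
  induction k with
  | zero => exact Commute.one_left _
  | succ k ih => exact (ew_comm hs h1 h2).mul_left (ih (by omega))

lemma dd_comm (hs : BraidRel n s) {k i : ℕ} (h1 : i + 1 < k) (h2 : k + 1 ≤ n) :
    Commute (dd s k) (s i) := by
  rw [dd_eq hs h2]
  exact (tw_comm hs h2 (by omega)).mul_left (tw_comm hs (by omega) h1).inv_left

lemma gars_sq (hs : BraidRel n s) {k : ℕ} (h : k < n) : gars s k ^ 2 = tw s (k + 1) := by
  let rw' : ℕ → G := fun k => Nat.rec 1 (fun k x => s k * x) k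
  have r0 : rw' 0 = 1 := rfl
  have rs : ∀ k, rw' (k + 1) = s k * rw' k := fun k => rfl
  have h1 : ∀ k, dd s k = rw' k * ew s k := by
    intro k
    induction k with
    | zero => simp [r0]
    | succ k ih => rw [dd_succ, ih, rs, ew_succ]; simp only [mul_assoc]
  have h2 : ∀ k, k < n → gars s k = (gars s (k - 1)) * rw' k := by
    intro k
    induction k with
    | zero => simp [gars, r0]
    | succ k ih =>
      intro hk
      rcases Nat.eq_zero_or_pos k with rfl | h0
      · simp [gars, rs, r0, ew]
      obtain ⟨l, rfl⟩ : ∃ l, k = l + 1 := ⟨k - 1, by omega⟩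
      have c : Commute (gars s l) (s (l + 1)) := gars_comm hs le_rfl hk
      conv_lhs => rw [gars_succ s (l + 1), ih (by omega)]
      rw [Nat.add_sub_cancel, Nat.add_sub_cancel, gars_succ s l, rs (l + 1), ew_succ s (l + 1)]
      simp only [mul_assoc]
      rw [← mul_assoc (s (l + 1)), ← c.eq, mul_assoc]
  induction k with
  | zero => simp [gars]
  | succ k ih =>
    have c : ∀ j, j ≤ k → Commute (dd s (k + 1)) (ew s j) := by
      intro j hj
      induction j with
      | zero => exact Commute.one_right _
      | succ j ih => exact (ih (by omega)).mul_right (dd_comm hs (by omega) h)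
    have c' : ∀ j, j ≤ k → Commute (dd s (k + 1)) (gars s j) := by
      intro j hj
      induction j with
      | zero => exact Commute.one_right _
      | succ j ih => exact (c _ hj).mul_right (ih (by omega))
    rw [tw_succ hs h, ← ih (by omega), pow_two]
    nth_rewrite 1 [h2 _ h]
    rw [Nat.add_sub_cancel, gars_succ, mul_assoc, ← mul_assoc (rw' (k + 1)) (ew s (k + 1)),
      ← h1 (k + 1), ← mul_assoc,
      ← (c' k le_rfl).eq, pow_two, mul_assoc]

lemma br_eq_one (hn : n ≤ 1) (b : Br n) : b = 1 := by
  have : (MonoidHom.id (Br n)) = 1 := Br.hom_ext fun i hi => absurd hi (by omega)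
  exact DFunLike.congr_fun this b

lemma D_eq (d : D n) : d = dl d.left * dr d.right :=
  (SemidirectProduct.inl_left_mul_inr_right d).symm

/-- The centralizer of the pure braid group in itself is generated by the full twist. -/
lemma pure_centralizer {n : ℕ} : ∀ {g : Br n}, prm n g = 1 →
    (∀ h : Br n, prm n h = 1 → Commute g h) → ∃ j : ℤ, g = twB n n ^ j := by
  induction n with
  | zero => intro g _ _; exact ⟨0, by rw [zpow_zero]; exact br_eq_one (by omega) g⟩
  | succ m ih =>
    intro g hg hc
    have hm : prm (m + 1) g m = m := by rw [hg]; rfl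
    set d := kap m m g with hd
    have hgd : iota m d = g := iota_kap hm
    have hpd : prm m d.right = 1 := by
      have := prm_pr_kap hm
      rw [hg] at this; exact this
    have hcd : ∀ e : D m, prm m e.right = 1 → Commute d e := by
      intro e he
      have h1 := hc (iota m e) (by rw [prm_iota]; exact he)
      rw [← hgd] at h1
      exact iota_injective (by simpa using h1.eq)
    obtain ⟨j, hj⟩ := ih hpd (fun b hb => (hcd (dr b) hb).map pr)
    set f := (zD m ^ (-j) * d) with hf
    have hfc : ∀ e : D m, prm m e.right = 1 → Commute f e := fun e he =>
      ((zD_central e).zpow_left _).mul_left (hcd e he)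
    have hfr : f.right = 1 := by
      have : pr f = 1 := by
        rw [hf, map_mul, map_zpow, zD, map_mul]
        simp only [SemidirectProduct.rightHom_inl, SemidirectProduct.rightHom_inr, one_mul]
        change _ * d.right = 1
        rw [hj, ← zpow_add, neg_add_cancel, zpow_zero]
      exact this
    have hfl : f = dl f.left := by conv_lhs => rw [D_eq f, hfr, map_one, mul_one]
    have hcl : ∀ v : Fr m, Commute f.left v := by
      intro v
      have := hfc (dl v) (by simp)
      rw [hfl] at this
      exact SemidirectProduct.inl_injective (by simpa using this.eq)
    suffices h : ∃ i : ℤ, f = zD m ^ i by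
      obtain ⟨i, hi⟩ := h
      refine ⟨j + i, ?_⟩
      rw [← iota_zD, ← hgd, ← map_zpow]
      congr 1
      rw [zpow_add, ← hi, hf, ← mul_assoc, ← zpow_add, add_neg_cancel, zpow_zero, one_mul]
    rcases Nat.lt_or_ge m 2 with h2 | h2
    · interval_cases m
      · exact ⟨0, by rw [zpow_zero, hfl, Subsingleton.elim f.left 1, map_one]⟩
      · have : f.left ∈ FS ({0} : Set (Fin 1)) :=
          FS_mono (fun a _ => Subsingleton.elim a 0) (mem_FS_univ f.left)
        obtain ⟨k, hk⟩ := FS_singleton this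
        refine ⟨k, ?_⟩
        rw [hfl, hk, zD, cc_succ (by omega)]; simp
    · obtain ⟨a, ha⟩ := centralizer_of_zpow (b := (⟨0, by omega⟩ : Fin m)) (k := 1) one_ne_zero
        (hcl (FreeGroup.of ⟨0, by omega⟩ ^ (1 : ℤ))).symm
      obtain ⟨b, hb⟩ := centralizer_of_zpow (b := (⟨1, by omega⟩ : Fin m)) (k := 1) one_ne_zero
        (hcl (FreeGroup.of ⟨1, by omega⟩ ^ (1 : ℤ))).symm
      have := congrArg (expo (⟨0, by omega⟩ : Fin m)) (ha.symm.trans hb)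
      rw [expo_zpow, expo_self, expo_zpow, expo_of_ne (by simp)] at this
      obtain rfl : a = 0 := by linarith
      exact ⟨0, by rw [hfl, ha]; simp⟩

end Twists
end BraidB

namespace BraidB

section LevelMaps
variable {α : Type*}

/-- Extension of an endomorphism of a free group to all levels. -/
def lev (j : ℤ) : FreeGroup α →* FreeGroup (α × ℤ) := FreeGroup.map fun a => (a, j)

/-- Letterwise extension of an endomorphism preserving the levels. -/
def levMap (f : FreeGroup α →* FreeGroup α) : FreeGroup (α × ℤ) →* FreeGroup (α × ℤ) :=
  FreeGroup.lift fun p => lev p.2 (f (FreeGroup.of p.1))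

lemma shf_lev (r j : ℤ) (g : FreeGroup α) : shf r (lev j g) = lev (j + r) g := by
  have : (shf r).comp (lev j) = lev (α := α) (j + r) := by
    ext a; simp [lev, shf_of]
  exact DFunLike.congr_fun this g

lemma levMap_shf (f : FreeGroup α →* FreeGroup α) (r : ℤ) (u : FreeGroup (α × ℤ)) :
    levMap f (shf r u) = shf r (levMap f u) := by
  have : (levMap f).comp (shf r) = (shf r).comp (levMap f) := by
    ext p; simp [levMap, shf_of, shf_lev]
  exact DFunLike.congr_fun this u

lemma lev_mem (j : ℤ) (g : FreeGroup α) : lev j g ∈ FS {p : α × ℤ | p.2 = j} :=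
  FS_le_comap (f := lev j) (fun a _ => by
    have : ((a, j) : α × ℤ) ∈ {p : α × ℤ | p.2 = j} := rfl
    simpa [lev] using of_mem_FS this) (mem_FS_univ g)

lemma levMap_mem (f : FreeGroup α →* FreeGroup α) {S : Set ℤ} {u : FreeGroup (α × ℤ)}
    (hu : u ∈ FS {p : α × ℤ | p.2 ∈ S}) : levMap f u ∈ FS {p : α × ℤ | p.2 ∈ S} := by
  refine FS_le_comap (f := levMap f) (fun p hp => ?_) hu
  simp only [levMap, FreeGroup.lift_apply_of]
  exact FS_mono (fun q hq => by
    simp only [Set.mem_ofPred_eq] at *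
    rwa [hq]) (lev_mem _ _)

lemma emb_of_FS (b : α) {g : FreeGroup α} (hg : g ∈ FS ({b}ᶜ : Set α)) :
    emb b g = SemidirectProduct.inl (lev 0 g) :=
  FS_eqOn (f := emb b) (f' := SemidirectProduct.inl.comp (lev 0)) (fun a ha => by
    simp [emb_of_ne (show a ≠ b from ha), lev]) hg

lemma emb_levMap {b : α} {f : FreeGroup α →* FreeGroup α} (hb : f (FreeGroup.of b) = FreeGroup.of b)
    (hf : ∀ a, a ≠ b → f (FreeGroup.of a) ∈ FS ({b}ᶜ : Set α)) (g : FreeGroup α) :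
    emb b (f g) = ⟨levMap f (emb b g).left, (emb b g).right⟩ := by
  have hcomm : ∀ r : Multiplicative ℤ, ((levMap f).comp (shA α r).toMonoidHom) =
      (shA α r).toMonoidHom.comp (levMap f) := by
    intro r
    ext1 p
    exact levMap_shf f r.toAdd (FreeGroup.of p)
  have : (emb b).comp f =
      (SemidirectProduct.map (levMap f) (MonoidHom.id _) hcomm).comp (emb b) := by
    ext1 a
    rw [MonoidHom.comp_apply, MonoidHom.comp_apply]
    by_cases hab : a = b
    · subst hab
      rw [hb, emb_self]; simp
    · rw [emb_of_FS b (hf a hab), emb_of_ne hab, SemidirectProduct.map_inl]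
      simp [levMap]
  exact DFunLike.congr_fun this g

/-- An endomorphism fixing the letter `b` and preserving the other letters only fixes elements up
to conjugation by a power of `b` when they are powers of `b`. -/
lemma eq_zpow_of_conj_fixed {b : α} {f : FreeGroup α →* FreeGroup α}
    (hb : f (FreeGroup.of b) = FreeGroup.of b)
    (hf : ∀ a, a ≠ b → f (FreeGroup.of a) ∈ FS ({b}ᶜ : Set α)) {k : ℤ} (hk : k ≠ 0)
    {w : FreeGroup α} (h : FreeGroup.of b ^ k * f w = w * FreeGroup.of b ^ k) :
    ∃ r : ℤ, w = FreeGroup.of b ^ r := by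
  have h1 := congrArg (emb b) h
  rw [map_mul, map_mul, emb_self_zpow, emb_levMap hb hf] at h1
  have h2 := congrArg SemidirectProduct.left h1
  simp only [SemidirectProduct.mul_left, SemidirectProduct.left_inr, SemidirectProduct.right_inr,
    one_mul, map_one, mul_one, shA_apply, toAdd_ofAdd] at h2
  set u := (emb b w).left
  have h3 : u = 1 := by
    obtain ⟨B, hB, hu⟩ := exists_bound_FS u
    have hj : ∀ j : ℕ, u ∈ FS {p : α × ℤ | p.2 ∈ {l : ℤ | |l - k * j| < B}} := by
      intro j
      induction j with
      | zero => simpa using hu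
      | succ j ih =>
        rw [← h2]
        refine map_mem_FS (fun p hp => ?_) (levMap_mem f ih)
        simp only [Set.mem_ofPred_eq] at hp ⊢
        rw [show p.2 + k - k * ((j + 1 : ℕ) : ℤ) = p.2 - k * j by push_cast; ring]
        exact hp
    refine FS_empty (FS_mono ?_ (FS_inter hu (hj (2 * B).toNat)))
    rintro p ⟨h4, h5⟩
    simp only [Set.mem_ofPred_eq] at h4 h5
    rw [Int.toNat_of_nonneg (by omega)] at h5
    have h6 : |k * (2 * B)| ≥ 2 * B := by
      rw [abs_mul, abs_of_pos (show 0 < 2 * B by omega)]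
      have := Int.one_le_abs hk
      nlinarith
    have h7 := abs_sub_abs_le_abs_sub (k * (2 * B)) p.2
    rw [abs_sub_comm] at h5
    omega
  refine ⟨expo b w, ?_⟩
  conv_lhs => rw [eq_bak_mul b w]
  change bak b (SemidirectProduct.inl u) * _ = _
  rw [h3]; simp

end LevelMaps

section Sections
variable {G : Type*} [Group G] {n : ℕ} {s : ℕ → G}

lemma BraidRel.twist (hs : BraidRel n s) {ε : ℤ} (hε : ε = 1 ∨ ε = -1) {z : G}
    (hz : ∀ g, Commute z g) : BraidRel n (fun i => s i ^ ε * z) where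
  comm i j h1 h2 := by
    have h3 : Commute (s i) (s j) := hs.comm i j h1 h2
    exact ((h3.zpow_zpow ε ε).mul_left (hz _)).mul_right ((hz _).symm)
  braid i h := by
    have h3 := hs.braid i h
    have e : s i ^ ε * s (i + 1) ^ ε * s i ^ ε = s (i + 1) ^ ε * s i ^ ε * s (i + 1) ^ ε := by
      rcases hε with rfl | rfl
      · simpa using h3
      · have := congrArg (·⁻¹) h3
        simpa [mul_assoc] using this
    have e2 : ∀ a b c : G, (a * z) * (b * z) * (c * z) = a * b * c * (z * z * z) := by
      intro a b c
      have h1 := (hz b).eq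
      have h2 := (hz c).eq
      calc a * z * (b * z) * (c * z) = a * (z * b) * (z * c) * z := by simp only [mul_assoc]
        _ = a * (b * z) * (c * z) * z := by rw [h1, h2]
        _ = a * b * (z * c) * z * z := by simp only [mul_assoc]
        _ = _ := by rw [h2]; simp only [mul_assoc]
    simp only [e2, e]

lemma tw_commute {a : G} {m : ℕ} (h : ∀ i, i + 1 < m → Commute a (s i)) : Commute a (tw s m) := by
  have : ∀ k, k + 1 ≤ m → Commute a (ew s k) := by
    intro k
    induction k with
    | zero => intro _; exact Commute.one_right _
    | succ k ih => intro hk; exact (ih (by omega)).mul_right (h k (by omega))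
  rcases Nat.eq_zero_or_pos m with rfl | hm
  · simp
  · exact (this (m - 1) (by omega)).pow_right m

/-- The degree on `D n`. -/
def degD (n : ℕ) : D n →* Multiplicative ℤ :=
  MonoidHom.mk' (fun d => Multiplicative.ofAdd (dgF d.left)) fun a b => by
    rw [← ofAdd_add]; congr 1
    rw [SemidirectProduct.mul_left, dgF_mul, dgF_act]

lemma degD_apply (d : D n) : (degD n d).toAdd = dgF d.left := rfl

lemma Br.isConj_act {u : Fr n} (h : ∀ i, i + 1 < n → IsConj (act n (sg n i) u) u) (β : Br n) :
    IsConj (act n β u) u := by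
  have hc : ∀ b : Br n, ∀ v w : Fr n, IsConj v w → IsConj (act n b v) (act n b w) :=
    fun b v w hvw => MonoidHom.map_isConj (act n b).toMonoidHom hvw
  induction β using Br.induction with
  | h1 => rw [map_one]; exact IsConj.refl u
  | hs i hi => exact h i hi
  | hm a b ha hb =>
    rw [map_mul, MulAut.mul_apply]
    exact (hc a _ _ hb).trans ha
  | hi a ha =>
    have := hc a⁻¹ _ _ ha
    rw [← MulAut.mul_apply, ← map_mul, inv_mul_cancel, map_one, MulAut.one_apply] at this
    exact this.symm

/-- Lifts of the standard generators to `D n` satisfying the braid relations. -/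
lemma section_form {n m : ℕ} (hn : n = m + 3) {s : ℕ → D n} (hs : BraidRel n s)
    (hp : ∀ i, i + 1 < n → pr (s i) = sg n i) :
    ∃ (v : Fr n) (k : ℤ), ∀ i, i + 1 < n →
      dl v * s i * (dl v)⁻¹ = dr (sg n i) * dl (cc n n ^ k) := by
  have hL : ∀ u : Fr n, (∀ β, IsConj (act n β u) u) → dgF u ≠ 0 →
      ∃ k : ℤ, IsConj u (cc n n ^ k) := by
    subst hn; exact fun u h hd => conj_cc_top_of_invariant h hd
  set t := tw s n with ht
  have hpt : pr t = twB n n := by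
    rw [ht, tw_map]; exact tw_congr fun i hi => hp i hi
  set u := t.left * (cc n n)⁻¹ with hu
  have htu : t = dl u * zD n := by
    rw [D_eq t, zD, ← mul_assoc, ← map_mul, hu, inv_mul_cancel_right]
    congr 2
  have hcu : ∀ i, i + 1 < n → Commute (dl u) (s i) := by
    intro i hi
    have h1 : Commute t (s i) := tw_comm hs le_rfl hi
    have h2 : (dl u : D n) = t * (zD n)⁻¹ := by rw [htu]; group
    rw [h2]
    exact h1.mul_left (zD_central _).inv_left
  have hsw : ∀ i, i + 1 < n → s i = dl (s i).left * dr (sg n i) := by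
    intro i hi
    have := D_eq (s i)
    rwa [show (s i).right = sg n i from hp i hi] at this
  have hac : ∀ i, i + 1 < n → IsConj (act n (sg n i) u) u := by
    intro i hi
    refine isConj_iff.2 ⟨(s i).left, ?_⟩
    have h1 := (hcu i hi).eq
    rw [hsw i hi, mul_assoc, dr_dl, ← mul_assoc, ← mul_assoc, mul_left_inj, ← map_mul,
      ← map_mul] at h1
    have := SemidirectProduct.inl_injective h1
    rw [← this, mul_inv_cancel_right]
  have hdeq : ∀ i, i + 2 < n → dgF (s i).left = dgF (s (i + 1)).left := by
    intro i hi
    have h1 := congrArg (fun d => (degD n d).toAdd) (hs.braid i hi)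
    simp only [map_mul, toAdd_mul, degD_apply] at h1
    linarith
  have hd0 : ∀ i, i + 1 < n → dgF (s i).left = dgF (s 0).left := by
    intro i
    induction i with
    | zero => intro _; rfl
    | succ i ih => intro hi; rw [← hdeq i (by omega), ih (by omega)]
  have hew : ∀ k, k < n → (degD n (ew s k)).toAdd = k * dgF (s 0).left := by
    intro k
    induction k with
    | zero => simp
    | succ k ih =>
      intro hk
      rw [ew_succ, map_mul, toAdd_mul, ih (by omega), degD_apply, hd0 k hk]; push_cast; ring
  have hdu : dgF u ≠ 0 := by
    have h1 : (degD n t).toAdd = n * ((n - 1 : ℕ) * dgF (s 0).left) := by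
      rw [ht, tw, map_pow, toAdd_pow, hew _ (by omega)]; simp
    rw [degD_apply] at h1
    rw [hu, dgF_mul, dgF_inv, dgF_cc le_rfl, h1]
    intro h2
    have h3 : ((m : ℤ) + 3) * (((m : ℤ) + 2) * dgF (s 0).left - 1) = 0 := by
      rw [show n - 1 = m + 2 by omega, show (n : ℤ) = m + 3 by omega] at h2
      push_cast at h2; linarith
    rcases mul_eq_zero.1 h3 with h4 | h4
    · omega
    · have h5 : ((m : ℤ) + 2) ∣ 1 := ⟨dgF (s 0).left, by linarith⟩
      have := Int.le_of_dvd one_pos h5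
      omega
  obtain ⟨k', hk'⟩ := hL u (Br.isConj_act hac) hdu
  obtain ⟨v, hv⟩ := isConj_iff.1 hk'
  have hk0 : k' ≠ 0 := by
    rintro rfl
    rw [zpow_zero, mul_inv_eq_one, mul_eq_left] at hv
    exact hdu (by rw [hv, dgF_one])
  have eC : cc n n = FreeGroup.of ⟨m + 2, by omega⟩ := by
    subst hn; exact cc_succ (by omega)
  have hw : ∀ i, i + 1 < n → ∃ r : ℤ, dl v * s i * (dl v)⁻¹ = dr (sg n i) * dl (cc n n ^ r) := by
    intro i hi
    set w := v * (s i).left * act n (sg n i) v⁻¹ with hw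
    have e1 : dl v * s i * (dl v)⁻¹ = dl w * dr (sg n i) := by
      rw [hsw i hi, ← map_inv, mul_assoc, mul_assoc, dr_dl, hw, map_mul, map_mul]
      simp only [mul_assoc]
    have h1 : Commute (dl (cc n n ^ k')) (dl w * dr (sg n i) : D n) := by
      rw [← e1, ← hv, map_mul, map_mul, map_inv]
      have h2 := (hcu i hi).eq
      rw [Commute, SemiconjBy]
      calc _ = dl v * (dl u * s i) * (dl v)⁻¹ := by group
        _ = _ := by rw [h2]; group
    have h3 : Commute (dl (cc n n ^ k')) (dr (sg n i) : D n) := by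
      rw [map_zpow]; exact ((dr_dl_comm_cc_top _).symm).zpow_left _
    have h4 : Commute (dl (cc n n ^ k')) (dl w : D n) := by
      have := h1.mul_right h3.inv_right
      rwa [mul_inv_cancel_right] at this
    have h5 : Commute (cc n n ^ k') w :=
      SemidirectProduct.inl_injective (by simpa using h4.eq)
    rw [eC] at h5
    obtain ⟨r, hr⟩ := centralizer_of_zpow hk0 h5
    refine ⟨r, ?_⟩
    rw [e1, hr, ← eC, dr_dl, map_zpow (act n _), act_cc_top]
  obtain ⟨k, hk⟩ := hw 0 (by omega)
  refine ⟨v, k, fun i hi => ?_⟩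
  obtain ⟨r, hr⟩ := hw i hi
  have h1 : ∀ j, ∀ r : ℤ, dl v * s j * (dl v)⁻¹ = dr (sg n j) * dl (cc n n ^ r) →
      dgF (s j).left = r * n := by
    intro j r h
    have := congrArg (fun d => (degD n d).toAdd) h
    simp only [map_mul, toAdd_mul, degD_apply, map_inv, toAdd_inv, SemidirectProduct.left_inr,
      SemidirectProduct.left_inl, dgF_zpow, dgF_cc le_rfl, dgF_one] at this
    linarith
  have h2 := h1 i r hr
  rw [hd0 i hi, h1 0 k hk] at h2
  have : r = k := by
    have hn0 : (n : ℤ) ≠ 0 := by omega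
    exact (mul_right_cancel₀ hn0 h2).symm
  rw [hr, this]

end Sections
end BraidB

namespace BraidB

section PureCommutant

lemma dl_comm_iff {n : ℕ} {b : Br n} {f : Fr n} : Commute (dl f) (dr b : D n) ↔ act n b f = f := by
  rw [Commute, SemiconjBy, dr_dl, mul_left_inj]
  exact ⟨fun h => (SemidirectProduct.inl_injective h).symm, fun h => by rw [h]⟩

/-- Pure braids commuting with the generators of the braid group on all but the last strand. -/
lemma pure_commute_form {l : ℕ} (hl : 1 ≤ l) {g : Br (l + 1)} (hg : prm (l + 1) g = 1)
    (hc : ∀ i, i + 1 < l → Commute g (sg (l + 1) i)) :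
    ∃ i j : ℤ, g = twB (l + 1) (l + 1) ^ i * twB (l + 1) l ^ j := by
  have hm : prm (l + 1) g l = l := by rw [hg]; rfl
  set d := kap l l g with hd
  have hgd : iota l d = g := iota_kap hm
  have hpd : prm l d.right = 1 := by
    have := prm_pr_kap hm
    rw [hg] at this; exact this
  have hcs : ∀ i, i + 1 < l → Commute d (dr (sg l i)) := by
    intro i hi
    have h1 := hc i hi
    rw [← hgd, ← iota_sg hi] at h1
    exact iota_injective (by simpa using h1.eq)
  have hcd : ∀ b : Br l, Commute d (dr b) := by
    intro b
    induction b using Br.induction with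
    | h1 => simp
    | hs i hi => exact hcs i hi
    | hm a b ha hb => rw [map_mul]; exact ha.mul_right hb
    | hi a ha => rw [map_inv]; exact ha.inv_right
  obtain ⟨j, hj⟩ := pure_centralizer hpd (fun b _ => (hcd b).map pr)
  set f := zD l ^ (-j) * d with hf
  have hfr : f.right = 1 := by
    have : pr f = 1 := by
      rw [hf, map_mul, map_zpow, zD, map_mul]
      simp only [SemidirectProduct.rightHom_inl, SemidirectProduct.rightHom_inr, one_mul]
      change _ * d.right = 1
      rw [hj, ← zpow_add, neg_add_cancel, zpow_zero]
    exact this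
  have hfl : f = dl f.left := by conv_lhs => rw [D_eq f, hfr, map_one, mul_one]
  have hft : Commute (cc l l ^ (1 : ℤ)) f.left := by
    have h1 : Commute f (dr (twB l l)) := ((zD_central _).zpow_left _).mul_left (hcd _)
    rw [hfl, dl_comm_iff, act_tw_full, mul_assoc, inv_mul_eq_iff_eq_mul] at h1
    rw [zpow_one]; exact h1.symm
  obtain ⟨k, rfl⟩ : ∃ k, l = k + 1 := ⟨l - 1, by omega⟩
  have eC : cc (k + 1) (k + 1) = FreeGroup.of ⟨k, by omega⟩ := cc_succ (by omega)
  rw [eC] at hft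
  obtain ⟨r, hr⟩ := centralizer_of_zpow one_ne_zero hft
  rw [← eC] at hr
  refine ⟨j + r, -r, ?_⟩
  have h1 : d = zD (k + 1) ^ (j + r) * dr (twB (k + 1) (k + 1)) ^ (-r) := by
    have h2 : dl (cc (k + 1) (k + 1)) = zD (k + 1) * (dr (twB (k + 1) (k + 1)))⁻¹ := by
      rw [zD, mul_inv_cancel_right]
    have h3 : d = zD (k + 1) ^ j * f := by rw [hf, zpow_neg, mul_inv_cancel_left]
    rw [h3, hfl, hr, map_zpow, h2, (zD_central _).mul_zpow, zpow_add, inv_zpow', mul_assoc]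
  rw [← hgd, h1, map_mul, map_zpow, map_zpow, iota_zD, iota_tw le_rfl]

end PureCommutant

section Solutions
variable {m : ℕ}

lemma Four.mul_of_comm {G : Type*} [Group G] {a b z : G} (h : Four a b) (ha : Commute z a)
    (hb : Commute z b) : Four a (b * z) := by
  unfold Four at *
  have h1 := ha.eq
  have h2 := hb.eq
  calc a * (b * z) * a * (b * z) = a * b * (z * a) * b * z := by simp only [mul_assoc]
    _ = a * b * a * (z * b) * z := by rw [h1]; simp only [mul_assoc]
    _ = a * b * a * b * (z * z) := by rw [h2]; simp only [mul_assoc]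
    _ = b * a * b * (a * z) * z := by rw [h]; simp only [mul_assoc]
    _ = b * a * (b * z) * a * z := by rw [← h1]; simp only [mul_assoc]
    _ = b * a * z * b * (a * z) := by rw [← h2]; simp only [mul_assoc]
    _ = _ := by
      rw [← h1]; simp only [mul_assoc]
      rw [← mul_assoc a z, ← h1, mul_assoc]

lemma Four.symm {G : Type*} [Group G] {a b : G} (h : Four a b) : Four b a := Eq.symm h

lemma Four.inv {G : Type*} [Group G] {a b : G} (h : Four a b) : Four a⁻¹ b⁻¹ := by
  have := congrArg (·⁻¹) h
  unfold Four
  simpa [mul_assoc] using this.symm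

lemma Four.zpow {G : Type*} [Group G] {a b : G} {ε : ℤ} (hε : ε = 1 ∨ ε = -1) (h : Four a b) :
    Four (a ^ ε) (b ^ ε) := by
  rcases hε with rfl | rfl
  · simpa using h
  · simpa using h.inv

/-- The last generator and the twist of the first strands around the core satisfy the four term
relation. -/
lemma four_cc_tw : Four (dr (sg (m + 3) (m + 1)) : D (m + 3))
    (dl (cc (m + 3) (m + 2)) * dr (twB (m + 3) (m + 2))) := by
  set σ := sg (m + 3) (m + 1) with hσ
  set T := twB (m + 3) (m + 2) with hT
  set P := cc (m + 3) (m + 2) with hP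
  set Q := cc (m + 3) (m + 1) with hQ
  set C := cc (m + 3) (m + 3) with hC
  have sP : act (m + 3) σ P = Q * P⁻¹ * C := by
    rw [hσ, hP, act_sg (by omega), if_pos rfl]
  have sQ : act (m + 3) σ Q = Q := by rw [hσ, hQ, act_sg (by omega), if_neg (by omega)]
  have sC : act (m + 3) σ C = C := act_cc_top _
  have tP : act (m + 3) T P = P := by
    rw [hT, hP, act_tw_lo (by omega) le_rfl]; group
  have tQ : act (m + 3) T Q = P⁻¹ * Q * P := act_tw_lo (by omega) (by omega)
  have tC : act (m + 3) T C = C := act_cc_top _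
  have hST : σ * T * σ * T = T * σ * T * σ := four_tw (braidRel_sg (m + 3)) (k := m + 1) le_rfl
  have e : ∀ (u v : Fr (m + 3)) (b b' : Br (m + 3)),
      (dl u * dr b) * (dl v * dr b') = dl (u * act (m + 3) b v) * dr (b * b') := by
    intro u v b b'
    rw [mul_assoc, ← mul_assoc (dr b), dr_dl]; simp only [map_mul, mul_assoc]
  have h1 : dr σ * (dl P * dr T) = dl (Q * P⁻¹ * C) * dr (σ * T) := by
    rw [← mul_assoc, dr_dl, sP, mul_assoc, map_mul dr]
  have h2 : (dl P * dr T) * dr σ = dl P * dr (T * σ) := by rw [mul_assoc, map_mul dr]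
  unfold Four
  have g1 : act (m + 3) (σ * T) (Q * P⁻¹ * C) = C⁻¹ * P * C := by
    simp only [map_mul, MulAut.mul_apply, map_inv, tP, tQ, tC, sP, sQ, sC]
    group
  have g2 : act (m + 3) (T * σ) P = P⁻¹ * Q * C := by
    simp only [map_mul, MulAut.mul_apply, map_inv, tP, tQ, tC, sP]
    group
  calc dr σ * (dl P * dr T) * dr σ * (dl P * dr T)
      = (dr σ * (dl P * dr T)) * (dr σ * (dl P * dr T)) := by simp only [mul_assoc]
    _ = dl (Q * C) * dr (σ * T * σ * T) := by
      rw [h1, e, g1]; congr 2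
      · group
      · simp only [mul_assoc]
    _ = ((dl P * dr T) * dr σ) * ((dl P * dr T) * dr σ) := by
      rw [hST, h2, e, g2]; congr 2
      · group
      · simp only [mul_assoc]
    _ = _ := by simp only [mul_assoc]

lemma twB_core_comm : Commute (dr (twB (m + 3) (m + 2)) : D (m + 3)) (dl (xx (m + 3) (m + 2))) := by
  refine Commute.symm (dl_comm_iff.2 ?_)
  rw [xx, map_mul, map_inv, act_cc_top, act_tw_lo (by omega) le_rfl]; group

lemma dr_dl_comm_cc_zpow {n : ℕ} (b : Br n) (k : ℤ) :
    Commute (dr b : D n) (dl (cc n n ^ k)) := by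
  rw [map_zpow]; exact (dr_dl_comm_cc_top b).zpow_right k

/-- Images of the last generator, when the braid generators map to themselves up to the core. -/
lemma core_solutions {k M : ℤ} {f : Fr (m + 3)}
    (hc : ∀ i, i < m + 1 → Commute (dl f * dr (twB (m + 3) (m + 2) ^ M) : D (m + 3))
      (dr (sg (m + 3) i) * dl (cc (m + 3) (m + 3) ^ k)))
    (h4 : Four (dr (sg (m + 3) (m + 1)) * dl (cc (m + 3) (m + 3) ^ k) : D (m + 3))
      (dl f * dr (twB (m + 3) (m + 2) ^ M))) :
    (M = 0 ∨ M = 1) ∧ ((∃ a : ℤ, f = cc (m + 3) (m + 3) ^ a) ∨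
    (k = 0 ∧ M = 0 ∧ ∃ j : ℤ,
      f = cc (m + 3) (m + 3) ^ j * xx (m + 3) (m + 2) * cc (m + 3) (m + 3) ^ (-j)) ∨
    (k = 0 ∧ M = 1 ∧ ∃ j : ℤ,
      f = cc (m + 3) (m + 3) ^ (j + 1) * (xx (m + 3) (m + 2))⁻¹ * cc (m + 3) (m + 3) ^ (-j))) := by
  have hM : M = 0 ∨ M = 1 := by
    have := h4.map (pr (n := m + 3))
    simp only [map_mul, SemidirectProduct.rightHom_inl, SemidirectProduct.rightHom_inr, one_mul,
      mul_one] at this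
    exact four_tw_zpow this
  refine ⟨hM, ?_⟩
  have hTs : ∀ i, i < m + 1 → Commute (twB (m + 3) (m + 2)) (sg (m + 3) i) := fun i hi =>
    tw_comm (braidRel_sg _) (by omega) (by omega)
  have hfc : ∀ i, i < m + 1 → Commute (dl f : D (m + 3))
      (dr (sg (m + 3) i) * dl (cc (m + 3) (m + 3) ^ k)) := by
    intro i hi
    have h1 : Commute (dr (twB (m + 3) (m + 2) ^ M) : D (m + 3))
        (dr (sg (m + 3) i) * dl (cc (m + 3) (m + 3) ^ k)) :=
      (((hTs i hi).zpow_left M).map dr).mul_right (dr_dl_comm_cc_zpow _ _)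
    have := (hc i hi).mul_left h1.inv_left
    rwa [mul_inv_cancel_right] at this
  have eC : cc (m + 3) (m + 3) = FreeGroup.of ⟨m + 2, by omega⟩ := cc_succ (by omega)
  by_cases hk : k = 0
  · subst hk
    simp only [zpow_zero, map_one, mul_one] at hfc h4
    have hfT : Commute (dl f : D (m + 3)) (dr (twB (m + 3) (m + 2))) := by
      rw [twB, tw_map]
      exact tw_commute fun i hi => hfc i (by omega)
    have hfS : f ∈ FS ({⟨m + 1, by omega⟩, ⟨m + 2, by omega⟩} : Set (Fin (m + 3))) := by
      have h1 := act_tw_twi 1 f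
      rw [Nat.cast_one, pow_one, dl_comm_iff.1 hfT] at h1
      refine FS_mono (fun a ha => ?_) (twi_fixed (by simp) h1)
      obtain ⟨a, ha'⟩ := a
      simp only [Set.mem_compl_iff, Set.mem_ofPred_eq, Set.mem_insert_iff, Fin.mk.injEq,
        Set.mem_singleton_iff] at ha ⊢
      omega
    rcases hM with rfl | rfl
    · simp only [zpow_zero, map_one, mul_one] at h4
      rcases four_solutions hfS h4 with h | h
      · exact Or.inl h
      · exact Or.inr (Or.inl ⟨rfl, rfl, h⟩)
    · rw [zpow_one] at h4 hc
      simp only [zpow_zero, map_one, mul_one] at hc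
      set σ := sg (m + 3) (m + 1) with hσ
      set T := twB (m + 3) (m + 2) with hT
      have hrel : DRel (m + 3) (fun i => (dr (sg (m + 3) i) : D (m + 3))) (dl f * dr T) :=
        { br := (braidRel_sg (m + 3)).map dr
          comm := fun i hi => (hc i (by omega)).symm.eq
          four := fun _ => h4 }
      have lr : ∀ b, D.lift _ _ hrel (dr b) = dr b := by
        intro b
        have : (D.lift _ _ hrel).comp dr = (dr : Br (m + 3) →* D (m + 3)) :=
          Br.hom_ext fun i hi => D.lift_sg hrel hi
        exact DFunLike.congr_fun this b
      have lx : D.lift _ _ hrel (dl (xx (m + 3) (m + 2))) = dl f * dr T :=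
        D.lift_x hrel (by omega)
      have lP : dl (cc (m + 3) (m + 2)) =
          (dl (xx (m + 3) (m + 2)))⁻¹ * dl (cc (m + 3) (m + 3)) := by
        rw [xx, ← map_inv, ← map_mul]; simp
      have hz := zD_central (n := m + 3)
      have ez : dl (cc (m + 3) (m + 3)) * (zD (m + 3))⁻¹ = (dr (twB (m + 3) (m + 3)))⁻¹ := by
        have h1 := (hz (dl (cc (m + 3) (m + 3)))).inv_left.eq
        rw [← h1, zD, mul_inv_rev, mul_assoc, inv_mul_cancel, mul_one]
      have e1 : dl (cc (m + 3) (m + 2)) * dr T * (zD (m + 3))⁻¹ =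
          (dl (xx (m + 3) (m + 2)))⁻¹ * (dr (twB (m + 3) (m + 3)))⁻¹ * dr T := by
        rw [← ez, lP, mul_assoc _ (dr T), ← (hz (dr T)).inv_left.eq]
        simp only [mul_assoc]
      have h5 := ((four_cc_tw (m := m)).mul_of_comm (hz _).inv_left (hz _).inv_left).map
        (D.lift _ _ hrel)
      rw [e1, map_mul, map_mul, map_inv, map_inv, lr, lr, lr, lx] at h5
      have hcT : Commute (dr (twB (m + 3) (m + 3)) : D (m + 3)) (dr T) :=
        Commute.map (twB_central T) dr
      have e2 : (dl f * dr T)⁻¹ * (dr (twB (m + 3) (m + 3)))⁻¹ * dr T =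
          (dl f)⁻¹ * (dr (twB (m + 3) (m + 3)))⁻¹ := by
        rw [hfT.eq, mul_inv_rev, mul_assoc, hcT.inv_left.eq, mul_assoc, inv_mul_cancel_left]
      rw [e2, ← ez, ← mul_assoc] at h5
      have h6 := h5.mul_of_comm (hz _) (hz _)
      rw [inv_mul_cancel_right, ← map_inv, ← map_mul] at h6
      have hcS : cc (m + 3) (m + 3) ∈
          FS ({⟨m + 1, by omega⟩, ⟨m + 2, by omega⟩} : Set (Fin (m + 3))) := by
        rw [eC]; exact of_mem_FS (Or.inr rfl)
      rcases four_solutions (mul_mem (inv_mem hfS) hcS) h6 with ⟨a, h⟩ | ⟨j, h⟩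
      · left
        refine ⟨1 - a, ?_⟩
        rw [inv_mul_eq_iff_eq_mul] at h
        rw [sub_eq_add_neg, zpow_add, zpow_one, zpow_neg, ← mul_inv_eq_iff_eq_mul.2 h]
      · right; right
        refine ⟨rfl, rfl, j, ?_⟩
        rw [inv_mul_eq_iff_eq_mul] at h
        rw [eq_mul_inv_of_mul_eq h.symm]
        generalize cc (m + 3) (m + 3) = c
        generalize xx (m + 3) (m + 2) = x
        group
  · left
    have h1 := hfc 0 (by omega)
    have h2 : dl (cc (m + 3) (m + 3) ^ k * act (m + 3) (sg (m + 3) 0) f) * dr (sg (m + 3) 0) =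
        dl (f * cc (m + 3) (m + 3) ^ k) * dr (sg (m + 3) 0) := by
      have h3 := (dr_dl_comm_cc_zpow (sg (m + 3) 0) k).eq
      have h4 := h1.eq
      rw [h3, ← mul_assoc, mul_assoc _ _ (dl f), dr_dl, ← mul_assoc, ← map_mul, ← map_mul] at h4
      exact h4.symm
    have h3 := SemidirectProduct.inl_injective (mul_right_cancel h2)
    rw [eC] at h3 ⊢
    refine eq_zpow_of_conj_fixed (f := (act (m + 3) (sg (m + 3) 0)).toMonoidHom) ?_ ?_ hk h3
    · rw [← eC]; exact act_cc_top _
    · rintro ⟨a, ha⟩ hab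
      have hab' : a ≠ m + 2 := fun h => hab (by simp [h])
      have hm : ∀ j, j ≤ m + 2 → cc (m + 3) j ∈
          FS ({⟨m + 2, by omega⟩}ᶜ : Set (Fin (m + 3))) := by
        intro j hj
        rcases Nat.eq_zero_or_pos j with rfl | h0
        · rw [cc_zero]; exact one_mem _
        · obtain ⟨j, rfl⟩ : ∃ i, j = i + 1 := ⟨j - 1, by omega⟩
          rw [cc_succ (by omega)]
          refine of_mem_FS ?_
          simp only [Set.mem_compl_iff, Set.mem_singleton_iff, Fin.mk.injEq]; omega
      change act (m + 3) (sg (m + 3) 0) (FreeGroup.of ⟨a, ha⟩) ∈ _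
      rw [← cc_succ ha, act_sg (by omega)]
      split_ifs
      · exact mul_mem (mul_mem (hm _ (by omega)) (inv_mem (hm _ (by omega)))) (hm _ (by omega))
      · exact hm _ (by omega)

end Solutions
end BraidB

namespace BraidB

/-- The braid dragging the last strand around all the others. -/
abbrev dlt (n : ℕ) : D n := dr (dd (sg n) (n - 1))

lemma dlt_comm_cc (n : ℕ) (k : ℤ) : Commute (dlt n) (dl (cc n n ^ k)) := dr_dl_comm_cc_zpow _ _

lemma twB_core_eq (m : ℕ) : (dr (twB (m + 3) (m + 2)) : D (m + 3)) =
    (dlt (m + 3))⁻¹ * dl (cc (m + 3) (m + 3) ^ (-1 : ℤ)) * zD (m + 3) := by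
  have h1 : (dr (twB (m + 3) (m + 2)) : D (m + 3)) =
      (dlt (m + 3))⁻¹ * dr (twB (m + 3) (m + 3)) := by
    rw [eq_inv_mul_iff_mul_eq, ← map_mul]
    congr 1
    rw [show m + 3 - 1 = m + 2 from rfl, dd_eq (braidRel_sg (m + 3)) le_rfl]
    exact inv_mul_cancel_right _ _
  rw [h1, mul_assoc, zD, ← mul_assoc (dl _), ← map_mul, zpow_neg_one, inv_mul_cancel, map_one,
    one_mul]

/-- Endomorphisms of `D n` lying over an endomorphism of standard form of the braid group. -/
theorem endo_form {m : ℕ} {ε q : ℤ} (hε : ε = 1 ∨ ε = -1) (φ : D (m + 3) →* D (m + 3))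
    (H1 : ∀ i, i + 1 < m + 3 →
      pr (φ (dr (sg (m + 3) i))) = sg (m + 3) i ^ ε * twB (m + 3) (m + 3) ^ q)
    (H2 : prm (m + 3) (pr (φ (dl (xx (m + 3) (m + 2))))) = 1) :
    ∃ (y : D (m + 3)) (k r s : ℤ), (∀ i, i + 1 < m + 3 → y * φ (dr (sg (m + 3) i)) * y⁻¹ =
      dr (sg (m + 3) i) ^ ε * dl (cc (m + 3) (m + 3) ^ k) * zD (m + 3) ^ q) ∧
      (y * φ (dl (xx (m + 3) (m + 2))) * y⁻¹ = dl (cc (m + 3) (m + 3) ^ r) * zD (m + 3) ^ s ∨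
      y * φ (dl (xx (m + 3) (m + 2))) * y⁻¹ =
        dlt (m + 3) ^ (-ε) * dl (cc (m + 3) (m + 3) ^ r) * zD (m + 3) ^ s ∨
      k = 0 ∧ (y * φ (dl (xx (m + 3) (m + 2))) * y⁻¹ =
          dl (xx (m + 3) (m + 2)) ^ ε * zD (m + 3) ^ s ∨
        y * φ (dl (xx (m + 3) (m + 2))) * y⁻¹ =
          dlt (m + 3) ^ (-ε) * dl (xx (m + 3) (m + 2)) ^ (-ε) * zD (m + 3) ^ s)) := by
  have hz := zD_central (n := m + 3)
  have hzz : ∀ (k : ℤ) g, Commute (zD (m + 3) ^ k) g := fun k g => (hz g).zpow_left k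
  have hεε : ε * ε = 1 := by rcases hε with rfl | rfl <;> rfl
  have prz : ∀ k : ℤ, pr (zD (m + 3) ^ k) = twB (m + 3) (m + 3) ^ k := by
    intro k; rw [map_zpow, zD, map_mul]; simp
  have htw : ∀ (k : ℤ) g, Commute (twB (m + 3) (m + 3) ^ k) g := fun k g =>
    Commute.zpow_left (twB_central g) k
  have hs0 : BraidRel (m + 3) (fun i => φ (dr (sg (m + 3) i)) ^ ε * zD (m + 3) ^ (-q * ε)) :=
    BraidRel.twist (((braidRel_sg (m + 3)).map dr).map φ) hε (hzz _)
  obtain ⟨v, k, hv⟩ := section_form rfl hs0 (fun i hi => by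
    rw [map_mul, map_zpow, H1 i hi, prz, (htw q _).symm.mul_zpow, ← zpow_mul, ← zpow_mul, hεε,
      zpow_one, mul_assoc, ← zpow_add]
    simp)
  set ψ : D (m + 3) →* D (m + 3) := (MulAut.conj (dl v)).toMonoidHom.comp φ with hψ
  have eψ : ∀ g, ψ g = dl v * φ g * (dl v)⁻¹ := fun g => rfl
  have hS : ∀ i, i + 1 < m + 3 → ψ (dr (sg (m + 3) i)) ^ ε * zD (m + 3) ^ (-q * ε) =
      dr (sg (m + 3) i) * dl (cc (m + 3) (m + 3) ^ k) := by
    intro i hi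
    rw [← hv i hi, eψ, conj_zpow]
    simp only [mul_assoc]
    rw [(hzz _ (dl v)⁻¹).eq]
  have hψs : ∀ i, i + 1 < m + 3 → ψ (dr (sg (m + 3) i)) =
      dr (sg (m + 3) i) ^ ε * dl (cc (m + 3) (m + 3) ^ (k * ε)) * zD (m + 3) ^ q := by
    intro i hi
    have h1 : ψ (dr (sg (m + 3) i)) ^ ε = dr (sg (m + 3) i) * dl (cc (m + 3) (m + 3) ^ k) *
        zD (m + 3) ^ (q * ε) := by
      rw [← hS i hi, mul_assoc, ← zpow_add]; simp
    have h2 := congrArg (· ^ ε) h1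
    simp only [← zpow_mul, hεε, zpow_one] at h2
    rw [h2, (hzz _ _).symm.mul_zpow, (dr_dl_comm_cc_zpow _ _).mul_zpow, ← zpow_mul, mul_assoc q,
      hεε, mul_one, ← map_zpow dl, ← zpow_mul]
  set x : D (m + 3) := dl (xx (m + 3) (m + 2)) with hx
  have hrel := (dRel_D (m + 3)).map ψ
  simp only [show m + 3 - 1 = m + 2 from rfl] at hrel
  rw [← hx] at hrel
  have hcψ : ∀ i, i < m + 1 → Commute (ψ x ^ ε) (dr (sg (m + 3) i) *
      dl (cc (m + 3) (m + 3) ^ k)) := by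
    intro i hi
    rw [← hS i (by omega)]
    have h1 : Commute (ψ x) (ψ (dr (sg (m + 3) i))) := (hrel.comm i (by omega)).symm
    exact (h1.zpow_zpow ε ε).mul_right (hzz _ _).symm
  have h4ψ : Four (dr (sg (m + 3) (m + 1)) * dl (cc (m + 3) (m + 3) ^ k)) (ψ x ^ ε) := by
    rw [← hS (m + 1) (by omega)]
    have h1 : Four (ψ (dr (sg (m + 3) (m + 1)))) (ψ x) := hrel.four (by omega)
    exact ((h1.zpow hε).symm.mul_of_comm (hzz _ _) (hzz _ _)).symm
  have hgp : prm (m + 3) (pr (ψ x ^ ε)) = 1 := by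
    rw [map_zpow, map_zpow, eψ, map_mul pr, map_mul pr, map_inv pr, SemidirectProduct.rightHom_inl,
      inv_one, mul_one, one_mul, H2, one_zpow]
  obtain ⟨j, M, hg⟩ := pure_commute_form (l := m + 2) (by omega) hgp (fun i hi => by
    have := (hcψ i (by omega)).map pr
    rwa [map_mul pr (dr _), SemidirectProduct.rightHom_inl, SemidirectProduct.rightHom_inr,
      mul_one] at this)
  set T := twB (m + 3) (m + 2) with hT
  set H := ψ x ^ ε * zD (m + 3) ^ (-j) with hH
  have hHx : ψ x ^ ε = H * zD (m + 3) ^ j := by rw [hH, mul_assoc, ← zpow_add]; simp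
  obtain ⟨f, hf⟩ : ∃ f, H = dl f * dr (T ^ M) := by
    refine ⟨H.left, ?_⟩
    conv_lhs => rw [D_eq H]
    congr 2
    change pr H = _
    have hg' : pr (ψ x ^ ε) = twB (m + 3) (m + 3) ^ j * T ^ M := hg
    rw [hH, map_mul, prz, hg', mul_assoc, ← (htw _ (T ^ M)).eq, ← mul_assoc, ← zpow_add]
    simp
  have hHψ : ψ x = H ^ ε * zD (m + 3) ^ (j * ε) := by
    have := congrArg (· ^ ε) hHx
    simp only [← zpow_mul, hεε, zpow_one] at this
    rw [this, (hzz _ _).symm.mul_zpow, ← zpow_mul]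
  have hsol := core_solutions (k := k) (M := M) (f := f)
    (fun i hi => by rw [← hf]; exact (hcψ i hi).mul_left (hzz _ _))
    (by rw [← hf]; exact h4ψ.mul_of_comm (hzz _ _) (hzz _ _))
  have hconj : ∀ (a : ℤ) i, i + 1 < m + 3 →
      (dl (cc (m + 3) (m + 3) ^ a) * dl v) * φ (dr (sg (m + 3) i)) *
        (dl (cc (m + 3) (m + 3) ^ a) * dl v)⁻¹ =
      dr (sg (m + 3) i) ^ ε * dl (cc (m + 3) (m + 3) ^ (k * ε)) * zD (m + 3) ^ q := by
    intro a i hi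
    have h1 : Commute (dl (cc (m + 3) (m + 3) ^ a)) (ψ (dr (sg (m + 3) i))) := by
      rw [hψs i hi]
      refine Commute.mul_right (Commute.mul_right ?_ ?_) (hzz _ _).symm
      · exact ((dr_dl_comm_cc_zpow _ _).symm).zpow_right ε
      · exact ((Commute.refl (cc (m + 3) (m + 3))).zpow_zpow a (k * ε)).map dl
    rw [← hψs i hi, mul_inv_rev, ← mul_inv_cancel_right (ψ _) (dl (cc (m + 3) (m + 3) ^ a)), ← h1.eq,
      eψ]
    simp only [mul_assoc]
  have hconjx : ∀ (a : ℤ), (dl (cc (m + 3) (m + 3) ^ a) * dl v) * φ x *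
        (dl (cc (m + 3) (m + 3) ^ a) * dl v)⁻¹ =
      (dl (cc (m + 3) (m + 3) ^ a) * H * (dl (cc (m + 3) (m + 3) ^ a))⁻¹) ^ ε *
        zD (m + 3) ^ (j * ε) := by
    intro a
    rw [conj_zpow, mul_assoc _ _ (zD (m + 3) ^ (j * ε)), ← (hzz _ _).eq, ← mul_assoc,
      mul_assoc _ (H ^ ε), ← hHψ, eψ]
    simp only [mul_assoc, mul_inv_rev]
  set c := cc (m + 3) (m + 3) with hc
  have hcT : ∀ a M : ℤ, Commute (dl (c ^ a)) (dr (T ^ M)) := fun a M =>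
    (dr_dl_comm_cc_zpow _ _).symm
  have hcδ := dlt_comm_cc (m + 3)
  rw [← hc] at hcδ
  have hTδ := twB_core_eq m
  rw [← hT, ← hc] at hTδ
  obtain ⟨hM, ⟨a, hfa⟩ | ⟨hk, rfl, i, hfi⟩ | ⟨hk, rfl, i, hfi⟩⟩ := hsol
  · refine ⟨dl (c ^ (0 : ℤ)) * dl v, k * ε, ?_⟩
    rcases hM with rfl | rfl
    · refine ⟨a * ε, j * ε, hconj 0, Or.inl ?_⟩
      rw [hconjx, hf, hfa]
      simp only [zpow_zero, map_one, mul_one, one_mul, inv_one]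
      rw [← map_zpow, ← zpow_mul]
    · refine ⟨(a - 1) * ε, ε + j * ε, hconj 0, Or.inr (Or.inl ?_)⟩
      rw [hconjx, hf, hfa]
      simp only [zpow_zero, map_one, mul_one, one_mul, inv_one, zpow_one]
      rw [hTδ, ← mul_assoc, ← mul_assoc, ← (hcδ a).inv_left.eq, mul_assoc _ (dl (c ^ a)),
        ← map_mul, ← zpow_add, (hz _).symm.mul_zpow, (hcδ _).inv_left.mul_zpow, inv_zpow',
        mul_assoc _ (zD (m + 3) ^ ε), ← zpow_add, ← map_zpow dl, ← zpow_mul, sub_eq_add_neg]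
  · refine ⟨dl (c ^ (-i)) * dl v, k * ε, 0, j * ε, hconj (-i), Or.inr (Or.inr ⟨by simp [hk], ?_⟩)⟩
    left
    rw [hconjx, hf, hfi]
    congr 2
    rw [zpow_zero, map_one, mul_one, ← map_inv, ← map_mul, ← map_mul, hx]
    congr 1
    group
  · have hxT : Commute (dr T) x := twB_core_comm
    have hcH : ∀ a : ℤ, dl (c ^ a) * H * (dl (c ^ a))⁻¹ = dl (c ^ a * f * c ^ (-a)) * dr T := by
      intro a
      have := hcT (-a) 1
      rw [zpow_one] at this
      rw [hf, zpow_one, ← map_inv, ← zpow_neg, mul_assoc, mul_assoc, ← this.eq, ← mul_assoc,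
        ← mul_assoc, ← map_mul, ← map_mul]
    have key : dl (c ^ (-i)) * H * (dl (c ^ (-i)))⁻¹ = (dlt (m + 3))⁻¹ * x⁻¹ * zD (m + 3) := by
      rw [hcH, hfi, show c ^ (-i) * (c ^ (i + 1) * (xx (m + 3) (m + 2))⁻¹ * c ^ (-i)) * c ^ (- -i) =
        c ^ (1 : ℤ) * (xx (m + 3) (m + 2))⁻¹ by group, map_mul, map_inv dl (xx _ _), ← hx, mul_assoc,
        ← hxT.inv_right.eq, hTδ, ← mul_assoc, ← mul_assoc, ← mul_assoc, ← (hcδ _).inv_left.eq,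
        mul_assoc _ (dl (c ^ (1 : ℤ))), ← map_mul, ← zpow_add, mul_assoc, (hz _).eq]
      simp [mul_assoc]
    rcases hε with rfl | rfl
    · refine ⟨dl (c ^ (-i)) * dl v, k * 1, 0, 1 + j * 1, hconj (-i),
        Or.inr (Or.inr ⟨by simp [hk], Or.inr ?_⟩)⟩
      rw [hconjx, key, zpow_one, zpow_add, zpow_one, zpow_neg_one, zpow_neg_one, mul_assoc]
    · refine ⟨dl (c ^ (-i - 1)) * dl v, k * (-1), 0, -1 + j * (-1), hconj _,
        Or.inr (Or.inr ⟨by simp [hk], Or.inr ?_⟩)⟩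
      have key2 : dl (c ^ (-i - 1)) * H * (dl (c ^ (-i - 1)))⁻¹ =
          x⁻¹ * (dlt (m + 3))⁻¹ * zD (m + 3) := by
        rw [hcH, hfi, show c ^ (-i - 1) * (c ^ (i + 1) * (xx (m + 3) (m + 2))⁻¹ * c ^ (-i)) *
          c ^ (-(-i - 1)) = (xx (m + 3) (m + 2))⁻¹ * c ^ (1 : ℤ) by group, map_mul,
          map_inv dl (xx _ _), ← hx, hTδ, ← mul_assoc, ← mul_assoc, mul_assoc x⁻¹,
          ← (hcδ _).inv_left.eq, ← mul_assoc, mul_assoc _ (dl (c ^ (1 : ℤ))), ← map_mul,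
          ← zpow_add]
        simp
      rw [hconjx, key2, zpow_add, zpow_neg_one, mul_inv_rev, mul_inv_rev, inv_inv, inv_inv, neg_neg,
        zpow_one, zpow_one, (hz _).inv_left.eq, zpow_neg_one]
      simp only [mul_assoc]

end BraidB

namespace BraidB

section Crossing

/-- The indicator of an unordered pair. -/
def pairInd (i j : ℕ) : ℕ × ℕ → Multiplicative ℤ := fun p =>
  Multiplicative.ofAdd (if p = (i, j) ∨ p = (j, i) then 1 else 0)

/-- The group recording crossings of pairs of strands. -/
abbrev CrossGp : Type := (ℕ × ℕ → Multiplicative ℤ) ⋊[mulAutArrow] Equiv.Perm ℕ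

lemma perm_pairInd (g : Equiv.Perm ℕ) (i j : ℕ) :
    (mulAutArrow : Equiv.Perm ℕ →* MulAut (ℕ × ℕ → Multiplicative ℤ)) g (pairInd i j) =
      pairInd (g i) (g j) := by
  funext p
  change pairInd i j (g⁻¹ • p) = _
  obtain ⟨a, b⟩ := p
  simp only [pairInd, Prod.smul_mk, Equiv.Perm.smul_def, Prod.mk.injEq, Equiv.Perm.inv_eq_iff_eq]

lemma braidRel_cross (n : ℕ) :
    BraidRel n (fun i => (⟨pairInd i (i + 1), Equiv.swap i (i + 1)⟩ : CrossGp)) where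
  comm i j h1 h2 := by
    refine SemidirectProduct.ext ?_ ((braidRel_swap n).comm i j h1 h2)
    simp only [SemidirectProduct.mul_left, perm_pairInd]
    rw [swap_succ_of_ne (i := i) (by omega) (by omega), swap_succ_of_ne (i := i) (by omega) (by omega),
      swap_succ_of_ne (i := j) (by omega) (by omega), swap_succ_of_ne (i := j) (by omega) (by omega),
      mul_comm]
  braid i h := by
    refine SemidirectProduct.ext ?_ ((braidRel_swap n).braid i h)
    simp only [SemidirectProduct.mul_left, SemidirectProduct.mul_right, perm_pairInd,
      Equiv.Perm.mul_apply]
    simp only [Equiv.swap_apply_left, Equiv.swap_apply_right,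
      swap_succ_of_ne (i := i) (j := i + 1 + 1) (by omega) (by omega),
      swap_succ_of_ne (i := i + 1) (j := i) (by omega) (by omega)]
    rw [mul_assoc, mul_comm, mul_comm (pairInd i (i + 1 + 1))]

/-- Crossings of a braid, together with its permutation. -/
def crossW (n : ℕ) : Br n →* CrossGp := Br.lift _ (braidRel_cross n)

lemma crossW_right {n : ℕ} (g : Br n) : (crossW n g).right = prm n g := by
  have : (SemidirectProduct.rightHom).comp (crossW n) = prm n :=
    Br.hom_ext fun i hi => by
      rw [MonoidHom.comp_apply, crossW, Br.lift_sg _ _ hi, prm_sg hi]; rfl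
  exact DFunLike.congr_fun this g

/-- The signed number of crossings of the strands ending at two points. -/
def cr {n : ℕ} (g : Br n) (a b : ℕ) : ℤ := Multiplicative.toAdd ((crossW n g).left (a, b))

variable {n : ℕ}

lemma cr_sg {i : ℕ} (hi : i + 1 < n) (a b : ℕ) :
    cr (sg n i) a b = if (a = i ∧ b = i + 1) ∨ (a = i + 1 ∧ b = i) then 1 else 0 := by
  rw [cr, crossW, Br.lift_sg _ _ hi]
  simp only [pairInd, toAdd_ofAdd, Prod.mk.injEq]

lemma cr_mul (g h : Br n) (a b : ℕ) :
    cr (g * h) a b = cr g a b + cr h ((prm n g)⁻¹ a) ((prm n g)⁻¹ b) := by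
  rw [cr, map_mul, SemidirectProduct.mul_left, crossW_right]
  rfl

@[simp] lemma cr_one (a b : ℕ) : cr (1 : Br n) a b = 0 := by simp [cr]

lemma cr_mul_pure {g : Br n} (hg : prm n g = 1) (h : Br n) (a b : ℕ) :
    cr (g * h) a b = cr g a b + cr h a b := by
  rw [cr_mul, hg]; simp

/-- Crossings define a homomorphism on pure braids. -/
lemma cr_zpow_pure {g : Br n} (hg : prm n g = 1) (k : ℤ) (a b : ℕ) :
    cr (g ^ k) a b = k * cr g a b := by
  have hk : ∀ k : ℤ, prm n (g ^ k) = 1 := fun k => by rw [map_zpow, hg, one_zpow]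
  induction k with
  | zero => simp
  | succ k ih =>
    rw [zpow_add, zpow_one, cr_mul_pure (hk _), ih]; ring
  | pred k ih =>
    have : cr (g ^ (-(k : ℤ) - 1)) a b + cr g a b = cr (g ^ (-(k : ℤ))) a b := by
      rw [← cr_mul_pure (hk _), ← zpow_add_one]; simp
    rw [ih] at this
    linarith

lemma cr_conj {p : Br n} (hp : prm n p = 1) (g : Br n) (a b : ℕ) :
    cr (g * p * g⁻¹) (prm n g a) (prm n g b) = cr p a b := by
  have h1 : prm n (g * p * g⁻¹) = 1 := by simp [hp]
  have h2 := cr_mul_pure h1 g (prm n g a) (prm n g b)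
  rw [inv_mul_cancel_right, cr_mul] at h2
  simp only [← Equiv.Perm.mul_apply, inv_mul_cancel, Equiv.Perm.one_apply] at h2
  linarith

lemma prm_dd {k : ℕ} (hk : k < n) : prm n (dd (sg n) k) = 1 := by
  induction k with
  | zero => simp
  | succ k ih =>
    rw [dd_succ, map_mul, map_mul, ih (by omega), prm_sg hk, mul_one, Equiv.swap_mul_self]

lemma cr_dd {k : ℕ} (hk : k < n) (a b : ℕ) :
    cr (dd (sg n) k) a b = if (a < k ∧ b = k) ∨ (b < k ∧ a = k) then 2 else 0 := by
  induction k generalizing a b with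
  | zero => simp
  | succ k ih =>
    rw [dd_succ, cr_mul, map_mul, prm_dd (by omega), mul_one, cr_mul, cr_sg hk, cr_sg hk, prm_sg hk,
      Equiv.swap_inv, ih (by omega)]
    by_cases a1 : a = k <;> by_cases a2 : a = k + 1 <;> by_cases b1 : b = k <;>
      by_cases b2 : b = k + 1 <;>
      simp [a1, a2, b1, b2, swap_succ_of_ne] <;> omega

lemma prm_twB {k : ℕ} (hk : k ≤ n) : prm n (twB n k) = 1 := by
  induction k with
  | zero => simp [twB]
  | succ k ih =>
    rw [twB, tw_succ (braidRel_sg n) hk, map_mul, prm_dd (by omega), one_mul]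
    exact ih (by omega)

lemma cr_twB {k : ℕ} (hk : k ≤ n) (a b : ℕ) :
    cr (twB n k) a b = if a < k ∧ b < k ∧ a ≠ b then 2 else 0 := by
  induction k with
  | zero => simp [twB]
  | succ k ih =>
    have := ih (by omega)
    rw [twB] at this
    rw [twB, tw_succ (braidRel_sg n) hk, cr_mul_pure (prm_dd (by omega)), cr_dd (by omega), this]
    split_ifs <;> omega

lemma prm_sg_sq {i : ℕ} : prm n (sg n i ^ 2) = 1 := by
  by_cases hi : i + 1 < n
  · rw [map_pow, prm_sg hi, pow_two, Equiv.swap_mul_self]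
  · rw [sg_eq_one (by omega)]; simp

lemma cr_sg_sq {i : ℕ} (hi : i + 1 < n) (a b : ℕ) :
    cr (sg n i ^ 2) a b = if (a = i ∧ b = i + 1) ∨ (a = i + 1 ∧ b = i) then 2 else 0 := by
  rw [pow_two, cr_mul, cr_sg hi, cr_sg hi, prm_sg hi, Equiv.swap_inv]
  by_cases a1 : a = i <;> by_cases a2 : a = i + 1 <;> by_cases b1 : b = i <;>
      by_cases b2 : b = i + 1 <;>
      simp [a1, a2, b1, b2, swap_succ_of_ne]

lemma prm_ew_apply {k i : ℕ} (hk : k < n) (hi : i < k) : prm n (ew (sg n) k) i = i + 1 := by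
  induction k with
  | zero => omega
  | succ k ih =>
    rw [ew_succ, map_mul, Equiv.Perm.mul_apply, prm_sg hk]
    rcases Nat.lt_or_ge i k with h | h
    · rw [swap_succ_of_ne (by omega) (by omega), ih (by omega) h]
    · obtain rfl : i = k := by omega
      rw [Equiv.swap_apply_left]
      clear ih hi
      have : ∀ j, j ≤ i → prm n (ew (sg n) j) (i + 1) = i + 1 := by
        intro j hj
        induction j with
        | zero => simp
        | succ j ih => rw [ew_succ, map_mul, Equiv.Perm.mul_apply, prm_sg (by omega),
            swap_succ_of_ne (by omega) (by omega), ih (by omega)]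
      exact this i le_rfl

lemma prm_ew_top {k : ℕ} (hk : k < n) : prm n (ew (sg n) k) k = 0 := by
  induction k with
  | zero => simp
  | succ k ih =>
    rw [ew_succ, map_mul, Equiv.Perm.mul_apply, prm_sg hk, Equiv.swap_apply_right, ih (by omega)]

lemma prm_ew_pow {k i j : ℕ} (hk : k < n) (hi : i + j ≤ k) :
    prm n (ew (sg n) k ^ j) i = i + j := by
  induction j with
  | zero => simp
  | succ j ih =>
    rw [pow_succ', map_mul, Equiv.Perm.mul_apply, ih (by omega), prm_ew_apply hk (by omega)]
    rfl

end Crossing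
end BraidB

namespace BraidB

/-- Endomorphisms of the braid group of standard form. -/
def StdEnd (n : ℕ) (s : ℕ → Br n) : Prop :=
  ∃ (y : Br n) (ε q : ℤ), (ε = 1 ∨ ε = -1) ∧
    ∀ i, i + 1 < n → s i = y * (sg n i ^ ε * twB n n ^ q) * y⁻¹

lemma perm_eq_of_conj_swap {n : ℕ} (hn : 3 ≤ n) {p : Equiv.Perm ℕ}
    (h : ∀ i, i + 1 < n → p * Equiv.swap i (i + 1) * p⁻¹ = Equiv.swap i (i + 1)) {j : ℕ}
    (hj : j < n) : p j = j := by
  have h1 : ∀ i, i + 1 < n → (p i = i ∨ p i = i + 1) ∧ (p (i + 1) = i ∨ p (i + 1) = i + 1) := by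
    intro i hi
    have h2 := h i hi
    rw [← Equiv.swap_apply_apply] at h2
    have h3 := DFunLike.congr_fun h2 (p i)
    have h4 := DFunLike.congr_fun h2 (p (i + 1))
    rw [Equiv.swap_apply_left] at h3
    rw [Equiv.swap_apply_right] at h4
    have h5 : p i ≠ p (i + 1) := fun h => by have := p.injective h; omega
    constructor
    · by_contra! hc
      rw [swap_succ_of_ne hc.1 hc.2] at h3
      exact h5 h3.symm
    · by_contra! hc
      rw [swap_succ_of_ne hc.1 hc.2] at h4
      exact h5 h4
  have hin : ∀ i i', p i = p i' → i = i' := fun i i' h => p.injective h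
  rcases Nat.eq_zero_or_pos j with rfl | h0
  · have a := h1 0 (by omega)
    have b := h1 1 (by omega)
    have := hin 0 1
    simp only [zero_add] at a b
    omega
  · obtain ⟨i, rfl⟩ : ∃ i, j = i + 1 := ⟨j - 1, by omega⟩
    have a := h1 i hj
    by_cases h2 : i + 2 < n
    · have b := h1 (i + 1) h2
      omega
    · obtain ⟨l, rfl⟩ : ∃ l, i = l + 1 := ⟨i - 1, by omega⟩
      have b := h1 l (by omega)
      have := hin (l + 1) (l + 1 + 1)
      omega

/-- A permutation preserving endomorphism which is of standard form on all but the last strand is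
of standard form. -/
theorem stdEnd_succ {m : ℕ} (θ : Br (m + 3 + 1) →* Br (m + 3 + 1))
    (hp : ∀ i, i + 1 < m + 3 + 1 → prm (m + 3 + 1) (θ (sg (m + 3 + 1) i)) = Equiv.swap i (i + 1))
    (h : StdEnd (m + 3) (fun i => pr (kap (m + 3) (m + 3) (θ (sg (m + 3 + 1) i))))) :
    StdEnd (m + 3 + 1) (fun i => θ (sg (m + 3 + 1) i)) := by
  have hpθ : ∀ g, prm (m + 3 + 1) (θ g) = prm (m + 3 + 1) g := by
    have : (prm (m + 3 + 1)).comp θ = prm (m + 3 + 1) :=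
      Br.hom_ext fun i hi => by rw [MonoidHom.comp_apply, hp i hi, prm_sg hi]
    exact fun g => DFunLike.congr_fun this g
  have htop : ∀ d, prm (m + 3 + 1) (θ (iota (m + 3) d)) (m + 3) = m + 3 := fun d => by
    rw [hpθ]; exact prm_iota_top d
  obtain ⟨y, ε, q, hε, hy⟩ := h
  let φ : D (m + 3) →* D (m + 3) := MonoidHom.mk' (fun d => (dr y)⁻¹ *
    kap (m + 3) (m + 3) (θ (iota (m + 3) d)) * dr y) fun a b => by
      rw [map_mul, map_mul, kap_mul_top (htop a)]; simp only [mul_assoc, mul_inv_cancel_left]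
  have hφ : ∀ d, φ d = (dr y)⁻¹ * kap (m + 3) (m + 3) (θ (iota (m + 3) d)) * dr y := fun d => rfl
  have hιφ : ∀ d, iota (m + 3) (φ d) =
      (iota (m + 3) (dr y))⁻¹ * θ (iota (m + 3) d) * iota (m + 3) (dr y) := fun d => by
    rw [hφ, map_mul, map_mul, iota_kap (htop d), map_inv]
  obtain ⟨y', k, r, s, h1, h2⟩ := endo_form (m := m) (q := q) hε φ (fun i hi => by
    rw [hφ, map_mul, map_mul, map_inv, SemidirectProduct.rightHom_inr, iota_sg hi]
    rw [show pr (kap (m + 3) (m + 3) (θ (sg (m + 3 + 1) i))) = _ from hy i hi]; group) (by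
    rw [← prm_iota, hιφ, map_mul, map_mul, map_inv]
    have : prm (m + 3 + 1) (θ (iota (m + 3) (dl (xx (m + 3) (m + 2))))) = 1 := by
      rw [hpθ, prm_iota]; simp
    rw [this]; group)
  set w := iota (m + 3) (y' * (dr y)⁻¹) with hw
  obtain ⟨θ', hθ'⟩ : ∃ θ' : Br (m + 3 + 1) →* Br (m + 3 + 1), ∀ g, θ' g = w * θ g * w⁻¹ :=
    ⟨(MulAut.conj w).toMonoidHom.comp θ, fun _ => rfl⟩
  have hιθ : ∀ d, θ' (iota (m + 3) d) = iota (m + 3) (y' * φ d * y'⁻¹) := by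
    intro d
    rw [hθ', map_mul, map_mul, hιφ, hw, map_mul, map_inv, map_inv]
    group
  have hcen := zD_central (n := m + 3)
  have hprz : prm (m + 3) (pr (zD (m + 3) ^ q)) = 1 := by
    rw [map_zpow, map_zpow, zD, map_mul]
    simp only [SemidirectProduct.rightHom_inl, SemidirectProduct.rightHom_inr, one_mul]
    rw [prm_twB le_rfl, one_zpow]
  have hsw : ∀ i, Equiv.swap i (i + 1) ^ ε = Equiv.swap i (i + 1) := by
    intro i; rcases hε with rfl | rfl <;> simp
  have hpw : prm (m + 3 + 1) w = 1 := by
    have h3 : ∀ j < m + 3, prm (m + 3 + 1) w j = j := fun j hj => by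
      refine perm_eq_of_conj_swap (n := m + 3) (by omega) (fun i hi => ?_) hj
      have h4 := congrArg (prm (m + 3 + 1)) (hιθ (dr (sg (m + 3) i)))
      rw [hθ', map_mul, map_mul, map_inv, hpθ, iota_sg hi, prm_sg (n := m + 3 + 1) (by omega)] at h4
      rw [h4, h1 i hi, prm_iota, map_mul pr, map_mul pr, map_mul (prm _), hprz, map_mul (prm _),
        SemidirectProduct.rightHom_inl, map_zpow, map_zpow, SemidirectProduct.rightHom_inr,
        prm_sg hi, hsw]
      simp
    ext j
    rcases Nat.lt_or_ge j (m + 3) with hj | hj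
    · exact h3 j hj
    · rcases Nat.eq_or_lt_of_le hj with rfl | hj
      · exact prm_iota_top _
      · exact prm_of_le _ (by omega)
  have hpθ' : ∀ g, prm (m + 3 + 1) (θ' g) = prm (m + 3 + 1) g := by
    intro g; rw [hθ', map_mul, map_mul, map_inv, hpw, hpθ]; simp
  -- crossing numbers of the images of the two outermost squared generators
  set S := θ' (sg (m + 3 + 1) 0 ^ 2) with hS
  set X := θ' (sg (m + 3 + 1) (m + 2) ^ 2) with hX
  have hSp : prm (m + 3 + 1) S = 1 := by rw [hS, hpθ']; exact prm_sg_sq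
  set g := ew (sg (m + 3 + 1)) (m + 3) ^ (m + 2) with hg
  have hgσ : g * sg (m + 3 + 1) 0 ^ 2 * g⁻¹ = sg (m + 3 + 1) (m + 2) ^ 2 := by
    have := ew_shift_pow (braidRel_sg (m + 3 + 1)) (k := m + 3) (i := 0) (j := m + 2) (by omega) (by omega)
    rw [← conj_pow, this, zero_add, mul_inv_cancel_right]
  have hcross : ∀ a b, cr X (prm (m + 3 + 1) g a) (prm (m + 3 + 1) g b) = cr S a b := by
    intro a b
    have := cr_conj hSp (θ' g) a b
    rwa [hpθ', hS, ← map_inv, ← map_mul, ← map_mul, hgσ] at this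
  have g0 : prm (m + 3 + 1) g 0 = m + 2 := by
    rw [hg, prm_ew_pow (by omega) (by omega)]; omega
  have g1 : prm (m + 3 + 1) g 1 = m + 3 := by
    rw [hg, prm_ew_pow (by omega) (by omega)]; omega
  have g2 : prm (m + 3 + 1) g 2 = 0 := by
    rw [hg, pow_succ', map_mul, Equiv.Perm.mul_apply, prm_ew_pow (by omega) (by omega),
      show 2 + (m + 1) = m + 3 by omega, prm_ew_top (by omega)]
  have hX1 := hcross 0 1
  have hX2 := hcross 2 1
  have hX3 := hcross 2 0
  rw [g0, g1] at hX1
  rw [g2, g1] at hX2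
  rw [g2, g0] at hX3
  set c : Br (m + 3 + 1) := dd (sg (m + 3 + 1)) (m + 3) with hc
  set z : Br (m + 3 + 1) := twB (m + 3 + 1) (m + 3 + 1) with hz
  have hιc : ∀ k : ℤ, iota (m + 3) (dl (cc (m + 3) (m + 3) ^ k)) = c ^ k := fun k => by
    rw [map_zpow, map_zpow, iota_cc_top]
  have hιz : ∀ k : ℤ, iota (m + 3) (zD (m + 3) ^ k) = z ^ k := fun k => by
    rw [map_zpow, iota_zD]
  have hzc : ∀ (k : ℤ) (g : Br (m + 3 + 1)), Commute (z ^ k) g := fun k g =>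
    Commute.zpow_left (twB_central g) k
  have hpc : prm (m + 3 + 1) c = 1 := prm_dd (by omega)
  have hpz : prm (m + 3 + 1) z = 1 := prm_twB le_rfl
  have hpck : ∀ k : ℤ, prm (m + 3 + 1) (c ^ k) = 1 := fun k => by rw [map_zpow, hpc, one_zpow]
  have hpzk : ∀ k : ℤ, prm (m + 3 + 1) (z ^ k) = 1 := fun k => by rw [map_zpow, hpz, one_zpow]
  have hθσ : ∀ i, i + 1 < m + 3 → θ' (sg (m + 3 + 1) i) = sg (m + 3 + 1) i ^ ε * c ^ k * z ^ q := by
    intro i hi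
    rw [← iota_sg hi, hιθ, h1 i hi, map_mul, map_mul, map_zpow, hιc, hιz]
  have hSS : ∀ a b, cr S a b = ε * cr (sg (m + 3 + 1) 0 ^ 2) a b + 2 * k * cr c a b + 2 * q * cr z a b := by
    intro a b
    have e1 : Commute (sg (m + 3 + 1) 0) c := by
      have := (dr_dl_comm_cc_zpow (sg (m + 3) 0) 1).map (iota (m + 3))
      rwa [hιc, iota_sg (by omega), zpow_one] at this
    have e2 : S = (sg (m + 3 + 1) 0 ^ 2) ^ ε * (c ^ (2 * k) * z ^ (2 * q)) := by
      rw [hS, map_pow, hθσ 0 (by omega), (hzc _ _).symm.mul_pow, (e1.zpow_zpow ε k).mul_pow]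
      simp only [← zpow_natCast, ← zpow_mul, mul_assoc]
      push_cast
      rw [mul_comm (2 : ℤ) k, mul_comm (2 : ℤ) q, mul_comm (2 : ℤ) ε]
    rw [e2, cr_mul_pure (by rw [map_zpow, prm_sg_sq, one_zpow]), cr_mul_pure (hpck _),
      cr_zpow_pure prm_sg_sq, cr_zpow_pure hpc, cr_zpow_pure hpz]
    ring
  rw [hSS, cr_sg_sq (by omega), cr_dd (by omega), hz, cr_twB le_rfl] at hX1 hX2 hX3
  have hιX : X = iota (m + 3) (y' * φ (dl (xx (m + 3) (m + 2))) * y'⁻¹) := by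
    rw [← hιθ, hX]; congr 1; exact (iota_x (n := m + 3) (by omega)).symm
  have hιx : iota (m + 3) (dl (xx (m + 3) (m + 2))) = sg (m + 3 + 1) (m + 2) ^ 2 :=
    iota_x (n := m + 3) (by omega)
  set d : Br (m + 3 + 1) := dd (sg (m + 3 + 1)) (m + 2) with hd
  have hιd : iota (m + 3) (dlt (m + 3)) = d := by
    rw [dlt, dd_map, dd_map]
    exact dd_congr fun i hi => iota_sg (by omega)
  have hpd : prm (m + 3 + 1) d = 1 := prm_dd (by omega)
  have hpdk : ∀ k : ℤ, prm (m + 3 + 1) (d ^ k) = 1 := fun k => by rw [map_zpow, hpd, one_zpow]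
  have hε0 : ε ≠ 0 := by rcases hε with rfl | rfl <;> decide
  obtain ⟨hk, hXx, hs⟩ : k = 0 ∧ X = (sg (m + 3 + 1) (m + 2) ^ 2) ^ ε * z ^ s ∧ s = 2 * q := by
    rcases h2 with h2 | h2 | ⟨hk, h2 | h2⟩
    · exfalso
      rw [h2, map_mul, hιc, hιz] at hιX
      rw [hιX, cr_mul_pure (hpck _), cr_zpow_pure hpc, cr_zpow_pure hpz, cr_dd (by omega), hz,
        cr_twB le_rfl] at hX1 hX2
      simp at hX1 hX2
      rcases hε with rfl | rfl <;> omega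
    · exfalso
      rw [h2, map_mul, map_mul, hιc, hιz, map_zpow, hιd] at hιX
      rw [hιX, mul_assoc, cr_mul_pure (hpdk _), cr_mul_pure (hpck _), cr_zpow_pure hpc,
        cr_zpow_pure hpz, cr_zpow_pure hpd, cr_dd (by omega), cr_dd (by omega), hz,
        cr_twB le_rfl] at hX1 hX2
      simp at hX1 hX2
      rcases hε with rfl | rfl <;> omega
    · rw [h2, map_mul, map_zpow, hιz, hιx] at hιX
      refine ⟨hk, hιX, ?_⟩
      rw [hιX, cr_mul_pure (by rw [map_zpow, prm_sg_sq, one_zpow]), cr_zpow_pure prm_sg_sq,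
        cr_zpow_pure hpz, cr_sg_sq (by omega), hz, cr_twB le_rfl] at hX2
      simp at hX2
      rcases hε with rfl | rfl <;> omega
    · exfalso
      rw [h2, map_mul, map_mul, map_zpow, map_zpow, hιz, hιx, hιd] at hιX
      rw [hιX, mul_assoc, cr_mul_pure (hpdk _),
        cr_mul_pure (by rw [map_zpow, prm_sg_sq, one_zpow]), cr_zpow_pure prm_sg_sq,
        cr_zpow_pure hpz, cr_zpow_pure hpd, cr_sg_sq (by omega), cr_dd (by omega), hz,
        cr_twB le_rfl] at hX2 hX3
      simp at hX2 hX3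
      rcases hε with rfl | rfl <;> omega
  let θ0 : Br (m + 3 + 1) →* Br (m + 3 + 1) := Br.lift _
    ((braidRel_sg (m + 3 + 1)).twist hε (z := z ^ q) (hzc q))
  have hθ0 : ∀ i, i + 1 < m + 3 + 1 → θ0 (sg (m + 3 + 1) i) = sg (m + 3 + 1) i ^ ε * z ^ q :=
    fun i hi => Br.lift_sg _ _ hi
  have hcomp : θ'.comp (iota (m + 3)) = θ0.comp (iota (m + 3)) := by
    refine D.hom_ext (fun i hi => ?_) ?_
    · rw [MonoidHom.comp_apply, MonoidHom.comp_apply, iota_sg hi, hθσ i hi, hθ0 i (by omega), hk,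
        zpow_zero, mul_one]
    · rw [MonoidHom.comp_apply, MonoidHom.comp_apply, show m + 3 - 1 = m + 2 from rfl, hιx, ← hX,
        hXx, hs, map_pow, hθ0 (m + 2) (by omega), (hzc _ _).symm.mul_pow]
      simp only [← zpow_natCast, ← zpow_mul]
      push_cast
      rw [mul_comm (2 : ℤ) q, mul_comm (2 : ℤ) ε]
  have hpure : ∀ p, prm (m + 3 + 1) p = 1 → θ' p = θ0 p := fun p hp1 => by
    have hpt : prm (m + 3 + 1) p (m + 3) = m + 3 := by rw [hp1]; rfl
    rw [← iota_kap hpt]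
    exact DFunLike.congr_fun hcomp _
  have hsurj : ∀ b : Br (m + 3 + 1), ∃ b' j, prm (m + 3 + 1) b' = prm (m + 3 + 1) b ∧
      θ0 b' = b * z ^ (j : ℤ) := by
    intro b
    induction b using Br.induction with
    | h1 => exact ⟨1, 0, rfl, by simp⟩
    | hs i hi =>
      refine ⟨sg (m + 3 + 1) i ^ ε, q * ε, by rw [map_zpow, prm_sg hi, hsw], ?_⟩
      rw [map_zpow, hθ0 i hi, (hzc q _).symm.mul_zpow, ← zpow_mul, ← zpow_mul,
        show ε * ε = 1 by rcases hε with rfl | rfl <;> rfl, zpow_one]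
    | hm a b ha hb =>
      obtain ⟨a', i, ha1, ha2⟩ := ha
      obtain ⟨b', j, hb1, hb2⟩ := hb
      refine ⟨a' * b', i + j, by rw [map_mul, map_mul, ha1, hb1], ?_⟩
      rw [map_mul, ha2, hb2, mul_assoc, ← mul_assoc (z ^ i), (hzc i b).eq, zpow_add]
      simp only [mul_assoc]
    | hi a ha =>
      obtain ⟨a', i, ha1, ha2⟩ := ha
      refine ⟨a'⁻¹, -i, by rw [map_inv, map_inv, ha1], ?_⟩
      rw [map_inv, ha2, mul_inv_rev, ← zpow_neg, (hzc (-i) _).eq]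
  set σ := sg (m + 3 + 1) (m + 2) with hσ
  have hσp : prm (m + 3 + 1) (θ0 σ) = prm (m + 3 + 1) σ := by
    rw [hθ0 _ (by omega), map_mul, hpzk, map_zpow, prm_sg (by omega), hsw, mul_one]
  obtain ⟨j, hj⟩ := pure_centralizer (g := (θ' σ)⁻¹ * θ0 σ) (by
      rw [map_mul, map_inv, hpθ', hσp, inv_mul_cancel]) (by
    intro b hb
    obtain ⟨b', j, hb1, hb2⟩ := hsurj b
    have hb3 : prm (m + 3 + 1) b' = 1 := hb1.trans hb
    have e1 := hpure _ hb3
    have e2 := hpure (σ * b' * σ⁻¹) (by rw [map_mul, map_mul, hb3, map_inv]; group)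
    rw [map_mul, map_mul, map_mul, map_mul, map_inv, map_inv, e1] at e2
    have e3 : Commute ((θ' σ)⁻¹ * θ0 σ) (θ0 b') := by
      refine mul_right_cancel (b := (θ0 σ)⁻¹) ?_
      calc _ = (θ' σ)⁻¹ * (θ0 σ * θ0 b' * (θ0 σ)⁻¹) := by group
        _ = _ := by rw [← e2]; group
    rw [show b = θ0 b' * z ^ (-j) by rw [hb2, mul_assoc, ← zpow_add]; simp]
    exact e3.mul_right (hzc _ _).symm)
  have hdeg : dgB (θ' σ) = dgB (θ0 σ) := by
    have hc1 := ew_shift_pow (braidRel_sg (m + 3 + 1)) (k := m + 3) (i := 0) (j := m + 2)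
      (by omega) (by omega)
    rw [← hg, zero_add, ← hσ] at hc1
    have hc2 := congrArg (fun t => dgB (θ' t)) hc1
    simp only [map_mul, dgB_mul] at hc2
    rw [hθσ 0 (by omega), hk] at hc2
    rw [hθ0 _ (by omega)]
    simp only [dgB_mul, dgB_zpow, dgB_sg (n := m + 3 + 1) (i := 0) (by omega), hσ,
      dgB_sg (n := m + 3 + 1) (i := m + 2) (by omega), zpow_zero, mul_one] at hc2 ⊢
    linarith
  have hj0 : j = 0 := by
    have := congrArg dgB hj
    rw [dgB_mul, dgB_inv, hdeg, dgB_zpow, dgB_tw le_rfl, neg_add_cancel] at this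
    push_cast at this
    rcases mul_eq_zero.1 this.symm with h | h
    · exact h
    · exfalso
      have : (0 : ℤ) < (m + 3 + 1) * (m + 3) := by positivity
      rw [add_sub_cancel_right] at h
      linarith
  rw [hj0, zpow_zero, inv_mul_eq_one] at hj
  refine ⟨w⁻¹, ε, q, hε, fun i hi => ?_⟩
  have : θ' (sg (m + 3 + 1) i) = sg (m + 3 + 1) i ^ ε * z ^ q := by
    rcases Nat.lt_or_ge (i + 1) (m + 3) with hi' | hi'
    · rw [hθσ i hi', hk, zpow_zero, mul_one]
    · obtain rfl : i = m + 2 := by omega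
      rw [← hσ, hj, hθ0 _ (by omega)]
  show θ (sg (m + 3 + 1) i) = _
  rw [← this, hθ']
  group

end BraidB

namespace BraidB

section Torus

local notation "F₂" => FreeGroup (Fin 2)

/-- The first free generator of the free group of rank two. -/
abbrev xT : F₂ := FreeGroup.of 0
/-- The second free generator of the free group of rank two. -/
abbrev qT : F₂ := FreeGroup.of 1

/-- Translation of the letters of the free group on the planar lattice. -/
def trV : Multiplicative (ℤ × ℤ) →* MulAut (FreeGroup (ℤ × ℤ)) where
  toFun v := FreeGroup.freeGroupCongr (Equiv.addRight v.toAdd)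
  map_one' := by ext p; simp
  map_mul' v w := by
    ext g
    refine Eq.trans ?_ (FreeGroup.map.comp _ _ g).symm
    show FreeGroup.map _ g = _
    congr 2
    funext p
    simp [add_comm, add_left_comm]

lemma trV_of (v : Multiplicative (ℤ × ℤ)) (p : ℤ × ℤ) :
    trV v (FreeGroup.of p) = FreeGroup.of (p + v.toAdd) := by
  simp [trV]

/-- The lattice analogue of the wreath product. -/
abbrev WV := FreeGroup (ℤ × ℤ) ⋊[trV] Multiplicative (ℤ × ℤ)

/-- Recording the letters `x` of a word together with their heights. -/
def emV : F₂ →* WV :=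
  FreeGroup.lift ![⟨FreeGroup.of (0, 0), Multiplicative.ofAdd (0, 1)⟩,
    ⟨1, Multiplicative.ofAdd (1, 0)⟩]

lemma emV_x : emV xT = ⟨FreeGroup.of (0, 0), Multiplicative.ofAdd (0, 1)⟩ := by simp [emV]
lemma emV_q : emV qT = ⟨1, Multiplicative.ofAdd (1, 0)⟩ := by simp [emV]

/-- The word read along a lattice letter. -/
def psV : FreeGroup (ℤ × ℤ) →* F₂ :=
  FreeGroup.lift fun p => xT ^ p.2 * qT ^ p.1 * xT * (qT ^ p.1)⁻¹ * (xT ^ (p.2 + 1))⁻¹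

lemma psV_of (p : ℤ × ℤ) : psV (FreeGroup.of p) =
    xT ^ p.2 * qT ^ p.1 * xT * (qT ^ p.1)⁻¹ * (xT ^ (p.2 + 1))⁻¹ := by simp [psV]

/-- The word described by a point of the lattice wreath product. -/
def valV (w : WV) : F₂ := psV w.left * xT ^ w.right.toAdd.2 * qT ^ w.right.toAdd.1

lemma valV_mul (w : WV) (g : F₂) : valV (w * emV g) = valV w * g := by
  induction g using FreeGroup.induction_on generalizing w with
  | C1 => simp
  | of a =>
    fin_cases a
    · show valV (w * emV xT) = valV w * xT
      rw [emV_x, valV, valV]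
      simp only [SemidirectProduct.mul_left, SemidirectProduct.mul_right, trV_of, map_mul, psV_of,
        toAdd_mul, toAdd_ofAdd, Prod.fst_add, Prod.snd_add, zero_add, add_zero, Prod.mk_zero_zero]
      group
    · show valV (w * emV qT) = valV w * qT
      rw [emV_q, valV, valV]
      simp only [SemidirectProduct.mul_left, SemidirectProduct.mul_right, map_one, mul_one,
        toAdd_mul, toAdd_ofAdd, Prod.fst_add, Prod.snd_add, add_zero]
      group
  | inv_of a ih =>
    have := ih (w * emV (FreeGroup.of a)⁻¹)
    rw [map_inv, inv_mul_cancel_right] at this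
    rw [this, mul_inv_cancel_right, map_inv]
  | mul a b ha hb => rw [map_mul, ← mul_assoc, hb, ha, mul_assoc]

lemma valV_emV (g : F₂) : valV (emV g) = g := by
  have := valV_mul 1 g
  rw [one_mul] at this
  rw [this, valV]; simp

lemma eq_psV {g : F₂} (h : (emV g).right = 1) : g = psV (emV g).left := by
  conv_lhs => rw [← valV_emV g, valV, h]
  simp

/-- The linear shear of the lattice. -/
def shV (N : ℤ) : Multiplicative (ℤ × ℤ) →* Multiplicative (ℤ × ℤ) :=
  AddMonoidHom.toMultiplicative
    { toFun := fun p => (p.1 + N * p.2, p.2)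
      map_zero' := by simp
      map_add' := fun p r => by ext <;> simp; ring }

/-- The shear of the free group of rank two. -/
def tauV (N : ℤ) : F₂ →* F₂ := FreeGroup.lift ![xT * qT ^ N, qT]

lemma emV_q_zpow (N : ℤ) : emV (qT ^ N) = SemidirectProduct.inr (Multiplicative.ofAdd (N, 0)) := by
  have h : emV qT = SemidirectProduct.inr (Multiplicative.ofAdd (1, 0)) := emV_q
  rw [map_zpow, h, ← map_zpow, ← ofAdd_zsmul]
  simp

lemma emV_tauV (N : ℤ) (g : F₂) :
    emV (tauV N g) = ⟨FreeGroup.map (fun p => (p.1 + N * p.2, p.2)) (emV g).left,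
      shV N (emV g).right⟩ := by
  let f : WV →* WV := SemidirectProduct.map (FreeGroup.map (fun p => (p.1 + N * p.2, p.2)))
    (shV N) (fun v => by
      ext p
      simp only [MonoidHom.comp_apply, MulEquiv.coe_toMonoidHom, trV_of, FreeGroup.map.of]
      congr 1
      ext <;> simp [shV]
      ring)
  have : emV.comp (tauV N) = f.comp emV := by
    ext a : 1
    fin_cases a
    · show emV (tauV N xT) = f (emV xT)
      rw [tauV, FreeGroup.lift_apply_of]
      simp only [Matrix.cons_val_zero]
      rw [map_mul, emV_q_zpow, emV_x]
      ext <;> simp [f, shV]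
    · show emV (tauV N qT) = f (emV qT)
      rw [tauV, FreeGroup.lift_apply_of]
      show emV qT = f (emV qT)
      rw [emV_q]
      ext <;> simp [f, shV]
  have := DFunLike.congr_fun this g
  rw [MonoidHom.comp_apply, MonoidHom.comp_apply] at this
  rw [this]
  rfl

/-- A bounded set of letters. -/
lemma exists_bound_FS2 (g : FreeGroup (ℤ × ℤ)) :
    ∃ B : ℤ, 0 < B ∧ g ∈ FS {p : ℤ × ℤ | |p.1| < B} := by
  obtain ⟨S, hS, hg⟩ := exists_finite_FS g
  obtain ⟨B, hB⟩ := (hS.image fun p : ℤ × ℤ => |p.1|).bddAbove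
  refine ⟨max B 0 + 1, by positivity, FS_mono (fun p hp => ?_) hg⟩
  have : |p.1| ≤ B := hB ⟨p, hp, rfl⟩
  simp only [Set.mem_ofPred_eq]
  omega

lemma shear_invariant {u : F₂} (h0 : (emV u).right = 1) (h : ∀ N : ℤ, IsConj (tauV N u) u) :
    ∃ A ∈ Subgroup.closure (Set.range fun j : ℤ => qT ^ j * xT * (qT ^ j)⁻¹ * xT⁻¹),
      IsConj u A := by
  set U := (emV u).left with hU
  obtain ⟨B, hB, hUB⟩ := exists_bound_FS2 U
  set N := 4 * B with hN
  obtain ⟨c, hc⟩ := isConj_iff.1 (MonoidHom.map_isConj emV (h N).symm)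
  rw [emV_tauV, h0, ← hU] at hc
  have hu : emV u = ⟨U, 1⟩ := SemidirectProduct.ext rfl h0
  rw [hu] at hc
  have hc1 := congrArg SemidirectProduct.left hc
  simp only [SemidirectProduct.mul_left, SemidirectProduct.mul_right, mul_one,
    SemidirectProduct.inv_left] at hc1
  rw [← MulAut.mul_apply, ← map_mul, mul_inv_cancel, map_one, MulAut.one_apply] at hc1
  have hc2 : IsConj (FreeGroup.map (fun p : ℤ × ℤ => (p.1 + N * p.2, p.2)) U) (trV c.right U) :=
    (isConj_iff.2 ⟨_, hc1⟩ : IsConj (trV c.right U) _).symm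
  set v := c.right.toAdd with hv
  have m1 : FreeGroup.map (fun p : ℤ × ℤ => (p.1 + N * p.2, p.2)) U ∈
      FS {p : ℤ × ℤ | |p.1 - N * p.2| < B} :=
    map_mem_FS (fun p hp => by
      simp only [Set.mem_ofPred_eq] at hp ⊢
      rw [add_sub_cancel_right]; exact hp) hUB
  have m2 : trV c.right U ∈ FS {p : ℤ × ℤ | |p.1 - v.1| < B} := by
    have : trV c.right U = FreeGroup.map (fun p : ℤ × ℤ => p + v) U := rfl
    rw [this]
    refine map_mem_FS (fun p hp => ?_) hUB
    simp only [Set.mem_ofPred_eq] at hp ⊢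
    rw [Prod.fst_add, add_sub_cancel_right]; exact hp
  obtain ⟨w, hw, hUw⟩ := FS_inter_conj m1 m2 hc2
  obtain ⟨r, hr⟩ : ∃ r : ℤ, ({p : ℤ × ℤ | |p.1 - N * p.2| < B} ∩ {p : ℤ × ℤ | |p.1 - v.1| < B}) ⊆
      {p : ℤ × ℤ | p.2 = r} := by
    by_cases hne : ({p : ℤ × ℤ | |p.1 - N * p.2| < B} ∩ {p : ℤ × ℤ | |p.1 - v.1| < B}).Nonempty
    · obtain ⟨p, hp1, hp2⟩ := hne
      refine ⟨p.2, fun p' ⟨h1, h2⟩ => ?_⟩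
      simp only [Set.mem_ofPred_eq] at hp1 hp2 h1 h2 ⊢
      rw [abs_lt] at hp1 hp2 h1 h2
      by_contra hne
      rcases lt_or_gt_of_ne hne with h3 | h3 <;> nlinarith
    · exact ⟨0, fun p hp => (hne ⟨p, hp⟩).elim⟩
  have hw1 := FS_mono hr hw
  have hUw2 := MonoidHom.map_isConj (FreeGroup.map (fun p : ℤ × ℤ => (p.1 - N * p.2, p.2))) hUw
  rw [FreeGroup.map.comp] at hUw2
  have hid : ((fun p : ℤ × ℤ => (p.1 - N * p.2, p.2)) ∘ fun p : ℤ × ℤ => (p.1 + N * p.2, p.2)) =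
      id := by
    funext p; ext <;> simp
  rw [hid, FreeGroup.map.id] at hUw2
  set w' := FreeGroup.map (fun p : ℤ × ℤ => (p.1 - N * p.2, p.2)) w with hw'
  have hw2 : w' ∈ FS {p : ℤ × ℤ | p.2 = r} := by
    refine map_mem_FS (S := {p : ℤ × ℤ | p.2 = r}) (fun p hp => ?_) hw1
    exact hp
  have hu3 := MonoidHom.map_isConj psV hUw2
  rw [hU, ← eq_psV h0] at hu3
  refine ⟨(xT ^ r)⁻¹ * psV w' * xT ^ r, ?_, hu3.trans (isConj_iff.2 ⟨(xT ^ r)⁻¹, by simp⟩)⟩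
  have := FS_le_comap (f := (MulAut.conj (xT ^ r)⁻¹).toMonoidHom.comp psV)
    (H := Subgroup.closure (Set.range fun j : ℤ => qT ^ j * xT * (qT ^ j)⁻¹ * xT⁻¹))
    (fun p hp => ?_) hw2
  · simpa only [MonoidHom.comp_apply, MulEquiv.coe_toMonoidHom, MulAut.conj_apply, inv_inv]
      using this
  · refine Subgroup.subset_closure ⟨p.1, ?_⟩
    simp only [Set.mem_ofPred_eq] at hp
    simp only [MonoidHom.comp_apply, MulEquiv.coe_toMonoidHom, MulAut.conj_apply, psV_of, hp]
    group

/-- The symmetric statement. -/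
lemma shear_invariant' {u : F₂} (h0 : (emV u).right = 1)
    (h : ∀ N : ℤ, IsConj (FreeGroup.lift ![xT, qT * xT ^ N] u) u) :
    ∃ A ∈ Subgroup.closure (Set.range fun j : ℤ => xT ^ j * qT * (xT ^ j)⁻¹ * qT⁻¹),
      IsConj u A := by
  let f : F₂ →* F₂ := FreeGroup.lift ![qT, xT]
  have fx : f xT = qT := FreeGroup.lift_apply_of
  have fq : f qT = xT := FreeGroup.lift_apply_of
  have hff : ∀ g, f (f g) = g := by
    have : f.comp f = MonoidHom.id _ := by
      ext a : 1
      fin_cases a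
      · show f (f xT) = xT
        rw [fx, fq]
      · show f (f qT) = qT
        rw [fq, fx]
    exact fun g => DFunLike.congr_fun this g
  have htau : ∀ N g, tauV N (f g) = f (FreeGroup.lift ![xT, qT * xT ^ N] g) := by
    intro N
    have : (tauV N).comp f = f.comp (FreeGroup.lift ![xT, qT * xT ^ N]) := by
      ext a : 1
      fin_cases a
      · show tauV N (f xT) = f (FreeGroup.lift ![xT, qT * xT ^ N] xT)
        rw [fx, tauV, FreeGroup.lift_apply_of, FreeGroup.lift_apply_of]
        exact fx.symm
      · show tauV N (f qT) = f (FreeGroup.lift ![xT, qT * xT ^ N] qT)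
        rw [fq, tauV, FreeGroup.lift_apply_of, FreeGroup.lift_apply_of]
        show xT * qT ^ N = f (qT * xT ^ N)
        rw [map_mul, map_zpow, fx, fq]
    exact fun g => DFunLike.congr_fun this g
  have hr : (emV (f u)).right = 1 := by
    let sw : Multiplicative (ℤ × ℤ) →* Multiplicative (ℤ × ℤ) :=
      AddMonoidHom.toMultiplicative (AddEquiv.prodComm : ℤ × ℤ ≃+ ℤ × ℤ).toAddMonoidHom
    have : (SemidirectProduct.rightHom.comp emV).comp f =
        sw.comp (SemidirectProduct.rightHom.comp emV) := by
      ext a : 1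
      fin_cases a
      · show SemidirectProduct.rightHom (emV (f xT)) = sw (SemidirectProduct.rightHom (emV xT))
        rw [fx, emV_q, emV_x]; rfl
      · show SemidirectProduct.rightHom (emV (f qT)) = sw (SemidirectProduct.rightHom (emV qT))
        rw [fq, emV_q, emV_x]; rfl
    have := DFunLike.congr_fun this u
    have e : (emV (f u)).right = sw (emV u).right := this
    rw [e, h0, map_one]
  obtain ⟨A, hA, hA2⟩ := shear_invariant hr fun N => by
    rw [htau]; exact MonoidHom.map_isConj f (h N)
  have hA3 := MonoidHom.map_isConj f hA2
  rw [hff] at hA3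
  refine ⟨f A, ?_, hA3⟩
  have := Subgroup.mem_map_of_mem f hA
  rw [MonoidHom.map_closure, ← Set.range_comp] at this
  convert this using 3
  funext j
  simp only [Function.comp_apply, map_mul, map_zpow, map_inv, fx, fq]

/-- The commutator of the two free generators. -/
abbrev kapT : F₂ := xT * qT * xT⁻¹ * qT⁻¹

/-- An element of the commutator subgroup which is invariant up to conjugacy under both shears is
conjugate to a power of the commutator of the generators. -/
theorem conj_commutator_of_invariant {u : F₂} (h0 : (emV u).right = 1)
    (h1 : ∀ N : ℤ, IsConj (FreeGroup.lift ![xT * qT ^ N, qT] u) u)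
    (h2 : ∀ N : ℤ, IsConj (FreeGroup.lift ![xT, qT * xT ^ N] u) u) :
    ∃ k : ℤ, IsConj u (kapT ^ k) := by
  obtain ⟨A, hA, huA⟩ := shear_invariant h0 h1
  obtain ⟨B, hB, huB⟩ := shear_invariant' h0 h2
  have ex : emb (1 : Fin 2) xT = SemidirectProduct.inl (FreeGroup.of (0, 0)) :=
    emb_of_ne (by decide)
  have eq : ∀ j : ℤ, emb (1 : Fin 2) (qT ^ j) =
    SemidirectProduct.inr (Multiplicative.ofAdd j) := fun j => emb_self_zpow _ _
  have eq1 : emb (1 : Fin 2) qT = SemidirectProduct.inr (Multiplicative.ofAdd 1) := emb_self _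
  have exj : ∀ j : ℤ, emb (1 : Fin 2) (qT ^ j * xT * (qT ^ j)⁻¹) =
      SemidirectProduct.inl (FreeGroup.of (0, j)) := by
    intro j
    rw [map_mul, map_mul, map_inv, eq, ex, ← map_inv, ← SemidirectProduct.inl_aut, shA_apply,
      shf_of]
    simp
  -- the two normal forms
  obtain ⟨A0, hA0, hA1⟩ : ∃ A0 ∈ Subgroup.closure (Set.range fun j : ℤ =>
      (FreeGroup.of ((0 : Fin 2), j)) * (FreeGroup.of ((0 : Fin 2), (0 : ℤ)))⁻¹),
      emb (1 : Fin 2) A = SemidirectProduct.inl A0 := by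
    have := Subgroup.mem_map_of_mem (emb (1 : Fin 2)) hA
    rw [MonoidHom.map_closure, ← Set.range_comp] at this
    have e : (emb (1 : Fin 2)) ∘ (fun j : ℤ => qT ^ j * xT * (qT ^ j)⁻¹ * xT⁻¹) =
        (SemidirectProduct.inl : _ →* KK (Fin 2)) ∘ fun j : ℤ =>
      (FreeGroup.of ((0 : Fin 2), j)) * (FreeGroup.of ((0 : Fin 2), (0 : ℤ)))⁻¹ := by
      funext j
      simp only [Function.comp_apply]
      rw [map_mul, exj, map_inv, ex, map_mul, map_inv]
    rw [e, Set.range_comp, ← MonoidHom.map_closure] at this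
    obtain ⟨A0, h, h'⟩ := this
    exact ⟨A0, h, h'.symm⟩
  obtain ⟨B0, hB0, hB1⟩ : ∃ B0 ∈ FS ({((0 : Fin 2), (0 : ℤ)), (0, 1)} : Set (Fin 2 × ℤ)),
      emb (1 : Fin 2) B = SemidirectProduct.inl B0 := by
    have : B ∈ ((FS ({((0 : Fin 2), (0 : ℤ)), (0, 1)} : Set (Fin 2 × ℤ))).map
        (SemidirectProduct.inl : _ →* KK (Fin 2))).comap (emb (1 : Fin 2)) := by
      refine (Subgroup.closure_le _).2 ?_ hB
      rintro _ ⟨j, rfl⟩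
      refine ⟨FreeGroup.of (0, 0) ^ j * (FreeGroup.of (0, 1) ^ j)⁻¹, ?_, ?_⟩
      · exact mul_mem (zpow_mem (of_mem_FS (by simp)) _)
          (inv_mem (zpow_mem (of_mem_FS (by simp)) _))
      · have e1 := exj 1
        have e2 : xT ^ j * qT * (xT ^ j)⁻¹ * qT⁻¹ =
            xT ^ j * ((qT ^ (1 : ℤ) * xT * (qT ^ (1 : ℤ))⁻¹) ^ j)⁻¹ := by
          rw [conj_zpow, zpow_one]; group
        show _ = emb (1 : Fin 2) (xT ^ j * qT * (xT ^ j)⁻¹ * qT⁻¹)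
        symm
        rw [e2, map_mul, map_inv, map_zpow, map_zpow, e1, ex, map_mul, map_inv, map_zpow, map_zpow]
    obtain ⟨B0, h, h'⟩ := this
    exact ⟨B0, h, h'.symm⟩
  have hAB := MonoidHom.map_isConj (emb (1 : Fin 2)) (huA.symm.trans huB)
  rw [hA1, hB1] at hAB
  obtain ⟨c, hc⟩ := isConj_iff.1 hAB
  have hc1 := congrArg SemidirectProduct.left hc
  simp only [SemidirectProduct.mul_left, SemidirectProduct.mul_right, mul_one,
    SemidirectProduct.inv_left, SemidirectProduct.left_inl, SemidirectProduct.right_inl] at hc1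
  rw [← MulAut.mul_apply, ← map_mul, mul_inv_cancel, map_one, MulAut.one_apply, shA_apply] at hc1
  set m := c.right.toAdd
  let ρ : FreeGroup (Fin 2 × ℤ) →* FreeGroup (Fin 2 × ℤ) :=
    FreeGroup.map fun p => if p.2 ≤ 0 then (0, 0) else (0, 1)
  have hρB : ρ B0 = B0 := by
    have := FS_eqOn (f := ρ) (f' := MonoidHom.id _) (fun a ha => ?_) hB0
    · exact this
    · rcases ha with rfl | ha
      · simp [ρ]
      · rw [Set.mem_singleton_iff] at ha
        subst ha; simp [ρ]
  set d : FreeGroup (Fin 2 × ℤ) := FreeGroup.of (0, 0) * (FreeGroup.of (0, 1))⁻¹ with hd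
  have hρA : ρ (shf m A0) ∈ Subgroup.zpowers d := by
    have : A0 ∈ (Subgroup.zpowers d).comap (ρ.comp (shf m)) := by
      refine (Subgroup.closure_le _).2 ?_ hA0
      rintro _ ⟨j, rfl⟩
      show ρ (shf m (FreeGroup.of ((0 : Fin 2), j) * (FreeGroup.of ((0 : Fin 2), (0 : ℤ)))⁻¹)) ∈
        Subgroup.zpowers d
      rw [map_mul, map_inv, shf_of, shf_of, map_mul, map_inv]
      simp only [ρ, FreeGroup.map.of]
      split_ifs
      · rw [mul_inv_cancel]; exact one_mem _
      · exact Subgroup.mem_zpowers _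
      · rw [← inv_mem_iff, mul_inv_rev, inv_inv]; exact Subgroup.mem_zpowers _
      · rw [mul_inv_cancel]; exact one_mem _
    exact this
  obtain ⟨k, hk⟩ := hρA
  have hk : d ^ k = ρ (shf m A0) := hk
  refine ⟨k, huB.trans ?_⟩
  have hBd : IsConj B0 (d ^ k) := by
    rw [hk, ← hρB, ← hc1]
    refine (isConj_iff.2 ⟨ρ c.left, ?_⟩ : IsConj (ρ (shf m A0)) _).symm
    rw [map_mul, map_mul, map_inv]
  have := MonoidHom.map_isConj (bak (1 : Fin 2)) (MonoidHom.map_isConj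
    (SemidirectProduct.inl : _ →* KK (Fin 2)) hBd)
  rw [← hB1, bak_emb, map_zpow, map_zpow, hd, map_mul, map_inv, map_mul, map_inv, bak_inl_of,
    bak_inl_of] at this
  convert this using 2
  show xT * qT * xT⁻¹ * qT⁻¹ = qT ^ (0 : ℤ) * xT * (qT ^ (0 : ℤ))⁻¹ *
    (qT ^ (1 : ℤ) * xT * (qT ^ (1 : ℤ))⁻¹)⁻¹
  group

end Torus

end BraidB

namespace BraidB

section Torus

local notation "F₂" => FreeGroup (Fin 2)

lemma freeTwo_hom_ext {G : Type*} [Group G] {f g : F₂ →* G} (h0 : f xT = g xT)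
    (h1 : f qT = g qT) : f = g := by
  ext a : 1
  fin_cases a
  · exact h0
  · exact h1

/-- The substitution homomorphism of the free group of rank two. -/
def sbT {G : Type*} [Group G] (a b : G) : F₂ →* G := FreeGroup.lift ![a, b]

@[simp] lemma sbT_x {G : Type*} [Group G] (a b : G) : sbT a b xT = a := FreeGroup.lift_apply_of
@[simp] lemma sbT_q {G : Type*} [Group G] (a b : G) : sbT a b qT = b := FreeGroup.lift_apply_of

/-- The first Dehn twist of the punctured torus. -/
def twT0 : MulAut F₂ := MonoidHom.toMulEquiv (sbT xT (qT * xT⁻¹)) (sbT xT (qT * xT))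
  (freeTwo_hom_ext (by simp) (by simp)) (freeTwo_hom_ext (by simp) (by simp))

/-- The second Dehn twist of the punctured torus. -/
def twT1 : MulAut F₂ := MonoidHom.toMulEquiv (sbT (xT * qT) qT) (sbT (xT * qT⁻¹) qT)
  (freeTwo_hom_ext (by simp) (by simp)) (freeTwo_hom_ext (by simp) (by simp))

lemma twT0_x : twT0 xT = xT := sbT_x xT (qT * xT⁻¹)
lemma twT0_q : twT0 qT = qT * xT⁻¹ := sbT_q xT (qT * xT⁻¹)
lemma twT1_x : twT1 xT = xT * qT := sbT_x (xT * qT) qT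
lemma twT1_q : twT1 qT = qT := sbT_q (xT * qT) qT

lemma mulAut_freeTwo_ext {f g : MulAut F₂} (h0 : f xT = g xT) (h1 : f qT = g qT) : f = g := by
  have : f.toMonoidHom = g.toMonoidHom := freeTwo_hom_ext h0 h1
  ext a
  exact DFunLike.congr_fun this a

/-- The action of the three strand braid group on the fundamental group of the punctured torus. -/
def acT : Br 3 →* MulAut F₂ := Br.lift (fun i => if i = 0 then twT0 else twT1)
  { comm := fun i j h1 h2 => by omega
    braid := fun i h => by
      obtain rfl : i = 0 := by omega
      simp only [if_true, zero_add, one_ne_zero, if_false]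
      apply mulAut_freeTwo_ext <;>
        simp only [MulAut.mul_apply, twT0_x, twT0_q, twT1_x, twT1_q, map_mul, map_inv] <;> group }

lemma acT_zero : acT (sg 3 0) = twT0 := Br.lift_sg _ _ (by omega)
lemma acT_one : acT (sg 3 1) = twT1 := Br.lift_sg _ _ (by omega)

/-- The four strand braid group as a semidirect product. -/
abbrev ET := F₂ ⋊[acT] Br 3

/-- Inclusion of the free normal subgroup. -/
abbrev elT : F₂ →* ET := SemidirectProduct.inl
/-- Inclusion of the three strand braid group. -/
abbrev erT : Br 3 →* ET := SemidirectProduct.inr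
/-- Projection to the three strand braid group. -/
abbrev prT : ET →* Br 3 := SemidirectProduct.rightHom

lemma erT_elT (b : Br 3) (v : F₂) : erT b * elT v = elT (acT b v) * erT b := by
  rw [SemidirectProduct.inl_aut, map_inv, inv_mul_cancel_right]

/-- The isomorphism from the four strand braid group. -/
def toET : Br 4 →* ET := Br.lift
  (fun i => if i = 0 then erT (sg 3 0) else if i = 1 then erT (sg 3 1) else
    elT xT⁻¹ * erT (sg 3 0))
  { comm := fun i j h1 h2 => by
      obtain rfl : i = 0 := by omega
      obtain rfl : j = 2 := by omega
      simp only [if_true, OfNat.ofNat_ne_zero, if_false, OfNat.ofNat_ne_one]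
      rw [← mul_assoc, erT_elT, acT_zero, map_inv, twT0_x]
    braid := fun i h => by
      have hb := congrArg erT ((braidRel_sg 3).braid 0 (by omega))
      simp only [zero_add, map_mul] at hb
      obtain rfl | rfl : i = 0 ∨ i = 1 := by omega
      · simpa using hb
      · simp only [one_ne_zero, if_false, if_true, Nat.reduceAdd, OfNat.ofNat_ne_zero,
          OfNat.ofNat_ne_one]
        have e1 : erT (sg 3 1) * elT xT⁻¹ = elT (xT * qT)⁻¹ * erT (sg 3 1) :=
          (erT_elT _ _).trans (by rw [acT_one, map_inv twT1, twT1_x])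
        have e2 : erT (sg 3 0) * elT (xT * qT)⁻¹ = elT (xT * (qT * xT⁻¹))⁻¹ * erT (sg 3 0) :=
          (erT_elT _ _).trans (by rw [acT_zero, map_inv twT0, map_mul twT0, twT0_x, twT0_q])
        calc erT (sg 3 1) * (elT xT⁻¹ * erT (sg 3 0)) * erT (sg 3 1)
            = (erT (sg 3 1) * elT xT⁻¹) * erT (sg 3 0) * erT (sg 3 1) := by
              simp only [mul_assoc]
          _ = elT (xT * qT)⁻¹ * (erT (sg 3 0) * erT (sg 3 1) * erT (sg 3 0)) := by
              rw [e1, hb]; simp only [mul_assoc]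
          _ = elT xT⁻¹ * elT (xT * (qT * xT⁻¹))⁻¹ *
                (erT (sg 3 0) * erT (sg 3 1) * erT (sg 3 0)) := by
              rw [← map_mul elT]; congr 2; group
          _ = elT xT⁻¹ * (erT (sg 3 0) * elT (xT * qT)⁻¹) * erT (sg 3 1) * erT (sg 3 0) := by
              rw [e2]; simp only [mul_assoc]
          _ = elT xT⁻¹ * erT (sg 3 0) * (erT (sg 3 1) * elT xT⁻¹) * erT (sg 3 0) := by
              rw [e1]; simp only [mul_assoc]
          _ = _ := by simp only [mul_assoc] }

lemma toET_zero : toET (sg 4 0) = erT (sg 3 0) := Br.lift_sg _ _ (by omega)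
lemma toET_one : toET (sg 4 1) = erT (sg 3 1) := Br.lift_sg _ _ (by omega)
lemma toET_two : toET (sg 4 2) = elT xT⁻¹ * erT (sg 3 0) := Br.lift_sg _ _ (by omega)

/-- The free generators as braids. -/
def xB : Br 4 := sg 4 0 * (sg 4 2)⁻¹
/-- The free generators as braids. -/
def qB : Br 4 := xB⁻¹ * sg 4 1 * xB * (sg 4 1)⁻¹

lemma xB_comm : sg 4 0 * xB * (sg 4 0)⁻¹ = xB := by
  have h : Commute (sg 4 0) (sg 4 2) := (braidRel_sg 4).comm 0 2 (by omega) (by omega)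
  have : Commute (sg 4 0) xB := (Commute.refl _).mul_right h.inv_right
  rw [this.eq, mul_inv_cancel_right]

lemma comm_conj_of_braid {G : Type*} [Group G] {a b c : G} (hac : Commute a c)
    (hab : a * b * a = b * a * b) (hbc : b * c * b = c * b * c) :
    Commute b ((a * c⁻¹)⁻¹ * b * (a * c⁻¹)) := by
  have h1 : a⁻¹ * b * a = b * a * b⁻¹ := by
    rw [eq_mul_inv_iff_mul_eq, mul_assoc, mul_assoc, inv_mul_eq_iff_eq_mul]
    simpa only [mul_assoc] using hab.symm
  have h2 : (a * c⁻¹)⁻¹ * b * (a * c⁻¹) = (c * b) * a * (c * b)⁻¹ := by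
    calc _ = c * (a⁻¹ * b * a) * c⁻¹ := by group
      _ = _ := by rw [h1]; group
  rw [h2]
  have h3 : b * (c * b) = (c * b) * c := by simpa only [mul_assoc] using hbc
  have h4 : b = (c * b) * c * (c * b)⁻¹ := eq_mul_inv_of_mul_eq h3
  nth_rewrite 1 [h4]
  exact hac.symm.conj (c * b)

lemma conj_of_braid {G : Type*} [Group G] {a b c : G} (hac : Commute a c)
    (hab : a * b * a = b * a * b) (hbc : b * c * b = c * b * c) :
    a * ((a * c⁻¹)⁻¹ * b * (a * c⁻¹) * b⁻¹) * a⁻¹ =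
      (a * c⁻¹)⁻¹ * b * (a * c⁻¹) * b⁻¹ * (a * c⁻¹)⁻¹ := by
  have h1 : b * c⁻¹ * b⁻¹ = c⁻¹ * b⁻¹ * c := by
    have : b * c * b⁻¹ = c⁻¹ * b * c := by
      rw [mul_inv_eq_iff_eq_mul, mul_assoc, mul_assoc, eq_inv_mul_iff_mul_eq]
      simpa only [mul_assoc] using hbc.symm
    have := congrArg (fun x => x⁻¹) this
    simpa [mul_assoc] using this
  have h2 : a * (a * c⁻¹)⁻¹ = (a * c⁻¹)⁻¹ * a :=
    ((Commute.refl a).mul_right hac.inv_right).inv_right.eq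
  calc _ = (a * (a * c⁻¹)⁻¹) * b * a * c⁻¹ * b⁻¹ * a⁻¹ := by group
    _ = (a * c⁻¹)⁻¹ * (a * b * a) * c⁻¹ * b⁻¹ * a⁻¹ := by rw [h2]; group
    _ = (a * c⁻¹)⁻¹ * b * a * (b * c⁻¹ * b⁻¹) * a⁻¹ := by rw [hab]; group
    _ = _ := by rw [h1]; group

lemma sg_one_qB : sg 4 1 * qB * (sg 4 1)⁻¹ = qB := by
  have h := comm_conj_of_braid (a := sg 4 0) (b := sg 4 1) (c := sg 4 2)
    ((braidRel_sg 4).comm 0 2 (by omega) (by omega)) ((braidRel_sg 4).braid 0 (by omega))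
    ((braidRel_sg 4).braid 1 (by omega))
  have : Commute (sg 4 1) qB := h.mul_right (Commute.refl _).inv_right
  rw [this.eq, mul_inv_cancel_right]

lemma sg_zero_qB : sg 4 0 * qB * (sg 4 0)⁻¹ = qB * xB⁻¹ :=
  conj_of_braid (a := sg 4 0) (b := sg 4 1) (c := sg 4 2)
    ((braidRel_sg 4).comm 0 2 (by omega) (by omega)) ((braidRel_sg 4).braid 0 (by omega))
    ((braidRel_sg 4).braid 1 (by omega))

/-- The standard inclusion of three strand braids. -/
def incT : Br 3 →* Br 4 := Br.lift (sg 4) ((braidRel_sg 4).mono (by omega))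

lemma incT_sg {i : ℕ} (hi : i + 1 < 3) : incT (sg 3 i) = sg 4 i := Br.lift_sg _ _ hi

/-- The inverse isomorphism. -/
def ofET : ET →* Br 4 := SemidirectProduct.lift (sbT xB qB) incT (by
  intro b
  induction b using Br.induction with
  | h1 => ext; simp
  | hs i hi =>
    obtain rfl | rfl : i = 0 ∨ i = 1 := by omega
    · apply freeTwo_hom_ext
      · simp only [MonoidHom.comp_apply, MulEquiv.coe_toMonoidHom, acT_zero, twT0_x, incT_sg hi,
          MulAut.conj_apply, sbT_x]
        exact xB_comm.symm
      · simp only [MonoidHom.comp_apply, MulEquiv.coe_toMonoidHom, acT_zero, twT0_q, incT_sg hi,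
          MulAut.conj_apply, sbT_x, sbT_q, map_mul, map_inv]
        exact sg_zero_qB.symm
    · apply freeTwo_hom_ext
      · simp only [MonoidHom.comp_apply, MulEquiv.coe_toMonoidHom, acT_one, twT1_x, incT_sg hi,
          MulAut.conj_apply, sbT_x, sbT_q, map_mul]
        rw [qB]; group
      · simp only [MonoidHom.comp_apply, MulEquiv.coe_toMonoidHom, acT_one, twT1_q, incT_sg hi,
          MulAut.conj_apply, sbT_q]
        exact sg_one_qB.symm
  | hm a b ha hb =>
    ext v : 1
    have h1 := fun v => DFunLike.congr_fun ha v
    have h2 := fun v => DFunLike.congr_fun hb v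
    simp only [MonoidHom.comp_apply, MulEquiv.coe_toMonoidHom] at h1 h2 ⊢
    rw [map_mul, MulAut.mul_apply, h1, h2, map_mul, map_mul, MulAut.mul_apply]
  | hi a ha =>
    ext v : 1
    have h1 := fun v => DFunLike.congr_fun ha v
    simp only [MonoidHom.comp_apply, MulEquiv.coe_toMonoidHom] at h1 ⊢
    have := h1 ((acT a)⁻¹ (FreeGroup.of v))
    rw [← MulAut.mul_apply, mul_inv_cancel, MulAut.one_apply] at this
    rw [this, map_inv, map_inv, map_inv, ← MulAut.mul_apply, inv_mul_cancel, MulAut.one_apply])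

lemma ofET_elT (v : F₂) : ofET (elT v) = sbT xB qB v := SemidirectProduct.lift_inl ..
lemma ofET_erT (b : Br 3) : ofET (erT b) = incT b := SemidirectProduct.lift_inr ..

lemma ofET_toET (b : Br 4) : ofET (toET b) = b := by
  have : ofET.comp toET = MonoidHom.id _ := by
    refine Br.hom_ext fun i hi => ?_
    rw [MonoidHom.comp_apply, MonoidHom.id_apply]
    obtain rfl | rfl | rfl : i = 0 ∨ i = 1 ∨ i = 2 := by omega
    · rw [toET_zero, ofET_erT, incT_sg (by omega)]
    · rw [toET_one, ofET_erT, incT_sg (by omega)]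
    · rw [toET_two, map_mul, ofET_erT, incT_sg (by omega), ofET_elT, map_inv, sbT_x, xB]
      group
  exact DFunLike.congr_fun this b

end Torus

end BraidB

namespace BraidB

open Matrix in
/-- The image of the first standard braid generator in the modular group. -/
def slL : SpecialLinearGroup (Fin 2) ℤ := ⟨!![1, -1; 0, 1], by simp [Matrix.det_fin_two]⟩
open Matrix in
/-- The image of the second standard braid generator in the modular group. -/
def slR : SpecialLinearGroup (Fin 2) ℤ := ⟨!![1, 0; 1, 1], by simp [Matrix.det_fin_two]⟩

/-- The reduced Burau representation at minus one. -/
def rhoM : Br 3 →* Matrix.SpecialLinearGroup (Fin 2) ℤ :=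
  Br.lift (fun i => if i = 0 then slL else slR)
  { comm := fun i j h1 h2 => by omega
    braid := fun i h => by
      obtain rfl : i = 0 := by omega
      simp only [if_true, zero_add, one_ne_zero, if_false]
      decide }

lemma rhoM_zero : rhoM (sg 3 0) = slL := Br.lift_sg _ _ (by omega)
lemma rhoM_one : rhoM (sg 3 1) = slR := Br.lift_sg _ _ (by omega)

lemma rhoM_surjective : Function.Surjective rhoM := by
  rw [← MonoidHom.range_eq_top, eq_top_iff, ← SpecialLinearGroup.SL2Z_generators,
    Subgroup.closure_le]
  rintro _ (rfl | rfl)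
  · refine ⟨sg 3 0 * sg 3 1 * sg 3 0, ?_⟩
    rw [map_mul, map_mul, rhoM_zero, rhoM_one]
    decide
  · refine ⟨(sg 3 0)⁻¹, ?_⟩
    rw [map_inv, rhoM_zero]
    decide

lemma rhoM_twB : rhoM (twB 3 3) = -1 := by
  have : rhoM (twB 3 3) = (slL * slR) ^ 3 := by
    simp [twB, tw, ew, rhoM_zero, rhoM_one]
  rw [this]
  decide

/-- The nonzero vectors modulo two. -/
def wv (j : ℕ) : Fin 2 → ZMod 2 := if j = 0 then ![0, 1] else if j = 1 then ![1, 1] else ![1, 0]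

/-- The representation modulo two. -/
def rho2 : Br 3 →* Matrix.SpecialLinearGroup (Fin 2) (ZMod 2) :=
  (Matrix.SpecialLinearGroup.map (Int.castRingHom (ZMod 2))).comp rhoM

lemma rho2_wv (b : Br 3) : ∀ j < 3, (rho2 b).1.mulVec (wv j) = wv (prm 3 b j) := by
  induction b using Br.induction with
  | h1 => intro j _; simp
  | hs i hi =>
    intro j hj
    rw [prm_sg hi]
    obtain rfl | rfl : i = 0 ∨ i = 1 := by omega
    · rw [rho2, MonoidHom.comp_apply, rhoM_zero]
      interval_cases j <;> decide
    · rw [rho2, MonoidHom.comp_apply, rhoM_one]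
      interval_cases j <;> decide
  | hm a b ha hb =>
    intro j hj
    rw [map_mul, map_mul, Matrix.SpecialLinearGroup.coe_mul, ← Matrix.mulVec_mulVec, hb j hj,
      ha _ ((prm_lt_iff b).2 hj), Equiv.Perm.mul_apply]
  | hi a ha =>
    intro j hj
    have h := ha ((prm 3 a)⁻¹ j) (by rw [← map_inv]; exact (prm_lt_iff _).2 hj)
    rw [← Equiv.Perm.mul_apply, mul_inv_cancel, Equiv.Perm.one_apply] at h
    rw [map_inv, map_inv, ← h, Matrix.mulVec_mulVec, ← Matrix.SpecialLinearGroup.coe_mul,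
      inv_mul_cancel, Matrix.SpecialLinearGroup.coe_one, Matrix.one_mulVec]

lemma wv_injOn {i j : ℕ} (hi : i < 3) (hj : j < 3) (h : wv i = wv j) : i = j := by
  revert h
  interval_cases i <;> interval_cases j <;> decide

lemma prm_of_rho2 {b : Br 3} (h : rho2 b = 1) : prm 3 b = 1 := by
  ext j
  rw [Equiv.Perm.one_apply]
  rcases lt_or_ge j 3 with hj | hj
  · have := rho2_wv b j hj
    rw [h, Matrix.SpecialLinearGroup.coe_one, Matrix.one_mulVec] at this
    exact (wv_injOn hj ((prm_lt_iff b).2 hj) this).symm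
  · exact prm_of_le b hj

lemma prm_of_rhoM {b : Br 3} (h : rhoM b = 1) : prm 3 b = 1 :=
  prm_of_rho2 (by rw [rho2, MonoidHom.comp_apply, h, map_one])

lemma sl_col_ne (A : Matrix.SpecialLinearGroup (Fin 2) ℤ) (h0 : A.1 0 0 = 0) : A.1 1 0 ≠ 0 := by
  intro h1
  have := A.2
  rw [Matrix.det_fin_two, h0, h1] at this
  simp at this

lemma pp_injective : Function.Injective
    (FreeGroup.lift ![-(slL⁻¹ ^ 2), slR ^ 2]) := by
  have ea : (-(slL⁻¹ ^ 2)).1 = !![-1, -2; 0, -1] := by decide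
  have ea' : (-(slL⁻¹ ^ 2))⁻¹.1 = !![-1, 2; 0, -1] := by decide
  have eb : (slR ^ 2).1 = !![1, 0; 2, 1] := by decide
  have eb' : (slR ^ 2)⁻¹.1 = !![1, 0; -2, 1] := by decide
  refine FreeGroup.injective_lift_of_ping_pong (α := Matrix.SpecialLinearGroup (Fin 2) ℤ) _
    ![{A | A.1 1 0 = 0 ∨ A.1 1 0 * A.1 1 0 < A.1 0 0 * A.1 1 0},
      {A | A.1 0 0 * A.1 0 0 ≤ A.1 0 0 * A.1 1 0}]
    ![{A | A.1 1 0 ≠ 0 ∧ A.1 1 0 * A.1 1 0 ≤ -(A.1 0 0 * A.1 1 0)},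
      {A | A.1 0 0 * A.1 0 0 < -(A.1 0 0 * A.1 1 0)}] ?_ ?_ ?_ ?_ ?_ ?_
  · intro i
    fin_cases i
    · exact ⟨1, Or.inl rfl⟩
    · exact ⟨slR, show (slR.1 0 0 * slR.1 0 0 ≤ slR.1 0 0 * slR.1 1 0) by decide⟩
  · intro i j hij
    have key : ∀ A : Matrix.SpecialLinearGroup (Fin 2) ℤ,
        (A.1 1 0 = 0 ∨ A.1 1 0 * A.1 1 0 < A.1 0 0 * A.1 1 0) →
        A.1 0 0 * A.1 0 0 ≤ A.1 0 0 * A.1 1 0 → False := by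
      rintro A (h | h) h'
      · rw [h] at h'
        have h0 : A.1 0 0 ≠ 0 := fun h0 => sl_col_ne A h0 h
        nlinarith [mul_self_pos.2 h0]
      · nlinarith [sq_nonneg (A.1 0 0 - A.1 1 0)]
    rw [Function.onFun, Set.disjoint_left]
    fin_cases i <;> fin_cases j
    · exact absurd rfl hij
    · exact fun A h h' => key A h h'
    · exact fun A h h' => key A h' h
    · exact absurd rfl hij
  · intro i j hij
    have key : ∀ A : Matrix.SpecialLinearGroup (Fin 2) ℤ,
        (A.1 1 0 ≠ 0 ∧ A.1 1 0 * A.1 1 0 ≤ -(A.1 0 0 * A.1 1 0)) →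
        A.1 0 0 * A.1 0 0 < -(A.1 0 0 * A.1 1 0) → False := by
      rintro A ⟨_, h⟩ h'
      nlinarith [sq_nonneg (A.1 0 0 + A.1 1 0)]
    rw [Function.onFun, Set.disjoint_left]
    fin_cases i <;> fin_cases j
    · exact absurd rfl hij
    · exact fun A h h' => key A h h'
    · exact fun A h h' => key A h' h
    · exact absurd rfl hij
  · intro i j
    rw [Set.disjoint_left]
    intro A
    have h0 := mul_self_nonneg (A.1 0 0)
    have h1 := mul_self_nonneg (A.1 1 0)
    fin_cases i <;> fin_cases j
    · rintro (h | h) ⟨h2, h3⟩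
      · exact h2 h
      · linarith
    · rintro (h | h) (h2 : A.1 0 0 * A.1 0 0 < -(A.1 0 0 * A.1 1 0))
      · rw [h] at h2
        linarith
      · linarith
    · rintro (h : A.1 0 0 * A.1 0 0 ≤ A.1 0 0 * A.1 1 0) ⟨h2, h3⟩
      have := mul_self_pos.2 h2
      linarith
    · rintro (h : A.1 0 0 * A.1 0 0 ≤ A.1 0 0 * A.1 1 0)
        (h2 : A.1 0 0 * A.1 0 0 < -(A.1 0 0 * A.1 1 0))
      linarith
  · intro i
    rw [Set.smul_set_subset_iff]
    intro A
    fin_cases i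
    · intro (h : ¬ (A.1 1 0 ≠ 0 ∧ A.1 1 0 * A.1 1 0 ≤ -(A.1 0 0 * A.1 1 0)))
      show ((-(slL⁻¹ ^ 2)) * A).1 1 0 = 0 ∨ ((-(slL⁻¹ ^ 2)) * A).1 1 0 *
        ((-(slL⁻¹ ^ 2)) * A).1 1 0 < ((-(slL⁻¹ ^ 2)) * A).1 0 0 * ((-(slL⁻¹ ^ 2)) * A).1 1 0
      simp only [Matrix.SpecialLinearGroup.coe_mul, ea, Matrix.mul_apply, Fin.sum_univ_two]
      simp
      by_cases h0 : A.1 1 0 = 0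
      · exact Or.inl h0
      · have := lt_of_not_ge fun h2 => h ⟨h0, h2⟩
        right
        linarith
    · intro (h : ¬ (A.1 0 0 * A.1 0 0 < -(A.1 0 0 * A.1 1 0)))
      show (slR ^ 2 * A).1 0 0 * (slR ^ 2 * A).1 0 0 ≤ (slR ^ 2 * A).1 0 0 * (slR ^ 2 * A).1 1 0
      rw [not_lt] at h
      simp only [Matrix.SpecialLinearGroup.coe_mul, eb, Matrix.mul_apply, Fin.sum_univ_two]
      simp
      linarith
  · intro i
    rw [Set.smul_set_subset_iff]
    intro A
    fin_cases i
    · intro (h : ¬ (A.1 1 0 = 0 ∨ A.1 1 0 * A.1 1 0 < A.1 0 0 * A.1 1 0))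
      show ((-(slL⁻¹ ^ 2))⁻¹ * A).1 1 0 ≠ 0 ∧ ((-(slL⁻¹ ^ 2))⁻¹ * A).1 1 0 *
        ((-(slL⁻¹ ^ 2))⁻¹ * A).1 1 0 ≤
          -(((-(slL⁻¹ ^ 2))⁻¹ * A).1 0 0 * ((-(slL⁻¹ ^ 2))⁻¹ * A).1 1 0)
      push Not at h
      simp only [Matrix.SpecialLinearGroup.coe_mul, ea', Matrix.mul_apply, Fin.sum_univ_two]
      simp
      exact ⟨h.1, by linarith [h.2]⟩
    · intro (h : ¬ (A.1 0 0 * A.1 0 0 ≤ A.1 0 0 * A.1 1 0))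
      show ((slR ^ 2)⁻¹ * A).1 0 0 * ((slR ^ 2)⁻¹ * A).1 0 0 <
        -(((slR ^ 2)⁻¹ * A).1 0 0 * ((slR ^ 2)⁻¹ * A).1 1 0)
      rw [not_le] at h
      simp only [Matrix.SpecialLinearGroup.coe_mul, eb', Matrix.mul_apply, Fin.sum_univ_two]
      simp
      linarith

/-- The free basis adapted to the ping-pong argument. -/
def ppB : FreeGroup (Fin 2) →* Fr 2 := FreeGroup.lift ![cc 2 2, xx 2 1]

lemma ppB_surjective : Function.Surjective ppB := by
  intro f
  refine ⟨FreeGroup.lift (fun j : Fin 2 => if j = 0 then qT⁻¹ * xT else xT) f, ?_⟩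
  have : ppB.comp (FreeGroup.lift (fun j : Fin 2 => if j = 0 then qT⁻¹ * xT else xT)) =
      MonoidHom.id _ := by
    refine Fr.hom_ext fun j h0 hj => ?_
    obtain rfl | rfl : j = 1 ∨ j = 2 := by omega
    · have h1 : cc 2 1 = FreeGroup.of 0 := cc_succ (by omega)
      rw [MonoidHom.comp_apply, MonoidHom.id_apply, h1, FreeGroup.lift_apply_of, if_pos rfl,
        map_mul, map_inv, ← h1]
      show (ppB qT)⁻¹ * ppB xT = _
      rw [show ppB qT = xx 2 1 from FreeGroup.lift_apply_of,
        show ppB xT = cc 2 2 from FreeGroup.lift_apply_of, xx]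
      group
    · have h1 : cc 2 2 = FreeGroup.of 1 := cc_succ (by omega)
      rw [MonoidHom.comp_apply, MonoidHom.id_apply, h1, FreeGroup.lift_apply_of,
        if_neg (by decide), ← h1]
      exact FreeGroup.lift_apply_of
  exact DFunLike.congr_fun this f

lemma rhoM_ppB (v : FreeGroup (Fin 2)) :
    rhoM (iota 2 (dl (ppB v))) = FreeGroup.lift ![-(slL⁻¹ ^ 2), slR ^ 2] v := by
  have : ((rhoM.comp (iota 2)).comp dl).comp ppB = FreeGroup.lift ![-(slL⁻¹ ^ 2), slR ^ 2] := by
    refine freeTwo_hom_ext ?_ ?_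
    · show rhoM (iota 2 (dl (ppB xT))) = _
      rw [show ppB xT = cc 2 2 from FreeGroup.lift_apply_of, FreeGroup.lift_apply_of,
        iota_cc_top]
      show rhoM (sg 3 1 * (sg 3 0 * 1 * sg 3 0) * sg 3 1) = -(slL⁻¹ ^ 2)
      simp only [map_mul, map_one, rhoM_zero, rhoM_one]
      decide
    · show rhoM (iota 2 (dl (ppB qT))) = _
      rw [show ppB qT = xx 2 1 from FreeGroup.lift_apply_of, FreeGroup.lift_apply_of,
        iota_x (n := 2) (by omega)]
      show rhoM (sg 3 1 ^ 2) = slR ^ 2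
      rw [map_pow, rhoM_one]
  exact DFunLike.congr_fun this v

lemma br_two_comm (a b : Br 2) : Commute a b := by
  have key : ∀ a : Br 2, a ∈ Subgroup.zpowers (sg 2 0) := by
    intro a
    induction a using Br.induction with
    | h1 => exact one_mem _
    | hs i hi =>
      obtain rfl : i = 0 := by omega
      exact Subgroup.mem_zpowers _
    | hm a b ha hb => exact mul_mem ha hb
    | hi a ha => exact inv_mem ha
  obtain ⟨i, rfl⟩ := key a
  obtain ⟨j, rfl⟩ := key b
  exact (Commute.refl _).zpow_zpow i j

/-- Normal form of pure braids on three strands. -/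
lemma pure_three {b : Br 3} (h : prm 3 b = 1) :
    ∃ (f : Fr 2) (j : ℤ), b = iota 2 (dl f) * twB 3 3 ^ j := by
  have hb : iota 2 (kap 2 2 b) = b := iota_kap (by rw [h]; rfl)
  have hg : prm 2 (pr (kap 2 2 b)) = 1 := (prm_pr_kap (n := 2) (g := b) (by rw [h]; rfl)).trans h
  obtain ⟨j, hj⟩ := pure_centralizer hg fun h _ => br_two_comm _ _
  refine ⟨(kap 2 2 b).left * cc 2 2 ^ (-j), j, ?_⟩
  have hc : Commute (dl (cc 2 2)) (dr (twB 2 2)) := (dr_dl_comm_cc_top _).symm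
  rw [← iota_zD, ← map_zpow, ← map_mul, zD, hc.mul_zpow, map_mul dl, ← map_zpow dl, ← map_zpow dr,
    ← hj, mul_assoc, ← mul_assoc (dl (cc 2 2 ^ (-j))), ← map_mul dl, zpow_neg, inv_mul_cancel,
    map_one, one_mul]
  nth_rewrite 1 [← hb, D_eq (kap 2 2 b)]
  rfl

lemma rhoM_ker {b : Br 3} (h : rhoM b = 1) : ∃ k : ℤ, b = twB 3 3 ^ (2 * k) := by
  obtain ⟨f, j, rfl⟩ := pure_three (prm_of_rhoM h)
  obtain ⟨v, rfl⟩ := ppB_surjective f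
  rw [map_mul, map_zpow, rhoM_twB, rhoM_ppB] at h
  have h2 : FreeGroup.lift ![-(slL⁻¹ ^ 2), slR ^ 2] (v ^ 2) = 1 := by
    rw [map_pow, eq_inv_of_mul_eq_one_left h]
    rcases Int.even_or_odd j with hj | hj
    · rw [hj.neg_one_zpow]; decide
    · rw [hj.neg_one_zpow]; decide
  have hv : v = 1 := by
    have := pp_injective (h2.trans (map_one _).symm)
    rwa [pow_eq_one_iff_left (by norm_num)] at this
  subst hv
  rw [map_one, one_mul] at h
  have hj : Even j := by
    by_contra hj
    rw [Int.not_even_iff_odd] at hj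
    rw [hj.neg_one_zpow] at h
    exact absurd h (by decide)
  obtain ⟨k, rfl⟩ := hj
  exact ⟨k, by rw [map_one, map_one, map_one, one_mul, two_mul]⟩

end BraidB

namespace BraidB

/-- A commutative free group is cyclic. -/
lemma free_comm_cyclic {G : Type*} [Group G] [IsFreeGroup G] (h : ∀ a b : G, a * b = b * a) :
    ∃ c : G, ∀ g, ∃ n : ℤ, g = c ^ n := by
  set e := IsFreeGroup.mulEquiv G
  have hs : ∀ i j : IsFreeGroup.Generators G, i = j := by
    intro i j
    have := e.injective ((map_mul e (FreeGroup.of i) (FreeGroup.of j)).trans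
      ((h _ _).trans (map_mul e (FreeGroup.of j) (FreeGroup.of i)).symm))
    by_contra hij
    obtain ⟨r, hr⟩ := centralizer_of_zpow (b := i) (k := 1) one_ne_zero
      (g := FreeGroup.of j) (by rw [zpow_one]; exact this)
    have h1 := congrArg (expo j) hr
    rw [expo_self, expo_zpow, expo_of_ne hij, mul_zero] at h1
    exact one_ne_zero h1
  rcases isEmpty_or_nonempty (IsFreeGroup.Generators G) with he | ⟨⟨i⟩⟩
  · refine ⟨1, fun g => ⟨0, ?_⟩⟩
    rw [zpow_zero]
    exact e.symm.injective (Subsingleton.elim _ _)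
  · refine ⟨e (FreeGroup.of i), fun g => ?_⟩
    have hz : ∀ v : FreeGroup (IsFreeGroup.Generators G),
        v ∈ Subgroup.zpowers (FreeGroup.of i) := by
      intro v
      induction v using FreeGroup.induction_on with
      | C1 => exact one_mem _
      | of a => rw [hs a i]; exact Subgroup.mem_zpowers _
      | inv_of a ih => exact inv_mem ih
      | mul a b ha hb => exact mul_mem ha hb
    obtain ⟨n, hn⟩ := hz (e.symm g)
    refine ⟨n, ?_⟩
    rw [← map_zpow]
    exact (e.symm_apply_eq.1 hn.symm)

section Torus

local notation "F₂" => FreeGroup (Fin 2)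

/-- A generator of the discrete Heisenberg group. -/
def heisX : Matrix.SpecialLinearGroup (Fin 3) ℤ := ⟨!![1, 1, 0; 0, 1, 0; 0, 0, 1], by decide⟩
/-- A generator of the discrete Heisenberg group. -/
def heisQ : Matrix.SpecialLinearGroup (Fin 3) ℤ := ⟨!![1, 0, 0; 0, 1, 1; 0, 0, 1], by decide⟩

/-- The representation to the discrete Heisenberg group. -/
def heis : F₂ →* Matrix.SpecialLinearGroup (Fin 3) ℤ := sbT heisX heisQ

lemma heis_x : heis xT = heisX := sbT_x _ _
lemma heis_q : heis qT = heisQ := sbT_q _ _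

lemma expo_x_q : expo 0 qT = 0 := expo_of_ne (by decide)
lemma expo_q_x : expo 1 xT = 0 := expo_of_ne (by decide)
lemma expo_x_x : expo 0 xT = 1 := expo_self _
lemma expo_q_q : expo 1 qT = 1 := expo_self _

lemma heis_eq (v : F₂) : ∃ c, (heis v).1 = !![1, expo 0 v, c; 0, 1, expo 1 v; 0, 0, 1] := by
  induction v using FreeGroup.induction_on with
  | C1 => exact ⟨0, by simp [Matrix.one_fin_three]⟩
  | of a =>
    refine ⟨0, ?_⟩
    fin_cases a
    · show (heis xT).1 = !![1, expo 0 xT, 0; 0, 1, expo 1 xT; 0, 0, 1]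
      rw [heis_x, expo_x_x, expo_q_x]; rfl
    · show (heis qT).1 = !![1, expo 0 qT, 0; 0, 1, expo 1 qT; 0, 0, 1]
      rw [heis_q, expo_x_q, expo_q_q]; rfl
  | inv_of a ih =>
    obtain ⟨c, hc⟩ := ih
    refine ⟨expo 0 (FreeGroup.of a) * expo 1 (FreeGroup.of a) - c, ?_⟩
    have h1 : (heis (FreeGroup.of a)).1 * (heis (FreeGroup.of a)⁻¹).1 = 1 := by
      rw [← Matrix.SpecialLinearGroup.coe_mul, ← map_mul, mul_inv_cancel, map_one,
        Matrix.SpecialLinearGroup.coe_one]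
    have h2 : !![1, expo 0 (FreeGroup.of a)⁻¹,
        expo 0 (FreeGroup.of a) * expo 1 (FreeGroup.of a) - c;
        0, 1, expo 1 (FreeGroup.of a)⁻¹; 0, 0, 1] * (heis (FreeGroup.of a)).1 = 1 := by
      rw [hc, expo_inv, expo_inv]
      ext i j
      fin_cases i <;> fin_cases j <;> simp [Matrix.mul_apply, Fin.sum_univ_three]
      ring
    exact (left_inv_eq_right_inv h2 h1).symm
  | mul a b ha hb =>
    obtain ⟨c, hc⟩ := ha
    obtain ⟨d, hd⟩ := hb
    refine ⟨d + expo 0 a * expo 1 b + c, ?_⟩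
    rw [map_mul, Matrix.SpecialLinearGroup.coe_mul, hc, hd, expo_mul, expo_mul]
    ext i j
    fin_cases i <;> fin_cases j <;> simp [Matrix.mul_apply, Fin.sum_univ_three, add_comm]

/-- Commuting words have proportional exponents. -/
lemma expo_of_commute {a b : F₂} (h : Commute a b) : expo 0 a * expo 1 b = expo 0 b * expo 1 a := by
  obtain ⟨c, hc⟩ := heis_eq a
  obtain ⟨d, hd⟩ := heis_eq b
  have := congrArg (fun A => (heis A).1 0 2) h.eq
  simp only [map_mul, Matrix.SpecialLinearGroup.coe_mul, hc, hd] at this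
  simp [Matrix.mul_apply, Fin.sum_univ_three] at this
  linarith

/-- The commutator of the free generators is not a proper power. -/
lemma kapT_root {c : F₂} {b : ℤ} (h : kapT = c ^ b) : b = 1 ∨ b = -1 := by
  have h0 := congrArg (expo 0) h
  have h1 := congrArg (expo 1) h
  have hk0 : expo 0 kapT = 0 := by simp only [expo_mul, expo_inv, expo_x_x, expo_x_q]; ring
  have hk1 : expo 1 kapT = 0 := by simp only [expo_mul, expo_inv, expo_q_x, expo_q_q]; ring
  rw [expo_zpow, hk0] at h0
  rw [expo_zpow, hk1] at h1
  have hkc : (heis kapT).1 0 2 = 1 := by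
    simp only [map_mul, map_inv, heis_x, heis_q]
    decide
  have hb : b ≠ 0 := by
    rintro rfl
    rw [h, zpow_zero, map_one] at hkc
    exact absurd hkc (by decide)
  have hc0 : expo 0 c = 0 := by
    rcases mul_eq_zero.1 h0.symm with h | h
    · exact absurd h hb
    · exact h
  have hc1 : expo 1 c = 0 := by
    rcases mul_eq_zero.1 h1.symm with h | h
    · exact absurd h hb
    · exact h
  obtain ⟨z, hz⟩ := heis_eq c
  rw [hc0, hc1] at hz
  have key : ∀ n : ℕ, ((heis c) ^ n).1 0 2 = n * z ∧ ((heis c) ^ n).1 0 1 = 0 ∧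
      ((heis c) ^ n).1 0 0 = 1 := by
    intro n
    induction n with
    | zero => simp
    | succ n ih =>
      rw [pow_succ, Matrix.SpecialLinearGroup.coe_mul, hz]
      simp only [Matrix.mul_apply, Fin.sum_univ_three, ih]
      simp
      ring
  obtain ⟨n, rfl | rfl⟩ := b.eq_nat_or_neg
  · rw [h, map_zpow, zpow_natCast, (key n).1] at hkc
    exact Or.inl (Int.eq_one_of_mul_eq_one_right (by omega) hkc)
  · right
    have hki : (heis kapT⁻¹).1 0 2 = -1 := by
      simp only [map_mul, map_inv, heis_x, heis_q]
      decide
    rw [h, ← zpow_neg, neg_neg, map_zpow, zpow_natCast, (key n).1] at hki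
    have : (n : ℤ) * (-z) = 1 := by linarith
    have := Int.eq_one_of_mul_eq_one_right (by omega) this
    rw [this]

lemma kapT_centralizer {k : ℤ} (hk : k ≠ 0) {g : F₂} (h : Commute (kapT ^ k) g) :
    ∃ m : ℤ, g = kapT ^ m := by
  have hc : g * kapT * g⁻¹ = kapT := by
    have : (g * kapT * g⁻¹) ^ k = kapT ^ k := by
      rw [conj_zpow, ← h.eq, mul_inv_cancel_right]
    exact zpow_left_injective hk this
  have hcomm : Commute g kapT := mul_inv_eq_iff_eq_mul.1 hc
  let H : Subgroup F₂ := Subgroup.closure {g, kapT}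
  have hH : ∀ a b : H, a * b = b * a := by
    have := fun a b ha hb => Subgroup.closure_induction₂ (x := a) (y := b) (k := ({g, kapT} : Set F₂))
      (p := fun a b _ _ => Commute a b)
      (by
        rintro a b (rfl | rfl) (rfl | rfl)
        · exact Commute.refl _
        · exact hcomm
        · exact hcomm.symm
        · exact Commute.refl _) (fun a _ => Commute.one_left _) (fun a _ => Commute.one_right _)
      (fun a b c _ _ _ h1 h2 => h1.mul_left h2) (fun a b c _ _ _ h1 h2 => h1.mul_right h2)
      (fun a b _ _ h => h.inv_left) (fun a b _ _ h => h.inv_right) ha hb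
    exact fun a b => Subtype.ext (this a b a.2 b.2)
  obtain ⟨c, hc⟩ := free_comm_cyclic hH
  obtain ⟨a, ha⟩ := hc ⟨g, Subgroup.subset_closure (Or.inl rfl)⟩
  obtain ⟨b, hb⟩ := hc ⟨kapT, Subgroup.subset_closure (Or.inr rfl)⟩
  have ha := congrArg Subtype.val ha
  have hb := congrArg Subtype.val hb
  rw [Subgroup.coe_zpow] at ha hb
  dsimp only at ha hb
  rcases kapT_root hb with rfl | rfl
  · exact ⟨a, by rw [ha, hb, zpow_one]⟩
  · refine ⟨-a, ?_⟩
    rw [ha, hb, ← zpow_mul]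
    congr 1
    ring

end Torus

end BraidB

namespace BraidB


lemma slL_zpow_one : (slL ^ (1 : ℤ)).1 = !![1, -1; 0, 1] := by decide

lemma slL_zpow_neg : (slL ^ (-1 : ℤ)).1 = !![1, 1; 0, 1] := by decide

lemma slR_zpow_one : (slR ^ (1 : ℤ)).1 = !![1, 0; 1, 1] := by decide

lemma slR_zpow_neg : (slR ^ (-1 : ℤ)).1 = !![1, 0; -1, 1] := by decide

/-- An intertwiner between the standard pair and another pair of unimodular matrices is
proportional to a unimodular one, up to a reflection. -/
lemma exists_sl_of_intertwine {T : Matrix (Fin 2) (Fin 2) ℤ} (hT : T.det ≠ 0)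
    {A B : Matrix.SpecialLinearGroup (Fin 2) ℤ} (hA : A.1 * T = T * slL.1)
    (hB : B.1 * T = T * slR.1) :
    ∃ (g : Matrix.SpecialLinearGroup (Fin 2) ℤ) (ε : ℤ), (ε = 1 ∨ ε = -1) ∧
      A = g * slL ^ ε * g⁻¹ ∧ B = g * slR ^ ε * g⁻¹ := by
  have hne : ¬ (T 0 0 = 0 ∧ T 1 0 = 0) := by
    rintro ⟨h0, h1⟩
    rw [Matrix.det_fin_two, h0, h1] at hT
    simp at hT
  have hd : (Int.gcd (T 0 0) (T 1 0) : ℤ) ≠ 0 := by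
    rw [Ne, Int.natCast_eq_zero, Int.gcd_eq_zero_iff]
    exact hne
  set d : ℤ := (Int.gcd (T 0 0) (T 1 0) : ℤ) with hdd
  obtain ⟨a, ha⟩ := Int.gcd_dvd_left (T 0 0) (T 1 0)
  obtain ⟨c, hc⟩ := Int.gcd_dvd_right (T 0 0) (T 1 0)
  rw [← hdd] at ha hc
  obtain ⟨p, q, hpq⟩ : ∃ p q : ℤ, a * p + c * q = 1 := by
    refine ⟨Int.gcdA (T 0 0) (T 1 0), Int.gcdB (T 0 0) (T 1 0), ?_⟩
    have := Int.gcd_eq_gcd_ab (T 0 0) (T 1 0)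
    rw [← hdd] at this
    apply mul_left_cancel₀ hd
    linear_combination -this - Int.gcdA (T 0 0) (T 1 0) * ha - Int.gcdB (T 0 0) (T 1 0) * hc
  let g1 : Matrix.SpecialLinearGroup (Fin 2) ℤ := ⟨!![a, -q; c, p], by
    rw [Matrix.det_fin_two_of]; linear_combination hpq⟩
  obtain ⟨y, D, hT'⟩ : ∃ y D : ℤ, T = g1.1 * !![d, y; 0, D] := by
    refine ⟨p * T 0 1 + q * T 1 1, -c * T 0 1 + a * T 1 1, ?_⟩
    ext i j
    fin_cases i <;> fin_cases j <;> simp [g1, Matrix.mul_apply, Fin.sum_univ_two]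
    · linear_combination ha
    · linear_combination -(T 0 1) * hpq
    · linear_combination hc
    · linear_combination -(T 1 1) * hpq
  have hinv : g1⁻¹.1 * g1.1 = 1 := by
    rw [← Matrix.SpecialLinearGroup.coe_mul, inv_mul_cancel, Matrix.SpecialLinearGroup.coe_one]
  have conj : ∀ {C : Matrix.SpecialLinearGroup (Fin 2) ℤ} {M : Matrix (Fin 2) (Fin 2) ℤ},
      C.1 * T = T * M → (g1⁻¹ * C * g1).1 * !![d, y; 0, D] = !![d, y; 0, D] * M := by
    intro C M h
    rw [hT', Matrix.mul_assoc g1.1] at h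
    have h := congrArg (g1⁻¹.1 * ·) h
    simp only [← Matrix.mul_assoc, hinv, Matrix.one_mul] at h
    simpa only [Matrix.SpecialLinearGroup.coe_mul] using h
  have hA1 := conj hA
  have hB1 := conj hB
  have dA := (g1⁻¹ * A * g1).2
  have dB := (g1⁻¹ * B * g1).2
  rw [Matrix.det_fin_two] at dA dB
  have A00 := congrFun₂ hA1 0 0
  have A01 := congrFun₂ hA1 0 1
  have A10 := congrFun₂ hA1 1 0
  have A11 := congrFun₂ hA1 1 1
  have B00 := congrFun₂ hB1 0 0
  have B01 := congrFun₂ hB1 0 1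
  have B10 := congrFun₂ hB1 1 0
  have B11 := congrFun₂ hB1 1 1
  clear hA1 hB1
  simp only [Matrix.mul_apply, Fin.sum_univ_two, slL, slR] at A00 A01 A10 A11 B00 B01 B10 B11
  generalize hA' : g1⁻¹ * A * g1 = A' at *
  generalize hB' : g1⁻¹ * B * g1 = B' at *
  simp at A00 A01 A10 A11 B00 B01 B10 B11
  have a00 : A'.1 0 0 = 1 := mul_right_cancel₀ hd (by rw [A00, one_mul])
  have a10 : A'.1 1 0 = 0 := A10.resolve_right hd
  have a11 : A'.1 1 1 = 1 := by rw [a00, a10] at dA; linarith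
  have hbc : A'.1 0 1 * B'.1 1 0 = -1 := mul_right_cancel₀ hd (by
    rw [a00] at A01; linear_combination A01 + A'.1 0 1 * B10)
  set m := B'.1 0 0 - 1 with hm
  have b00 : B'.1 0 0 = m + 1 := by ring
  have hy : y = m * d := by linear_combination -B00
  have b11 : B'.1 1 1 = 1 - m := by
    have hD : D ≠ 0 := by
      rw [← B10]
      refine mul_ne_zero ?_ hd
      intro h0
      rw [h0] at hbc
      simp at hbc
    apply mul_right_cancel₀ hD
    linear_combination B11 - B'.1 1 0 * hy - m * B10
  have hγ : B'.1 1 0 = 1 ∨ B'.1 1 0 = -1 :=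
    Int.isUnit_iff.1 (IsUnit.of_mul_eq_one (-A'.1 0 1) (by linear_combination -hbc))
  obtain ⟨g2, hg2⟩ : ∃ g2 : Matrix.SpecialLinearGroup (Fin 2) ℤ,
      g2.1 = !![1, m * B'.1 1 0; 0, 1] := ⟨⟨_, by simp [Matrix.det_fin_two_of]⟩, rfl⟩
  obtain ⟨γ, hγd⟩ : ∃ γ : ℤ, B'.1 1 0 = γ := ⟨_, rfl⟩
  rw [hγd] at hγ hbc hg2
  clear_value g1
  refine ⟨g1 * g2, γ, hγ, ?_, ?_⟩
  · have : A = g1 * A' * g1⁻¹ := by rw [← hA']; group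
    rw [this, _root_.mul_inv_rev, ← mul_assoc, mul_left_inj, mul_assoc, mul_assoc, mul_right_inj,
      ← mul_assoc, eq_mul_inv_iff_mul_eq]
    apply Subtype.ext
    rcases hγ with rfl | rfl
    · rw [Matrix.SpecialLinearGroup.coe_mul, Matrix.SpecialLinearGroup.coe_mul, slL_zpow_one, hg2]
      ext i j
      fin_cases i <;> fin_cases j <;>
        simp [Matrix.mul_apply, Fin.sum_univ_two, a00, a10, a11]
      linarith
    · rw [Matrix.SpecialLinearGroup.coe_mul, Matrix.SpecialLinearGroup.coe_mul, slL_zpow_neg, hg2]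
      ext i j
      fin_cases i <;> fin_cases j <;>
        simp [Matrix.mul_apply, Fin.sum_univ_two, a00, a10, a11]
      linarith
  · have : B = g1 * B' * g1⁻¹ := by rw [← hB']; group
    rw [this, _root_.mul_inv_rev, ← mul_assoc, mul_left_inj, mul_assoc, mul_assoc, mul_right_inj,
      ← mul_assoc, eq_mul_inv_iff_mul_eq]
    have b01 : B'.1 0 1 * γ = -m ^ 2 := by
      rw [b11, b00, hγd] at dB
      linear_combination -dB
    apply Subtype.ext
    rcases hγ with rfl | rfl
    · rw [Matrix.SpecialLinearGroup.coe_mul, Matrix.SpecialLinearGroup.coe_mul, slR_zpow_one, hg2]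
      ext i j
      fin_cases i <;> fin_cases j <;>
        simp [Matrix.mul_apply, Fin.sum_univ_two, b00, hγd, b11]
      all_goals first | ring1 | linear_combination b01
    · rw [Matrix.SpecialLinearGroup.coe_mul, Matrix.SpecialLinearGroup.coe_mul, slR_zpow_neg, hg2]
      ext i j
      fin_cases i <;> fin_cases j <;>
        simp [Matrix.mul_apply, Fin.sum_univ_two, b00, hγd, b11]
      all_goals first | ring1 | linear_combination -b01

end BraidB

namespace BraidB

section Torus
local notation "F₂" => FreeGroup (Fin 2)

lemma prm_hom_eq {n : ℕ} {θ : Br n →* Br n}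
    (hp : ∀ i, i + 1 < n → prm n (θ (sg n i)) = Equiv.swap i (i + 1)) (g : Br n) :
    prm n (θ g) = prm n g := by
  have : (prm n).comp θ = prm n := Br.hom_ext fun i hi => by
    rw [MonoidHom.comp_apply, hp i hi, prm_sg hi]
  exact DFunLike.congr_fun this g

/-- The exceptional homomorphism from four strands to three. -/
abbrev resT : Br 4 →* Br 3 := prT.comp toET

lemma resT_zero : resT (sg 4 0) = sg 3 0 := by
  rw [MonoidHom.comp_apply, toET_zero]; rfl

lemma resT_one : resT (sg 4 1) = sg 3 1 := by
  rw [MonoidHom.comp_apply, toET_one]; rfl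

lemma resT_two : resT (sg 4 2) = sg 3 0 := by
  rw [MonoidHom.comp_apply, toET_two, map_mul]
  show 1 * sg 3 0 = _
  rw [one_mul]

lemma prm_resT_of_pure {b : Br 4} (h : prm 4 b = 1) : prm 3 (resT b) = 1 := by
  have hh : ((prm 3).comp resT).comp (iota 3) = (prm 3).comp pr := by
    refine D.hom_ext (fun i hi => ?_) ?_
    · simp only [MonoidHom.comp_apply]
      rw [iota_sg hi]
      obtain rfl | rfl : i = 0 ∨ i = 1 := by omega
      · exact congrArg _ resT_zero
      · exact congrArg _ resT_one
    · rw [MonoidHom.comp_apply, iota_x (by omega), MonoidHom.comp_apply, map_pow]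
      show prm 3 (resT (sg 4 2) ^ 2) = _
      rw [resT_two, map_pow, prm_sg (by omega), pow_two, Equiv.swap_mul_self]
      exact (map_one (prm 3)).symm
  have hb : iota 3 (kap 3 3 b) = b := iota_kap (by rw [h]; rfl)
  have := DFunLike.congr_fun hh (kap 3 3 b)
  simp only [MonoidHom.comp_apply] at this
  rw [hb] at this
  exact this.trans ((prm_pr_kap (by rw [h]; rfl)).trans h)

lemma pure_three_sq {a b : Br 3} (ha : prm 3 a = 1) (hb : prm 3 b = 1) (h : a ^ 2 = b ^ 2) :
    a = b := by
  obtain ⟨f, j, rfl⟩ := pure_three ha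
  obtain ⟨f', j', rfl⟩ := pure_three hb
  have c : ∀ k : ℤ, ∀ g, Commute (twB 3 3 ^ k) g := fun k g => (twB_central g).zpow_left k
  rw [(c j _).symm.mul_pow, (c j' _).symm.mul_pow] at h
  have key : ∀ {A A' z : Br 3}, (∀ g, Commute z g) → A ^ 2 * (z ^ j) ^ 2 = A' ^ 2 * (z ^ j') ^ 2 →
      A ^ 2 * (A' ^ 2)⁻¹ = z ^ (2 * (j' - j)) := by
    intro A A' z hz h
    rw [mul_inv_eq_iff_eq_mul, ((hz (A' ^ 2)).zpow_left _).eq, ← mul_left_inj ((z ^ j) ^ 2), h,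
      mul_assoc, mul_right_inj]
    simp only [pow_two, ← zpow_add]
    congr 1
    ring
  have h2 : iota 2 (dl (f ^ 2 * (f' ^ 2)⁻¹)) = iota 2 (zD 2 ^ (2 * (j' - j))) := by
    rw [map_zpow, iota_zD, map_mul, map_mul, map_inv, map_inv, map_pow, map_pow, map_pow, map_pow]
    exact key (fun g => twB_central g) h
  have h3 := iota_injective h2
  have h4 := congrArg (fun d : D 2 => dgB (pr d)) h3
  have h5 : j' = j := by
    simp only [map_zpow, dgB_zpow, zD, map_mul, SemidirectProduct.rightHom_inl,
      SemidirectProduct.rightHom_inr, one_mul, dgB_tw le_rfl, dgB_one] at h4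
    norm_num at h4
    omega
  subst h5
  rw [sub_self, mul_zero, zpow_zero, ← map_one dl] at h3
  have h6 := mul_inv_eq_one.1 (SemidirectProduct.inl_injective h3)
  rw [pow_left_injective two_ne_zero h6]

/-- A homomorphism lifting the standard permutations identifies the images of the outer
generators under the exceptional homomorphism. -/
lemma resT_hom_two {θ : Br 4 →* Br 4}
    (hp : ∀ i, i + 1 < 4 → prm 4 (θ (sg 4 i)) = Equiv.swap i (i + 1)) :
    resT (θ (sg 4 2)) = resT (θ (sg 4 0)) := by
  have hpθ := prm_hom_eq hp
  set g : Br 4 := ew (sg 4) 3 ^ 2 with hg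
  have hg2 : g ^ 2 = twB 4 4 := by rw [hg, ← pow_mul]; rfl
  have hg0 : g * sg 4 0 = sg 4 2 * g :=
    ew_shift_pow (braidRel_sg 4) (k := 3) (i := 0) (j := 2) (by omega) (by omega)
  have hw : prm 3 (resT (θ g)) = 1 := by
    have h1 : prm 4 (θ g * g⁻¹) = 1 := by rw [map_mul, hpθ, map_inv, mul_inv_cancel]
    have h2 := prm_resT_of_pure h1
    have h3 : prm 3 (resT g) = 1 := by
      have : resT g = (sg 3 0 * sg 3 1 * sg 3 0) ^ 2 := by
        rw [hg, map_pow, ew_succ, ew_succ, ew_succ, ew_zero, one_mul, map_mul, map_mul, resT_zero,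
          resT_one, resT_two]
      rw [this, map_pow, map_mul, map_mul, prm_sg (by omega), prm_sg (by omega)]
      have e : Equiv.swap 0 (0 + 1) * Equiv.swap 1 (1 + 1) * Equiv.swap 0 (0 + 1)
          = Equiv.swap 0 2 := by
        have := Equiv.swap_mul_swap_mul_swap (x := 2) (y := 1) (z := 0) (by decide) (by decide)
        rw [Equiv.swap_comm 0 (0 + 1), Equiv.swap_comm 1 (1 + 1)]
        exact this
      rw [e, pow_two, Equiv.swap_mul_self]
    rw [map_mul, map_inv, map_mul, map_inv, h3, inv_one, mul_one] at h2
    exact h2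
  set w := resT (θ g) with hwd
  set y := resT (θ (sg 4 0)) with hy
  have hc : Commute (w ^ 2) y := by
    rw [hwd, hy, ← map_pow, ← map_pow, hg2]
    exact ((twB_central (sg 4 0)).map θ).map resT
  have h1 : y * w * y⁻¹ = w := by
    refine pure_three_sq ?_ hw ?_
    · rw [map_mul, map_mul, hw, mul_one, map_inv, mul_inv_cancel]
    · rw [conj_pow, ← hc.eq, mul_inv_cancel_right]
  have h2 : w * y = resT (θ (sg 4 2)) * w := by
    rw [hwd, hy, ← map_mul, ← map_mul, hg0, map_mul, map_mul]
  rw [← mul_left_inj w, ← h2, ← mul_inv_eq_iff_eq_mul.1 h1]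

lemma resT_hom_x {θ : Br 4 →* Br 4}
    (hp : ∀ i, i + 1 < 4 → prm 4 (θ (sg 4 i)) = Equiv.swap i (i + 1)) (v : F₂) :
    prT (toET (θ (ofET (elT v)))) = 1 := by
  have h0 : resT (θ xB) = 1 := by
    rw [xB, map_mul, map_mul, map_inv, map_inv, resT_hom_two hp, mul_inv_cancel]
  have h1 : resT (θ qB) = 1 := by
    rw [qB, map_mul, map_mul, map_mul, map_inv, map_inv, map_mul, map_mul, map_mul, map_inv,
      map_inv, h0]
    group
  have : ((resT.comp θ).comp (ofET.comp elT)) = 1 := by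
    refine freeTwo_hom_ext ?_ ?_
    · show resT (θ (ofET (elT xT))) = 1
      rw [ofET_elT, sbT_x, h0]
    · show resT (θ (ofET (elT qT))) = 1
      rw [ofET_elT, sbT_q, h1]
  exact DFunLike.congr_fun this v

end Torus
end BraidB

namespace BraidB

section Torus
local notation "F₂" => FreeGroup (Fin 2)

lemma exists_restrict_free {Φ : ET →* ET} (h : ∀ v, prT (Φ (elT v)) = 1) :
    ∃ τ : F₂ →* F₂, ∀ v, Φ (elT v) = elT (τ v) := by
  refine ⟨MonoidHom.mk' (fun v => (Φ (elT v)).left) fun a b => ?_, fun v => ?_⟩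
  · rw [map_mul, map_mul, SemidirectProduct.mul_left]
    have : (Φ (elT a)).right = 1 := h a
    rw [this, map_one, MulAut.one_apply]
  · exact SemidirectProduct.ext rfl (h v)

lemma exists_erT_form (Φ : ET →* ET) (b : Br 3) :
    ∃ t, Φ (erT b) = elT t * erT (prT (Φ (erT b))) :=
  ⟨(Φ (erT b)).left, (SemidirectProduct.inl_left_mul_inr_right _).symm⟩

lemma free_intertwine {Φ : ET →* ET} {τ : F₂ →* F₂} (h : ∀ v, Φ (elT v) = elT (τ v)) {b c : Br 3}
    {t : F₂} (ht : Φ (erT b) = elT t * erT c) (v : F₂) :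
    τ (acT b v) = t * acT c (τ v) * t⁻¹ := by
  apply SemidirectProduct.inl_injective (φ := acT)
  rw [eq_comm, map_mul, map_mul, map_inv, mul_inv_eq_iff_eq_mul]
  have h1 := congrArg Φ (erT_elT b v)
  rw [map_mul, map_mul, h, h, ht, mul_assoc, erT_elT] at h1
  rw [← mul_left_inj (erT c)]
  simpa only [mul_assoc] using h1

/-- The action of an endomorphism of the free group on the abelianisation. -/
noncomputable def matT (f : F₂ →* F₂) : Matrix (Fin 2) (Fin 2) ℤ :=
  Matrix.of fun i j => expo i (f (FreeGroup.of j))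

lemma expo_hom (f : F₂ →* F₂) (i : Fin 2) (v : F₂) :
    expo i (f v) = matT f i 0 * expo 0 v + matT f i 1 * expo 1 v := by
  induction v using FreeGroup.induction_on with
  | C1 => simp
  | of a =>
    fin_cases a
    · show expo i (f xT) = _ * expo 0 xT + _ * expo 1 xT
      rw [expo_x_x, expo_q_x]; simp [matT]
    · show expo i (f qT) = _ * expo 0 qT + _ * expo 1 qT
      rw [expo_x_q, expo_q_q]; simp [matT]
  | inv_of a ih => simp only [map_inv, expo_inv] at ih ⊢; rw [ih]; ring
  | mul a b ha hb => rw [map_mul, expo_mul, expo_mul, expo_mul, ha, hb]; ring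

lemma matT_comp (f g : F₂ →* F₂) : matT (f.comp g) = matT f * matT g := by
  ext i j
  rw [Matrix.mul_apply, Fin.sum_univ_two]
  exact expo_hom f i _

lemma matT_id : matT (MonoidHom.id _) = 1 := by
  ext i j
  fin_cases i <;> fin_cases j
  · exact expo_x_x
  · exact expo_x_q
  · exact expo_q_x
  · exact expo_q_q

lemma matT_acT (b : Br 3) : matT (acT b).toMonoidHom = (rhoM b).1 := by
  induction b using Br.induction with
  | h1 => rw [map_one, map_one]; exact matT_id
  | hs i hi =>
    obtain rfl | rfl : i = 0 ∨ i = 1 := by omega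
    · rw [acT_zero, rhoM_zero]
      ext i j
      fin_cases j
      · show expo i (twT0 xT) = _
        rw [twT0_x]; fin_cases i <;> simp [slL, expo_q_x]
      · show expo i (twT0 qT) = _
        rw [twT0_q]; fin_cases i <;> simp [slL, expo_q_x, expo_x_q]
    · rw [acT_one, rhoM_one]
      ext i j
      fin_cases j
      · show expo i (twT1 xT) = _
        rw [twT1_x]; fin_cases i <;> simp [slR, expo_q_x, expo_x_q]
      · show expo i (twT1 qT) = _
        rw [twT1_q]; fin_cases i <;> simp [slR, expo_x_q]
  | hm a b ha hb =>
    rw [map_mul, map_mul, Matrix.SpecialLinearGroup.coe_mul, ← ha, ← hb, ← matT_comp]; rfl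
  | hi a ha =>
    have h1 : matT (acT a).toMonoidHom * matT (acT a⁻¹).toMonoidHom = 1 := by
      rw [← matT_comp, ← matT_id]
      congr 1
      ext v : 1
      rw [map_inv]
      exact MulAut.apply_inv_self (M := F₂) (acT a) _
    have h2 : (rhoM a⁻¹).1 * (rhoM a).1 = 1 := by
      rw [← Matrix.SpecialLinearGroup.coe_mul, ← map_mul, inv_mul_cancel, map_one,
        Matrix.SpecialLinearGroup.coe_one]
    rw [ha] at h1
    exact (left_inv_eq_right_inv h2 h1).symm

lemma mat_intertwine {Φ : ET →* ET} {τ : F₂ →* F₂} (h : ∀ v, Φ (elT v) = elT (τ v)) (b : Br 3) :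
    (rhoM (prT (Φ (erT b)))).1 * matT τ = matT τ * (rhoM b).1 := by
  obtain ⟨t, ht⟩ := exists_erT_form Φ b
  rw [← matT_acT, ← matT_acT, ← matT_comp, ← matT_comp]
  ext i j
  show expo i (acT _ (τ (FreeGroup.of j))) = expo i (τ (acT b (FreeGroup.of j)))
  rw [free_intertwine h ht]
  simp only [expo_mul, expo_inv]
  ring

/-- The outer part of an endomorphism with nonzero determinant. -/
lemma outer_form {Φ : ET →* ET} {τ : F₂ →* F₂} (h : ∀ v, Φ (elT v) = elT (τ v))
    (hdet : (matT τ).det ≠ 0) : ∃ (γ : Br 3) (ε k : ℤ), (ε = 1 ∨ ε = -1) ∧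
      ∀ i, i + 1 < 3 → prT (Φ (erT (sg 3 i))) = γ * (sg 3 i ^ ε * twB 3 3 ^ (2 * k)) * γ⁻¹ := by
  have h0 := mat_intertwine h (sg 3 0)
  have h1 := mat_intertwine h (sg 3 1)
  rw [rhoM_zero] at h0
  rw [rhoM_one] at h1
  obtain ⟨g, ε, hε, hA, hB⟩ := exists_sl_of_intertwine hdet h0 h1
  obtain ⟨γ, rfl⟩ := rhoM_surjective g
  have key : ∀ {a s : Br 3}, rhoM a = rhoM γ * rhoM s ^ ε * (rhoM γ)⁻¹ →
      ∃ k : ℤ, a = γ * (s ^ ε * twB 3 3 ^ (2 * k)) * γ⁻¹ := by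
    intro a s e
    obtain ⟨k, hk⟩ := rhoM_ker (b := (s ^ ε)⁻¹ * (γ⁻¹ * a * γ)) (by
      rw [map_mul, map_mul, map_mul, e, map_inv, map_inv, map_zpow]; group)
    refine ⟨k, ?_⟩
    rw [← hk]; group
  rw [← rhoM_zero] at hA
  rw [← rhoM_one] at hB
  obtain ⟨k0, hk0⟩ := key hA
  obtain ⟨k1, hk1⟩ := key hB
  have hc : k1 = k0 := by
    have hb := (braidRel_sg 3).braid 0 (by omega)
    have := congrArg (fun g => dgB (prT (Φ (erT g)))) hb
    simp only [map_mul, zero_add] at this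
    rw [hk0, hk1] at this
    have d0 : dgB (sg 3 0) = 1 := dgB_sg (by omega)
    have d1 : dgB (sg 3 1) = 1 := dgB_sg (by omega)
    simp only [dgB_mul, dgB_inv, dgB_zpow, d0, d1, dgB_tw le_rfl] at this
    norm_num at this
    linarith
  subst hc
  refine ⟨γ, ε, k1, hε, fun i hi => ?_⟩
  obtain rfl | rfl : i = 0 ∨ i = 1 := by omega
  · exact hk0
  · exact hk1

end Torus
end BraidB

namespace BraidB

section Torus
local notation "F₂" => FreeGroup (Fin 2)

lemma prm_xB : prm 4 xB = Equiv.swap 0 1 * Equiv.swap 2 3 := by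
  rw [xB, map_mul, map_inv, prm_sg (by omega), prm_sg (by omega), Equiv.swap_inv]

lemma prm_qB : prm 4 qB = Equiv.swap 0 3 * Equiv.swap 1 2 := by
  rw [qB, map_mul, map_mul, map_mul, map_inv, map_inv, prm_xB, prm_sg (by omega), Equiv.swap_inv]
  congr 1
  ext n
  match n with
  | 0 => decide
  | 1 => decide
  | 2 => decide
  | 3 => decide
  | n + 4 => simp [Equiv.swap_apply_of_ne_of_ne]

lemma even_of_commuting_involutions {X Q : Equiv.Perm ℕ} (hXQ : X * Q = Q * X) (hX : X ^ 2 = 1)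
    (hQ : Q ^ 2 = 1) (h1 : X 0 ≠ 0) (h2 : Q 0 ≠ 0) (h3 : X (Q 0) ≠ 0) {v : F₂}
    (h : sbT X Q v = 1) : Even (expo 0 v) ∧ Even (expo 1 v) := by
  have hform : sbT X Q v = X ^ expo 0 v * Q ^ expo 1 v := by
    have hc : Commute X Q := hXQ
    clear h
    induction v using FreeGroup.induction_on with
    | C1 => simp
    | of a =>
      fin_cases a
      · show sbT X Q xT = _ ^ expo 0 xT * _ ^ expo 1 xT
        rw [sbT_x, expo_x_x, expo_q_x]; simp
      · show sbT X Q qT = _ ^ expo 0 qT * _ ^ expo 1 qT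
        rw [sbT_q, expo_x_q, expo_q_q]; simp
    | inv_of a ih =>
      rw [map_inv, ih, expo_inv, expo_inv, mul_inv_rev, zpow_neg, zpow_neg]
      exact ((hc.zpow_zpow _ _).inv_inv).symm.eq
    | mul a b ha hb =>
      rw [map_mul, ha, hb, expo_mul, expo_mul, zpow_add, zpow_add, mul_assoc, mul_assoc,
        ← mul_assoc (Q ^ _), (hc.symm.zpow_zpow _ _).eq, mul_assoc]
  rw [hform] at h
  have hpar : ∀ {Y : Equiv.Perm ℕ}, Y ^ 2 = 1 → ∀ k : ℤ, (Even k ∧ Y ^ k = 1) ∨ (¬ Even k ∧ Y ^ k = Y) := by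
    intro Y hY k
    rcases Int.even_or_odd' k with ⟨j, rfl | rfl⟩
    · exact Or.inl ⟨even_two_mul j, by rw [zpow_mul, zpow_ofNat, hY, one_zpow]⟩
    · exact Or.inr ⟨by simp, by rw [zpow_add, zpow_mul, zpow_ofNat, hY, one_zpow, one_mul, zpow_one]⟩
  rcases hpar hX (expo 0 v) with ⟨ha, ha2⟩ | ⟨ha, ha2⟩ <;>
    rcases hpar hQ (expo 1 v) with ⟨hb, hb2⟩ | ⟨hb, hb2⟩ <;> rw [ha2, hb2] at h
  · exact ⟨ha, hb⟩
  · exact absurd (DFunLike.congr_fun h 0) h2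
  · exact absurd (DFunLike.congr_fun h 0) h1
  · exact absurd (DFunLike.congr_fun h 0) h3

lemma even_of_pure {v : F₂} (h : prm 4 (ofET (elT v)) = 1) :
    Even (expo 0 v) ∧ Even (expo 1 v) := by
  have e : sbT (prm 4 xB) (prm 4 qB) v = 1 := by
    rw [← h, ofET_elT]
    have : (prm 4).comp (sbT xB qB) = sbT (prm 4 xB) (prm 4 qB) :=
      freeTwo_hom_ext (by simp) (by simp)
    exact (DFunLike.congr_fun this v).symm
  rw [prm_xB, prm_qB] at e
  refine even_of_commuting_involutions ?_ ?_ ?_ (by decide) (by decide) (by decide) e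
  · ext n
    match n with
    | 0 => decide
    | 1 => decide
    | 2 => decide
    | 3 => decide
    | n + 4 => simp [Equiv.swap_apply_of_ne_of_ne]
  · ext n
    match n with
    | 0 => decide
    | 1 => decide
    | 2 => decide
    | 3 => decide
    | n + 4 => simp [Equiv.swap_apply_of_ne_of_ne, pow_two]
  · ext n
    match n with
    | 0 => decide
    | 1 => decide
    | 2 => decide
    | 3 => decide
    | n + 4 => simp [Equiv.swap_apply_of_ne_of_ne, pow_two]

lemma matT_det_ne_zero {θ : Br 4 →* Br 4}
    (hp : ∀ i, i + 1 < 4 → prm 4 (θ (sg 4 i)) = Equiv.swap i (i + 1)) {τ : F₂ →* F₂}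
    (h : ∀ v, toET (θ (ofET (elT v))) = elT (τ v)) : (matT τ).det ≠ 0 := by
  have hev : ∀ v, Even (expo 0 (τ v * v⁻¹)) ∧ Even (expo 1 (τ v * v⁻¹)) := by
    intro v
    apply even_of_pure
    rw [map_mul, map_mul, ← h, ofET_toET, map_mul, prm_hom_eq hp, map_inv, map_inv, map_inv,
      mul_inv_cancel]
  obtain ⟨⟨a, ha⟩, ⟨b, hb⟩⟩ := hev xT
  obtain ⟨⟨c, hc⟩, ⟨d, hd⟩⟩ := hev qT
  rw [expo_mul, expo_inv] at ha hb hc hd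
  rw [expo_x_x] at ha
  rw [expo_q_x] at hb
  rw [expo_x_q] at hc
  rw [expo_q_q] at hd
  rw [Matrix.det_fin_two]
  show expo 0 (τ xT) * expo 1 (τ qT) - expo 0 (τ qT) * expo 1 (τ xT) ≠ 0
  rw [eq_add_of_sub_eq ha, eq_add_of_sub_eq hb, eq_add_of_sub_eq hc, eq_add_of_sub_eq hd]
  intro h0
  have : 2 * (a + d + 2 * a * d - 2 * b * c) + 1 = 0 := by linear_combination h0
  omega

end Torus
end BraidB

namespace BraidB

section Torus
local notation "F₂" => FreeGroup (Fin 2)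

lemma acT_kapT (b : Br 3) : acT b kapT = kapT := by
  induction b using Br.induction with
  | h1 => rw [map_one, MulAut.one_apply]
  | hs i hi =>
    obtain rfl | rfl : i = 0 ∨ i = 1 := by omega
    · rw [acT_zero, kapT, map_mul, map_mul, map_mul, map_inv, map_inv, twT0_x, twT0_q]; group
    · rw [acT_one, kapT, map_mul, map_mul, map_mul, map_inv, map_inv, twT1_x, twT1_q]; group
  | hm a b ha hb => rw [map_mul acT, MulAut.mul_apply, hb, ha]
  | hi a ha => rw [map_inv, MulAut.inv_apply, MulEquiv.symm_apply_eq, ha]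

lemma acT_tw_sq (v : F₂) : acT (twB 3 3 ^ 2) v = kapT * v * kapT⁻¹ := by
  set f : MulAut F₂ := acT (ew (sg 3) 2) with hf
  have h1 : ∀ v, f v = twT0 (twT1 v) := fun v => by
    rw [hf, ew_succ, ew_succ, ew_zero, one_mul, map_mul, acT_zero, acT_one]; rfl
  have fx : f xT = xT * qT * xT⁻¹ := by
    rw [h1, twT1_x, map_mul, twT0_x, twT0_q, mul_assoc]
  have fq : f qT = qT * xT⁻¹ := by rw [h1, twT1_q, twT0_q]
  have f3x : (f ^ 3) xT = kapT * xT⁻¹ := by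
    show f (f (f xT)) = _
    simp only [map_mul, map_inv, fx, fq, kapT]; group
  have f3q : (f ^ 3) qT = xT * qT⁻¹ * xT⁻¹ := by
    show f (f (f qT)) = _
    simp only [map_mul, map_inv, fx, fq]; group
  have fk : (f ^ 3) kapT = kapT := by rw [hf, ← map_pow, acT_kapT]
  have key : acT (twB 3 3 ^ 2) = MulAut.conj kapT := by
    have e : acT (twB 3 3 ^ 2) = f ^ 3 * f ^ 3 := by
      rw [map_pow, pow_two]
      simp only [twB, tw, map_pow]
      rfl
    rw [e]
    refine mulAut_freeTwo_ext ?_ ?_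
    · rw [MulAut.mul_apply, f3x, map_mul, map_inv, fk, f3x, MulAut.conj_apply]; group
    · rw [MulAut.mul_apply, f3q, map_mul, map_mul, map_inv, map_inv, f3q, f3x, MulAut.conj_apply,
        kapT]
      group
  rw [key, MulAut.conj_apply]

/-- A central element of the four strand braid group. -/
def zET : ET := elT kapT⁻¹ * erT (twB 3 3 ^ 2)

lemma commute_kapT_erT (b : Br 3) : Commute (elT kapT) (erT b) := by
  have := erT_elT b kapT
  rw [acT_kapT] at this
  exact this.symm

lemma zET_central (g : ET) : Commute zET g := by
  rw [← SemidirectProduct.inl_left_mul_inr_right g]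
  refine Commute.mul_right ?_ ?_
  · rw [zET, Commute, SemiconjBy, mul_assoc, erT_elT, acT_tw_sq, map_mul, map_mul, map_inv]
    group
  · refine Commute.mul_left ?_ ?_
    · rw [map_inv]; exact (commute_kapT_erT _).inv_left
    · exact (((twB_central (n := 3) g.right).pow_left 2).map erT)

lemma not_commute_of_det {τ : F₂ →* F₂} (h : (matT τ).det ≠ 0) : ¬ Commute (τ xT) (τ qT) := by
  intro hc
  apply h
  rw [Matrix.det_fin_two]
  show expo 0 (τ xT) * expo 1 (τ qT) - expo 0 (τ qT) * expo 1 (τ xT) = 0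
  rw [expo_of_commute hc, sub_self]

lemma zpow_apply_fixed {G : Type*} [Group G] {A : MulAut G} {q : G} (hq : A q = q) (N : ℤ) :
    (A ^ N) q = q :=
  (MulAction.stabilizer (MulAut G) q).zpow_mem (x := A) hq N

lemma zpow_apply_shear {G : Type*} [Group G] {A : MulAut G} {q x : G} (hq : A q = q)
    (hx : A x = x * q) (N : ℤ) : (A ^ N) x = x * q ^ N := by
  have hqn : ∀ n : ℕ, (A ^ n) q = q := fun n => by
    have := zpow_apply_fixed hq n
    rwa [zpow_natCast] at this
  have hn : ∀ n : ℕ, (A ^ n) x = x * q ^ n := by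
    intro n
    induction n with
    | zero => simp
    | succ n ih => rw [pow_succ, MulAut.mul_apply, hx, map_mul, ih, hqn, pow_succ, mul_assoc]
  obtain ⟨n, rfl | rfl⟩ := N.eq_nat_or_neg
  · rw [zpow_natCast, zpow_natCast, hn]
  · rw [zpow_neg, MulAut.inv_apply, MulEquiv.symm_apply_eq, map_mul, zpow_natCast, hn, map_zpow,
      hqn, zpow_neg, zpow_natCast, mul_inv_cancel_right]

lemma twT1_zpow (N : ℤ) (u : F₂) : (twT1 ^ N) u = FreeGroup.lift ![xT * qT ^ N, qT] u := by
  have : (twT1 ^ N).toMonoidHom = sbT (xT * qT ^ N) qT :=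
    freeTwo_hom_ext ((zpow_apply_shear twT1_q twT1_x N).trans (sbT_x _ _).symm)
      ((zpow_apply_fixed twT1_q N).trans (sbT_q _ _).symm)
  exact DFunLike.congr_fun this u

lemma twT0_zpow (N : ℤ) (u : F₂) : (twT0 ^ N) u = FreeGroup.lift ![xT, qT * xT ^ (-N)] u := by
  have h := zpow_apply_shear (A := twT0) (q := xT⁻¹) (by rw [map_inv, twT0_x]) twT0_q N
  rw [inv_zpow'] at h
  have : (twT0 ^ N).toMonoidHom = sbT xT (qT * xT ^ (-N)) :=
    freeTwo_hom_ext ((zpow_apply_fixed twT0_x N).trans (sbT_x _ _).symm)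
      (h.trans (sbT_q _ _).symm)
  exact DFunLike.congr_fun this u

/-- An endomorphism with nonzero determinant and standard outer part sends the peripheral
commutator to a conjugate of a power of itself. -/
lemma exists_conj_kapT {Φ : ET →* ET} {τ : F₂ →* F₂} (h : ∀ v, Φ (elT v) = elT (τ v))
    (hc : ¬ Commute (τ xT) (τ qT)) {ε k : ℤ} (hε : ε = 1 ∨ ε = -1)
    (hΦ : ∀ i, i + 1 < 3 → prT (Φ (erT (sg 3 i))) = sg 3 i ^ ε * twB 3 3 ^ (2 * k)) :
    ∃ k0 : ℤ, k0 ≠ 0 ∧ IsConj (τ kapT) (kapT ^ k0) := by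
  have hε2 : ε * ε = 1 := by rcases hε with rfl | rfl <;> norm_num
  have inv : ∀ i, i + 1 < 3 → ∀ N : ℤ, IsConj ((acT (sg 3 i) ^ N) (τ kapT)) (τ kapT) := by
    intro i hi N
    obtain ⟨t, ht⟩ := exists_erT_form Φ (sg 3 i ^ (ε * N))
    have e : prT (Φ (erT (sg 3 i ^ (ε * N)))) = sg 3 i ^ N * (twB 3 3 ^ 2) ^ (k * (ε * N)) := by
      rw [map_zpow erT, map_zpow Φ, map_zpow prT, hΦ i hi,
        (((twB_central (n := 3) (sg 3 i ^ ε)).zpow_left (2 * k)).symm).mul_zpow, ← zpow_mul,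
        ← mul_assoc, hε2, one_mul, ← zpow_mul, ← zpow_natCast, ← zpow_mul]
      congr 2
      push_cast
      ring
    obtain ⟨κ, hκ⟩ : ∃ κ, κ = kapT := ⟨_, rfl⟩
    have h1 := free_intertwine h ht kapT
    rw [acT_kapT, e, map_mul acT, MulAut.mul_apply, map_zpow acT, map_zpow acT] at h1
    have h2 : acT (twB 3 3 ^ 2) = MulAut.conj kapT := by
      ext1 v; rw [acT_tw_sq, MulAut.conj_apply]
    rw [h2] at h1
    rw [← hκ] at h1 ⊢
    rw [← map_zpow MulAut.conj, MulAut.conj_apply, map_mul, map_mul, map_inv] at h1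
    exact isConj_iff.2 ⟨t * (acT (sg 3 i) ^ N) (κ ^ (k * (ε * N))), by
      exact Eq.trans (by simp only [mul_inv_rev, mul_assoc]) h1.symm⟩
  have i0 := inv 0 (by omega)
  have i1 := inv 1 (by omega)
  rw [acT_zero] at i0
  rw [acT_one] at i1
  obtain ⟨k0, hk0⟩ := conj_commutator_of_invariant (u := τ kapT) (by
    have hcm : emV (τ kapT) = emV (τ xT) * emV (τ qT) * (emV (τ xT))⁻¹ * (emV (τ qT))⁻¹ := by
      simp only [kapT, map_mul, map_inv]
    rw [hcm]
    show (emV (τ xT)).right * (emV (τ qT)).right * ((emV (τ xT)).right)⁻¹ *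
      ((emV (τ qT)).right)⁻¹ = 1
    rw [mul_comm (emV (τ xT)).right, mul_inv_cancel_right, mul_inv_cancel])
    (fun N => by rw [← twT1_zpow]; exact i1 N)
    (fun N => by
      have := twT0_zpow (-N) (τ kapT)
      rw [neg_neg] at this
      rw [← this]; exact i0 _)
  refine ⟨k0, ?_, hk0⟩
  rintro rfl
  rw [zpow_zero, isConj_one_left] at hk0
  apply hc
  have : τ xT * τ qT * (τ xT)⁻¹ * (τ qT)⁻¹ = 1 := by rw [← hk0]; simp only [kapT, map_mul, map_inv]
  exact mul_inv_eq_iff_eq_mul.1 (mul_inv_eq_one.1 this)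

end Torus
end BraidB

namespace BraidB

section Torus
local notation "F₂" => FreeGroup (Fin 2)

lemma swap_zpow {a b : ℕ} {ε : ℤ} (hε : ε = 1 ∨ ε = -1) :
    Equiv.swap a b ^ ε = Equiv.swap a b := by
  rcases hε with rfl | rfl
  · exact zpow_one _
  · rw [zpow_neg_one, Equiv.swap_inv]

/-- The normal form on the first two generators. -/
lemma exists_transvection {Φ : ET →* ET} {τ : F₂ →* F₂} (h : ∀ v, Φ (elT v) = elT (τ v))
    (hdet : (matT τ).det ≠ 0) : ∃ (Y : ET) (ε m k : ℤ), (ε = 1 ∨ ε = -1) ∧ ∀ i, i + 1 < 3 →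
      Y * Φ (erT (sg 3 i)) * Y⁻¹ = elT kapT ^ m * zET ^ k * erT (sg 3 i) ^ ε := by
  obtain ⟨γ, ε, k, hε, hγ⟩ := outer_form h hdet
  obtain ⟨Φ1, hΦ1⟩ : ∃ Φ1 : ET →* ET, ∀ g, Φ1 g = erT γ⁻¹ * Φ g * erT γ :=
    ⟨((MulAut.conj (erT γ⁻¹)).toMonoidHom).comp Φ, fun g => by
      show erT γ⁻¹ * Φ g * (erT γ⁻¹)⁻¹ = _
      rw [← map_inv, inv_inv]⟩
  obtain ⟨τ1, hτ1⟩ : ∃ τ1 : F₂ →* F₂, ∀ v, τ1 v = acT γ⁻¹ (τ v) :=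
    ⟨(acT γ⁻¹).toMonoidHom.comp τ, fun _ => rfl⟩
  have h1 : ∀ v, Φ1 (elT v) = elT (τ1 v) := fun v => by
    rw [hΦ1, hτ1, h, erT_elT, mul_assoc, ← map_mul, inv_mul_cancel, map_one, mul_one]
  have hc1 : ¬ Commute (τ1 xT) (τ1 qT) := by
    rw [hτ1, hτ1]
    intro hc
    apply not_commute_of_det hdet
    have := hc.map (acT γ⁻¹).symm.toMonoidHom
    simpa only [MulEquiv.coe_toMonoidHom, MulEquiv.symm_apply_apply] using this
  have hp1 : ∀ i, i + 1 < 3 → prT (Φ1 (erT (sg 3 i))) = sg 3 i ^ ε * twB 3 3 ^ (2 * k) := by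
    intro i hi
    rw [hΦ1, map_mul, map_mul, hγ i hi]
    show γ⁻¹ * _ * γ = _
    group
  obtain ⟨k0, hk0, hconj⟩ := exists_conj_kapT h1 hc1 hε hp1
  obtain ⟨s, hs⟩ := isConj_iff.1 hconj
  obtain ⟨Φ2, hΦ2⟩ : ∃ Φ2 : ET →* ET, ∀ g, Φ2 g = elT s * Φ1 g * (elT s)⁻¹ :=
    ⟨((MulAut.conj (elT s)).toMonoidHom).comp Φ1, fun g => rfl⟩
  obtain ⟨τ2, hτ2⟩ : ∃ τ2 : F₂ →* F₂, ∀ v, τ2 v = s * τ1 v * s⁻¹ :=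
    ⟨(MulAut.conj s).toMonoidHom.comp τ1, fun _ => rfl⟩
  have h2 : ∀ v, Φ2 (elT v) = elT (τ2 v) := fun v => by
    rw [hΦ2, hτ2, h1, map_mul, map_mul, map_inv]
  have hp2 : ∀ i, i + 1 < 3 → prT (Φ2 (erT (sg 3 i))) = sg 3 i ^ ε * twB 3 3 ^ (2 * k) := by
    intro i hi
    rw [hΦ2, map_mul, map_mul, hp1 i hi]
    show 1 * _ * 1⁻¹ = _
    group
  have hκ : τ2 kapT = kapT ^ k0 := by rw [hτ2, hs]
  have hform : ∀ i, i + 1 < 3 → ∃ m : ℤ, Φ2 (erT (sg 3 i)) =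
      elT kapT ^ m * zET ^ k * erT (sg 3 i) ^ ε := by
    intro i hi
    obtain ⟨t, ht⟩ := exists_erT_form Φ2 (sg 3 i)
    have e := free_intertwine h2 ht kapT
    rw [acT_kapT, hκ, map_zpow, acT_kapT] at e
    obtain ⟨m, rfl⟩ := kapT_centralizer hk0 (g := t) (eq_mul_inv_iff_mul_eq.1 e)
    refine ⟨m + k, ?_⟩
    rw [ht, hp2 i hi, map_zpow elT, map_mul erT, map_zpow erT, map_zpow erT]
    have hz : erT (twB 3 3) ^ (2 * k) = elT kapT ^ k * zET ^ k := by
      rw [← (zET_central (elT kapT)).symm.mul_zpow, zET, ← mul_assoc, ← map_mul, mul_inv_cancel,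
        map_one, one_mul, map_pow, zpow_mul]
      norm_cast
    rw [hz, ((commute_kapT_erT (sg 3 i)).zpow_left k |>.mul_left
      ((zET_central (erT (sg 3 i))).zpow_left k)).zpow_right ε |>.eq.symm]
    rw [zpow_add]
    simp only [mul_assoc]
  obtain ⟨m0, hm0⟩ := hform 0 (by omega)
  obtain ⟨m1, hm1⟩ := hform 1 (by omega)
  have hm : elT kapT ^ m1 = elT kapT ^ m0 := by
    have hb := congrArg Φ2 (congrArg erT ((braidRel_sg 3).braid 0 (by omega)))
    simp only [map_mul, zero_add] at hb
    have hb' : (erT (sg 3 0)) ^ ε * (erT (sg 3 1)) ^ ε * (erT (sg 3 0)) ^ ε =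
      (erT (sg 3 1)) ^ ε * (erT (sg 3 0)) ^ ε * (erT (sg 3 1)) ^ ε := by
      have := congrArg erT ((braidRel_sg 3).braid 0 (by omega))
      simp only [map_mul, zero_add] at this
      rcases hε with rfl | rfl
      · simpa only [zpow_one] using this
      · simp only [zpow_neg_one]
        have := congrArg (·⁻¹) this
        simpa only [mul_inv_rev, mul_assoc] using this
    rw [hm0, hm1] at hb
    have c : ∀ i (m : ℤ), Commute (elT kapT ^ m * zET ^ k) (erT (sg 3 i) ^ ε) := fun i m =>
      ((commute_kapT_erT (sg 3 i)).zpow_left m |>.mul_left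
      ((zET_central (erT (sg 3 i))).zpow_left k)).zpow_right ε
    have cc : Commute (elT kapT ^ m0 * zET ^ k) (elT kapT ^ m1 * zET ^ k) :=
      Commute.mul_left (Commute.mul_right (Commute.zpow_zpow_self _ _ _)
        ((zET_central _).symm.zpow_right _)) ((zET_central _).zpow_left _)
    have gen : ∀ {C D a b : ET}, Commute C a → Commute C b → Commute D a → Commute D b →
        Commute C D → a * b * a = b * a * b → C * a * (D * b) * (C * a) = D * b * (C * a) * (D * b) →
        D = C := by
      intro C D a b h1 h2 h3 h4 h5 h6 h7
      have e1 : C * a * (D * b) * (C * a) = C * D * C * (a * b * a) := by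
        simp only [mul_assoc]
        rw [← mul_assoc a D, ← h3.eq, ← mul_assoc b C, ← h2.eq]
        simp only [mul_assoc]
        rw [← mul_assoc a C, ← h1.eq]
        simp only [mul_assoc]
      have e2 : D * b * (C * a) * (D * b) = C * D * D * (a * b * a) := by
        rw [h6, h5.eq]
        simp only [mul_assoc]
        rw [← mul_assoc a D, ← h3.eq, ← mul_assoc b C, ← h2.eq]
        simp only [mul_assoc]
        rw [← mul_assoc b D, ← h4.eq]
        simp only [mul_assoc]
      rw [e1, e2, mul_left_inj, mul_right_inj] at h7
      exact h7.symm
    exact mul_right_cancel (gen (c 0 m0) (c 1 m0) (c 0 m1) (c 1 m1) cc hb' hb)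
  refine ⟨elT s * erT γ⁻¹, ε, m0, k, hε, fun i hi => ?_⟩
  have e : elT s * erT γ⁻¹ * Φ (erT (sg 3 i)) * (elT s * erT γ⁻¹)⁻¹ = Φ2 (erT (sg 3 i)) := by
    rw [hΦ2, hΦ1, mul_inv_rev, map_inv]; group
  rw [e]
  obtain rfl | rfl : i = 0 ∨ i = 1 := by omega
  · exact hm0
  · rw [hm1, hm]

end Torus
end BraidB

namespace BraidB

/-- The general inductive statement. -/
def StdLift (n : ℕ) : Prop := ∀ θ : Br n →* Br n,
  (∀ i, i + 1 < n → prm n (θ (sg n i)) = Equiv.swap i (i + 1)) → StdEnd n (fun i => θ (sg n i))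

lemma StdEnd.of_conj {n : ℕ} {s t : ℕ → Br n} (x : Br n)
    (h : ∀ i, i + 1 < n → t i = x * s i * x⁻¹) (hs : StdEnd n s) : StdEnd n t := by
  obtain ⟨y, ε, q, hε, hy⟩ := hs
  refine ⟨x * y, ε, q, hε, fun i hi => ?_⟩
  rw [h i hi, hy i hi]
  group

lemma eq_one_of_fixes {n : ℕ} {b : Br n} (h : ∀ j, j < n → prm n b j = j) : prm n b = 1 := by
  ext j
  rcases lt_or_ge j n with hj | hj
  · rw [h j hj]; rfl
  · rw [prm_of_le b hj]; rfl

lemma eq_one_of_fixes_pred {n : ℕ} {b : Br (n + 1)} (h : ∀ j, j < n → prm (n + 1) b j = j) :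
    prm (n + 1) b = 1 := by
  refine eq_one_of_fixes fun j hj => ?_
  rcases Nat.lt_succ_iff_lt_or_eq.1 hj with hj | rfl
  · exact h j hj
  · have h1 := (prm_lt_iff (n := j + 1) b).2 hj
    rcases Nat.lt_succ_iff_lt_or_eq.1 h1 with h2 | h2
    · exact (prm (j + 1) b).injective (h _ h2)
    · exact h2

lemma prm_ofET_kapT : prm 4 (ofET (elT kapT)) = 1 := by
  rw [ofET_elT]
  simp only [kapT, map_mul, map_inv, sbT_x, sbT_q]
  rw [prm_xB, prm_qB]
  ext n
  match n with
  | 0 => decide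
  | 1 => decide
  | 2 => decide
  | 3 => decide
  | n + 4 => simp [Equiv.swap_apply_of_ne_of_ne]

lemma prm_ofET_zET : prm 4 (ofET zET) = 1 := by
  rw [zET, map_mul, map_mul, map_inv elT, map_inv ofET, map_inv (prm 4), prm_ofET_kapT, inv_one,
    one_mul, ofET_erT, map_pow, map_pow, twB, tw_map,
    tw_congr (t := sg 4) (fun i hi => incT_sg (by omega))]
  have : prm 4 (twB 4 3) = 1 := prm_twB (by omega)
  rw [twB] at this
  rw [this, one_pow]

theorem stdLift_four : StdLift 4 := by
  intro θ hp
  obtain ⟨Φ, hΦ⟩ : ∃ Φ : ET →* ET, ∀ g, Φ g = toET (θ (ofET g)) :=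
    ⟨(toET.comp θ).comp ofET, fun _ => rfl⟩
  obtain ⟨τ, hτ⟩ := exists_restrict_free (Φ := Φ) fun v => by rw [hΦ]; exact resT_hom_x hp v
  obtain ⟨Y, ε, m, k, hε, hY⟩ := exists_transvection hτ
    (matT_det_ne_zero hp (τ := τ) fun v => by rw [← hΦ, hτ])
  obtain ⟨θ2, hθ2⟩ : ∃ θ2 : Br 4 →* Br 4, ∀ b, θ2 b = ofET Y * θ b * (ofET Y)⁻¹ :=
    ⟨(MulAut.conj (ofET Y)).toMonoidHom.comp θ, fun _ => rfl⟩
  obtain ⟨C, hC⟩ : ∃ C, C = ofET (elT kapT ^ m * zET ^ k) := ⟨_, rfl⟩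
  have hs : ∀ i, i + 1 < 3 → ofET (erT (sg 3 i)) = sg 4 i := fun i hi => by
    rw [ofET_erT, incT_sg hi]
  have hθs : ∀ i, i + 1 < 3 → θ2 (sg 4 i) = C * sg 4 i ^ ε := by
    intro i hi
    have := congrArg ofET (hY i hi)
    rw [map_mul, map_mul, map_inv, hΦ, ofET_toET, hs i hi, map_mul, map_zpow, hs i hi, ← hC] at this
    rw [hθ2, this]
  have hCc : ∀ i, i + 1 < 3 → Commute C (sg 4 i) := by
    intro i hi
    rw [hC, ← hs i hi]
    exact ((commute_kapT_erT (sg 3 i)).zpow_left m |>.mul_left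
      ((zET_central (erT (sg 3 i))).zpow_left k)).map ofET
  have hCp : prm 4 C = 1 := by
    rw [hC, map_mul, map_mul, map_zpow, map_zpow, map_zpow, map_zpow, prm_ofET_kapT, prm_ofET_zET,
      one_zpow, one_zpow, mul_one]
  have hP : prm 4 (ofET Y) = 1 := by
    refine eq_one_of_fixes_pred (n := 3) fun j hj => perm_eq_of_conj_swap le_rfl (fun i hi => ?_) hj
    have := congrArg (prm 4) (hθs i hi)
    rw [hθ2, map_mul, map_mul, map_inv, hp i (by omega), map_mul, hCp, one_mul, map_zpow,
      prm_sg (by omega), swap_zpow hε] at this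
    exact this
  have hp2 : ∀ i, i + 1 < 4 → prm 4 (θ2 (sg 4 i)) = Equiv.swap i (i + 1) := by
    intro i hi
    rw [hθ2, map_mul, map_mul, map_inv, hP, one_mul, inv_one, mul_one, hp i hi]
  refine StdEnd.of_conj (s := fun i => θ2 (sg 4 i)) (ofET Y)⁻¹ (fun i hi => by
    show _ = _ * θ2 (sg 4 i) * _
    rw [hθ2]; group) ?_
  refine stdEnd_succ (m := 0) θ2 hp2 ?_
  have hC3 : prm (3 + 1) C 3 = 3 := by rw [hCp]; rfl
  have hk : ∀ i, i + 1 < 3 → kap 3 3 (sg 4 i) = dr (sg 3 i) := fun i hi => by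
    rw [← iota_sg hi, kap_iota]
  have hkz : ∀ i, i + 1 < 3 → kap 3 3 (sg 4 i ^ ε) = dr (sg 3 i) ^ ε := fun i hi => by
    rw [← iota_sg hi, ← map_zpow, kap_iota]
  obtain ⟨q, hq⟩ : ∃ q : ℤ, pr (kap 3 3 C) = twB 3 3 ^ q := by
    refine pure_centralizer ((prm_pr_kap (n := 3) hC3).trans hCp) fun h hh => ?_
    clear hh
    induction h using Br.induction with
    | h1 => exact Commute.one_right _
    | hs i hi =>
      have h1 : kap 3 3 (C * sg 4 i) = kap 3 3 (sg 4 i * C) := by rw [(hCc i hi).eq]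
      rw [kap_mul_top hC3, kap_mul_top (by
        rw [prm_sg (by omega), swap_succ_of_ne (by omega) (by omega)]), hk i hi] at h1
      have h2 := congrArg pr h1
      rw [map_mul, map_mul] at h2
      exact h2
    | hm a b ha hb => exact ha.mul_right hb
    | hi a ha => exact ha.inv_right
  refine ⟨1, ε, q, hε, fun i hi => ?_⟩
  show pr (kap 3 3 (θ2 (sg 4 i))) = _
  rw [hθs i hi, kap_mul_top hC3, hkz i hi, map_mul, hq, map_zpow, one_mul, inv_one, mul_one]
  exact ((twB_central _).zpow_left q).eq

theorem stdLift_of_four {n : ℕ} (hn : 4 ≤ n) : StdLift n := by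
  induction n, hn using Nat.le_induction with
  | base => exact stdLift_four
  | succ n hn ih =>
    obtain ⟨m, rfl⟩ : ∃ m, n = m + 3 := ⟨n - 3, by omega⟩
    intro θ hp
    have hpθ := prm_hom_eq hp
    have htop : ∀ d, prm (m + 3 + 1) (θ (iota (m + 3) d)) (m + 3) = m + 3 := fun d => by
      rw [hpθ]; exact prm_iota_top d
    refine stdEnd_succ θ hp ?_
    obtain ⟨φ, hφ⟩ : ∃ φ : Br (m + 3) →* Br (m + 3), ∀ b,
        φ b = pr (kap (m + 3) (m + 3) (θ (iota (m + 3) (dr b)))) :=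
      ⟨MonoidHom.mk' _ fun a b => by
        rw [map_mul, map_mul, map_mul, kap_mul_top (htop _)]; rfl, fun _ => rfl⟩
    obtain ⟨y, ε, q, hε, hy⟩ := ih φ fun i hi => by
      rw [hφ, prm_pr_kap (htop _), hpθ, iota_sg hi, prm_sg (by omega)]
    refine ⟨y, ε, q, hε, fun i hi => ?_⟩
    refine Eq.trans ?_ (hy i hi)
    show _ = φ (sg (m + 3) i)
    rw [hφ, iota_sg hi]

end BraidB

namespace BraidB
open scoped commutatorElement

/-- The first `n - 1` terms of `s` coincide. -/
def Cyc {G : Type*} (n : ℕ) (s : ℕ → G) : Prop := ∀ i, i + 1 < n → s i = s 0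

section
variable {G : Type*} [Group G] {n : ℕ}

lemma eq_of_braid_of_commute {a b : G} (h : a * b * a = b * a * b) (hc : a * b = b * a) :
    a = b := by
  rw [← hc] at h
  exact mul_left_cancel h

lemma cyc_of_comm {s : ℕ → G} (hs : BraidRel n s) (h : s 0 * s 1 = s 1 * s 0) : Cyc n s := by
  have key : ∀ i, i + 2 < n → s (i + 1) = s i := by
    intro i
    induction i with
    | zero => exact fun hi => (eq_of_braid_of_commute (hs.braid 0 hi) h).symm
    | succ i ih =>
      intro hi
      refine (eq_of_braid_of_commute (hs.braid (i + 1) hi) ?_).symm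
      rw [ih (by omega)]
      exact hs.comm i (i + 2) le_rfl (by omega)
  intro i
  induction i with
  | zero => exact fun _ => rfl
  | succ i ih => exact fun hi => (key i hi).trans (ih (by omega))

lemma Cyc.commute (f : Br n →* G) (h : Cyc n fun i => f (sg n i)) (a b : Br n) :
    Commute (f a) (f b) := by
  have h1 : ∀ a : Br n, ∀ i, i + 1 < n → Commute (f a) (f (sg n i)) := by
    intro a i hi
    induction a using Br.induction with
    | h1 => rw [map_one]; exact Commute.one_left _
    | hs j hj =>
      have e : f (sg n j) = f (sg n i) := (h j hj).trans (h i hi).symm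
      rw [e]
    | hm a b ha hb => rw [map_mul]; exact ha.mul_left hb
    | hi a ha => rw [map_inv]; exact ha.inv_left
  induction b using Br.induction with
  | h1 => rw [map_one]; exact Commute.one_right _
  | hs j hj => exact h1 a j hj
  | hm a b ha hb => rw [map_mul]; exact ha.mul_right hb
  | hi a ha => rw [map_inv]; exact ha.inv_right

lemma Cyc.commutator_le_ker (f : Br n →* G) (h : Cyc n fun i => f (sg n i)) :
    commutator (Br n) ≤ f.ker := by
  rw [commutator_def, Subgroup.commutator_le]
  intro a _ b _
  rw [MonoidHom.mem_ker, map_commutatorElement, commutatorElement_eq_one_iff_commute]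
  exact h.commute f a b

lemma sg_mul_inv_mem (n : ℕ) {i j : ℕ} (hi : i + 1 < n) (hj : j + 1 < n) :
    sg n i * (sg n j)⁻¹ ∈ commutator (Br n) := by
  have h : Cyc n fun i => Abelianization.of (sg n i) :=
    cyc_of_comm ((braidRel_sg n).map Abelianization.of) (mul_comm _ _)
  rw [← Abelianization.ker_of, MonoidHom.mem_ker, map_mul, map_inv, mul_inv_eq_one]
  exact (h i hi).trans (h j hj).symm

lemma cyc_of_commutator_le (f : Br n →* G) (h : commutator (Br n) ≤ f.ker) :
    Cyc n fun i => f (sg n i) := by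
  intro i hi
  have := h (sg_mul_inv_mem n hi (show 0 + 1 < n by omega))
  rwa [MonoidHom.mem_ker, map_mul, map_inv, mul_inv_eq_one] at this

/-- For `n ≥ 5` the commutator subgroup of the braid group is perfect. -/
lemma commutator_perfect (hn : 5 ≤ n) :
    commutator (Br n) ≤ ⁅commutator (Br n), commutator (Br n)⁆ := by
  have hN : (⁅commutator (Br n), commutator (Br n)⁆).Normal := inferInstance
  set N := ⁅commutator (Br n), commutator (Br n)⁆
  have hc : Cyc n fun i => QuotientGroup.mk' N (sg n i) := by
    have hs := (braidRel_sg n).map (QuotientGroup.mk' N)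
    refine cyc_of_comm hs ?_
    have h1 := sg_mul_inv_mem n (show 0 + 1 < n by omega) (show 3 + 1 < n by omega)
    have h2 := sg_mul_inv_mem n (show 1 + 1 < n by omega) (show 3 + 1 < n by omega)
    have h3 : ⁅sg n 0 * (sg n 3)⁻¹, sg n 1 * (sg n 3)⁻¹⁆ ∈ (QuotientGroup.mk' N).ker := by
      rw [QuotientGroup.ker_mk']; exact Subgroup.commutator_mem_commutator h1 h2
    rw [MonoidHom.mem_ker, map_commutatorElement, commutatorElement_eq_one_iff_commute] at h3
    have c0 : Commute (QuotientGroup.mk' N (sg n 0)) (QuotientGroup.mk' N (sg n 3)) :=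
      hs.comm 0 3 (by omega) (by omega)
    have c1 : Commute (QuotientGroup.mk' N (sg n 1)) (QuotientGroup.mk' N (sg n 3)) :=
      hs.comm 1 3 (by omega) (by omega)
    have h3' := h3
    rw [map_mul, map_mul, map_inv] at h3'
    have h4 : Commute (QuotientGroup.mk' N (sg n 0))
        (QuotientGroup.mk' N (sg n 1) * (QuotientGroup.mk' N (sg n 3))⁻¹) := by
      have e := h3'.mul_left ((c1.symm.mul_right ((Commute.refl _).inv_right)) :
        Commute (QuotientGroup.mk' N (sg n 3)) _)
      rwa [inv_mul_cancel_right] at e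
    have h5 := h4.mul_right c0
    rw [inv_mul_cancel_right] at h5
    exact h5
  have := hc.commutator_le_ker (QuotientGroup.mk' N)
  rwa [QuotientGroup.ker_mk'] at this

end

/-- A perfect subgroup of a free group is trivial. -/
lemma perfect_to_free {P α : Type*} [Group P] (hP : commutator P = ⊤) (f : P →* FreeGroup α)
    (p : P) : f p = 1 := by
  let χ : f.range →* Multiplicative ℤ :=
    IsFreeGroup.lift (fun _ => Multiplicative.ofAdd (1 : ℤ))
  have h1 : ∀ h : f.range, χ h = 1 := by
    rintro ⟨_, q, rfl⟩
    have : commutator P ≤ (χ.comp f.rangeRestrict).ker := Abelianization.commutator_subset_ker _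
    rw [hP] at this
    exact this (Subgroup.mem_top q)
  have h2 : IsEmpty (IsFreeGroup.Generators f.range) := by
    refine ⟨fun i => ?_⟩
    have h3 := h1 (IsFreeGroup.of i)
    simp only [χ, IsFreeGroup.lift_of] at h3
    exact absurd h3 (by decide)
  have h3 : Subsingleton f.range :=
    (IsFreeGroup.toFreeGroup f.range).toEquiv.subsingleton
  have := Subsingleton.elim (⟨f p, p, rfl⟩ : f.range) 1
  exact congrArg Subtype.val this

lemma perfect_to_D {P : Type*} [Group P] (hP : commutator P = ⊤) {n : ℕ} (f : P →* D n)
    (h : ∀ p, pr (f p) = 1) (p : P) : f p = 1 := by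
  have h' : ∀ p, (f p).right = 1 := h
  let g : P →* Fr n :=
    { toFun := fun p => (f p).left
      map_one' := by rw [map_one]; rfl
      map_mul' := fun a b => by
        rw [map_mul, SemidirectProduct.mul_left, h' a, map_one]; rfl }
  exact SemidirectProduct.ext (perfect_to_free hP g p) (h p)

/-- A perfect group has no nontrivial pure braid representation. -/
lemma perfect_to_pure {P : Type*} [Group P] (hP : commutator P = ⊤) :
    ∀ {n : ℕ} (f : P →* Br n), (∀ p, prm n (f p) = 1) → ∀ p, f p = 1
  | 0, f, _, p => br_eq_one (by omega) _
  | n + 1, f, h, p => by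
    have ht : ∀ p, prm (n + 1) (f p) n = n := fun p => by rw [h p]; rfl
    let g : P →* D n :=
      { toFun := fun p => kap n n (f p)
        map_one' := by rw [map_one, kap_one]
        map_mul' := fun a b => by rw [map_mul, kap_mul_top (ht a)] }
    have hg : ∀ p, g p = kap n n (f p) := fun _ => rfl
    have h1 := perfect_to_pure hP (pr.comp g) fun p => by
      rw [MonoidHom.comp_apply, hg, prm_pr_kap (ht p), h]
    have h2 := perfect_to_D hP g h1 p
    rw [← iota_kap (ht p), ← hg, h2, map_one]

section
variable {n : ℕ}

lemma commutator_top_of_perfect (hn : 5 ≤ n) : commutator (commutator (Br n)) = ⊤ := by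
  have h := commutator_perfect hn
  apply Subgroup.map_injective (commutator (Br n)).subtype_injective
  rw [commutator_def (commutator (Br n)), Subgroup.map_commutator, ← MonoidHom.range_eq_map, Subgroup.range_subtype]
  exact le_antisymm (Subgroup.commutator_le_left _ _) h

lemma cyc_of_prm_cyc (hn : 5 ≤ n) {m : ℕ} (θ : Br n →* Br m)
    (h : Cyc n fun i => prm m (θ (sg n i))) : Cyc n fun i => θ (sg n i) := by
  refine cyc_of_commutator_le θ fun b hb => ?_
  have h1 := Cyc.commutator_le_ker ((prm m).comp θ) h
  exact perfect_to_pure (commutator_top_of_perfect hn) (θ.comp (commutator (Br n)).subtype)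
    (fun p => h1 p.2) ⟨b, hb⟩

lemma cyc_of_pr_cyc (hn : 5 ≤ n) {m : ℕ} (θ : Br n →* D m)
    (h : Cyc n fun i => pr (θ (sg n i))) : Cyc n fun i => θ (sg n i) := by
  refine cyc_of_commutator_le θ fun b hb => ?_
  have h1 := Cyc.commutator_le_ker (pr.comp θ) h
  exact perfect_to_D (commutator_top_of_perfect hn) (θ.comp (commutator (Br n)).subtype)
    (fun p => h1 p.2) ⟨b, hb⟩

end
end BraidB

namespace BraidB

section
variable {G : Type*} [Group G] {n : ℕ}

lemma BraidRel.conj {s : ℕ → G} (hs : BraidRel n s) {i : ℕ} (hi : i + 2 < n) :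
    s (i + 1) = (s i * s (i + 1)) * s i * (s i * s (i + 1))⁻¹ := by
  rw [eq_mul_inv_iff_mul_eq, hs.braid i hi]; simp only [mul_assoc]

lemma BraidRel.conj_zero {s : ℕ → G} (hs : BraidRel n s) {i : ℕ} (hi : i + 1 < n) :
    ∃ g : G, s i = g * s 0 * g⁻¹ := by
  induction i with
  | zero => exact ⟨1, by simp⟩
  | succ i ih =>
    obtain ⟨g, hg⟩ := ih (by omega)
    refine ⟨s i * s (i + 1) * g, ?_⟩
    calc s (i + 1) = s i * s (i + 1) * (g * s 0 * g⁻¹) * (s i * s (i + 1))⁻¹ := by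
          rw [← hg]; exact hs.conj hi
      _ = _ := by group

lemma cyc_of_comm_at {s : ℕ → G} (hs : BraidRel n s) {i : ℕ} (hi : i + 2 < n)
    (h : s i * s (i + 1) = s (i + 1) * s i) : Cyc n s := by
  refine cyc_of_comm hs ?_
  refine down_induction (p := fun i => s i * s (i + 1) = s (i + 1) * s i) i h ?_ 0 (by omega)
  intro j hj h2
  have h3 := eq_of_braid_of_commute (hs.braid (j + 1) (by omega)) h2
  rw [h3]
  exact hs.comm j (j + 2) le_rfl (by omega)

lemma cyc_of_eq {s : ℕ → G} (hn : 5 ≤ n) (hs : BraidRel n s) {i j : ℕ} (hij : i + 2 ≤ j)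
    (hj : j + 1 < n) (h : s i = s j) : Cyc n s := by
  by_cases h1 : j + 2 < n
  · refine cyc_of_comm_at hs h1 ?_
    rw [← h]; exact hs.comm i (j + 1) (by omega) (by omega)
  · obtain _ | i := i
    · refine cyc_of_comm_at hs (i := 0) (by omega) ?_
      rw [h]; exact (hs.comm 1 j (by omega) (by omega)).symm
    · refine cyc_of_comm_at hs (i := i) (by omega) ?_
      rw [h]; exact hs.comm i j (by omega) (by omega)

end

section
variable {X : Type*} [DecidableEq X] {n : ℕ}
open Equiv

lemma swap_ne_of_commute {a b d : X} (had : a ≠ d) (hab : a ≠ b)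
    (hc : swap a b * swap a d = swap a d * swap a b) : b = d := by
  by_contra hbd
  have := congrFun (congrArg DFunLike.coe hc) a
  simp only [Perm.mul_apply, swap_apply_left] at this
  rw [swap_apply_of_ne_of_ne (Ne.symm had) (Ne.symm hbd),
    swap_apply_of_ne_of_ne (Ne.symm hab) hbd] at this
  exact hbd this.symm

lemma swap_disjoint_of_commute {a b c d : X} (hab : a ≠ b) (hcd : c ≠ d)
    (hne : swap a b ≠ swap c d) (hc : swap a b * swap c d = swap c d * swap a b) :
    a ≠ c ∧ a ≠ d ∧ b ≠ c ∧ b ≠ d := by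
  refine ⟨?_, ?_, ?_, ?_⟩ <;> rintro rfl
  · exact hne (by rw [swap_ne_of_commute hcd hab hc])
  · rw [swap_comm c a] at hne hc
    exact hne (by rw [swap_ne_of_commute hcd.symm hab hc])
  · rw [swap_comm a b] at hne hc
    exact hne (by rw [swap_ne_of_commute hcd hab.symm hc])
  · rw [swap_comm a b, swap_comm c b] at hne hc
    exact hne (by rw [swap_ne_of_commute hcd.symm hab.symm hc])

lemma swap_commute_of_disjoint {a b c d : X} (h1 : a ≠ c) (h2 : a ≠ d) (h3 : b ≠ c)
    (h4 : b ≠ d) : swap a b * swap c d = swap c d * swap a b := by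
  have := mul_swap_eq_swap_mul (swap a b) c d
  rwa [swap_apply_of_ne_of_ne h1.symm h3.symm, swap_apply_of_ne_of_ne h2.symm h4.symm] at this

/-- Two transpositions which do not commute have the form `(a b)`, `(b c)`. -/
lemma swap_chain_two {a b : X} {t : Perm X} (ht : t.IsSwap)
    (hc : swap a b * t ≠ t * swap a b) : (∃ c, c ≠ b ∧ t = swap b c) ∨ ∃ c, c ≠ a ∧ t = swap a c := by
  obtain ⟨c, d, hcd, rfl⟩ := ht
  by_cases h1 : a = c
  · subst h1; exact Or.inr ⟨d, hcd.symm, rfl⟩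
  by_cases h2 : a = d
  · subst h2; exact Or.inr ⟨c, hcd, swap_comm _ _⟩
  by_cases h3 : b = c
  · subst h3; exact Or.inl ⟨d, hcd.symm, rfl⟩
  by_cases h4 : b = d
  · subst h4; exact Or.inl ⟨c, hcd, swap_comm _ _⟩
  exact absurd (swap_commute_of_disjoint h1 h2 h3 h4) hc

lemma swap_chain (hn : 5 ≤ n) {s : ℕ → Perm X} (hs : BraidRel n s) (hc : ¬ Cyc n s)
    (h0 : (s 0).IsSwap) : ∃ p : ℕ → X, (∀ i j, i < j → j < n → p i ≠ p j) ∧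
      ∀ i, i + 1 < n → s i = swap (p i) (p (i + 1)) := by
  have hsw : ∀ i, i + 1 < n → (s i).IsSwap := by
    intro i hi
    obtain ⟨g, hg⟩ := hs.conj_zero hi
    obtain ⟨x, y, hxy, h⟩ := h0
    refine ⟨g x, g y, g.injective.ne hxy, ?_⟩
    rw [hg, h, swap_apply_apply]
  have key : ∀ m, 2 ≤ m → m < n → ∃ p : ℕ → X, (∀ i j, i < j → j ≤ m → p i ≠ p j) ∧
      ∀ i, i < m → s i = swap (p i) (p (i + 1)) := by
    intro m hm
    induction m, hm using Nat.le_induction with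
    | base =>
      intro h2
      have hnc : s 0 * s 1 ≠ s 1 * s 0 := fun h => hc (cyc_of_comm hs h)
      obtain ⟨a, b, hab, h⟩ : ∃ a b, a ≠ b ∧ s 0 = swap a b := h0
      rw [h] at hnc
      obtain ⟨a, b, c, hab, hcb, h, h'⟩ : ∃ a b c, a ≠ b ∧ c ≠ b ∧ s 0 = swap a b ∧
          s 1 = swap b c := by
        rcases swap_chain_two (hsw 1 (by omega)) hnc with ⟨c, hcb, h'⟩ | ⟨c, hca, h'⟩
        · exact ⟨a, b, c, hab, hcb, h, h'⟩
        · exact ⟨b, a, c, hab.symm, hca, h.trans (swap_comm _ _), h'⟩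
      have hac : a ≠ c := by
        rintro rfl
        apply hc
        apply cyc_of_comm hs
        rw [h, h', swap_comm a b]
      refine ⟨fun i => if i = 0 then a else if i = 1 then b else c, ?_, ?_⟩
      · intro i j hij hj
        obtain ⟨rfl, rfl⟩ | ⟨rfl, rfl⟩ | ⟨rfl, rfl⟩ : (i = 0 ∧ j = 1) ∨ (i = 0 ∧ j = 2) ∨
            (i = 1 ∧ j = 2) := by omega
        · simpa using hab
        · simpa using hac
        · simpa using hcb.symm
      · intro i hi
        obtain rfl | rfl : i = 0 ∨ i = 1 := by omega
        · simpa using h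
        · simpa using h'
    | succ m hm ih =>
      intro hmn
      obtain ⟨p, hp, hps⟩ := ih (by omega)
      have hdis : ∀ v w, v ≠ w → s m = swap v w → ∀ i, i < m → p i ≠ v ∧ p i ≠ w := by
        intro v w hvw hv
        have h1 : ∀ i, i + 1 < m → (p i ≠ v ∧ p i ≠ w ∧ p (i + 1) ≠ v ∧ p (i + 1) ≠ w) := by
          intro i hi
          have hne : s i ≠ s m := fun h => hc (cyc_of_eq hn hs (by omega) (by omega) h)
          have hcm := hs.comm i m (by omega) (by omega)
          rw [hps i (by omega), hv] at hne hcm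
          exact swap_disjoint_of_commute (hp _ _ (by omega) (by omega)) hvw hne hcm
        intro i hi
        by_cases h2 : i + 1 < m
        · exact ⟨(h1 i h2).1, (h1 i h2).2.1⟩
        · obtain ⟨j, rfl⟩ : ∃ j, i = j + 1 := ⟨i - 1, by omega⟩
          exact ⟨(h1 j hi).2.2.1, (h1 j hi).2.2.2⟩
      have hnc : s (m - 1) * s m ≠ s m * s (m - 1) := by
        obtain ⟨j, rfl⟩ : ∃ j, m = j + 1 := ⟨m - 1, by omega⟩
        exact fun h => hc (cyc_of_comm_at hs (i := j) (by omega) h)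
      rw [hps (m - 1) (by omega), show m - 1 + 1 = m by omega] at hnc
      obtain ⟨c, hcm, hsm⟩ : ∃ c, c ≠ p m ∧ s m = swap (p m) c := by
        rcases swap_chain_two (hsw m (by omega)) hnc with h | ⟨c, hca, h⟩
        · exact h
        · exact absurd rfl (hdis _ _ hca.symm h (m - 1) (by omega)).1
      have hd := hdis _ _ hcm.symm hsm
      refine ⟨fun i => if i ≤ m then p i else c, ?_, ?_⟩
      · intro i j hij hj
        have hi : i ≤ m := by omega
        by_cases h2 : j ≤ m
        · simpa only [hi, h2, if_true] using hp i j hij h2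
        · simp only [hi, h2, if_true, if_false]
          rcases Nat.lt_or_ge i m with h3 | h3
          · exact (hd i h3).2
          · rw [show i = m by omega]; exact hcm.symm
      · intro i hi
        beta_reduce
        by_cases h2 : i < m
        · rw [if_pos (by omega), if_pos (by omega)]; exact hps i h2
        · obtain rfl : i = m := by omega
          rw [if_pos le_rfl, if_neg (by omega)]; exact hsm
  obtain ⟨p, h1, h2⟩ := key (n - 1) (by omega) (by omega)
  exact ⟨p, fun i j hij hj => h1 i j hij (by omega), fun i hi => h2 i (by omega)⟩

end

lemma le_card_of_swap_chain {X : Type*} [Fintype X] {n : ℕ} {p : ℕ → X} (hp : ∀ i j, i < j → j < n → p i ≠ p j) :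
    Function.Injective (fun i : Fin n => p i) ∧ n ≤ Fintype.card X := by
  have h : Function.Injective (fun i : Fin n => p i) := by
    intro i j hij
    rcases lt_trichotomy (i : ℕ) j with h | h | h
    · exact absurd hij (hp _ _ h j.2)
    · exact Fin.ext h
    · exact absurd hij.symm (hp _ _ h i.2)
  exact ⟨h, by simpa using Fintype.card_le_of_injective _ h⟩

end BraidB

namespace BraidB
open Equiv

section
variable {X : Type*} {s : Perm X}

lemma inv_apply_self' (f : Perm X) (x : X) : f⁻¹ (f x) = x := by
  rw [← Perm.mul_apply, inv_mul_cancel, Perm.one_apply]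

lemma sameCycle_of_commute {c : Perm X} (hc : Commute s c) {x y : X} (h : s.SameCycle x y) :
    s.SameCycle (c x) (c y) := by
  obtain ⟨i, rfl⟩ := h
  refine ⟨i, ?_⟩
  rw [← Perm.mul_apply, (hc.zpow_left i).eq, Perm.mul_apply]

lemma apply_comm_of_sameCycle {g h : Perm X} (hg : Commute s g) (hh : Commute s h) {x : X}
    (h1 : s.SameCycle x (g x)) (h2 : s.SameCycle x (h x)) : g (h x) = h (g x) := by
  obtain ⟨i, hi⟩ := h1
  obtain ⟨j, hj⟩ := h2
  rw [← hi, ← hj, ← Perm.mul_apply g, ← Perm.mul_apply h, ← (hg.zpow_left j).eq,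
    ← (hh.zpow_left i).eq, Perm.mul_apply, Perm.mul_apply, ← hi, ← hj, ← Perm.mul_apply,
    ← Perm.mul_apply, ← zpow_add, ← zpow_add, add_comm]

lemma commute_of_sameCycle {g h : Perm X} (hg : Commute s g) (hh : Commute s h)
    (h1 : ∀ x, s.SameCycle x (g x)) (h2 : ∀ x, s.SameCycle x (h x)) : Commute g h :=
  Perm.ext fun x => apply_comm_of_sameCycle hg hh (h1 x) (h2 x)

lemma sameCycle_inv_mul {a b : Perm X} (ha : Commute s a)
    (h : ∀ x, s.SameCycle (b x) (a x)) (x : X) : s.SameCycle x ((a⁻¹ * b) x) := by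
  have := sameCycle_of_commute ha.inv_right (h x)
  rw [inv_apply_self'] at this
  exact this.symm

lemma cyc_of_sameCycle {n : ℕ} (hn : 6 ≤ n) {s : ℕ → Perm X} (hs : BraidRel n s)
    (h3 : ∀ x, (s 0).SameCycle (s 3 x) (s 2 x)) (h4 : ∀ x, (s 0).SameCycle (s 4 x) (s 2 x)) :
    Cyc n s := by
  have c2 : Commute (s 0) (s 2) := hs.comm 0 2 (by omega) (by omega)
  have c3 : Commute (s 0) (s 3) := hs.comm 0 3 (by omega) (by omega)
  have c4 : Commute (s 0) (s 4) := hs.comm 0 4 (by omega) (by omega)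
  have c24 : Commute (s 2) (s 4) := hs.comm 2 4 (by omega) (by omega)
  have hb := hs.braid 2 (by omega)
  have hb' := hs.braid 3 (by omega)
  obtain ⟨k, hk⟩ : ∃ k, k = (s 2)⁻¹ * s 4 := ⟨_, rfl⟩
  have hkl : Commute k ((s 2)⁻¹ * s 3) := by
    rw [hk]
    exact commute_of_sameCycle (c2.inv_right.mul_right c4) (c2.inv_right.mul_right c3)
      (sameCycle_inv_mul c2 h4) (sameCycle_inv_mul c2 h3)
  have hk2 : Commute k (s 2) := by
    rw [hk]; exact ((Commute.refl _).inv_left).mul_left c24.symm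
  have hk3 : Commute k (s 3) := by
    have := hk2.mul_right hkl
    rwa [mul_inv_cancel_left] at this
  have h4' : s 4 = s 2 * k := by rw [hk]; group
  have : k = 1 := by
    have e1 : s 3 * s 2 * s 3 * k = s 2 * s 3 * s 2 * k * k := by
      calc s 3 * s 2 * s 3 * k = s 3 * s 4 * s 3 := by
            rw [h4']; simp only [mul_assoc, hk3.eq]
        _ = s 4 * s 3 * s 4 := hb'
        _ = s 2 * (k * s 3) * s 2 * k := by rw [h4']; simp only [mul_assoc]
        _ = s 2 * s 3 * (k * s 2) * k := by rw [hk3.eq]; simp only [mul_assoc]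
        _ = _ := by rw [hk2.eq]; simp only [mul_assoc]
    rw [hb] at e1
    have e2 := mul_left_cancel (a := s 3 * s 2 * s 3) (b := k) (c := k * k)
      (e1.trans (by simp only [mul_assoc]))
    exact (mul_left_cancel (a := k) (b := 1) (c := k) (by rw [mul_one]; exact e2)).symm
  exact cyc_of_eq (by omega) hs (i := 2) (j := 4) le_rfl (by omega) (by rw [h4', this, mul_one])

end

section
variable {X : Type*} {G : Type*} [Group G]

/-- The restriction of a permutation representation to an invariant subset. -/
def resSub (θ : G →* Perm X) (p : X → Prop) (h : ∀ g x, p x → p (θ g x)) :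
    G →* Perm {x // p x} where
  toFun g :=
    { toFun := fun x => ⟨θ g x, h g x x.2⟩
      invFun := fun x => ⟨θ g⁻¹ x, h g⁻¹ x x.2⟩
      left_inv := fun x => Subtype.ext (by simp)
      right_inv := fun x => Subtype.ext (by simp) }
  map_one' := by ext; simp
  map_mul' a b := by ext; simp

lemma resSub_apply (θ : G →* Perm X) (p : X → Prop) (h : ∀ g x, p x → p (θ g x)) (g : G)
    (x : {x // p x}) : (resSub θ p h g x : X) = θ g x := rfl

variable (s : Perm X)

/-- The orbits of `s`. -/
abbrev Orb : Type _ := Quotient (Perm.SameCycle.setoid s)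

variable {s}

lemma orb_eq {x y : X} : (Quotient.mk _ x : Orb s) = Quotient.mk _ y ↔ s.SameCycle x y :=
  Quotient.eq (r := Perm.SameCycle.setoid s)

/-- The action of the centralizer of `s` on the orbits of `s`. -/
def resOrb (θ : G →* Perm X) (hc : ∀ g, Commute s (θ g)) : G →* Perm (Orb s) where
  toFun g := Quotient.congr (θ g) fun x y => ⟨sameCycle_of_commute (hc g), fun h => by
    have := sameCycle_of_commute (hc g).inv_right h
    rwa [inv_apply_self', inv_apply_self'] at this⟩
  map_one' := by
    ext ω; induction ω using Quotient.ind; simp [Quotient.congr_mk]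
  map_mul' a b := by
    ext ω; induction ω using Quotient.ind; simp [Quotient.congr_mk]

lemma resOrb_mk (θ : G →* Perm X) (hc : ∀ g, Commute s (θ g)) (g : G) (x : X) :
    resOrb θ hc g (Quotient.mk _ x) = Quotient.mk _ (θ g x) := rfl

/-- The nontrivial orbits. -/
def Mov (s : Perm X) (ω : Orb s) : Prop := ∃ x, Quotient.mk _ x = ω ∧ s x ≠ x

lemma fix_of_commute {c : Perm X} (hc : Commute s c) {x : X} (h : s x = x) : s (c x) = c x := by
  rw [← Perm.mul_apply, hc.eq, Perm.mul_apply, h]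

lemma moved_of_commute {c : Perm X} (hc : Commute s c) {x : X} (h : s x ≠ x) :
    s (c x) ≠ c x := by
  rw [← Perm.mul_apply, hc.eq, Perm.mul_apply]; exact c.injective.ne h

lemma mov_resOrb (θ : G →* Perm X) (hc : ∀ g, Commute s (θ g)) (g : G) (ω : Orb s)
    (h : Mov s ω) : Mov s (resOrb θ hc g ω) := by
  obtain ⟨x, rfl, hx⟩ := h
  exact ⟨θ g x, rfl, moved_of_commute (hc g) hx⟩

/-- The action of the centralizer of `s` on the fixed points of `s`. -/
def resF (θ : G →* Perm X) (hc : ∀ g, Commute s (θ g)) : G →* Perm {x // s x = x} :=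
  resSub θ (fun x => s x = x) fun g _ h => fix_of_commute (hc g) h

/-- The action of the centralizer of `s` on the nontrivial orbits of `s`. -/
def resM (θ : G →* Perm X) (hc : ∀ g, Commute s (θ g)) : G →* Perm {ω // Mov s ω} :=
  resSub (resOrb θ hc) (Mov s) (mov_resOrb θ hc)

lemma sameCycle_of_res (θ : G →* Perm X) (hc : ∀ g, Commute s (θ g)) {a b : G}
    (hF : resF θ hc a = resF θ hc b) (hM : resM θ hc a = resM θ hc b) (x : X) :
    s.SameCycle (θ a x) (θ b x) := by
  by_cases hx : s x = x
  · have := congrArg Subtype.val (DFunLike.congr_fun hF ⟨x, hx⟩)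
    rw [resF, resSub_apply, resSub_apply] at this
    rw [this]
  · have := congrArg Subtype.val (DFunLike.congr_fun hM ⟨Quotient.mk _ x, x, rfl, hx⟩)
    rw [resM, resSub_apply, resSub_apply, resOrb_mk, resOrb_mk, orb_eq] at this
    exact this

/-- Two representatives of a nontrivial orbit. -/
noncomputable def rep2 (s : Perm X) (a : {ω // Mov s ω} × Bool) : X :=
  if a.2 then s a.1.2.choose else a.1.2.choose

lemma rep2_mk (a : {ω // Mov s ω} × Bool) : (Quotient.mk _ (rep2 s a) : Orb s) = a.1 := by
  have h := a.1.2.choose_spec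
  rw [rep2]
  split_ifs
  · refine Eq.trans ?_ h.1
    rw [orb_eq, Perm.sameCycle_apply_left]
  · exact h.1

lemma rep2_moved (a : {ω // Mov s ω} × Bool) : s (rep2 s a) ≠ rep2 s a := by
  have h := a.1.2.choose_spec
  rw [rep2]
  split_ifs
  · exact s.injective.ne h.2
  · exact h.2

lemma rep2_injective : Function.Injective (rep2 s) := by
  rintro ⟨ω, b⟩ ⟨ω', b'⟩ h
  have h1 : ω = ω' := by
    have := congrArg (Quotient.mk (Perm.SameCycle.setoid s)) h
    rw [rep2_mk, rep2_mk] at this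
    exact Subtype.ext this
  subst h1
  have h2 := ω.2.choose_spec.2
  rw [rep2, rep2] at h
  rcases b with _ | _ <;> rcases b' with _ | _ <;> simp at h ⊢
  · exact h2 h.symm
  · exact h2 h

end

section
open Classical
variable {X : Type*} [Fintype X] {s : Perm X}

lemma card_fix_add (s : Perm X) :
    Fintype.card {x // s x = x} + s.support.card = Fintype.card X := by
  have h1 : s.support.card = Fintype.card {x // ¬ s x = x} := by
    rw [Fintype.card_subtype]; congr 1
  rw [h1, Fintype.card_subtype_compl]
  have := Fintype.card_subtype_le (fun x => s x = x)
  omega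

lemma two_mul_card_mov : Fintype.card {ω // Mov s ω} * 2 ≤ s.support.card := by
  have h := Fintype.card_le_of_injective
    (fun a : {ω // Mov s ω} × Bool => (⟨rep2 s a, Perm.mem_support.2 (rep2_moved a)⟩ : s.support))
    (fun a b h => rep2_injective (congrArg Subtype.val h))
  rwa [Fintype.card_prod, Fintype.card_bool, Fintype.card_coe] at h

lemma involution_of_card_mov (h : Fintype.card X ≤ Fintype.card {ω // Mov s ω} * 2) (x : X) :
    s x ≠ x ∧ s (s x) = x := by
  have hs : Function.Surjective (rep2 s) := by
    refine ((Fintype.bijective_iff_injective_and_card _).2 ⟨rep2_injective, ?_⟩).2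
    have h1 := Fintype.card_le_of_injective _ (rep2_injective (s := s))
    rw [Fintype.card_prod, Fintype.card_bool] at h1 ⊢
    omega
  obtain ⟨a, rfl⟩ := hs x
  refine ⟨rep2_moved a, ?_⟩
  have key : ∀ ω : {ω // Mov s ω}, s (s ω.2.choose) = ω.2.choose := by
    intro ω
    obtain ⟨⟨ω', b⟩, hb⟩ := hs (s (s ω.2.choose))
    have h2 : ω' = ω := by
      have h3 := congrArg (Quotient.mk (Perm.SameCycle.setoid s)) hb
      rw [rep2_mk] at h3
      refine Subtype.ext (h3.trans ?_)
      refine Eq.trans ?_ ω.2.choose_spec.1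
      rw [orb_eq, Perm.sameCycle_apply_left, Perm.sameCycle_apply_left]
    subst h2
    rcases b with _ | _
    · simpa [rep2] using hb.symm
    · simp only [rep2, if_true] at hb
      exact absurd (s.injective hb).symm ω'.2.choose_spec.2
  obtain ⟨ω, b⟩ := a
  rcases b with _ | _
  · simpa [rep2] using key ω
  · simp [rep2, key ω]

end
end BraidB

namespace BraidB
open Equiv

section
variable {X : Type*} {n : ℕ} {s : ℕ → Perm X}

/-- The action of the generators commuting with the first one. -/
def tail (hs : BraidRel n s) : Br (n - 2) →* Perm X := Br.lift _ (hs.shift 2)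

lemma tail_sg (hs : BraidRel n s) {i : ℕ} (hi : i + 3 < n) :
    tail hs (sg (n - 2) i) = s (i + 2) := Br.lift_sg _ _ (by omega)

lemma commute_tail (hs : BraidRel n s) (b : Br (n - 2)) : Commute (s 0) (tail hs b) := by
  induction b using Br.induction with
  | h1 => rw [map_one]; exact Commute.one_right _
  | hs i hi => rw [tail_sg hs (by omega)]; exact hs.comm 0 (i + 2) (by omega) (by omega)
  | hm a b ha hb => rw [map_mul]; exact ha.mul_right hb
  | hi a ha => rw [map_inv]; exact ha.inv_right

lemma sameCycle_tail (hs : BraidRel n s)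
    (hF : Cyc (n - 2) fun i => resF (tail hs) (commute_tail hs) (sg (n - 2) i))
    (hM : Cyc (n - 2) fun i => resM (tail hs) (commute_tail hs) (sg (n - 2) i))
    {i : ℕ} (hi : i + 3 < n) (x : X) : (s 0).SameCycle (s (i + 2) x) (s 2 x) := by
  have := sameCycle_of_res (tail hs) (commute_tail hs) (hF i (by omega)) (hM i (by omega)) x
  rwa [tail_sg hs hi, tail_sg hs (by omega)] at this

lemma ne_one_of_not_cyc (hs : BraidRel n s) (hc : ¬ Cyc n s) : s 0 ≠ 1 := by
  intro h
  exact hc (cyc_of_comm hs (by rw [h, one_mul, mul_one]))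

end

section
variable {Y : Type*} [Fintype Y]

lemma perm_commute_of_card_le_two (h : Fintype.card Y ≤ 2) (a b : Perm Y) : a * b = b * a := by
  classical
  obtain ⟨k, ⟨e⟩⟩ : ∃ k : ℕ, Nonempty (Y ≃ Fin k) := ⟨_, ⟨Fintype.equivFin Y⟩⟩
  have hk : k ≤ 2 := by rw [Fintype.card_congr e, Fintype.card_fin] at h; exact h
  apply (MulEquiv.injective (Equiv.permCongrHom e) : _)
  rw [map_mul, map_mul]
  generalize permCongrHom e a = a
  generalize permCongrHom e b = b
  interval_cases k <;> revert a b <;> decide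

lemma perm_sq_of_card_le_two (h : Fintype.card Y ≤ 2) (a : Perm Y) : a ^ 2 = 1 := by
  classical
  obtain ⟨k, ⟨e⟩⟩ : ∃ k : ℕ, Nonempty (Y ≃ Fin k) := ⟨_, ⟨Fintype.equivFin Y⟩⟩
  have hk : k ≤ 2 := by rw [Fintype.card_congr e, Fintype.card_fin] at h; exact h
  apply (MulEquiv.injective (Equiv.permCongrHom e) : _)
  rw [map_pow, map_one]
  generalize permCongrHom e a = a
  interval_cases k <;> revert a <;> decide

lemma perm_commute_of_cube {Y : Type*} [Fintype Y] (h : Fintype.card Y = 3) {a b : Perm Y}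
    (ha : a ^ 3 = 1) (hb : b ^ 3 = 1) : a * b = b * a := by
  have e : Y ≃ Fin 3 := Fintype.equivFinOfCardEq h
  have ha' := congrArg (Equiv.permCongrHom e) ha
  have hb' := congrArg (Equiv.permCongrHom e) hb
  apply (MulEquiv.injective (Equiv.permCongrHom e) : _)
  rw [map_mul, map_mul]
  rw [map_pow, map_one] at ha' hb'
  revert ha' hb'
  generalize permCongrHom e a = a
  generalize permCongrHom e b = b
  revert a b
  decide

lemma cyc_of_card_le_two {n : ℕ} {t : ℕ → Perm Y} (h : Fintype.card Y ≤ 2)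
    (ht : BraidRel n t) : Cyc n t := cyc_of_comm ht (perm_commute_of_card_le_two h _ _)

end

section
open Classical
variable {X : Type*} [Fintype X] {n : ℕ} {s : ℕ → Perm X}

lemma swap_of_card_fix (hs : BraidRel n s) (hc : ¬ Cyc n s)
    (hX : Fintype.card X ≤ n) (h : n ≤ Fintype.card {x // s 0 x = x} + 2) : (s 0).IsSwap := by
  rw [← Perm.card_support_eq_two]
  have h1 := card_fix_add (s 0)
  have h2 : ¬ (s 0).support.card ≤ 1 := fun h =>
    ne_one_of_not_cyc hs hc (Perm.card_support_le_one.1 h)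
  omega

/-- The possible images of a generator in a noncyclic action on at most `n` points. -/
def SmallAct (n : ℕ) : Prop := ∀ (X : Type) [Fintype X] (s : ℕ → Perm X), BraidRel n s →
  Fintype.card X ≤ n → ¬ Cyc n s →
    (s 0).IsSwap ∨ n = 6 ∧ Fintype.card X = 6 ∧ ∀ x, s 0 x ≠ x ∧ s 0 (s 0 x) = x

lemma SmallAct.cyc (hn : 5 ≤ n) (h : SmallAct n) {X : Type} [Fintype X] {s : ℕ → Perm X}
    (hs : BraidRel n s) (hX : Fintype.card X < n) : Cyc n s := by
  by_contra hc
  rcases h X s hs hX.le hc with h | ⟨h6, h7, -⟩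
  · obtain ⟨p, hp, -⟩ := swap_chain hn hs hc h
    have := (le_card_of_swap_chain hp).2
    omega
  · omega

lemma smallAct_step (hn : 7 ≤ n) (h : SmallAct (n - 2)) : SmallAct n := by
  intro X _ s hs hX hc
  left
  by_contra hsw
  have h1 : ¬ n ≤ Fintype.card {x // s 0 x = x} + 2 := fun h =>
    hsw (swap_of_card_fix hs hc hX h)
  have h2 := two_mul_card_mov (s := s 0)
  have h3 := card_fix_add (s 0)
  have hF : Cyc (n - 2) fun i => resF (tail hs) (commute_tail hs) (sg (n - 2) i) :=
    h.cyc (by omega) ((braidRel_sg _).map _) (by omega)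
  have hM : Cyc (n - 2) fun i => resM (tail hs) (commute_tail hs) (sg (n - 2) i) :=
    h.cyc (by omega) ((braidRel_sg _).map _) (by omega)
  exact hc (cyc_of_sameCycle (by omega) hs (sameCycle_tail hs hF hM (by omega))
    (sameCycle_tail hs hF hM (by omega)))

lemma smallAct_six : SmallAct 6 := by
  intro X _ s hs hX hc
  have h2 := two_mul_card_mov (s := s 0)
  have h3 := card_fix_add (s 0)
  by_cases hMv : 3 ≤ Fintype.card {ω // Mov (s 0) ω}
  · exact Or.inr ⟨rfl, by omega, involution_of_card_mov (by omega)⟩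
  left
  have hM : Cyc (6 - 2) fun i => resM (tail hs) (commute_tail hs) (sg (6 - 2) i) :=
    cyc_of_card_le_two (by omega) ((braidRel_sg _).map _)
  by_contra hsw
  have h1 : ¬ 6 ≤ Fintype.card {x // s 0 x = x} + 2 := fun h =>
    hsw (swap_of_card_fix hs hc hX h)
  by_cases hFx : Fintype.card {x // s 0 x = x} ≤ 2
  · have hF : Cyc (6 - 2) fun i => resF (tail hs) (commute_tail hs) (sg (6 - 2) i) :=
      cyc_of_card_le_two hFx ((braidRel_sg _).map _)
    exact hc (cyc_of_sameCycle (by omega) hs (sameCycle_tail hs hF hM (by omega))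
      (sameCycle_tail hs hF hM (by omega)))
  · have h4 : (s 0).support.card = 3 := by
      have h5 : ¬ (s 0).support.card ≤ 1 := fun h =>
        ne_one_of_not_cyc hs hc (Perm.card_support_le_one.1 h)
      have h6 : (s 0).support.card ≠ 2 := fun h => hsw (Perm.card_support_eq_two.1 h)
      omega
    have hcyc := card_support_eq_three_iff.1 h4
    have hcube : ∀ i, i + 1 < 6 → s i ^ 3 = 1 := by
      intro i hi
      obtain ⟨g, hg⟩ := hs.conj_zero hi
      rw [hg, conj_pow, ← hcyc.orderOf, pow_orderOf_eq_one, mul_one, mul_inv_cancel]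
    refine hc (cyc_of_comm_at hs (i := 2) (by omega) ?_)
    ext x
    have c2 : Commute (s 0) (s 2) := hs.comm 0 2 (by omega) (by omega)
    have c3 : Commute (s 0) (s 3) := hs.comm 0 3 (by omega) (by omega)
    by_cases hx : s 0 x = x
    · have := perm_commute_of_cube (Y := {x // s 0 x = x}) (by omega)
        (a := resF (tail hs) (commute_tail hs) (sg (6 - 2) 0))
        (b := resF (tail hs) (commute_tail hs) (sg (6 - 2) 1)) ?_ ?_
      · have := congrArg Subtype.val (DFunLike.congr_fun this ⟨x, hx⟩)
        rw [← map_mul, ← map_mul, resF, resSub_apply, resSub_apply, map_mul, map_mul,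
          tail_sg hs (by omega), tail_sg hs (by omega)] at this
        exact this
      · ext y
        rw [← map_pow, resF, resSub_apply, map_pow, tail_sg hs (by omega), hcube _ (by omega)]
        rfl
      · ext y
        rw [← map_pow, resF, resSub_apply, map_pow, tail_sg hs (by omega), hcube _ (by omega)]
        rfl
    · exact apply_comm_of_sameCycle c2 c3
        (hcyc.isCycle.sameCycle hx (moved_of_commute c2 hx))
        (hcyc.isCycle.sameCycle hx (moved_of_commute c3 hx))

lemma eq_one_of_conj_inv {t a k : Perm X} (hX : Fintype.card X ≤ 5) (ha : Commute t a)
    (hk : Commute t k) (hO : ∀ x, t.SameCycle x (k x)) (h3 : k ^ 3 = 1) (hak : k * a = a * k⁻¹) :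
    k = 1 := by
  by_contra hne
  obtain ⟨x, hx⟩ : ∃ x, k x ≠ x := by
    by_contra! h
    exact hne (Perm.ext h)
  have h3' : ∀ y, k (k (k y)) = y := fun y => by
    have := DFunLike.congr_fun h3 y
    rwa [pow_succ, pow_two] at this
  have hx2 : k (k x) ≠ x := fun h => hx (by rw [← h, h3', h])
  have hx3 : k (k x) ≠ k x := k.injective.ne hx
  by_cases h : t.SameCycle x (a x)
  · have e1 := apply_comm_of_sameCycle hk ha (hO x) h
    rw [← Perm.mul_apply, hak, Perm.mul_apply] at e1
    have e2 := congrArg k (a.injective e1)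
    rw [← Perm.mul_apply, mul_inv_cancel, Perm.one_apply] at e2
    exact hx2 e2.symm
  · have hO2 : t.SameCycle x (k (k x)) := (hO x).trans (hO _)
    have hd : ∀ y z, t.SameCycle x y → t.SameCycle x z → y ≠ a z := by
      rintro y z hy hz rfl
      exact h (hy.trans (sameCycle_of_commute ha hz).symm)
    have h0 := Perm.SameCycle.refl t x
    have hcard : ({x, k x, k (k x), a x, a (k x), a (k (k x))} : Finset X).card = 6 := by
      have e := a.injective
      rw [Finset.card_insert_of_notMem, Finset.card_insert_of_notMem,
        Finset.card_insert_of_notMem, Finset.card_insert_of_notMem,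
        Finset.card_insert_of_notMem, Finset.card_singleton]
      · simpa using fun h => hx h.symm
      · simpa using ⟨fun h => hx h.symm, fun h => hx2 h.symm⟩
      · simpa using ⟨hd _ _ hO2 h0, hd _ _ hO2 (hO x), hd _ _ hO2 hO2⟩
      · simpa using ⟨fun h => hx h.symm, hd _ _ (hO x) h0, hd _ _ (hO x) (hO x), hd _ _ (hO x) hO2⟩
      · simpa using ⟨fun h => hx h.symm, fun h => hx2 h.symm, hd _ _ h0 h0, hd _ _ h0 (hO x),
          hd _ _ h0 hO2⟩
    have := Finset.card_le_univ ({x, k x, k (k x), a x, a (k x), a (k (k x))} : Finset X)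
    omega

lemma smallAct_five : SmallAct 5 := by
  intro X _ s hs hX hc
  left
  by_contra hsw
  have h1 : ¬ 5 ≤ Fintype.card {x // s 0 x = x} + 2 := fun h =>
    hsw (swap_of_card_fix hs hc hX h)
  have h2 := two_mul_card_mov (s := s 0)
  have h3 := card_fix_add (s 0)
  have hF2 : Fintype.card {x // s 0 x = x} ≤ 2 := by omega
  have hM2 : Fintype.card {ω // Mov (s 0) ω} ≤ 2 := by omega
  have hF : Cyc (5 - 2) fun i => resF (tail hs) (commute_tail hs) (sg (5 - 2) i) :=
    cyc_of_card_le_two hF2 ((braidRel_sg _).map _)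
  have hM : Cyc (5 - 2) fun i => resM (tail hs) (commute_tail hs) (sg (5 - 2) i) :=
    cyc_of_card_le_two hM2 ((braidRel_sg _).map _)
  have h32 : ∀ x, (s 0).SameCycle (s 3 x) (s 2 x) := sameCycle_tail hs hF hM (by omega)
  have hsq : ∀ x, (s 0).SameCycle x ((s 2 * s 2) x) := by
    intro x
    have := sameCycle_of_res (tail hs) (commute_tail hs) (a := 1) (b := sg (5 - 2) 0 ^ 2)
      (by rw [map_pow, perm_sq_of_card_le_two hF2, map_one])
      (by rw [map_pow, perm_sq_of_card_le_two hM2, map_one]) x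
    rwa [map_one, map_pow, tail_sg hs (by omega), pow_two, Perm.one_apply] at this
  have c2 : Commute (s 0) (s 2) := hs.comm 0 2 (by omega) (by omega)
  have c3 : Commute (s 0) (s 3) := hs.comm 0 3 (by omega) (by omega)
  have hb : s 2 * s 3 * s 2 = s 3 * s 2 * s 3 := hs.braid 2 (by omega)
  obtain ⟨k, hk⟩ : ∃ k, k = (s 2)⁻¹ * s 3 := ⟨_, rfl⟩
  have hb3 : s 3 = s 2 * k := by rw [hk]; group
  have ck : Commute (s 0) k := by rw [hk]; exact c2.inv_right.mul_right c3
  have hkO : ∀ x, (s 0).SameCycle x (k x) := by rw [hk]; exact sameCycle_inv_mul c2 h32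
  have hka : Commute k (s 2 * s 2) := commute_of_sameCycle ck (c2.mul_right c2) hkO hsq
  have e1 : s 2 * (k * s 2) = k * (s 2 * s 2) * k := by
    apply mul_left_cancel (a := s 2)
    calc s 2 * (s 2 * (k * s 2)) = s 2 * s 3 * s 2 := by rw [hb3]; simp only [mul_assoc]
      _ = s 3 * s 2 * s 3 := hb
      _ = _ := by rw [hb3]; simp only [mul_assoc]
  have e2 : k * s 2 = s 2 * (k * k) := by
    apply mul_left_cancel (a := s 2)
    rw [e1, hka.eq]; simp only [mul_assoc]
  have e3 : k ^ 3 = 1 := by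
    have e4 : s 2 * s 2 * k = s 2 * s 2 * (k * k * (k * k)) := by
      calc s 2 * s 2 * k = k * s 2 * s 2 := by rw [← hka.eq, mul_assoc]
        _ = s 2 * (k * k) * s 2 := by rw [e2]
        _ = s 2 * (k * (k * s 2)) := by simp only [mul_assoc]
        _ = s 2 * (k * (s 2 * (k * k))) := by rw [e2]
        _ = s 2 * (k * s 2 * (k * k)) := by simp only [mul_assoc]
        _ = s 2 * (s 2 * (k * k) * (k * k)) := by rw [e2]
        _ = _ := by simp only [mul_assoc]
    have e5 := mul_left_cancel e4
    have e6 : k * 1 = k * k ^ 3 := by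
      rw [mul_one]; nth_rewrite 1 [e5]; simp only [pow_succ, pow_zero, one_mul, mul_assoc]
    exact (mul_left_cancel e6).symm
  have e7 : k⁻¹ = k * k := by
    rw [inv_eq_iff_mul_eq_one, ← e3]; simp only [pow_succ, pow_zero, one_mul, mul_assoc]
  have hk1 : k = 1 := eq_one_of_conj_inv hX c2 ck hkO e3 (by rw [e7, e2])
  refine hc (cyc_of_comm_at hs (i := 2) (by omega) ?_)
  change s 2 * s 3 = s 3 * s 2
  rw [hb3, hk1, mul_one]

theorem smallAct : ∀ {n : ℕ}, 5 ≤ n → SmallAct n := by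
  intro n
  induction n using Nat.strong_induction_on with
  | _ n ih =>
    intro hn
    obtain rfl | rfl | h : n = 5 ∨ n = 6 ∨ 7 ≤ n := by omega
    · exact smallAct_five
    · exact smallAct_six
    · exact smallAct_step h (ih (n - 2) (by omega) (by omega))

end
end BraidB

namespace BraidB
open Equiv

section
variable {n : ℕ}

/-- The permutation of the strands, as a permutation of `Fin n`. -/
def prF (n : ℕ) : Br n →* Perm (Fin n) where
  toFun b :=
    { toFun := fun x => ⟨prm n b x, (prm_lt_iff b).2 x.2⟩
      invFun := fun x => ⟨prm n b⁻¹ x, (prm_lt_iff b⁻¹).2 x.2⟩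
      left_inv := fun x => Fin.ext (by simp)
      right_inv := fun x => Fin.ext (by simp) }
  map_one' := by ext; simp
  map_mul' a b := by ext; simp

lemma prF_apply (b : Br n) (x : Fin n) : (prF n b x : ℕ) = prm n b x := rfl

lemma prm_eq_of_prF {a b : Br n} (h : prF n a = prF n b) : prm n a = prm n b := by
  ext j
  by_cases hj : j < n
  · rw [← prF_apply a ⟨j, hj⟩, h, prF_apply]
  · rw [prm_of_le a (by omega), prm_of_le b (by omega)]

lemma prF_sg {i : ℕ} (hi : i + 1 < n) :
    prF n (sg n i) = swap ⟨i, by omega⟩ ⟨i + 1, hi⟩ := by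
  ext x
  rw [prF_apply, prm_sg hi]
  simp only [swap_apply_def, Fin.ext_iff]
  split_ifs <;> rfl

lemma prF_surjective (n : ℕ) : Function.Surjective (prF n) := by
  obtain _ | m := n
  · exact fun p => ⟨1, Subsingleton.elim _ _⟩
  rw [← MonoidHom.mrange_eq_top, eq_top_iff, ← Perm.mclosure_swap_castSucc_succ m,
    Submonoid.closure_le]
  rintro _ ⟨i, rfl⟩
  exact ⟨sg (m + 1) i, prF_sg (by omega)⟩

/-- Parity of the order of a pair. -/
def inv2 (a b : ℕ) : ℤ := if a < b then 0 else 1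

lemma prm_mul_inv (g h : Br n) (a : ℕ) : (prm n (g * h))⁻¹ a = (prm n h)⁻¹ ((prm n g)⁻¹ a) := by
  rw [map_mul, mul_inv_rev, Perm.mul_apply]

lemma cr_inv_apply (g : Br n) (a b : ℕ) :
    cr g⁻¹ a b = - cr g (prm n g a) (prm n g b) := by
  have h := cr_mul g g⁻¹ (prm n g a) (prm n g b)
  rw [mul_inv_cancel, cr_one, inv_apply_self', inv_apply_self'] at h
  omega

lemma cr_comm (g : Br n) : ∀ a b : ℕ, cr g a b = cr g b a := by
  induction g using Br.induction with
  | h1 => intro a b; rw [cr_one, cr_one]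
  | hs i hi =>
    intro a b; rw [cr_sg hi, cr_sg hi]
    congr 1
    rw [eq_iff_iff]; omega
  | hm g h hg hh => intro a b; rw [cr_mul, cr_mul, hg, hh]
  | hi g hg => intro a b; rw [cr_inv_apply, cr_inv_apply, hg]

lemma cr_parity (g : Br n) : ∀ a b : ℕ, a ≠ b →
    Even (cr g a b + inv2 a b + inv2 ((prm n g)⁻¹ a) ((prm n g)⁻¹ b)) := by
  induction g using Br.induction with
  | h1 =>
    intro a b _
    rw [cr_one, map_one, inv_one, Perm.one_apply, Perm.one_apply]
    exact ⟨inv2 a b, by ring⟩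
  | hs i hi =>
    intro a b hab
    rw [cr_sg hi, prm_sg hi, swap_inv]
    simp only [swap_apply_def, inv2]
    split_ifs <;> first | omega | decide
  | hm g h hg hh =>
    intro a b hab
    have h1 := hg a b hab
    have h2 := hh ((prm n g)⁻¹ a) ((prm n g)⁻¹ b) ((prm n g)⁻¹.injective.ne hab)
    rw [cr_mul, prm_mul_inv, prm_mul_inv]
    have h3 := h1.add h2
    have e : ∀ p q x y z : ℤ, Even (p + x + y + (q + y + z)) → Even (p + q + x + z) := by
      intro p q x y z h
      have : p + q + x + z = p + x + y + (q + y + z) - 2 * y := by ring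
      rw [this]; exact h.sub (even_two_mul y)
    exact e _ _ _ _ _ h3
  | hi g hg =>
    intro a b hab
    have h1 := hg _ _ ((prm n g).injective.ne hab)
    rw [inv_apply_self', inv_apply_self'] at h1
    rw [cr_inv_apply, map_inv, inv_inv]
    have e : ∀ p x y : ℤ, Even (p + x + y) → Even (-p + y + x) := by
      intro p x y h
      have : -p + y + x = p + x + y - 2 * p := by ring
      rw [this]; exact h.sub (even_two_mul p)
    exact e _ _ _ h1

end

/-- The fixed point free involutions of a six element set. -/
def synthemes : List (Fin 6 → Fin 6) :=
  [![1, 0, 3, 2, 5, 4], ![1, 0, 4, 5, 2, 3], ![1, 0, 5, 4, 3, 2],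
   ![2, 3, 0, 1, 5, 4], ![2, 4, 0, 5, 1, 3], ![2, 5, 0, 4, 3, 1],
   ![3, 2, 1, 0, 5, 4], ![3, 4, 5, 0, 1, 2], ![3, 5, 4, 0, 2, 1],
   ![4, 2, 1, 5, 0, 3], ![4, 3, 5, 1, 0, 2], ![4, 5, 3, 2, 0, 1],
   ![5, 2, 1, 4, 3, 0], ![5, 3, 4, 1, 2, 0], ![5, 4, 3, 2, 1, 0]]

set_option synthInstance.maxHeartbeats 2000000 in
set_option synthInstance.maxSize 100000 in
lemma table_mem_synthemes : ∀ a0 : Fin 6, a0 ≠ 0 → ∀ a1 : Fin 6, a1 ≠ 1 → (a0 = 1 ↔ a1 = 0) →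
    ∀ a2 : Fin 6, a2 ≠ 2 → (a0 = 2 ↔ a2 = 0) → (a1 = 2 ↔ a2 = 1) →
    ∀ a3 : Fin 6, a3 ≠ 3 → (a0 = 3 ↔ a3 = 0) → (a1 = 3 ↔ a3 = 1) → (a2 = 3 ↔ a3 = 2) →
    ∀ a4 : Fin 6, a4 ≠ 4 → (a0 = 4 ↔ a4 = 0) → (a1 = 4 ↔ a4 = 1) → (a2 = 4 ↔ a4 = 2) →
      (a3 = 4 ↔ a4 = 3) →
    ∀ a5 : Fin 6, a5 ≠ 5 → (a0 = 5 ↔ a5 = 0) → (a1 = 5 ↔ a5 = 1) → (a2 = 5 ↔ a5 = 2) →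
      (a3 = 5 ↔ a5 = 3) → (a4 = 5 ↔ a5 = 4) → ![a0, a1, a2, a3, a4, a5] ∈ synthemes := by
  decide +kernel

lemma mem_synthemes {f : Fin 6 → Fin 6} (h1 : ∀ x, f x ≠ x) (h2 : ∀ x, f (f x) = x) :
    f ∈ synthemes := by
  have e : ∀ x y, f x = y ↔ f y = x := fun x y =>
    ⟨fun h => by rw [← h, h2], fun h => by rw [← h, h2]⟩
  have := table_mem_synthemes (f 0) (h1 0) (f 1) (h1 1) (e _ _) (f 2) (h1 2) (e _ _) (e _ _)
    (f 3) (h1 3) (e _ _) (e _ _) (e _ _) (f 4) (h1 4) (e _ _) (e _ _) (e _ _) (e _ _)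
    (f 5) (h1 5) (e _ _) (e _ _) (e _ _) (e _ _) (e _ _)
  have hf : ![f 0, f 1, f 2, f 3, f 4, f 5] = f := by
    funext x; fin_cases x <;> rfl
  rwa [hf] at this

/-- Commutation of maps on six points. -/
def commSix (a b : Fin 6 → Fin 6) : Bool := [0, 1, 2, 3, 4, 5].all fun i => a (b i) == b (a i)

lemma commSix_iff (a b : Perm (Fin 6)) : commSix a b = true ↔ a * b = b * a := by
  simp [commSix, Perm.ext_iff, Fin.forall_fin_succ]

/-- The cube of a Coxeter product. -/
def coxCube (s0 s1 s2 s3 s4 : Fin 6 → Fin 6) (a : Fin 6) : Fin 6 :=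
  s0 (s1 (s2 (s3 (s4 (s0 (s1 (s2 (s3 (s4 (s0 (s1 (s2 (s3 (s4 a))))))))))))))

/-- The cube of the Coxeter product is a transposition not contained in `s0`. -/
def goodSix (s0 s1 s2 s3 s4 : Fin 6 → Fin 6) : Bool :=
  [0, 1, 2, 3, 4, 5].any fun y => [0, 1, 2, 3, 4, 5].any fun z =>
    y != z && (coxCube s0 s1 s2 s3 s4 y == z && (coxCube s0 s1 s2 s3 s4 z == y &&
      ((s0 y != z) && [0, 1, 2, 3, 4, 5].all fun a =>
        a == y || (a == z || coxCube s0 s1 s2 s3 s4 a == a))))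

lemma synthemes_search : (synthemes.all fun s1 => commSix ![1, 0, 3, 2, 5, 4] s1 ||
    synthemes.all fun s2 => !commSix ![1, 0, 3, 2, 5, 4] s2 || commSix s1 s2 ||
    synthemes.all fun s3 => !commSix ![1, 0, 3, 2, 5, 4] s3 || !commSix s1 s3 || commSix s2 s3 ||
    synthemes.all fun s4 => !commSix ![1, 0, 3, 2, 5, 4] s4 || !commSix s1 s4 ||
    !commSix s2 s4 || commSix s3 s4 || goodSix ![1, 0, 3, 2, 5, 4] s1 s2 s3 s4) = true := by
  decide +kernel

lemma exists_transposition_of_eq {s : ℕ → Perm (Fin 6)} (hs : BraidRel 6 s) (hc : ¬ Cyc 6 s)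
    (h0 : (s 0 : Fin 6 → Fin 6) = ![1, 0, 3, 2, 5, 4])
    (hinv : ∀ i, i + 1 < 6 → ∀ x, s i x ≠ x ∧ s i (s i x) = x) :
    ∃ y z : Fin 6, y ≠ z ∧ (ew s 5 ^ 3) y = z ∧ (ew s 5 ^ 3) z = y ∧
      (∀ a, a ≠ y → a ≠ z → (ew s 5 ^ 3) a = a) ∧ s 0 y ≠ z := by
  have hm : ∀ i, i + 1 < 6 → (s i : Fin 6 → Fin 6) ∈ synthemes := fun i hi =>
    mem_synthemes (fun x => (hinv i hi x).1) (fun x => (hinv i hi x).2)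
  have hcm : ∀ i j, i + 2 ≤ j → j + 1 < 6 → commSix (s i) (s j) = true := fun i j h1 h2 =>
    (commSix_iff _ _).2 (hs.comm i j h1 h2)
  have hnc : ∀ i, i + 2 < 6 → commSix (s i) (s (i + 1)) = false := fun i hi => by
    rw [← Bool.not_eq_true, commSix_iff]
    exact fun h => hc (cyc_of_comm_at hs hi h)
  have e1 := List.all_eq_true.1 (h0 ▸ synthemes_search) _ (hm 1 (by omega))
  rw [hnc 0 (by omega), Bool.false_or] at e1
  have e2 := List.all_eq_true.1 e1 _ (hm 2 (by omega))
  rw [hcm 0 2 (by omega) (by omega), hnc 1 (by omega), Bool.not_true, Bool.false_or,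
    Bool.false_or] at e2
  have e3 := List.all_eq_true.1 e2 _ (hm 3 (by omega))
  rw [hcm 0 3 (by omega) (by omega), hcm 1 3 (by omega) (by omega), hnc 2 (by omega),
    Bool.not_true, Bool.false_or, Bool.false_or, Bool.false_or] at e3
  have e4 := List.all_eq_true.1 e3 _ (hm 4 (by omega))
  rw [hcm 0 4 (by omega) (by omega), hcm 1 4 (by omega) (by omega), hcm 2 4 (by omega) (by omega),
    hnc 3 (by omega),
    Bool.not_true, Bool.false_or, Bool.false_or, Bool.false_or, Bool.false_or] at e4
  have hτ : ∀ a, (ew s 5 ^ 3) a = coxCube (s 0) (s 1) (s 2) (s 3) (s 4) a := fun a => rfl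
  simp only [goodSix, List.any_eq_true, List.all_eq_true, Bool.and_eq_true, Bool.or_eq_true,
    bne_iff_ne, beq_iff_eq] at e4
  obtain ⟨y, -, z, -, hyz, h1, h2, h3, h4⟩ := e4
  refine ⟨y, z, hyz, h1, h2, fun a ha hb => ?_, h3⟩
  rcases h4 a (by fin_cases a <;> simp) with h | h | h
  · exact absurd h ha
  · exact absurd h hb
  · exact h

/-- Fixed point free involutions of six points are conjugate. -/
lemma isConj_of_involution {σ τ : Perm (Fin 6)} (hσ : ∀ x, σ x ≠ x ∧ σ (σ x) = x)
    (hτ : ∀ x, τ x ≠ x ∧ τ (τ x) = x) : IsConj σ τ := by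
  have key : ∀ σ : Perm (Fin 6), (∀ x, σ x ≠ x ∧ σ (σ x) = x) →
      σ.cycleType = Multiset.replicate 3 2 := by
    intro σ hσ
    have h1 : σ ^ 2 = 1 := by ext x; simp [pow_two, (hσ x).2]
    have h2 := Perm.cycleType_of_pow_prime_eq_one h1
    have h3 : σ.support = Finset.univ := by ext x; simp [(hσ x).1]
    have h4 := σ.sum_cycleType
    rw [h2, Multiset.sum_replicate, h3, Finset.card_univ, Fintype.card_fin, smul_eq_mul] at h4
    rw [h2, show σ.cycleType.card = 3 by omega]
  rw [Perm.isConj_iff_cycleType_eq, key σ hσ, key τ hτ]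

lemma exists_transposition {s : ℕ → Perm (Fin 6)} (hs : BraidRel 6 s) (hc : ¬ Cyc 6 s)
    (hinv : ∀ i, i + 1 < 6 → ∀ x, s i x ≠ x ∧ s i (s i x) = x) :
    ∃ y z : Fin 6, y ≠ z ∧ (ew s 5 ^ 3) y = z ∧ (ew s 5 ^ 3) z = y ∧
      (∀ a, a ≠ y → a ≠ z → (ew s 5 ^ 3) a = a) ∧ s 0 y ≠ z := by
  obtain ⟨π, hπ⟩ := isConj_iff.1 (isConj_of_involution (hinv 0 (by omega))
    (τ := swap 0 1 * swap 2 3 * swap 4 5) (by decide))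
  have hw := ew_map (MulAut.conj π).toMonoidHom s 5
  obtain ⟨y, z, hyz, h1, h2, h3, h4⟩ := exists_transposition_of_eq
    (hs.map (MulAut.conj π).toMonoidHom)
    (fun h => hc fun i hi => (MulAut.conj π).injective (h i hi))
    ((congrArg (fun σ : Perm (Fin 6) => (σ : Fin 6 → Fin 6)) hπ).trans (by decide))
    (fun i hi x => by
      have := hinv i hi (π⁻¹ x)
      refine ⟨fun h => this.1 ?_, ?_⟩
      · exact (Perm.eq_inv_iff_eq).2 h
      · exact (congrArg π (by simpa using this.2)).trans (π.apply_symm_apply x))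
  rw [← hw, ← map_pow] at h1 h2 h3
  have e : ∀ (g : Perm (Fin 6)) x, (MulAut.conj π).toMonoidHom g x = π (g (π⁻¹ x)) :=
    fun _ _ => rfl
  rw [e] at h1 h2 h4
  refine ⟨π⁻¹ y, π⁻¹ z, (π⁻¹).injective.ne hyz, ?_, ?_, fun a ha hb => ?_, fun h => h4 ?_⟩
  · exact Perm.eq_inv_iff_eq.2 h1
  · exact Perm.eq_inv_iff_eq.2 h2
  · have h5 := h3 (π a) (fun h => ha (Perm.eq_inv_iff_eq.2 h)) (fun h => hb (Perm.eq_inv_iff_eq.2 h))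
    rw [e] at h5
    simpa using h5
  · exact Perm.eq_inv_iff_eq.1 h

/-- No endomorphism of the braid group on six strands induces the exotic action. -/
lemma not_exotic (θ : Br 6 →* Br 6) (hc : ¬ Cyc 6 fun i => prF 6 (θ (sg 6 i)))
    (h0 : ∀ x, prF 6 (θ (sg 6 0)) x ≠ x ∧ prF 6 (θ (sg 6 0)) (prF 6 (θ (sg 6 0)) x) = x) :
    False := by
  have hs := (braidRel_sg 6).map ((prF 6).comp θ)
  have hinv : ∀ i, i + 1 < 6 → ∀ x, ((prF 6).comp θ) (sg 6 i) x ≠ x ∧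
      ((prF 6).comp θ) (sg 6 i) (((prF 6).comp θ) (sg 6 i) x) = x := by
    intro i hi x
    obtain ⟨g, hg⟩ := hs.conj_zero hi
    have h := h0 (g⁻¹ x)
    rw [hg]
    constructor
    · intro e
      apply h.1
      have := congrArg (g⁻¹ : Perm (Fin 6)) e
      rwa [Perm.mul_apply, Perm.mul_apply, inv_apply_self'] at this
    · simp only [Perm.mul_apply, inv_apply_self']
      have := congrArg g h.2
      rwa [← Perm.mul_apply g g⁻¹ x, mul_inv_cancel, Perm.one_apply] at this
  obtain ⟨y, z, hyz, hy, hz, hfix, h0yz⟩ := exists_transposition hs hc hinv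
  rw [← ew_map, ← map_pow] at hy hz hfix
  obtain ⟨G, hG⟩ : ∃ G, G = θ (ew (sg 6) 5 ^ 3) := ⟨_, rfl⟩
  rw [MonoidHom.comp_apply, ← hG] at hy hz hfix
  have hG2 : G * G = θ (twB 6 6) := by
    rw [hG, ← map_mul, ← pow_add]; rfl
  have hsq : prm 6 (G * G) = 1 := by
    rw [← map_one (prm 6)]
    apply prm_eq_of_prF
    rw [map_one, map_mul]
    ext x
    rw [Perm.mul_apply, Perm.one_apply]
    by_cases h1 : x = y
    · rw [h1, hy, hz]
    by_cases h2 : x = z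
    · rw [h2, hz, hy]
    rw [hfix x h1 h2, hfix x h1 h2]
  have hinvG : (prm 6 G)⁻¹ = prm 6 G := by
    rw [inv_eq_iff_mul_eq_one, ← map_mul, hsq]
  have hcr : ∀ a b, cr (G * G) a b = cr G a b + cr G (prm 6 G a) (prm 6 G b) := fun a b => by
    rw [cr_mul, hinvG]
  have hpy : prm 6 G y = z := by rw [← prF_apply, hy]
  have hpz : prm 6 G z = y := by rw [← prF_apply, hz]
  have hpf : ∀ a : Fin 6, a ≠ y → a ≠ z → prm 6 G a = a := fun a h1 h2 => by
    rw [← prF_apply, hfix a h1 h2]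
  have k1 := cr_parity G y z (fun h => hyz (Fin.ext h))
  rw [hinvG, hpy, hpz] at k1
  have k2 := hcr y z
  rw [hpy, hpz, cr_comm G z y] at k2
  obtain ⟨c, hcdef⟩ : ∃ c, c = θ (sg 6 0) := ⟨_, rfl⟩
  have hcomm : c * (G * G) * c⁻¹ = G * G := by
    rw [hG2, hcdef, ← map_inv, ← map_mul, ← map_mul, ← (twB_central (sg 6 0)).eq,
      mul_inv_cancel_right]
  have k3 := cr_conj hsq c y z
  rw [hcomm] at k3
  have hi0 := hinv 0 (by omega)
  simp only [MonoidHom.comp_apply, ← hcdef] at hi0 h0yz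
  have n1 : prF 6 c z ≠ y := fun h => h0yz (by rw [← h, (hi0 z).2])
  have k4 := hcr (prF 6 c y) (prF 6 c z)
  rw [hpf _ (hi0 y).1 h0yz, hpf _ n1 (hi0 z).1] at k4
  have k5 := cr_parity G (prF 6 c y) (prF 6 c z)
    (fun h => hyz ((prF 6 c).injective (Fin.ext h)))
  rw [hinvG, hpf _ (hi0 y).1 h0yz, hpf _ n1 (hi0 z).1] at k5
  rw [prF_apply, prF_apply] at k4 k5
  rw [k3] at k4
  have hne : (y : ℕ) ≠ z := fun h => hyz (Fin.ext h)
  have k6 : inv2 (y : ℕ) z + inv2 (z : ℕ) y = 1 := by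
    simp only [inv2]
    split_ifs <;> omega
  obtain ⟨p, hp⟩ := k1
  obtain ⟨q, hq⟩ := k5
  omega

end BraidB

namespace BraidB
open Equiv

/-- Every endomorphism of the braid group on `n ≥ 5` strands is either cyclic or induces, up to
conjugation, the standard permutations of the strands. -/
theorem cyc_or_standard_prm {n : ℕ} (hn : 5 ≤ n) (θ : Br n →* Br n) :
    Cyc n (fun i => θ (sg n i)) ∨
      ∃ x : Br n, ∀ i, i + 1 < n → prm n (x * θ (sg n i) * x⁻¹) = swap i (i + 1) := by
  have hs : BraidRel n fun i => prF n (θ (sg n i)) := (braidRel_sg n).map ((prF n).comp θ)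
  by_cases hc : Cyc n fun i => prF n (θ (sg n i))
  · exact Or.inl (cyc_of_prm_cyc hn θ fun i hi => prm_eq_of_prF (hc i hi))
  right
  rcases smallAct hn (Fin n) _ hs (by simp) hc with h0 | ⟨rfl, -, h⟩
  · replace h0 : (prF n (θ (sg n 0))).IsSwap := by
      obtain ⟨a, b, hab, h⟩ := h0
      exact ⟨a, b, hab, by convert h⟩
    obtain ⟨p, hp, hsp⟩ := swap_chain hn hs hc h0
    have hinj := (le_card_of_swap_chain hp).1
    obtain ⟨π, hπ⟩ : ∃ π : Perm (Fin n), ∀ i, π i = p i :=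
      ⟨Equiv.ofBijective _ (Finite.injective_iff_bijective.1 hinj), fun _ => rfl⟩
    obtain ⟨x, hx⟩ := prF_surjective n π⁻¹
    refine ⟨x, fun i hi => ?_⟩
    rw [← prm_sg hi]
    apply prm_eq_of_prF
    rw [map_mul, map_mul, map_inv, hx, prF_sg hi, hsp i hi, inv_inv]
    have h1 : p i = π ⟨i, by omega⟩ := (hπ ⟨i, by omega⟩).symm
    have h2 : p (i + 1) = π ⟨i + 1, hi⟩ := (hπ ⟨i + 1, hi⟩).symm
    rw [h1, h2, swap_apply_apply]
    group
  · exact (not_exotic θ hc h).elim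

/-- Every non-cyclic endomorphism of the braid group on `n ≥ 5` strands is standard. -/
theorem cyc_or_stdEnd {n : ℕ} (hn : 5 ≤ n) (θ : Br n →* Br n) :
    Cyc n (fun i => θ (sg n i)) ∨ StdEnd n (fun i => θ (sg n i)) := by
  refine (cyc_or_standard_prm hn θ).imp_right ?_
  rintro ⟨x, hx⟩
  have := stdLift_of_four (n := n) (by omega) ((MulAut.conj x).toMonoidHom.comp θ) hx
  refine StdEnd.of_conj x⁻¹ (fun i _ => ?_) this
  simp [mul_assoc]

end BraidB

namespace BraidB
open Equiv

/-- An endomorphism of `D (m + 3)` which is not cyclic on the braid generators has, up to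
conjugation, one of four explicit forms. -/
theorem D.endo_classification {m : ℕ} (hm : 2 ≤ m) (φ : D (m + 3) →* D (m + 3)) :
    Cyc (m + 3) (fun i => φ (dr (sg (m + 3) i))) ∨
    ∃ (ε : ℤ) (y : D (m + 3)) (k r s q : ℤ), (ε = 1 ∨ ε = -1) ∧
      (∀ i, i + 1 < m + 3 → y * φ (dr (sg (m + 3) i)) * y⁻¹ =
        dr (sg (m + 3) i) ^ ε * dl (cc (m + 3) (m + 3) ^ k) * zD (m + 3) ^ q) ∧
      (y * φ (dl (xx (m + 3) (m + 2))) * y⁻¹ = dl (cc (m + 3) (m + 3) ^ r) * zD (m + 3) ^ s ∨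
      y * φ (dl (xx (m + 3) (m + 2))) * y⁻¹ =
        dlt (m + 3) ^ (-ε) * dl (cc (m + 3) (m + 3) ^ r) * zD (m + 3) ^ s ∨
      k = 0 ∧ (y * φ (dl (xx (m + 3) (m + 2))) * y⁻¹ =
          dl (xx (m + 3) (m + 2)) ^ ε * zD (m + 3) ^ s ∨
        y * φ (dl (xx (m + 3) (m + 2))) * y⁻¹ =
          dlt (m + 3) ^ (-ε) * dl (xx (m + 3) (m + 2)) ^ (-ε) * zD (m + 3) ^ s)) := by
  have hn : 5 ≤ m + 3 := by omega
  rcases cyc_or_stdEnd hn (pr.comp (φ.comp dr)) with h | ⟨y, ε, q, hε, h⟩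
  · exact Or.inl (cyc_of_pr_cyc hn (φ.comp dr) h)
  right
  obtain ⟨ψ, hψ⟩ : ∃ ψ : D (m + 3) →* D (m + 3), ∀ g, ψ g = (dr y)⁻¹ * φ g * dr y :=
    ⟨(MulAut.conj (dr y)⁻¹).toMonoidHom.comp φ, fun g => by simp⟩
  have H1 : ∀ i, i + 1 < m + 3 →
      pr (ψ (dr (sg (m + 3) i))) = sg (m + 3) i ^ ε * twB (m + 3) (m + 3) ^ q := by
    intro i hi
    have := h i hi
    simp only [MonoidHom.comp_apply] at this
    rw [hψ, map_mul, map_mul, map_inv, this]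
    have hpr : ∀ b : Br (m + 3), pr (dr b : D (m + 3)) = b := fun b => rfl
    rw [hpr]
    group
  have H2 : prm (m + 3) (pr (ψ (dl (xx (m + 3) (m + 2))))) = 1 := by
    refine eq_one_of_fixes_pred (n := m + 2) fun j hj =>
      perm_eq_of_conj_swap (n := m + 2) (by omega) (fun i hi => ?_) hj
    have h1 := congrArg (fun g => prm (m + 3) (pr (ψ g)))
      ((dRel_D (m + 3)).comm i (by omega))
    simp only [map_mul, H1 i (by omega), map_zpow] at h1
    rw [prm_sg (by omega), prm_twB le_rfl, swap_zpow hε, one_zpow, mul_one] at h1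
    rw [mul_inv_eq_iff_eq_mul]
    exact h1.symm
  obtain ⟨z, k, r, s, hz1, hz2⟩ := endo_form hε ψ H1 H2
  have key : ∀ g, z * (dr y)⁻¹ * φ g * (z * (dr y)⁻¹)⁻¹ = z * ψ g * z⁻¹ := by
    intro g; rw [hψ]; group
  refine ⟨ε, z * (dr y)⁻¹, k, r, s, q, hε, ?_, ?_⟩
  · intro i hi; rw [key, hz1 i hi]
  · rw [key]; exact hz2

/-- Powers of the central element of the free group in terms of the full twist. -/
lemma dl_cc_zpow (n : ℕ) (k : ℤ) :
    (dl (cc n n ^ k) : D n) = dr (twB n n) ^ (-k) * zD n ^ k := by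
  have h : Commute (dl (cc n n) : D n) (dr (twB n n)) := (dr_dl_comm_cc_top _).symm
  rw [zD, h.mul_zpow, map_zpow, (h.zpow_zpow k k).eq, zpow_neg, inv_mul_cancel_left]

end BraidB

namespace BraidB

section
variable {n : ℕ}

lemma dRel_ArtinB (hn : 2 ≤ n) : DRel n (fun i => rB n (i + 1)) (rB n n) where
  br :=
    { comm := fun i j h1 h2 => by
        have := PresentedGroup.one_of_mem (rels := BnRels n)
          (Or.inr (Or.inr ⟨⟨i, by omega⟩, ⟨j, by omega⟩, h1, rfl⟩))
        simp only [map_mul, map_inv] at this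
        simp only [rB, dif_pos (show i + 1 - 1 < n by omega), dif_pos (show j + 1 - 1 < n by omega)]
        exact mul_inv_eq_one.mp this
      braid := fun i h => by
        have := PresentedGroup.one_of_mem (rels := BnRels n)
          (Or.inl ⟨⟨i, by omega⟩, ⟨i + 1, by omega⟩, rfl, by simp only; omega, rfl⟩)
        simp only [map_mul, map_inv] at this
        simp only [rB, dif_pos (show i + 1 - 1 < n by omega),
          dif_pos (show i + 1 + 1 - 1 < n by omega)]
        exact mul_inv_eq_one.mp this }
  comm i hi := by
    have := PresentedGroup.one_of_mem (rels := BnRels n)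
      (Or.inr (Or.inr ⟨⟨i, by omega⟩, ⟨n - 1, by omega⟩, by simp only; omega, rfl⟩))
    simp only [map_mul, map_inv] at this
    simp only [rB, dif_pos (show i + 1 - 1 < n by omega), dif_pos (show n - 1 < n by omega)]
    exact mul_inv_eq_one.mp this
  four _ := by
    have := PresentedGroup.one_of_mem (rels := BnRels n)
      (Or.inr (Or.inl ⟨⟨n - 2, by omega⟩, ⟨n - 1, by omega⟩, by simp only; omega,
        by simp only; omega, rfl⟩))
    simp only [map_mul, map_inv] at this
    simp only [Four, rB, dif_pos (show n - 2 + 1 - 1 < n by omega),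
      dif_pos (show n - 1 < n by omega)]
    exact mul_inv_eq_one.mp this

/-- The images of the standard generators of `ArtinB n` in `D n`. -/
def genD (n i : ℕ) : D n := if i + 1 < n then dr (sg n i) else dl (xx n (n - 1))

/-- The homomorphism from the Artin group of type `B_n` to its semidirect product model. -/
def toD (n : ℕ) : ArtinB n →* D n :=
  PresentedGroup.toGroup (rels := BnRels n) (f := fun i : Fin n => genD n i) (by
    rintro w (⟨i, j, h1, h2, rfl⟩ | ⟨i, j, h1, h2, rfl⟩ | ⟨i, j, h1, rfl⟩)
    · simp only [map_mul, map_inv, FreeGroup.lift_apply_of, genD, ← h1]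
      rw [if_pos (by omega), if_pos (by omega), mul_inv_eq_one]
      exact (dRel_D n).br.braid i (by omega)
    · simp only [map_mul, map_inv, FreeGroup.lift_apply_of, genD]
      rw [if_pos (by omega), if_neg (by omega), mul_inv_eq_one,
        show (i : ℕ) = n - 2 by omega]
      exact (dRel_D n).four (by omega)
    · have hj := j.2
      simp only [map_mul, map_inv, FreeGroup.lift_apply_of, genD]
      rw [if_pos (show (i : ℕ) + 1 < n by omega), mul_inv_eq_one]
      split_ifs with h2
      · exact (dRel_D n).br.comm i j h1 h2
      · exact (dRel_D n).comm i (by omega))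

lemma toD_rB {i : ℕ} (hi : i + 1 < n) : toD n (rB n (i + 1)) = dr (sg n i) := by
  rw [rB, dif_pos (show i + 1 - 1 < n by omega)]
  refine (PresentedGroup.toGroup.of (rels := BnRels n) _).trans ?_
  simp [genD, hi]

lemma toD_rB_last (hn : 0 < n) : toD n (rB n n) = dl (xx n (n - 1)) := by
  rw [rB, dif_pos (show n - 1 < n by omega)]
  refine (PresentedGroup.toGroup.of (rels := BnRels n) _).trans ?_
  simp only [genD]
  rw [if_neg (by omega)]

/-- The Artin group of type `B_n` is isomorphic to its semidirect product model. -/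
def artinEquivD (hn : 2 ≤ n) : ArtinB n ≃* D n :=
  MonoidHom.toMulEquiv (toD n) (D.lift _ _ (dRel_ArtinB hn))
    (by
      refine PresentedGroup.ext fun i => ?_
      obtain ⟨i, hi⟩ := i
      have e : (PresentedGroup.of ⟨i, hi⟩ : ArtinB n) = rB n (i + 1) := by simp [rB, hi]
      rw [e, MonoidHom.comp_apply, MonoidHom.id_apply]
      rcases Nat.lt_or_ge (i + 1) n with h | h
      · rw [toD_rB h, D.lift_sg _ h]
      · obtain rfl : n = i + 1 := by omega
        rw [toD_rB_last (by omega), D.lift_x _ (by omega)])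
    (by
      refine D.hom_ext (fun i hi => ?_) ?_
      · rw [MonoidHom.comp_apply, D.lift_sg _ hi, toD_rB hi, MonoidHom.id_apply]
      · rw [MonoidHom.comp_apply, D.lift_x _ (by omega), toD_rB_last (by omega),
          MonoidHom.id_apply])

lemma prod_range_eq_ew {G : Type*} [Group G] (s : ℕ → G) (k : ℕ) :
    ((List.range k).map s).prod = ew s k := by
  induction k with
  | zero => rfl
  | succ k ih => rw [List.range_succ, List.map_append, List.prod_append, ih, ew_succ]; simp

lemma gars_eq_prod {G : Type*} [Group G] (s : ℕ → G) (k : ℕ) :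
    ((List.range k).map fun j => ((List.range (k - j)).map s).prod).prod = gars s k := by
  induction k with
  | zero => rfl
  | succ k ih =>
    rw [List.range_succ_eq_map, List.map_cons, List.prod_cons, List.map_map, gars_succ, ← ih,
      Nat.sub_zero, prod_range_eq_ew]
    simp [Function.comp_def]

lemma dd_eq_prod {G : Type*} [Group G] (s : ℕ → G) (k : ℕ) :
    ((List.range k).map fun i => s (k - i)).prod * s 0 ^ 2 *
      ((List.range k).map fun i => s (i + 1)).prod = dd s (k + 1) := by
  induction k with
  | zero => simp [dd_succ, pow_two]
  | succ k ih =>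
    rw [dd_succ, ← ih, List.range_succ_eq_map, List.map_cons, List.prod_cons, List.map_map,
      ← List.range_succ_eq_map, List.range_succ, List.map_append, List.prod_append]
    simp [Function.comp_def, mul_assoc]

lemma gars_map {G H : Type*} [Group G] [Group H] (f : G →* H) (s : ℕ → G) (k : ℕ) :
    f (gars s k) = gars (fun i => f (s i)) k := by
  induction k with
  | zero => exact map_one f
  | succ k ih => rw [gars_succ, gars_succ, map_mul, ih, ew_map]

lemma gars_congr {G : Type*} [Group G] {s t : ℕ → G} {k : ℕ} (h : ∀ i, i < k → s i = t i) :
    gars s k = gars t k := by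
  induction k with
  | zero => rfl
  | succ k ih => rw [gars_succ, gars_succ, ih fun i hi => h i (by omega), ew_congr h]

lemma toD_ΔB (hn : 2 ≤ n) : toD n (ΔB n) = zD n := by
  obtain ⟨m, rfl⟩ : ∃ m, n = m + 1 := ⟨n - 1, by omega⟩
  rw [zD_eq_pow (by omega), ΔB, ρB, map_pow, prod_range_eq_ew, ew_succ, map_mul, ew_map,
    toD_rB_last (by omega), ew_congr fun i hi => toD_rB (by omega)]
  rfl

lemma toD_ΔY_sq (hn : 2 ≤ n) : toD n (ΔY n) ^ 2 = dr (twB n n) := by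
  rw [ΔY, gars_eq_prod, gars_map, gars_congr fun i hi => toD_rB (by omega), ← gars_map,
    ← map_pow, gars_sq (braidRel_sg n) (by omega), Nat.sub_add_cancel (by omega)]

lemma toD_δB (hn : 2 ≤ n) : toD n (δB n) = dlt n := by
  obtain ⟨m, rfl⟩ : ∃ m, n = m + 2 := ⟨n - 2, by omega⟩
  have e : δB (m + 2) = dd (fun i => rB (m + 2) (i + 1)) (m + 1) := by
    have e1 : ((List.range m).map fun i => rB (m + 2) (m + 2 - 1 - i)) =
        (List.range m).map fun i => rB (m + 2) (m - i + 1) := by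
      refine List.map_congr_left fun i hi => ?_
      rw [List.mem_range] at hi
      congr 1
      omega
    rw [← dd_eq_prod, ← e1]
    rfl
  rw [e, dd_map, dd_congr fun i hi => toD_rB (by omega), ← dd_map]
  rfl

end

end BraidB

/-- classification of endomorphisms of `A[Bₙ]` up to conjugation,
written in the standard generators `r_1, …, r_n`. -/
theorem endomorphism_classification_standard_generators (n : ℕ) (hn : 5 ≤ n)
    (φ : ArtinB n →* ArtinB n) :
    ∃ x : ArtinB n,
      (∃ g h : ArtinB n, g * h = h * g ∧
        (∀ i, 1 ≤ i → i ≤ n - 1 → conjComp x φ (rB n i) = g) ∧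
        conjComp x φ (rB n n) = h) ∨
      (∃ ε p q : ℤ, (ε = 1 ∨ ε = -1) ∧
        (∀ i, 1 ≤ i → i ≤ n - 1 → conjComp x φ (rB n i) = rB n i ^ ε * ΔB n ^ p) ∧
        conjComp x φ (rB n n) = rB n n ^ ε * ΔB n ^ q) ∨
      (∃ ε p q : ℤ, (ε = 1 ∨ ε = -1) ∧
        (∀ i, 1 ≤ i → i ≤ n - 1 → conjComp x φ (rB n i) = rB n i ^ ε * ΔB n ^ p) ∧
        conjComp x φ (rB n n) = δB n ^ (-ε) * rB n n ^ (-ε) * ΔB n ^ q) ∨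
      (∃ ε p q r s : ℤ, (ε = 1 ∨ ε = -1) ∧
        (∀ i, 1 ≤ i → i ≤ n - 1 →
          conjComp x φ (rB n i) = rB n i ^ ε * ΔY n ^ (2 * p) * ΔB n ^ q) ∧
        conjComp x φ (rB n n) = ΔY n ^ (2 * r) * ΔB n ^ s) ∨
      (∃ ε p q r s : ℤ, (ε = 1 ∨ ε = -1) ∧
        (∀ i, 1 ≤ i → i ≤ n - 1 →
          conjComp x φ (rB n i) = rB n i ^ ε * ΔY n ^ (2 * p) * ΔB n ^ q) ∧
        conjComp x φ (rB n n) = δB n ^ (-ε) * ΔY n ^ (2 * r) * ΔB n ^ s) := by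
  open BraidB in
  obtain ⟨m, rfl⟩ : ∃ m, n = m + 3 := ⟨n - 3, by omega⟩
  have h2 : 2 ≤ m + 3 := by omega
  obtain ⟨e, he⟩ : ∃ e : ArtinB (m + 3) ≃* D (m + 3), ∀ g, e g = toD (m + 3) g :=
    ⟨artinEquivD h2, fun _ => rfl⟩
  obtain ⟨Φ, hΦ⟩ : ∃ Φ : D (m + 3) →* D (m + 3), ∀ g, Φ (e g) = e (φ g) :=
    ⟨(e.toMonoidHom.comp φ).comp e.symm.toMonoidHom, fun g => by simp⟩
  have er : ∀ i, i + 1 < m + 3 → e (rB (m + 3) (i + 1)) = dr (sg (m + 3) i) := fun i hi => by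
    rw [he, toD_rB hi]
  have ex : e (rB (m + 3) (m + 3)) = dl (xx (m + 3) (m + 2)) := by
    rw [he, toD_rB_last (by omega)]; rfl
  have eΔ : e (ΔB (m + 3)) = zD (m + 3) := by rw [he, toD_ΔB h2]
  have eδ : e (δB (m + 3)) = dlt (m + 3) := by rw [he, toD_δB h2]
  have eY : ∀ k : ℤ, e (ΔY (m + 3) ^ (2 * k)) = dr (twB (m + 3) (m + 3)) ^ k := fun k => by
    rw [map_zpow, zpow_mul, he, ← toD_ΔY_sq h2]; rfl
  have ecc : ∀ k : ℤ, dl (cc (m + 3) (m + 3) ^ k) =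
      e (ΔY (m + 3) ^ (2 * -k)) * e (ΔB (m + 3)) ^ k := fun k => by
    rw [eY, eΔ, dl_cc_zpow]
  have conj_eq : ∀ x g, e (conjComp x φ g) = e x * Φ (e g) * (e x)⁻¹ := fun x g => by
    rw [hΦ, ← map_inv, ← map_mul, ← map_mul]; rfl
  rcases D.endo_classification (by omega) Φ with hc | ⟨ε, y, k, r, s, q, hε, hr, hx⟩
  · refine ⟨1, Or.inl ⟨φ (rB (m + 3) 1), φ (rB (m + 3) (m + 3)), ?_, fun i h1 hi => ?_, ?_⟩⟩
    · rw [← map_mul, ← map_mul]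
      exact congrArg φ ((dRel_ArtinB h2).comm 0 (by omega))
    · obtain ⟨i, rfl⟩ : ∃ j, i = j + 1 := ⟨i - 1, by omega⟩
      have h := hc i (by omega)
      simp only [← er i (by omega), ← er 0 (by omega), hΦ] at h
      simpa [conjComp] using e.injective h
    · simp [conjComp]
  obtain ⟨x, rfl⟩ := e.surjective y
  have hr' : ∀ i, 1 ≤ i → i ≤ m + 3 - 1 → conjComp x φ (rB (m + 3) i) =
      rB (m + 3) i ^ ε * ΔY (m + 3) ^ (2 * -k) * ΔB (m + 3) ^ (k + q) := by
    intro i h1 hi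
    obtain ⟨i, rfl⟩ : ∃ j, i = j + 1 := ⟨i - 1, by omega⟩
    apply e.injective
    rw [conj_eq, er i (by omega), hr i (by omega), ecc, ← eΔ, ← er i (by omega), zpow_add]
    simp only [map_mul, map_zpow, mul_assoc]
  refine ⟨x, Or.inr ?_⟩
  rw [← ex] at hx
  simp only [← conj_eq, ← eΔ, ← eδ, ecc, ← map_zpow, ← map_mul] at hx
  rcases hx with hx | hx | ⟨rfl, hx | hx⟩
  · refine Or.inr (Or.inr (Or.inl ⟨ε, -k, k + q, -r, r + s, hε, hr', ?_⟩))
    rw [e.injective hx, zpow_add, mul_assoc]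
  · refine Or.inr (Or.inr (Or.inr ⟨ε, -k, k + q, -r, r + s, hε, hr', ?_⟩))
    rw [e.injective hx, zpow_add]
    simp only [mul_assoc]
  · refine Or.inl ⟨ε, q, s, hε, fun i h1 hi => ?_, e.injective hx⟩
    simpa using hr' i h1 hi
  · refine Or.inr (Or.inl ⟨ε, q, s, hε, fun i h1 hi => ?_, e.injective hx⟩)
    simpa using hr' i h1 hi
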